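/- Let (s,u) be a solution of problem (P) with initial data (s₀,φ) ∈ W, and let T_m denote its maximal existence time. If T_m < ∞, then: lim_{t↗T_m} u(t,0) = ∞ and lim_{t↗T_m} s(t) < ∞; sup_{t∈(T_m/2,T_m)} (T_m − t)^{1/(2(p−1))} u(t,0) < ∞; for every δ ∈ (0,s₀), sup_{t∈(T_m/2,T_m)} ‖u(t)‖_{L^∞(δ,s(t))} < ∞; and lim_{t↗T_m} E(s(t),u(t)) = −∞. -/

import Mathlib

open Set MeasureTheory Filter Topology Real
open scoped ENNReal

noncomputable section

/-- `(s₀, φ)` belongs to the class `W`: `s₀ ∈ (0,∞)`, `φ` is Lipschitz on `[0,s₀]`,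
not identically zero, nonnegative there, and vanishes at `s₀`. -/
def memW (s₀ : ℝ) (φ : ℝ → ℝ) : Prop :=
  0 < s₀ ∧ (∃ K : NNReal, LipschitzOnWith K φ (Icc 0 s₀)) ∧
    (∃ x ∈ Icc 0 s₀, φ x ≠ 0) ∧ (∀ x ∈ Icc 0 s₀, 0 ≤ φ x) ∧ φ s₀ = 0

/-- `(s,u)` is a solution of the one-phase Stefan problem (P) on `(0,T]` (finite `T`)
with exponent `p` and initial data `(s₀,φ)`. -/
structure IsSolOn (p s₀ : ℝ) (φ : ℝ → ℝ) (T : ℝ) (s : ℝ → ℝ) (u : ℝ → ℝ → ℝ) : Prop where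
  T_pos : 0 < T
  s_cont : ContinuousOn s (Icc 0 T)
  s_diff : ∀ t ∈ Ioc 0 T, DifferentiableAt ℝ s t
  s_deriv_cont : ContinuousOn (deriv s) (Ioc 0 T)
  s_pos : ∀ t ∈ Icc 0 T, 0 < s t
  ut_diff : ∀ t ∈ Ioc 0 T, ∀ x ∈ Ioo 0 (s t), DifferentiableAt ℝ (fun τ => u τ x) t
  ux_diff : ∀ t ∈ Ioc 0 T, ∀ x ∈ Ioo 0 (s t), DifferentiableAt ℝ (u t) x
  uxx_diff : ∀ t ∈ Ioc 0 T, ∀ x ∈ Ioo 0 (s t), DifferentiableAt ℝ (deriv (u t)) x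
  ut_cont : ContinuousOn (fun q : ℝ × ℝ => deriv (fun τ => u τ q.2) q.1)
      {q : ℝ × ℝ | q.1 ∈ Ioc 0 T ∧ q.2 ∈ Ioo 0 (s q.1)}
  uxx_cont : ContinuousOn (fun q : ℝ × ℝ => deriv (deriv (u q.1)) q.2)
      {q : ℝ × ℝ | q.1 ∈ Ioc 0 T ∧ q.2 ∈ Ioo 0 (s q.1)}
  ux_cont : ContinuousOn (fun q : ℝ × ℝ => deriv (u q.1) q.2)
      {q : ℝ × ℝ | q.1 ∈ Ioc 0 T ∧ q.2 ∈ Icc 0 (s q.1)}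
  u_cont : ContinuousOn (fun q : ℝ × ℝ => u q.1 q.2)
      {q : ℝ × ℝ | q.1 ∈ Icc 0 T ∧ q.2 ∈ Icc 0 (s q.1)}
  u_nonneg : ∀ t ∈ Icc 0 T, ∀ x ∈ Icc 0 (s t), 0 ≤ u t x
  heat : ∀ t ∈ Ioc 0 T, ∀ x ∈ Ioo 0 (s t),
      deriv (fun τ => u τ x) t = deriv (deriv (u t)) x
  bc_zero : ∀ t ∈ Ioc 0 T, -deriv (u t) 0 = u t 0 ^ p
  bc_free : ∀ t ∈ Ioc 0 T, u t (s t) = 0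
  stefan : ∀ t ∈ Ioc 0 T, deriv s t = -deriv (u t) (s t)
  init : ∀ x ∈ Icc 0 s₀, u 0 x = φ x
  init_s : s 0 = s₀

/-- `(s,u)` is a global-in-time solution of problem (P). -/
def IsGlobalSol (p s₀ : ℝ) (φ : ℝ → ℝ) (s : ℝ → ℝ) (u : ℝ → ℝ → ℝ) : Prop :=
  ∀ T : ℝ, 0 < T → IsSolOn p s₀ φ T s u

/-- `Tm ∈ (0,∞]` is the maximal existence time of the solution `(s,u)` of (P) with
initial data `(s₀,φ)`: the solution exists on `(0,T]` for every `T < Tm`, and for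
`T > Tm` problem (P) admits no solution on `(0,T]`. -/
def IsMaxSol (p s₀ : ℝ) (φ : ℝ → ℝ) (Tm : ℝ≥0∞) (s : ℝ → ℝ) (u : ℝ → ℝ → ℝ) : Prop :=
  0 < Tm ∧
    (∀ T : ℝ, 0 < T → ENNReal.ofReal T < Tm → IsSolOn p s₀ φ T s u) ∧
    (∀ T : ℝ, Tm < ENNReal.ofReal T → ¬∃ σ v, IsSolOn p s₀ φ T σ v)

/-- The sup norm `‖u(t)‖_{L^∞(0,s(t))}`. -/
def supNorm (s : ℝ → ℝ) (u : ℝ → ℝ → ℝ) (t : ℝ) : ℝ :=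
  sSup (u t '' Ioo 0 (s t))

/-- The `L¹` norm `‖u(t)‖_{L¹(0,s(t))}` of the nonnegative function `u(t,·)`. -/
def L1Norm (s : ℝ → ℝ) (u : ℝ → ℝ → ℝ) (t : ℝ) : ℝ :=
  ∫ x in (0:ℝ)..(s t), u t x

/-- The energy `E(s(t),u(t))`. -/
def energy (p : ℝ) (s : ℝ → ℝ) (u : ℝ → ℝ → ℝ) (t : ℝ) : ℝ :=
  1 / 2 * (∫ x in (0:ℝ)..(s t), (deriv (u t) x) ^ 2) - u t 0 ^ (p + 1) / (p + 1)

/-- first order in time, second order in space jet. -/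
def HeatJet (W : ℝ → ℝ → ℝ) (t x wt wxx : ℝ) : Prop :=
  HasDerivAt (fun τ => W τ x) wt t ∧
    ∃ wx : ℝ → ℝ, (∀ᶠ y in 𝓝 x, HasDerivAt (W t) (wx y) y) ∧ HasDerivAt wx wxx x

theorem HeatJet.add {W V : ℝ → ℝ → ℝ} {t x a b c d : ℝ} (h1 : HeatJet W t x a b)
    (h2 : HeatJet V t x c d) : HeatJet (fun t x => W t x + V t x) t x (a + c) (b + d) := by
  obtain ⟨h1t, w1, h1x, h1y⟩ := h1
  obtain ⟨h2t, w2, h2x, h2y⟩ := h2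
  refine ⟨h1t.add h2t, fun y => w1 y + w2 y, ?_, h1y.add h2y⟩
  filter_upwards [h1x, h2x] with y k1 k2 using k1.add k2

theorem HeatJet.smul {W : ℝ → ℝ → ℝ} {t x a b : ℝ} (c : ℝ) (h1 : HeatJet W t x a b) :
    HeatJet (fun t x => c * W t x) t x (c * a) (c * b) := by
  obtain ⟨h1t, w1, h1x, h1y⟩ := h1
  refine ⟨h1t.const_mul c, fun y => c * w1 y, ?_, h1y.const_mul c⟩
  filter_upwards [h1x] with y k1 using k1.const_mul c

theorem HeatJet.sub {W V : ℝ → ℝ → ℝ} {t x a b c d : ℝ} (h1 : HeatJet W t x a b)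
    (h2 : HeatJet V t x c d) : HeatJet (fun t x => W t x - V t x) t x (a - c) (b - d) := by
  have := h1.add (h2.smul (-1))
  convert this using 1
  · funext t x; ring
  · ring
  · ring

theorem HeatJet.const (c t x : ℝ) : HeatJet (fun _ _ => c) t x 0 0 :=
  ⟨hasDerivAt_const _ _, fun _ => 0, Eventually.of_forall fun y => hasDerivAt_const _ _,
    hasDerivAt_const _ _⟩

theorem HeatJet.shift {W : ℝ → ℝ → ℝ} {t x a b h : ℝ} (h1 : HeatJet W t (x + h) a b) :
    HeatJet (fun t x => W t (x + h)) t x a b := by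
  obtain ⟨h1t, w1, h1x, h1y⟩ := h1
  refine ⟨h1t, fun y => w1 (y + h), ?_, h1y.comp_add_const x h⟩
  have hc : Tendsto (fun y : ℝ => y + h) (𝓝 x) (𝓝 (x + h)) :=
    (continuous_id.add continuous_const).tendsto x
  filter_upwards [hc.eventually h1x] with y hy
  exact hy.comp_add_const y h

theorem HeatJet.refl {W : ℝ → ℝ → ℝ} {t x a b h : ℝ} (h1 : HeatJet W t (h - x) a b) :
    HeatJet (fun t x => W t (h - x)) t x a b := by
  obtain ⟨h1t, w1, h1x, h1y⟩ := h1
  have hc : Tendsto (fun y : ℝ => h - y) (𝓝 x) (𝓝 (h - x)) :=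
    (continuous_const.sub continuous_id).tendsto x
  refine ⟨h1t, fun y => - w1 (h - y), ?_, ?_⟩
  · filter_upwards [hc.eventually h1x] with y hy
    exact hy.comp_const_sub h y
  · have := (h1y.comp_const_sub h x).fun_neg
    rwa [neg_neg] at this

theorem HeatJet.congr {W V : ℝ → ℝ → ℝ} {t x a b : ℝ} (h1 : HeatJet W t x a b)
    (h : ∀ᶠ q in 𝓝 ((t, x) : ℝ × ℝ), V q.1 q.2 = W q.1 q.2) : HeatJet V t x a b := by
  obtain ⟨h1t, w1, h1x, h1y⟩ := h1
  have e1 : ∀ᶠ τ in 𝓝 t, V τ x = W τ x :=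
    (Continuous.tendsto (f := fun τ : ℝ => (τ, x)) (by fun_prop) t).eventually h
  have e2 : ∀ᶠ y in 𝓝 x, V t y = W t y :=
    (Continuous.tendsto (f := fun y : ℝ => (t, y)) (by fun_prop) x).eventually h
  refine ⟨h1t.congr_of_eventuallyEq e1, w1, ?_, h1y⟩
  filter_upwards [h1x, e2.eventually_nhds] with y hy he
  exact hy.congr_of_eventuallyEq he

/-- second derivative test (necessary condition). -/
theorem second_deriv_nonpos {f f' : ℝ → ℝ} {x c : ℝ} (h1 : ∀ᶠ y in 𝓝 x, HasDerivAt f (f' y) y)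
    (h2 : HasDerivAt f' c x) (hm : IsLocalMax f x) : c ≤ 0 := by
  by_contra hc
  push Not at hc
  have h0 : f' x = 0 := hm.hasDerivAt_eq_zero h1.self_of_nhds
  have hpos : ∀ᶠ y in 𝓝[>] x, 0 < f' y := by
    have := (hasDerivAt_iff_tendsto_slope.1 h2).mono_left
      (nhdsWithin_mono x (fun y (hy : y ∈ Ioi x) => ne_of_gt hy))
    filter_upwards [this.eventually (lt_mem_nhds hc), self_mem_nhdsWithin] with y hy hxy
    rw [slope_def_field, h0, sub_zero] at hy
    have : 0 < y - x := sub_pos.2 hxy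
    by_contra hn
    push Not at hn
    exact absurd hy (not_lt.2 (div_nonpos_of_nonpos_of_nonneg hn this.le))
  have h1' : ∀ᶠ y in 𝓝[>] x, HasDerivAt f (f' y) y := h1.filter_mono nhdsWithin_le_nhds
  have hm' : ∀ᶠ y in 𝓝[>] x, f y ≤ f x := hm.filter_mono nhdsWithin_le_nhds
  obtain ⟨b, hb, hbs⟩ := mem_nhdsGT_iff_exists_Ioc_subset.1
    (inter_mem (inter_mem hpos h1') hm')
  have hb' : x < b := hb
  obtain ⟨ξ, hξ, he⟩ := exists_hasDerivAt_eq_slope f f' hb'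
    (fun y hy => by
      rcases eq_or_lt_of_le hy.1 with h | h
      · rw [← h]; exact h1.self_of_nhds.continuousAt.continuousWithinAt
      · exact (hbs ⟨h, hy.2⟩).1.2.continuousAt.continuousWithinAt)
    (fun y hy => (hbs ⟨hy.1, hy.2.le⟩).1.2)
  have k1 : 0 < f' ξ := (hbs ⟨hξ.1, hξ.2.le⟩).1.1
  have k2 : f b ≤ f x := (hbs ⟨hb', le_rfl⟩).2
  rw [he] at k1
  exact absurd k1 (not_lt.2 (div_nonpos_of_nonpos_of_nonneg (by linarith) (by linarith)))

theorem deriv_nonpos_right {f : ℝ → ℝ} {x d : ℝ} (h : HasDerivWithinAt f d (Ici x) x)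
    (hm : ∀ᶠ y in 𝓝[>] x, f y ≤ f x) : d ≤ 0 := by
  have := hasDerivWithinAt_iff_tendsto_slope.1 h
  simp only [Ici_sdiff_left] at this
  refine le_of_tendsto this ?_
  filter_upwards [hm, self_mem_nhdsWithin] with y hy hxy
  rw [slope_def_field]
  exact div_nonpos_of_nonpos_of_nonneg (by linarith) (sub_nonneg.2 (le_of_lt hxy))

theorem deriv_nonneg_left {f : ℝ → ℝ} {x d : ℝ} (h : HasDerivWithinAt f d (Iic x) x)
    (hm : ∀ᶠ y in 𝓝[<] x, f y ≤ f x) : 0 ≤ d := by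
  have := hasDerivWithinAt_iff_tendsto_slope.1 h
  simp only [Iic_sdiff_right] at this
  refine ge_of_tendsto this ?_
  filter_upwards [hm, self_mem_nhdsWithin] with y hy hxy
  rw [slope_def_field]
  exact div_nonneg_of_nonpos (by linarith) (sub_nonpos.2 (le_of_lt hxy))

/-- compactness of the space-time region -/
theorem region_compact {a b : ℝ → ℝ} {t0 t1 : ℝ} (ha : ContinuousOn a (Icc t0 t1))
    (hb : ContinuousOn b (Icc t0 t1)) :
    IsCompact {q : ℝ × ℝ | q.1 ∈ Icc t0 t1 ∧ q.2 ∈ Icc (a q.1) (b q.1)} := by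
  have hc : IsCompact (Icc t0 t1 ×ˢ Icc (0:ℝ) 1) := isCompact_Icc.prod isCompact_Icc
  have himg : IsCompact ((fun q : ℝ × ℝ => (q.1, (1 - q.2) * a q.1 + q.2 * b q.1)) ''
      (Icc t0 t1 ×ˢ Icc (0:ℝ) 1)) := by
    refine hc.image_of_continuousOn ?_
    have h1 : ContinuousOn (fun q : ℝ × ℝ => a q.1) (Icc t0 t1 ×ˢ Icc (0:ℝ) 1) :=
      ha.comp continuousOn_fst (fun q hq => hq.1)
    have h2 : ContinuousOn (fun q : ℝ × ℝ => b q.1) (Icc t0 t1 ×ˢ Icc (0:ℝ) 1) :=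
      hb.comp continuousOn_fst (fun q hq => hq.1)
    exact continuousOn_fst.prodMk
      (((continuousOn_const.sub continuousOn_snd).mul h1).add (continuousOn_snd.mul h2))
  have hsub : {q : ℝ × ℝ | q.1 ∈ Icc t0 t1 ∧ q.2 ∈ Icc (a q.1) (b q.1)} =
      {q : ℝ × ℝ | q.1 ∈ Icc t0 t1 ∧ a q.1 ≤ b q.1} ∩
      ((fun q : ℝ × ℝ => (q.1, (1 - q.2) * a q.1 + q.2 * b q.1)) ''
      (Icc t0 t1 ×ˢ Icc (0:ℝ) 1)) := by
    ext ⟨t, x⟩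
    simp only [mem_ofPred_eq, mem_inter_iff, mem_image, Prod.exists, mem_prod, mem_Icc,
      Prod.mk.injEq]
    constructor
    · rintro ⟨ht, hx1, hx2⟩
      refine ⟨⟨ht, hx1.trans hx2⟩, t, (x - a t) / (b t - a t), ⟨ht, ?_, ?_⟩, rfl, ?_⟩
      · exact div_nonneg (by linarith) (by linarith)
      · exact div_le_one_of_le₀ (by linarith) (by linarith)
      · rcases eq_or_lt_of_le (hx1.trans hx2) with h | h
        · rw [← h]; simp; linarith
        · have : b t - a t ≠ 0 := by linarith
          field_simp
          ring
    · rintro ⟨⟨ht, hab⟩, t', y, ⟨ht', hy0, hy1⟩, rfl, rfl⟩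
      refine ⟨ht, ?_, ?_⟩ <;> nlinarith
  rw [hsub]
  have hcl : IsClosed {t : ℝ | t ∈ Icc t0 t1 ∧ a t ≤ b t} := by
    have : {t : ℝ | t ∈ Icc t0 t1 ∧ a t ≤ b t} = Icc t0 t1 ∩ (fun t => b t - a t) ⁻¹' (Ici 0) := by
      ext t; simp
    rw [this]
    exact (hb.sub ha).preimage_isClosed_of_isClosed isClosed_Icc isClosed_Ici
  exact himg.inter_left (hcl.preimage continuous_fst)

/-- The maximum principle on a moving domain. -/
theorem max_principle {a b : ℝ → ℝ} {t0 t1 : ℝ} (ha : ContinuousOn a (Icc t0 t1))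
    (hb : ContinuousOn b (Icc t0 t1)) {W : ℝ → ℝ → ℝ}
    (hW : ContinuousOn (fun q : ℝ × ℝ => W q.1 q.2)
      {q : ℝ × ℝ | q.1 ∈ Icc t0 t1 ∧ q.2 ∈ Icc (a q.1) (b q.1)})
    (hinit : ∀ x ∈ Icc (a t0) (b t0), W t0 x ≤ 0)
    (hgood : ∀ t ∈ Ioc t0 t1, ∀ x ∈ Icc (a t) (b t), W t x ≤ 0 ∨
      (x ∈ Ioo (a t) (b t) ∧ ∃ wt wxx, HeatJet W t x wt wxx ∧ wt ≤ wxx) ∨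
      (x < b t ∧ ∃ d, 0 < d ∧ HasDerivWithinAt (W t) d (Ici x) x) ∨
      (a t < x ∧ ∃ d, d < 0 ∧ HasDerivWithinAt (W t) d (Iic x) x)) :
    ∀ t ∈ Icc t0 t1, ∀ x ∈ Icc (a t) (b t), W t x ≤ 0 := by
  have hK := region_compact ha hb
  set K := {q : ℝ × ℝ | q.1 ∈ Icc t0 t1 ∧ q.2 ∈ Icc (a q.1) (b q.1)} with hKdef
  -- perturbed statement
  have key : ∀ ε > 0, ∀ t ∈ Icc t0 t1, ∀ x ∈ Icc (a t) (b t), W t x - ε * (t - t0) ≤ 0 := by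
    intro ε hε t ht x hx
    by_contra hcon
    push Not at hcon
    have hV : ContinuousOn (fun q : ℝ × ℝ => W q.1 q.2 - ε * (q.1 - t0)) K :=
      hW.sub (by fun_prop)
    obtain ⟨⟨τ, y⟩, hq, hmax⟩ := hK.exists_isMaxOn ⟨(t, x), ⟨ht, hx⟩⟩ hV
    have hmax' : ∀ τ' y', τ' ∈ Icc t0 t1 → y' ∈ Icc (a τ') (b τ') →
        W τ' y' - ε * (τ' - t0) ≤ W τ y - ε * (τ - t0) :=
      fun τ' y' h1 h2 => hmax (show ((τ', y') : ℝ × ℝ) ∈ K from ⟨h1, h2⟩)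
    have hτ : τ ∈ Icc t0 t1 := hq.1
    have hy : y ∈ Icc (a τ) (b τ) := hq.2
    have hpos : 0 < W τ y - ε * (τ - t0) := lt_of_lt_of_le hcon (hmax' t x ht hx)
    have hτ0 : t0 < τ := by
      rcases eq_or_lt_of_le hτ.1 with h | h
      · have := hinit y (by rw [h]; exact hy)
        rw [← h] at hpos
        simp at hpos
        linarith
      · exact h
    have hWpos : 0 < W τ y := by nlinarith [mul_pos hε (sub_pos.2 hτ0)]
    have hmx : ∀ y' ∈ Icc (a τ) (b τ), W τ y' ≤ W τ y := fun y' h => by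
      have := hmax' τ y' hτ h
      linarith
    rcases hgood τ ⟨hτ0, hτ.2⟩ y hy with h | ⟨hi, wt, wxx, ⟨hjt, wx, hjx, hjy⟩, hle⟩ |
      ⟨hyb, d, hd, hder⟩ | ⟨hya, d, hd, hder⟩
    · linarith
    · have hloc : IsLocalMax (W τ) y := by
        filter_upwards [Ioo_mem_nhds hi.1 hi.2] with y' h using hmx y' ⟨h.1.le, h.2.le⟩
      have hxx := second_deriv_nonpos hjx hjy hloc
      have hev : ∀ᶠ τ' in 𝓝[<] τ, τ' ∈ Icc t0 t1 ∧ y ∈ Icc (a τ') (b τ') := by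
        have hsub : ∀ᶠ τ' in 𝓝[<] τ, τ' ∈ Icc t0 t1 := by
          filter_upwards [Ioo_mem_nhdsLT hτ0] with τ' h
          exact ⟨h.1.le, h.2.le.trans hτ.2⟩
        have hle : 𝓝[<] τ ≤ 𝓝[Icc t0 t1] τ := by
          rw [nhdsWithin, nhdsWithin]
          refine le_inf inf_le_left (le_principal_iff.2 hsub)
        have e1 := ((ha τ hτ).mono_left hle).eventually (gt_mem_nhds hi.1)
        have e2 := ((hb τ hτ).mono_left hle).eventually (lt_mem_nhds hi.2)
        filter_upwards [hsub, e1, e2] with τ' h1 h2 h3 using ⟨h1, h2.le, h3.le⟩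
      have hder : HasDerivWithinAt (fun τ' => W τ' y - ε * (τ' - t0)) (wt - ε) (Iic τ) τ := by
        have := (hjt.fun_sub (((hasDerivAt_id τ).sub_const t0).const_mul ε)).hasDerivWithinAt
          (s := Iic τ)
        simpa using this
      have := deriv_nonneg_left hder (by
        filter_upwards [hev] with τ' h using hmax' τ' y h.1 h.2)
      linarith
    · have := deriv_nonpos_right hder (by
        filter_upwards [Ioo_mem_nhdsGT hyb] with y' h
        exact hmx y' ⟨hy.1.trans h.1.le, h.2.le⟩)
      linarith
    · have := deriv_nonneg_left hder (by
        filter_upwards [Ioo_mem_nhdsLT hya] with y' h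
        exact hmx y' ⟨h.1.le, h.2.le.trans hy.2⟩)
      linarith
  intro t ht x hx
  refine le_of_forall_pos_le_add (fun δ hδ => ?_)
  have h1 : 0 < t - t0 + 1 := by linarith [ht.1]
  have := key (δ / (t - t0 + 1)) (by positivity) t ht x hx
  have h2 : δ / (t - t0 + 1) * (t - t0) ≤ δ := by
    rw [div_mul_eq_mul_div, div_le_iff₀ h1]
    nlinarith [ht.1]
  linarith

/-- Working interface for a classical solution on `(0,Tm)`. -/
structure Cl (p Tm : ℝ) (s : ℝ → ℝ) (u : ℝ → ℝ → ℝ) : Prop where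
  sc : ContinuousOn s (Ico 0 Tm)
  sd : ∀ t ∈ Ioo 0 Tm, HasDerivAt s (-(deriv (u t) (s t))) t
  spos : ∀ t ∈ Ico 0 Tm, 0 < s t
  jet : ∀ t ∈ Ioo 0 Tm, ∀ x ∈ Ioo 0 (s t),
    HeatJet u t x (deriv (deriv (u t)) x) (deriv (deriv (u t)) x)
  uc : ContinuousOn (fun q : ℝ × ℝ => u q.1 q.2) {q | q.1 ∈ Ico 0 Tm ∧ q.2 ∈ Icc 0 (s q.1)}
  ux : ∀ t ∈ Ioo 0 Tm, ∀ x ∈ Icc 0 (s t),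
    HasDerivWithinAt (u t) (deriv (u t) x) (Icc 0 (s t)) x
  uxc : ContinuousOn (fun q : ℝ × ℝ => deriv (u q.1) q.2)
    {q | q.1 ∈ Ioo 0 Tm ∧ q.2 ∈ Icc 0 (s q.1)}
  uxxc : ContinuousOn (fun q : ℝ × ℝ => deriv (deriv (u q.1)) q.2)
    {q | q.1 ∈ Ioo 0 Tm ∧ q.2 ∈ Ioo 0 (s q.1)}
  nn : ∀ t ∈ Ico 0 Tm, ∀ x ∈ Icc 0 (s t), 0 ≤ u t x
  bc0 : ∀ t ∈ Ioo 0 Tm, deriv (u t) 0 = -(u t 0 ^ p)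
  bcs : ∀ t ∈ Ioo 0 Tm, u t (s t) = 0

theorem IsSolOn.ux_within {p s₀ T : ℝ} {φ s : ℝ → ℝ} {u : ℝ → ℝ → ℝ}
    (h : IsSolOn p s₀ φ T s u) {t : ℝ} (ht : t ∈ Ioc 0 T) {x : ℝ} (hx : x ∈ Icc 0 (s t)) :
    HasDerivWithinAt (u t) (deriv (u t) x) (Icc 0 (s t)) x := by
  have hsp := h.s_pos t ⟨ht.1.le, ht.2⟩
  have hc : ContinuousOn (u t) (Icc 0 (s t)) :=
    h.u_cont.comp (f := fun y => (t, y)) (by fun_prop) (fun y hy => ⟨⟨ht.1.le, ht.2⟩, hy⟩)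
  have hd : ContinuousOn (deriv (u t)) (Icc 0 (s t)) :=
    h.ux_cont.comp (f := fun y => (t, y)) (by fun_prop) (fun y hy => ⟨ht, hy⟩)
  have hdiff : DifferentiableOn ℝ (u t) (Ioo 0 (s t)) := fun y hy =>
    (h.ux_diff t ht y hy).differentiableWithinAt
  rcases eq_or_lt_of_le hx.1 with h0 | h0
  · subst h0
    refine HasDerivWithinAt.mono (t := Ici 0) ?_ (fun y hy => hy.1)
    refine hasDerivWithinAt_Ici_of_tendsto_deriv hdiff
      ((hc 0 hx).mono Ioo_subset_Icc_self) (Ioo_mem_nhdsGT hsp) ?_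
    exact (hd 0 hx).mono_left (nhdsWithin_le_of_mem
      (mem_of_superset (Ioo_mem_nhdsGT hsp) Ioo_subset_Icc_self))
  · rcases eq_or_lt_of_le hx.2 with h1 | h1
    · subst h1
      refine HasDerivWithinAt.mono (t := Iic (s t)) ?_ (fun y hy => hy.2)
      refine hasDerivWithinAt_Iic_of_tendsto_deriv hdiff
        ((hc _ hx).mono Ioo_subset_Icc_self) (Ioo_mem_nhdsLT hsp) ?_
      exact (hd _ hx).mono_left (nhdsWithin_le_of_mem
        (mem_of_superset (Ioo_mem_nhdsLT hsp) Ioo_subset_Icc_self))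
    · exact (h.ux_diff t ht x ⟨h0, h1⟩).hasDerivAt.hasDerivWithinAt

theorem Cl.of_sol {p s₀ Tm : ℝ} {φ s : ℝ → ℝ} {u : ℝ → ℝ → ℝ}
    (h : ∀ T, 0 < T → T < Tm → IsSolOn p s₀ φ T s u) : Cl p Tm s u := by
  have hT : ∀ t ∈ Ico 0 Tm, ∃ T, 0 < T ∧ T < Tm ∧ t < T := fun t ht => by
    refine ⟨(t + Tm) / 2, ?_, ?_, ?_⟩ <;> linarith [ht.1, ht.2]
  have key : ∀ {P : ℝ → ℝ → Prop} {f : ℝ × ℝ → ℝ},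
      (∀ T, 0 < T → T < Tm → ContinuousOn f {q | q.1 ∈ Ioc 0 T ∧ P q.1 q.2}) →
      ContinuousOn f {q | q.1 ∈ Ioo 0 Tm ∧ P q.1 q.2} := by
    intro P f hf q hq
    obtain ⟨T, h0, h1, h2⟩ := hT q.1 ⟨hq.1.1.le, hq.1.2⟩
    refine (hf T h0 h1 q ⟨⟨hq.1.1, h2.le⟩, hq.2⟩).mono_of_mem_nhdsWithin ?_
    filter_upwards [self_mem_nhdsWithin,
      mem_nhdsWithin_of_mem_nhds ((continuous_fst.tendsto q).eventually (gt_mem_nhds h2))]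
      with q' h3 h4 using ⟨⟨h3.1.1, le_of_lt h4⟩, h3.2⟩
  refine ⟨?_, ?_, ?_, ?_, ?_, ?_, ?_, ?_, ?_, ?_, ?_⟩
  · intro t ht
    obtain ⟨T, h0, h1, h2⟩ := hT t ht
    refine ((h T h0 h1).s_cont t ⟨ht.1, h2.le⟩).mono_of_mem_nhdsWithin ?_
    filter_upwards [self_mem_nhdsWithin, mem_nhdsWithin_of_mem_nhds (gt_mem_nhds h2)]
      with q' h3 h4 using ⟨h3.1, le_of_lt h4⟩
  · intro t ht
    have := (h t ht.1 ht.2)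
    rw [← this.stefan t ⟨ht.1, le_rfl⟩]
    exact (this.s_diff t ⟨ht.1, le_rfl⟩).hasDerivAt
  · intro t ht
    obtain ⟨T, h0, h1, h2⟩ := hT t ht
    exact (h T h0 h1).s_pos t ⟨ht.1, h2.le⟩
  · intro t ht x hx
    have := (h t ht.1 ht.2)
    have ht' : t ∈ Ioc 0 t := ⟨ht.1, le_rfl⟩
    refine ⟨?_, deriv (u t), ?_, (this.uxx_diff t ht' x hx).hasDerivAt⟩
    · rw [← this.heat t ht' x hx]
      exact (this.ut_diff t ht' x hx).hasDerivAt
    · filter_upwards [Ioo_mem_nhds hx.1 hx.2] with y hy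
      exact (this.ux_diff t ht' y hy).hasDerivAt
  · intro q hq
    obtain ⟨T, h0, h1, h2⟩ := hT q.1 hq.1
    refine ((h T h0 h1).u_cont q ⟨⟨hq.1.1, h2.le⟩, hq.2⟩).mono_of_mem_nhdsWithin ?_
    filter_upwards [self_mem_nhdsWithin,
      mem_nhdsWithin_of_mem_nhds ((continuous_fst.tendsto q).eventually (gt_mem_nhds h2))]
      with q' h3 h4 using ⟨⟨h3.1.1, le_of_lt h4⟩, h3.2⟩
  · intro t ht x hx
    exact (h t ht.1 ht.2).ux_within ⟨ht.1, le_rfl⟩ hx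
  · exact key (P := fun t x => x ∈ Icc 0 (s t)) fun T h0 h1 => (h T h0 h1).ux_cont
  · exact key (P := fun t x => x ∈ Ioo 0 (s t)) fun T h0 h1 => (h T h0 h1).uxx_cont
  · intro t ht
    obtain ⟨T, h0, h1, h2⟩ := hT t ht
    exact (h T h0 h1).u_nonneg t ⟨ht.1, h2.le⟩
  · intro t ht
    rw [← (h t ht.1 ht.2).bc_zero t ⟨ht.1, le_rfl⟩, neg_neg]
  · intro t ht
    exact (h t ht.1 ht.2).bc_free t ⟨ht.1, le_rfl⟩

section apriori
variable {p Tm : ℝ} {s : ℝ → ℝ} {u : ℝ → ℝ → ℝ}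

theorem Cl.utc (h : Cl p Tm s u) {t : ℝ} (ht : t ∈ Ico 0 Tm) : ContinuousOn (u t) (Icc 0 (s t)) :=
  h.uc.comp (f := fun y => (t, y)) (by fun_prop) (fun _ hy => ⟨ht, hy⟩)

theorem Cl.uxtc (h : Cl p Tm s u) {t : ℝ} (ht : t ∈ Ioo 0 Tm) :
    ContinuousOn (deriv (u t)) (Icc 0 (s t)) :=
  h.uxc.comp (f := fun y => (t, y)) (by fun_prop) (fun _ hy => ⟨ht, hy⟩)

theorem Cl.uxd (h : Cl p Tm s u) {t : ℝ} (ht : t ∈ Ioo 0 Tm) {x : ℝ} (hx : x ∈ Ioo 0 (s t)) :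
    HasDerivAt (u t) (deriv (u t) x) x :=
  (h.ux t ht x ⟨hx.1.le, hx.2.le⟩).hasDerivAt (Icc_mem_nhds hx.1 hx.2)

/-- upper bound of a left derivative from a linear bound -/
theorem left_deriv_bound {f : ℝ → ℝ} {b d x K : ℝ} (hb : b < x)
    (h : HasDerivWithinAt f d (Icc b x) x) (hf : ∀ y ∈ Ioo b x, f y - f x ≤ K * (x - y)) :
    -d ≤ K := by
  have h' : HasDerivWithinAt f d (Iic x) x :=
    h.mono_of_mem_nhdsWithin (Icc_mem_nhdsLE hb)
  have := deriv_nonneg_left (f := fun y => f y + K * y) (d := d + K) (x := x) (by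
    simpa using h'.fun_add ((hasDerivWithinAt_id x (Iic x)).const_mul K)) (by
    filter_upwards [Ioo_mem_nhdsLT hb] with y hy
    have := hf y hy
    linarith)
  linarith

theorem Cl.ds_nonneg (h : Cl p Tm s u) {t : ℝ} (ht : t ∈ Ioo 0 Tm) : deriv (u t) (s t) ≤ 0 := by
  have hs := h.spos t ⟨ht.1.le, ht.2⟩
  have h1 := left_deriv_bound (f := fun x => - u t x) (K := 0) hs
    ((h.ux t ht (s t) ⟨hs.le, le_rfl⟩).fun_neg) (fun y hy => by
      have := h.nn t ⟨ht.1.le, ht.2⟩ y ⟨hy.1.le, hy.2.le⟩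
      rw [h.bcs t ht]; linarith)
  linarith

theorem Cl.s_mono (h : Cl p Tm s u) : MonotoneOn s (Ico 0 Tm) := by
  refine monotoneOn_of_deriv_nonneg (convex_Ico 0 Tm) h.sc ?_ ?_
  · rw [interior_Ico]
    exact fun t ht => (h.sd t ht).differentiableAt.differentiableWithinAt
  · rw [interior_Ico]
    intro t ht
    rw [(h.sd t ht).deriv]
    linarith [h.ds_nonneg ht]

/-- comparison on subdomains -/
theorem Cl.comp (h : Cl p Tm s u) {t0 t1 : ℝ} (h0 : 0 ≤ t0) (h1 : t1 < Tm) {a b : ℝ → ℝ}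
    (ha : ContinuousOn a (Icc t0 t1)) (hb : ContinuousOn b (Icc t0 t1))
    (ha0 : ∀ t ∈ Icc t0 t1, 0 ≤ a t) (hbs : ∀ t ∈ Icc t0 t1, b t ≤ s t) {w : ℝ → ℝ → ℝ}
    (hw : ContinuousOn (fun q : ℝ × ℝ => w q.1 q.2)
      {q | q.1 ∈ Icc t0 t1 ∧ q.2 ∈ Icc (a q.1) (b q.1)})
    (hjet : ∀ t ∈ Ioc t0 t1, ∀ x ∈ Ioo (a t) (b t), ∃ c d, HeatJet w t x c d ∧ d ≤ c)
    (hi : ∀ x ∈ Icc (a t0) (b t0), u t0 x ≤ w t0 x)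
    (hl : ∀ t ∈ Ioc t0 t1, a t ≤ b t → u t (a t) ≤ w t (a t))
    (hr : ∀ t ∈ Ioc t0 t1, a t ≤ b t → u t (b t) ≤ w t (b t)) :
    ∀ t ∈ Icc t0 t1, ∀ x ∈ Icc (a t) (b t), u t x ≤ w t x := by
  intro t ht x hx
  have := max_principle (W := fun t x => u t x - w t x) ha hb ?_ ?_ ?_ t ht x hx
  · linarith
  · refine (h.uc.mono ?_).sub hw
    rintro ⟨τ, y⟩ ⟨hq1, hq2⟩
    exact ⟨⟨h0.trans hq1.1, hq1.2.trans_lt h1⟩, (ha0 τ hq1).trans hq2.1, hq2.2.trans (hbs τ hq1)⟩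
  · intro x hx; linarith [hi x hx]
  · intro t ht x hx
    have ht' : t ∈ Icc t0 t1 := ⟨ht.1.le, ht.2⟩
    rcases eq_or_lt_of_le hx.1 with e | e
    · left; have := hl t ht (hx.1.trans hx.2); rw [← e]; linarith
    rcases eq_or_lt_of_le hx.2 with e' | e'
    · left; have := hr t ht (hx.1.trans hx.2); rw [e']; linarith
    right; left
    obtain ⟨c, d, hj, hcd⟩ := hjet t ht x ⟨e, e'⟩
    have hj2 := h.jet t ⟨h0.trans_lt ht.1, ht.2.trans_lt h1⟩ x
      ⟨(ha0 t ht').trans_lt e, e'.trans_le (hbs t ht')⟩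
    exact ⟨⟨e, e'⟩, _, _, hj2.sub hj, by linarith⟩

/-- sup bound -/
theorem Cl.sup_bound (h : Cl p Tm s u) {t0 t1 M : ℝ} (h0 : 0 ≤ t0) (h1 : t1 < Tm)
    (hM : 0 ≤ M) (hi : ∀ x ∈ Icc 0 (s t0), u t0 x ≤ M) (hg : ∀ t ∈ Ioc t0 t1, u t 0 ≤ M) :
    ∀ t ∈ Icc t0 t1, ∀ x ∈ Icc 0 (s t), u t x ≤ M := by
  refine h.comp h0 h1 (a := fun _ => 0) (b := s) (w := fun _ _ => M) continuousOn_const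
    (h.sc.mono fun t ht => ⟨h0.trans ht.1, ht.2.trans_lt h1⟩) (fun _ _ => le_rfl)
    (fun _ _ => le_rfl) continuousOn_const (fun t _ x _ => ⟨0, 0, HeatJet.const M t x, le_rfl⟩)
    hi (fun t ht _ => hg t ht) (fun t ht _ => ?_)
  rw [h.bcs t ⟨h0.trans_lt ht.1, ht.2.trans_lt h1⟩]; exact hM

/-- free boundary barrier -/
theorem Cl.fb_bound (h : Cl p Tm s u) {t0 t1 C1 d L0 : ℝ} (h0 : 0 ≤ t0) (h1 : t1 < Tm)
    (hd : 0 < d) (hds : d ≤ s t0) (hC1 : 0 ≤ C1) (hL0 : 0 ≤ L0)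
    (hu : ∀ t ∈ Icc t0 t1, u t (s t - d) ≤ C1)
    (hi : ∀ x ∈ Icc (s t0 - d) (s t0), u t0 x ≤ L0 * (s t0 - x)) :
    ∀ t ∈ Icc t0 t1, ∀ x ∈ Icc (s t - d) (s t), u t x ≤ (2 * C1 / d + L0) * (s t - x) := by
  have hmem : ∀ t ∈ Icc t0 t1, t ∈ Ico 0 Tm := fun t ht => ⟨h0.trans ht.1, ht.2.trans_lt h1⟩
  have hsc : ContinuousOn s (Icc t0 t1) := h.sc.mono hmem
  have hsc2 : ContinuousOn (fun q : ℝ × ℝ => s q.1)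
      {q | q.1 ∈ Icc t0 t1 ∧ q.2 ∈ Icc (s q.1 - d) (s q.1)} :=
    hsc.comp continuousOn_fst (fun q hq => hq.1)
  set w : ℝ → ℝ → ℝ := fun t x =>
    C1 * (2 / d * (s t - x) - (s t - x) ^ 2 / d ^ 2) + L0 * (s t - x) with hwdef
  have hyd : ∀ y, 0 ≤ y → y ≤ d → 0 ≤ 2 / d * y - y ^ 2 / d ^ 2 := by
    intro y hy0 hyd
    have : 2 / d * y - y ^ 2 / d ^ 2 = y * (2 * d - y) / d ^ 2 := by field_simp
    rw [this]
    exact div_nonneg (mul_nonneg hy0 (by linarith)) (by positivity)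
  have key := h.comp h0 h1 (a := fun t => s t - d) (b := s) (w := w)
    (hsc.sub continuousOn_const) hsc ?_ (fun _ _ => le_rfl) ?_ ?_ ?_ ?_ ?_
  · intro t ht x hx
    refine (key t ht x hx).trans ?_
    have : w t x = (2 * C1 / d + L0) * (s t - x) - C1 * ((s t - x) ^ 2 / d ^ 2) := by
      simp only [hwdef]; ring
    rw [this]
    have : 0 ≤ C1 * ((s t - x) ^ 2 / d ^ 2) := by positivity
    linarith
  · intro t ht
    have := h.s_mono (hmem t0 ⟨le_rfl, ht.1.trans ht.2⟩) (hmem t ht) ht.1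
    linarith
  · have hl : ContinuousOn (fun q : ℝ × ℝ => s q.1 - q.2)
        {q | q.1 ∈ Icc t0 t1 ∧ q.2 ∈ Icc (s q.1 - d) (s q.1)} := hsc2.sub continuousOn_snd
    exact (continuousOn_const.mul ((continuousOn_const.mul hl).sub
      ((hl.pow 2).div_const _))).add (continuousOn_const.mul hl)
  · intro t ht x hx
    have ht' : t ∈ Ioo 0 Tm := ⟨h0.trans_lt ht.1, ht.2.trans_lt h1⟩
    have hD := h.ds_nonneg ht'
    set D := -(deriv (u t) (s t)) with hDdef
    refine ⟨D * (C1 * (2 / d - 2 * (s t - x) / d ^ 2) + L0), - (C1 * (2 / d ^ 2)), ⟨?_,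
      fun y => C1 * (- (2 / d) + 2 * (s t - y) / d ^ 2) - L0, ?_, ?_⟩, ?_⟩
    · have h1 := (h.sd t ht').sub_const x
      have := ((((h1.const_mul (2 / d)).fun_sub ((h1.fun_pow 2).div_const (d ^ 2))).const_mul C1).fun_add
        (h1.const_mul L0))
      refine this.congr_deriv ?_
      simp [hDdef]; ring
    · refine Eventually.of_forall fun y => ?_
      have h1 := (hasDerivAt_id y).const_sub (s t)
      have := ((((h1.const_mul (2 / d)).fun_sub ((h1.fun_pow 2).div_const (d ^ 2))).const_mul C1).fun_add
        (h1.const_mul L0))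
      refine this.congr_deriv ?_
      simp [hDdef]; ring
    · have h1 := (hasDerivAt_id x).const_sub (s t)
      have := ((((h1.const_mul 2).div_const (d ^ 2)).const_add (-(2 / d))).const_mul C1).sub_const L0
      refine this.congr_deriv ?_
      simp [hDdef]; ring
    · have e1 : 0 ≤ 2 / d - 2 * (s t - x) / d ^ 2 := by
        have : 2 / d - 2 * (s t - x) / d ^ 2 = 2 * (d - (s t - x)) / d ^ 2 := by field_simp
        rw [this]
        exact div_nonneg (by linarith [hx.1]) (by positivity)
      have e2 : 0 ≤ D * (C1 * (2 / d - 2 * (s t - x) / d ^ 2) + L0) :=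
        mul_nonneg (by linarith) (add_nonneg (mul_nonneg hC1 e1) hL0)
      have e3 : 0 ≤ C1 * (2 / d ^ 2) := by positivity
      linarith
  · intro x hx
    have := mul_nonneg hC1 (hyd (s t0 - x) (by linarith [hx.2]) (by linarith [hx.1]))
    have := hi x hx
    simp only [hwdef]; linarith
  · intro t ht _
    have := hu t ⟨ht.1.le, ht.2⟩
    have e : w t (s t - d) = C1 + L0 * d := by
      simp only [hwdef]; field_simp; ring
    rw [e]; nlinarith
  · intro t ht _
    have e : w t (s t) = 0 := by simp [hwdef]
    rw [e, h.bcs t ⟨h0.trans_lt ht.1, ht.2.trans_lt h1⟩]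

theorem Cl.sd_bound (h : Cl p Tm s u) {t Λ d : ℝ} (ht : t ∈ Ioo 0 Tm) (hd : 0 < d)
    (hds : d ≤ s t) (hu : ∀ x ∈ Icc (s t - d) (s t), u t x ≤ Λ * (s t - x)) :
    -(deriv (u t) (s t)) ≤ Λ := by
  refine left_deriv_bound (f := u t) (b := s t - d) (by linarith)
    ((h.ux t ht (s t) ⟨by linarith, le_rfl⟩).mono (Icc_subset_Icc_left (by linarith))) ?_
  intro y hy
  rw [h.bcs t ht, sub_zero]
  exact hu y ⟨hy.1.le, hy.2.le⟩
end apriori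

theorem right_deriv_bound {f : ℝ → ℝ} {b d x K : ℝ} (hb : x < b)
    (h : HasDerivWithinAt f d (Icc x b) x) (hf : ∀ y ∈ Ioo x b, f y - f x ≤ K * (y - x)) :
    d ≤ K := by
  have h' : HasDerivWithinAt f d (Ici x) x :=
    h.mono_of_mem_nhdsWithin (Icc_mem_nhdsGE hb)
  have := deriv_nonpos_right (f := fun y => f y - K * y) (d := d - K) (x := x) (by
    simpa using h'.fun_sub ((hasDerivWithinAt_id x (Ici x)).const_mul K)) (by
    filter_upwards [Ioo_mem_nhdsGT hb] with y hy
    have := hf y hy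
    linarith)
  linarith

section apriori
variable {p Tm : ℝ} {s : ℝ → ℝ} {u : ℝ → ℝ → ℝ}

theorem Cl.lip (h : Cl p Tm s u) {t L a b : ℝ} (ht : t ∈ Ioo 0 Tm) (ha : 0 ≤ a) (hb : b ≤ s t)
    (hL : ∀ x ∈ Icc a b, |deriv (u t) x| ≤ L) :
    ∀ x ∈ Icc a b, ∀ y ∈ Icc a b, |u t y - u t x| ≤ L * |y - x| := by
  intro x hx y hy
  have := Convex.norm_image_sub_le_of_norm_hasDerivWithin_le (f := u t) (f' := deriv (u t))
    (s := Icc a b) (C := L) (fun z hz => (h.ux t ht z ⟨ha.trans hz.1, hz.2.trans hb⟩).mono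
      (Icc_subset_Icc ha hb)) (fun z hz => by simpa using hL z hz) (convex_Icc a b) hx hy
  simpa using this

theorem Cl.int_grad (h : Cl p Tm s u) {t0 t1 x0 r C1 L0 : ℝ} (h0 : 0 < t0) (h1 : t1 < Tm)
    (hr : 0 < r) (hx0 : r ≤ x0) (hxr : x0 + r ≤ s t0) (hC1 : 0 ≤ C1)
    (hu : ∀ t ∈ Icc t0 t1, ∀ x ∈ Icc (x0 - r) (x0 + r), u t x ≤ C1)
    (hi : ∀ x ∈ Icc (x0 - r) (x0 + r), |deriv (u t0) x| ≤ L0) :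
    ∀ t ∈ Icc t0 t1, |deriv (u t) x0| ≤ C1 / r + L0 := by
  intro t ht
  have hmem : ∀ t ∈ Icc t0 t1, t ∈ Ioo 0 Tm := fun t ht => ⟨h0.trans_le ht.1, ht.2.trans_lt h1⟩
  have hL0 : 0 ≤ L0 := (abs_nonneg _).trans (hi x0 ⟨by linarith, by linarith⟩)
  have hsm : ∀ t ∈ Icc t0 t1, x0 + r ≤ s t := fun t ht => hxr.trans
    (h.s_mono (Ioo_subset_Ico_self (hmem t0 ⟨le_rfl, ht.1.trans ht.2⟩))
      (Ioo_subset_Ico_self (hmem t ht)) ht.1)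
  set w : ℝ → ℝ := fun x => C1 * (2 / r * x - x ^ 2 / r ^ 2) + 2 * L0 * x with hw
  have hw0 : ∀ x ∈ Icc 0 r, 2 * L0 * x ≤ w x := by
    intro x hx
    have : 2 / r * x - x ^ 2 / r ^ 2 = x * (2 * r - x) / r ^ 2 := by field_simp
    have : 0 ≤ 2 / r * x - x ^ 2 / r ^ 2 := by
      rw [this]; exact div_nonneg (mul_nonneg hx.1 (by linarith [hx.2])) (by positivity)
    have := mul_nonneg hC1 this
    simp only [hw]; linarith
  have hwr : C1 ≤ w r := by
    have : w r = C1 + 2 * L0 * r := by simp only [hw]; field_simp; ring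
    rw [this]; nlinarith
  have key : ∀ σ : ℝ, |σ| ≤ 1 → ∀ x ∈ Icc 0 r,
      σ * (u t (x + x0) - u t (x0 - x)) - w x ≤ 0 := by
    intro σ hσ x hx
    have hσ' := abs_le.1 hσ
    refine max_principle (W := fun t x => σ * (u t (x + x0) - u t (x0 - x)) - w x)
      (a := fun _ => 0) (b := fun _ => r) (t0 := t0) (t1 := t1) continuousOn_const continuousOn_const
      ?_ ?_ ?_ t ht x hx
    · have e1 := h.uc.comp (f := fun q : ℝ × ℝ => (q.1, q.2 + x0)) (s := {q | q.1 ∈ Icc t0 t1 ∧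
        q.2 ∈ Icc 0 r}) (by fun_prop) (fun q hq => ⟨Ioo_subset_Ico_self (hmem _ hq.1), by
          dsimp; linarith [hq.2.1], by have := hsm _ hq.1; dsimp; linarith [hq.2.2]⟩)
      have e2 := h.uc.comp (f := fun q : ℝ × ℝ => (q.1, x0 - q.2)) (s := {q | q.1 ∈ Icc t0 t1 ∧
        q.2 ∈ Icc 0 r}) (by fun_prop) (fun q hq => ⟨Ioo_subset_Ico_self (hmem _ hq.1), by
          dsimp; linarith [hq.2.2], by have := hsm _ hq.1; dsimp; linarith [hq.2.1]⟩)
      exact (continuousOn_const.mul (e1.sub e2)).sub (by fun_prop)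
    · intro x hx
      have ht0 := hmem t0 ⟨le_rfl, ht.1.trans ht.2⟩
      have := h.lip ht0 (by linarith) hxr hi (x0 - x) ⟨by linarith [hx.2], by linarith [hx.1]⟩
        (x + x0) ⟨by linarith [hx.1], by linarith [hx.2]⟩
      have e : |x + x0 - (x0 - x)| = 2 * x := by
        rw [show x + x0 - (x0 - x) = 2 * x by ring, abs_of_nonneg (by linarith [hx.1])]
      rw [e] at this
      have e2 : σ * (u t0 (x + x0) - u t0 (x0 - x)) ≤ L0 * (2 * x) := by
        refine (le_abs_self _).trans ?_
        rw [abs_mul]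
        nlinarith [abs_nonneg (u t0 (x + x0) - u t0 (x0 - x)), abs_nonneg σ]
      have := hw0 x hx
      linarith
    · intro t ht x hx
      have ht' : t ∈ Icc t0 t1 := ⟨ht.1.le, ht.2⟩
      have hs := hsm t ht'
      rcases eq_or_lt_of_le hx.1 with e | e
      · left; subst e; simp [hw]
      rcases eq_or_lt_of_le hx.2 with e' | e'
      · left; subst e'
        have a1 := hu t ht' (x + x0) ⟨by linarith, by linarith⟩
        have a2 := hu t ht' (x0 - x) ⟨by linarith, by linarith⟩
        have a3 := h.nn t (Ioo_subset_Ico_self (hmem t ht')) (x + x0) ⟨by linarith, by linarith⟩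
        have a4 := h.nn t (Ioo_subset_Ico_self (hmem t ht')) (x0 - x) ⟨by linarith, by linarith⟩
        have : σ * (u t (x + x0) - u t (x0 - x)) ≤ C1 := by
          refine (le_abs_self _).trans ?_
          rw [abs_mul]
          have : |u t (x + x0) - u t (x0 - x)| ≤ C1 := abs_le.2 ⟨by linarith, by linarith⟩
          nlinarith [abs_nonneg (u t (x + x0) - u t (x0 - x)), abs_nonneg σ]
        linarith
      right; left
      have j1 := (h.jet t (hmem t ht') (x + x0) ⟨by linarith, by linarith⟩).shift
      have j2 := (h.jet t (hmem t ht') (x0 - x) ⟨by linarith, by linarith⟩).refl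
      have j3 : HeatJet (fun _ x => w x) t x 0 (-(2 * C1 / r ^ 2)) := by
        refine ⟨hasDerivAt_const _ _, fun x => C1 * (2 / r - 2 * x / r ^ 2) + 2 * L0, ?_, ?_⟩
        · refine Eventually.of_forall fun y => ?_
          have h1 := hasDerivAt_id y
          refine HasDerivAt.congr_deriv (((((h1.const_mul (2 / r)).fun_sub ((h1.fun_pow 2).div_const
            (r ^ 2))).const_mul C1).fun_add (h1.const_mul (2 * L0)))) ?_
          simp
        · have h1 := hasDerivAt_id x
          refine HasDerivAt.congr_deriv (((((h1.const_mul 2).div_const (r ^ 2)).const_sub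
            (2 / r)).const_mul C1).add_const (2 * L0)) ?_
          ring
      have j := ((j1.sub j2).smul σ).sub j3
      have e3 : 0 ≤ 2 * C1 / r ^ 2 := by positivity
      refine ⟨⟨e, e'⟩, _, _, j, ?_⟩
      linarith
  have hd := h.uxd (hmem t ht) (x := x0) ⟨by linarith, by linarith [hsm t ht]⟩
  have key2 : ∀ σ : ℝ, |σ| ≤ 1 → σ * (2 * deriv (u t) x0) ≤ 2 * C1 / r + 2 * L0 := by
    intro σ hσ
    refine right_deriv_bound (f := fun x => σ * (u t (x + x0) - u t (x0 - x))) (b := r) (x := 0)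
      hr (HasDerivAt.hasDerivWithinAt ?_) ?_
    · have d1 : HasDerivAt (fun x => u t (x + x0)) (deriv (u t) x0) 0 :=
        HasDerivAt.comp_add_const 0 x0 (by simpa using hd)
      have d2 : HasDerivAt (fun x => u t (x0 - x)) (-(deriv (u t) x0)) 0 :=
        HasDerivAt.comp_const_sub x0 0 (by simpa using hd)
      exact ((d1.fun_sub d2).const_mul σ).congr_deriv (by ring)
    · intro y hy
      have := key σ hσ y ⟨hy.1.le, hy.2.le⟩
      have e : w y = (2 * C1 / r + 2 * L0) * y - C1 * (y ^ 2 / r ^ 2) := by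
        simp only [hw]; ring
      have e2 : 0 ≤ C1 * (y ^ 2 / r ^ 2) := by positivity
      simp only [zero_add, sub_zero, sub_self, mul_zero]
      linarith
  have k1 := key2 1 (by simp)
  have k2 := key2 (-1) (by simp)
  have e : 2 * C1 / r = 2 * (C1 / r) := by ring
  rw [abs_le]
  constructor <;> linarith

theorem Cl.grad (h : Cl p Tm s u) {t0 t1 δ Γ : ℝ} (h0 : 0 < t0) (h1 : t1 < Tm)
    (hδ : 0 ≤ δ) (hδs : δ < s t0)
    (hl : ∀ t ∈ Icc t0 t1, |deriv (u t) δ| ≤ Γ - 1)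
    (hi : ∀ x ∈ Icc δ (s t0), |deriv (u t0) x| ≤ Γ)
    (hf : ∃ d > 0, ∀ t ∈ Icc t0 t1, ∀ x ∈ Icc (s t - d) (s t), u t x ≤ Γ * (s t - x)) :
    ∀ t ∈ Icc t0 t1, ∀ x ∈ Icc δ (s t), |deriv (u t) x| ≤ Γ := by
  intro t ht
  have hmem : ∀ t ∈ Icc t0 t1, t ∈ Ioo 0 Tm := fun t ht => ⟨h0.trans_le ht.1, ht.2.trans_lt h1⟩
  have ht00 : t0 ∈ Icc t0 t1 := ⟨le_rfl, ht.1.trans ht.2⟩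
  have ht0 := hmem t0 ht00
  have hΓ : 0 ≤ Γ := by linarith [abs_nonneg (deriv (u t0) δ), hl t0 ht00]
  have hsm : ∀ t ∈ Icc t0 t1, s t0 ≤ s t := fun t ht =>
    (h.s_mono (Ioo_subset_Ico_self ht0) (Ioo_subset_Ico_self (hmem t ht)) ht.1)
  obtain ⟨d, hd, hfb⟩ := hf
  obtain ⟨h₁, h₁p, hunif⟩ : ∃ h₁ > 0, ∀ t ∈ Icc t0 t1, ∀ x ∈ Icc δ (s t0), x ≤ δ + h₁ →
      |deriv (u t) x| ≤ Γ := by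
    have hc : ContinuousOn (fun q : ℝ × ℝ => deriv (u q.1) q.2) (Icc t0 t1 ×ˢ Icc δ (s t0)) :=
      h.uxc.mono fun q hq => ⟨hmem _ hq.1, hδ.trans hq.2.1, hq.2.2.trans (hsm _ hq.1)⟩
    have huc := (isCompact_Icc.prod isCompact_Icc).uniformContinuousOn_of_continuous hc
    obtain ⟨ε, hε, H⟩ := Metric.uniformContinuousOn_iff.1 huc 1 one_pos
    refine ⟨ε / 2, by positivity, fun t ht x hx hx2 => ?_⟩
    have := H (t, x) ⟨ht, hx⟩ (t, δ) ⟨ht, le_rfl, hδs.le⟩ (by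
      rw [Prod.dist_eq, dist_self, Real.dist_eq]
      simp only [max_lt_iff]
      exact ⟨hε, by rw [abs_of_nonneg (by linarith [hx.1])]; linarith⟩)
    rw [Real.dist_eq] at this
    have h3 := abs_sub_abs_le_abs_sub (deriv (u t) x) (deriv (u t) δ)
    have h4 := hl t ht
    linarith
  have key : ∀ σ : ℝ, |σ| ≤ 1 → ∀ y, 0 < y → y < min h₁ (min d (s t0 - δ)) →
      ∀ x ∈ Icc δ (s t - y), σ * (u t (x + y) - u t x) - Γ * y ≤ 0 := by
    intro σ hσ y hy0 hym x hx
    have hy1 : y < h₁ := hym.trans_le (min_le_left _ _)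
    have hy2 : y < d := hym.trans_le ((min_le_right _ _).trans (min_le_left _ _))
    have hy3 : y < s t0 - δ := hym.trans_le ((min_le_right _ _).trans (min_le_right _ _))
    have hsig : ∀ z K : ℝ, |z| ≤ K → σ * z ≤ K := fun z K hz => by
      refine (le_abs_self _).trans ?_
      rw [abs_mul]
      nlinarith [abs_nonneg z, abs_nonneg σ]
    have hsc : ContinuousOn s (Icc t0 t1) := h.sc.mono fun t ht => Ioo_subset_Ico_self (hmem t ht)
    refine max_principle (W := fun t x => σ * (u t (x + y) - u t x) - Γ * y)
      (a := fun _ => δ) (b := fun t => s t - y) (t0 := t0) (t1 := t1) continuousOn_const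
      (hsc.sub continuousOn_const) ?_ ?_ ?_ t ht x hx
    · have e1 := h.uc.comp (f := fun q : ℝ × ℝ => (q.1, q.2 + y)) (s := {q | q.1 ∈ Icc t0 t1 ∧
        q.2 ∈ Icc δ (s q.1 - y)}) (by fun_prop) (fun q hq => ⟨Ioo_subset_Ico_self (hmem _ hq.1), by
          dsimp; linarith [hq.2.1], by dsimp; linarith [hq.2.2]⟩)
      have e2 := h.uc.mono (t := {q : ℝ × ℝ | q.1 ∈ Icc t0 t1 ∧
        q.2 ∈ Icc δ (s q.1 - y)}) (fun q hq => ⟨Ioo_subset_Ico_self (hmem _ hq.1), by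
          linarith [hq.2.1], by linarith [hq.2.2]⟩)
      exact (continuousOn_const.mul (e1.sub e2)).sub continuousOn_const
    · intro x hx
      have := h.lip ht0 hδ le_rfl hi x ⟨hx.1, by linarith [hx.2]⟩
        (x + y) ⟨by linarith [hx.1], by linarith [hx.2]⟩
      rw [add_sub_cancel_left, abs_of_pos hy0] at this
      linarith [hsig _ _ this]
    · intro t ht x hx
      have ht' : t ∈ Icc t0 t1 := ⟨ht.1.le, ht.2⟩
      have hs := hsm t ht'
      rcases eq_or_lt_of_le hx.1 with e | e
      · left
        have := h.lip (hmem t ht') hδ (b := δ + y) (by linarith) (L := Γ) (fun z hz =>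
          hunif t ht' z ⟨hz.1, by linarith [hz.2]⟩ (by linarith [hz.2])) x ⟨e.le, by linarith⟩
          (x + y) ⟨by linarith, by linarith⟩
        rw [add_sub_cancel_left, abs_of_pos hy0] at this
        linarith [hsig _ _ this]
      rcases eq_or_lt_of_le hx.2 with e' | e'
      · left
        have a1 := hfb t ht' x ⟨by linarith, by linarith⟩
        have a3 := h.nn t (Ioo_subset_Ico_self (hmem t ht')) x ⟨by linarith, by linarith⟩
        have e2 : x + y = s t := by rw [e']; ring
        rw [e2, h.bcs t (hmem t ht')]
        have e3 : s t - x = y := by rw [e']; ring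
        rw [e3] at a1
        have := hsig (0 - u t x) (Γ * y) (by rw [zero_sub, abs_neg, abs_of_nonneg a3]; exact a1)
        linarith
      right; left
      have j1 := (h.jet t (hmem t ht') (x + y) ⟨by linarith, by linarith⟩).shift
      have j2 := (h.jet t (hmem t ht') x ⟨by linarith, by linarith⟩)
      exact ⟨⟨e, e'⟩, _, _, ((j1.sub j2).smul σ).sub (HeatJet.const (Γ * y) t x), le_rfl⟩
  have hm : 0 < min h₁ (min d (s t0 - δ)) := lt_min h₁p (lt_min hd (by linarith))
  intro x hx
  have hst := h.spos t (Ioo_subset_Ico_self (hmem t ht))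
  rcases eq_or_lt_of_le hx.2 with e | e
  · rw [e, abs_of_nonpos (h.ds_nonneg (hmem t ht))]
    have hs := hsm t ht
    refine h.sd_bound (hmem t ht) (d := min d (s t)) (lt_min hd hst) (min_le_right _ _) ?_
    intro z hz
    exact hfb t ht z ⟨by linarith [hz.1, min_le_left d (s t)], hz.2⟩
  · have hb : x < x + min (min h₁ (min d (s t0 - δ))) (s t - x) := by
      have := lt_min hm (sub_pos.2 e); linarith
    have key2 : ∀ σ : ℝ, |σ| ≤ 1 → σ * deriv (u t) x ≤ Γ := by
      intro σ hσ
      refine right_deriv_bound (f := fun z => σ * u t z) hb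
        (((h.ux t (hmem t ht) x ⟨hδ.trans hx.1, hx.2⟩).mono (Icc_subset_Icc (hδ.trans hx.1)
          ?_)).const_mul σ) ?_
      · linarith [min_le_right (min h₁ (min d (s t0 - δ))) (s t - x)]
      · intro z hz
        have := key σ hσ (z - x) (by linarith [hz.1])
          (by linarith [min_le_left (min h₁ (min d (s t0 - δ))) (s t - x), hz.2]) x
          ⟨hx.1, by linarith [min_le_right (min h₁ (min d (s t0 - δ))) (s t - x), hz.2]⟩
        rw [add_sub_cancel] at this
        linarith
    have k1 := key2 1 (by simp)
    have k2 := key2 (-1) (by simp)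
    rw [abs_le]
    constructor <;> linarith
end apriori

theorem swap_int {f : ℝ → ℝ → ℝ} (hf : Continuous (fun q : ℝ × ℝ => f q.1 q.2)) {a b c d : ℝ}
    (hab : a ≤ b) (hcd : c ≤ d) :
    ∫ x in a..b, ∫ y in c..d, f x y = ∫ y in c..d, ∫ x in a..b, f x y := by
  simp only [intervalIntegral.integral_of_le hab, intervalIntegral.integral_of_le hcd]
  refine integral_integral_swap ?_
  rw [Measure.prod_restrict]
  exact (hf.continuousOn.integrableOn_compact (isCompact_Icc.prod isCompact_Icc)).mono_set
    (prod_mono Ioc_subset_Icc_self Ioc_subset_Icc_self)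

theorem sub_int {f : ℝ → ℝ} {h : ℝ} (hh : 0 < h) (t : ℝ) :
    ∫ r in (0:ℝ)..1, f (t + h * r) = h⁻¹ * ∫ τ in t..t + h, f τ := by
  rw [intervalIntegral.integral_comp_add_mul _ hh.ne' t]; simp

theorem sub_int_deriv {f : ℝ → ℝ} (hf : Continuous f) {h : ℝ} (hh : 0 < h) (t : ℝ) :
    HasDerivAt (fun t => ∫ r in (0:ℝ)..1, f (t + h * r)) (h⁻¹ * (f (t + h) - f t)) t := by
  have e : (fun t => ∫ r in (0:ℝ)..1, f (t + h * r)) =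
      fun t => h⁻¹ * ((∫ τ in (0:ℝ)..t + h, f τ) - ∫ τ in (0:ℝ)..t, f τ) := by
    funext t
    rw [sub_int hh t, intervalIntegral.integral_interval_sub_left
      (hf.intervalIntegrable _ _) (hf.intervalIntegrable _ _)]
  rw [e]
  have d1 : ∀ t, HasDerivAt (fun t => ∫ τ in (0:ℝ)..t, f τ) (f t) t := fun t =>
    intervalIntegral.integral_hasDerivAt_right (hf.intervalIntegrable _ _)
      (hf.stronglyMeasurableAtFilter _ _) hf.continuousAt
  exact (((d1 (t + h)).comp_add_const t h).fun_sub (d1 t)).const_mul _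

/-- chain rule for averages of Hölder-1/2 functions -/
theorem fb_lim {f F f' g : ℝ → ℝ} (hF : ∀ y, HasDerivAt F (f y) y)
    (hf : ∀ y, HasDerivAt f (f' y) y) (hf' : Continuous f') (hg : Continuous g)
    {t1 t2 h0 K : ℝ} (ht : t1 ≤ t2) (hh0 : 0 < h0)
    (hK : ∀ t ∈ Icc t1 t2, ∀ h, 0 < h → h ≤ h0 → ∀ r ∈ Icc (0:ℝ) 1,
      |g (t + h * r) - g t| ≤ K * √h) :
    Tendsto (fun h => ∫ t in t1..t2, (∫ r in (0:ℝ)..1, f (g (t + h * r))) *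
      (h⁻¹ * (g (t + h) - g t))) (𝓝[>] 0) (𝓝 (F (g t2) - F (g t1))) := by
  have hfc : Continuous f := continuous_iff_continuousAt.2 fun y => (hf y).continuousAt
  have hFc : Continuous F := continuous_iff_continuousAt.2 fun y => (hF y).continuousAt
  set G : ℝ → ℝ → ℝ := fun h t => ∫ r in (0:ℝ)..1, g (t + h * r) with hG
  have hGc : Continuous (fun q : ℝ × ℝ => G q.1 q.2) := by
    simp only [hG]; fun_prop
  have hGc' : ∀ h, Continuous (G h) := fun h => by
    simp only [hG]; fun_prop
  have hmain : ∀ h, 0 < h → ∫ t in t1..t2, f (G h t) * (h⁻¹ * (g (t + h) - g t)) =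
      F (G h t2) - F (G h t1) := by
    intro h hh
    refine intervalIntegral.integral_eq_sub_of_hasDerivAt (f := fun t => F (G h t)) (fun t _ =>
      (hF _).comp t (sub_int_deriv hg hh t)) (Continuous.intervalIntegrable ?_ _ _)
    have := hGc' h
    fun_prop
  have hG0 : ∀ t, G 0 t = g t := fun t => by simp [hG]
  have hlim : Tendsto (fun h => F (G h t2) - F (G h t1)) (𝓝[>] 0) (𝓝 (F (g t2) - F (g t1))) := by
    have hc : Continuous (fun h => F (G h t2) - F (G h t1)) := by
      have h1 : ∀ t, Continuous fun h => G h t := fun t =>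
        hGc.comp (f := fun h : ℝ => (h, t)) (by fun_prop)
      exact (hFc.comp (h1 t2)).sub (hFc.comp (h1 t1))
    have := (hc.tendsto 0).mono_left (nhdsWithin_le_nhds (s := Ioi 0))
    rwa [hG0, hG0] at this
  have hK0 : 0 ≤ K := by
    have := (abs_nonneg _).trans (hK t1 ⟨le_rfl, ht⟩ h0 hh0 le_rfl 0 ⟨le_rfl, zero_le_one⟩)
    exact nonneg_of_mul_nonneg_left this (Real.sqrt_pos.2 hh0)
  -- range bound
  obtain ⟨M, hM⟩ : ∃ M, ∀ t ∈ Icc t1 (t2 + h0), |g t| ≤ M := by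
    obtain ⟨M, hM⟩ := isCompact_Icc.exists_bound_of_continuousOn
      (hg.continuousOn (s := Icc t1 (t2 + h0)))
    exact ⟨M, hM⟩
  have hdiff : Tendsto (fun h => (∫ t in t1..t2, (∫ r in (0:ℝ)..1, f (g (t + h * r))) *
      (h⁻¹ * (g (t + h) - g t))) - (F (G h t2) - F (G h t1))) (𝓝[>] 0) (𝓝 0) := by
    rw [Metric.tendsto_nhds]
    intro ε hε
    set ε' := ε / (4 * (K ^ 2 + 1) * (t2 - t1 + 1)) with hε'
    have hε'p : 0 < ε' := by
      have : 0 ≤ t2 - t1 := by linarith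
      positivity
    have huc := (isCompact_Icc (a := -M) (b := M)).uniformContinuousOn_of_continuous
      hf'.continuousOn
    obtain ⟨δ, hδ, H⟩ := Metric.uniformContinuousOn_iff.1 huc ε' hε'p
    have hev : ∀ᶠ h in 𝓝[>] (0:ℝ), 2 * (K * √h) < δ := by
      have : Continuous (fun h : ℝ => 2 * (K * √h)) := by fun_prop
      have := (this.tendsto 0).mono_left (nhdsWithin_le_nhds (s := Ioi 0))
      simp only [Real.sqrt_zero, mul_zero] at this
      exact this.eventually (gt_mem_nhds hδ)
    filter_upwards [hev, Ioc_mem_nhdsGT hh0] with h hhδ hh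
    have hsq := Real.sqrt_pos.2 hh.1
    have hKs : 0 ≤ K * √h := by positivity
    -- Taylor estimate
    have htay : ∀ y ∈ Icc (-M) M, ∀ z ∈ Icc (-M) M, |y - z| < δ →
        |f y - f z - f' z * (y - z)| ≤ ε' * |y - z| := by
      intro y hy z hz hyz
      have := Convex.norm_image_sub_le_of_norm_hasDerivWithin_le
        (f := fun w => f w - f' z * w) (f' := fun w => f' w - f' z) (s := uIcc z y) (C := ε')
        (x := z) (y := y)
        (fun w _ => ((hf w).fun_sub (by simpa using (hasDerivAt_id w).const_mul (f' z))).hasDerivWithinAt)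
        (fun w hw => by
          have hw' : w ∈ Icc (-M) M := (uIcc_subset_Icc hz hy) hw
          have : |w - z| ≤ |y - z| := abs_sub_left_of_mem_uIcc hw
          exact (H w hw' z hz (by rw [Real.dist_eq]; linarith)).le) (convex_uIcc z y)
        left_mem_uIcc right_mem_uIcc
      simp only [Real.norm_eq_abs] at this
      convert this using 2
      ring
    have hgr : ∀ t ∈ Icc t1 t2, ∀ r ∈ Icc (0:ℝ) 1, g (t + h * r) ∈ Icc (-M) M := fun t ht' r hr =>
      abs_le.1 (hM _ ⟨by nlinarith [ht'.1, hr.1, hh.1], by nlinarith [ht'.2, hr.2, hh.1, hh.2]⟩)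
    have hci : ∀ t, Continuous fun r : ℝ => g (t + h * r) := fun t => by fun_prop
    have hGm : ∀ t ∈ Icc t1 t2, |G h t - g t| ≤ K * √h := by
      intro t ht'
      have e : G h t - g t = ∫ r in (0:ℝ)..1, (g (t + h * r) - g t) := by
        rw [intervalIntegral.integral_sub ((hci t).intervalIntegrable _ _) (by simp)]; simp [hG]
      rw [e]
      have := intervalIntegral.norm_integral_le_of_norm_le_const (a := 0) (b := 1)
        (f := fun r => g (t + h * r) - g t) (C := K * √h) (fun r hr => by
          rw [uIoc_of_le zero_le_one] at hr
          exact hK t ht' h hh.1 hh.2 r ⟨hr.1.le, hr.2⟩)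
      simpa using this
    have hGM : ∀ t ∈ Icc t1 t2, G h t ∈ Icc (-M) M := by
      intro t ht'
      have := intervalIntegral.norm_integral_le_of_norm_le_const (a := 0) (b := 1)
        (f := fun r => g (t + h * r)) (C := M) (fun r hr => by
          rw [uIoc_of_le zero_le_one] at hr
          exact abs_le.2 (hgr t ht' r ⟨hr.1.le, hr.2⟩))
      exact abs_le.1 (by simpa using this)
    have hA : ∀ t ∈ Icc t1 t2, |(∫ r in (0:ℝ)..1, f (g (t + h * r))) - f (G h t)| ≤
        ε' * (2 * (K * √h)) := by
      intro t ht'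
      have e : (∫ r in (0:ℝ)..1, f (g (t + h * r))) - f (G h t) =
          ∫ r in (0:ℝ)..1, (f (g (t + h * r)) - f (G h t) - f' (G h t) * (g (t + h * r) - G h t)) := by
        have i1 : IntervalIntegrable (fun r : ℝ => f (g (t + h * r))) volume 0 1 :=
          (hfc.comp (hci t)).intervalIntegrable _ _
        have i2 := (hci t).intervalIntegrable (μ := volume) 0 1
        rw [intervalIntegral.integral_sub (i1.sub (by simp)) ((i2.sub (by simp)).const_mul _),
          intervalIntegral.integral_sub i1 (by simp), intervalIntegral.integral_const_mul,
          intervalIntegral.integral_sub i2 (by simp)]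
        simp [hG]
      rw [e]
      have := intervalIntegral.norm_integral_le_of_norm_le_const (a := 0) (b := 1)
        (f := fun r => f (g (t + h * r)) - f (G h t) - f' (G h t) * (g (t + h * r) - G h t))
        (C := ε' * (2 * (K * √h))) (fun r hr => by
          rw [uIoc_of_le zero_le_one] at hr
          have hr' : r ∈ Icc (0:ℝ) 1 := ⟨hr.1.le, hr.2⟩
          have b1 := hK t ht' h hh.1 hh.2 r hr'
          have b2 := hGm t ht'
          have b3 : |g (t + h * r) - G h t| ≤ 2 * (K * √h) := by
            rw [abs_le] at *
            constructor <;> linarith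
          refine (htay _ (hgr t ht' r hr') _ (hGM t ht') (by linarith)).trans ?_
          gcongr)
      simpa using this
    rw [← hmain h hh.1, ← intervalIntegral.integral_sub, Real.dist_eq, sub_zero]
    · have hb := intervalIntegral.norm_integral_le_of_norm_le_const (a := t1) (b := t2)
        (f := fun t => (∫ r in (0:ℝ)..1, f (g (t + h * r))) * (h⁻¹ * (g (t + h) - g t)) -
          f (G h t) * (h⁻¹ * (g (t + h) - g t))) (C := ε' * (2 * K ^ 2)) (fun t ht' => by
          rw [uIoc_of_le ht] at ht'
          have ht'' : t ∈ Icc t1 t2 := ⟨ht'.1.le, ht'.2⟩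
          rw [← sub_mul, Real.norm_eq_abs, abs_mul, abs_mul, abs_inv, abs_of_pos hh.1]
          have b1 := hA t ht''
          have b2 := hK t ht'' h hh.1 hh.2 1 ⟨zero_le_one, le_rfl⟩
          rw [mul_one] at b2
          calc _ ≤ ε' * (2 * (K * √h)) * (h⁻¹ * (K * √h)) := by
                have := inv_pos.2 hh.1
                gcongr
            _ = ε' * (2 * K ^ 2) * ((√h * √h) * h⁻¹) := by ring
            _ = _ := by rw [Real.mul_self_sqrt hh.1.le, mul_inv_cancel₀ hh.1.ne', mul_one])
      rw [Real.norm_eq_abs, abs_of_nonneg (by linarith : 0 ≤ t2 - t1)] at hb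
      refine hb.trans_lt ?_
      have hT : 0 ≤ t2 - t1 := by linarith
      have : ε = ε' * (4 * (K ^ 2 + 1) * (t2 - t1 + 1)) := by
        rw [hε']; field_simp
      rw [this, mul_assoc]
      refine mul_lt_mul_of_pos_left ?_ hε'p
      nlinarith [sq_nonneg K, mul_nonneg (sq_nonneg K) hT]
    · exact Continuous.intervalIntegrable (by fun_prop) _ _
    · have := hGc' h
      exact Continuous.intervalIntegrable (by fun_prop) _ _
  simpa using hdiff.add hlim

structure Strip (p t1 t3 R : ℝ) (U V : ℝ → ℝ → ℝ) : Prop where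
  Rp : 0 < R
  Uc : Continuous (fun q : ℝ × ℝ => U q.1 q.2)
  Vc : Continuous (fun q : ℝ × ℝ => V q.1 q.2)
  d : ∀ t ∈ Icc t1 t3, ∀ x ∈ Ioo 0 R, HasDerivAt (U t) (V t x) x
  I : ∀ t ∈ Icc t1 t3, ∀ t' ∈ Icc t1 t3, ∀ x ∈ Icc 0 R,
    ∫ y in (0:ℝ)..x, (U t' y - U t y) = ∫ τ in t..t', (V τ x - V τ 0)
  bc : ∀ t, V t 0 = -(U t 0 ^ p)
  nn : ∀ t x, 0 ≤ U t x

structure Cut (R Z : ℝ) (ζ ζ' : ℝ → ℝ) : Prop where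
  c : Continuous ζ
  c' : Continuous ζ'
  d : ∀ x, HasDerivAt ζ (ζ' x) x
  one : ∀ x ≤ R / 2, ζ x = 1
  zero : ∀ x ≥ R, ζ x = 0
  d0 : ∀ x ≤ R / 2, ζ' x = 0
  Zb : ∀ x, |ζ' x| ≤ Z
  le1 : ∀ x, |ζ x| ≤ 1

theorem Cut.exists {R : ℝ} (hR : 0 < R) : ∃ Z ζ ζ', Cut R Z ζ ζ' := by
  set ζ : ℝ → ℝ := fun x => Real.smoothTransition (2 - 2 * x / R) with hζ
  have hcd : ContDiff ℝ 1 ζ := (Real.smoothTransition.contDiff (n := 1)).comp (by fun_prop)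
  have hd : Differentiable ℝ ζ := hcd.differentiable (by simp)
  have hc' : Continuous (deriv ζ) := hcd.continuous_deriv (by simp)
  have h1 : ∀ x ≤ R / 2, ζ x = 1 := fun x hx => by
    refine Real.smoothTransition.one_of_one_le ?_
    have : 2 * x / R ≤ 1 := by rw [div_le_one hR]; linarith
    linarith
  have h0 : ∀ x ≥ R, ζ x = 0 := fun x hx => by
    refine Real.smoothTransition.zero_of_nonpos ?_
    have : 2 ≤ 2 * x / R := by rw [le_div_iff₀ hR]; linarith
    linarith
  have hd0 : ∀ x ≤ R / 2, deriv ζ x = 0 := fun x hx => by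
    have : IsLocalMax ζ x := Eventually.of_forall fun y => by
      rw [h1 x hx]; exact Real.smoothTransition.le_one _
    exact this.deriv_eq_zero
  have hd1 : ∀ x ≥ R, deriv ζ x = 0 := fun x hx => by
    have : IsLocalMin ζ x := Eventually.of_forall fun y => by
      rw [h0 x hx]; exact Real.smoothTransition.nonneg _
    exact this.deriv_eq_zero
  obtain ⟨Z, hZ⟩ := isCompact_Icc.exists_bound_of_continuousOn (hc'.continuousOn (s := Icc (R/2) R))
  refine ⟨Z, ζ, deriv ζ, hd.continuous, hc', fun x => (hd x).hasDerivAt, h1, h0, hd0, ?_, ?_⟩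
  · have hZ0 : 0 ≤ Z := (norm_nonneg _).trans (hZ R ⟨by linarith, le_rfl⟩)
    intro x
    rcases le_total x (R / 2) with h | h
    · rw [hd0 x h]; simpa
    rcases le_total x R with h' | h'
    · exact hZ x ⟨h, h'⟩
    · rw [hd1 x h']; simpa
  · intro x
    rw [abs_of_nonneg (Real.smoothTransition.nonneg _)]
    exact Real.smoothTransition.le_one _

/-- localized energy -/
def Ez (p R : ℝ) (ζ : ℝ → ℝ) (U V : ℝ → ℝ → ℝ) (t : ℝ) : ℝ :=
  1 / 2 * (∫ x in (0:ℝ)..R, ζ x ^ 2 * V t x ^ 2) - U t 0 ^ (p + 1) / (p + 1)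

section
variable {p t1 t2 t3 R Z Γ : ℝ} {U V : ℝ → ℝ → ℝ} {ζ ζ' : ℝ → ℝ}

theorem Strip.holder (hS : Strip p t1 t3 R U V) {L : ℝ} (hL : ∀ t ∈ Icc t1 t3, ∀ x ∈ Icc 0 R,
    |V t x| ≤ L) {t t' : ℝ} (ht : t ∈ Icc t1 t3) (ht' : t' ∈ Icc t1 t3) (hR : √|t' - t| ≤ R) :
    |U t' 0 - U t 0| ≤ 3 * L * √|t' - t| := by
  set r := √|t' - t| with hr
  have hr0 : 0 ≤ r := Real.sqrt_nonneg _
  rcases eq_or_lt_of_le hr0 with h | hrp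
  · have : t' = t := by
      rw [hr, eq_comm, Real.sqrt_eq_zero (abs_nonneg _), abs_eq_zero] at h; linarith
    rw [← h, this]; simp
  have hUt : ∀ t, Continuous (U t) := fun t => hS.Uc.comp (f := fun y => (t, y)) (by fun_prop)
  have hlip : ∀ t ∈ Icc t1 t3, ∀ y ∈ Icc 0 r, |U t y - U t 0| ≤ L * y := by
    intro t ht y hy
    have := norm_image_sub_le_of_norm_deriv_right_le_segment (a := 0) (b := y)
      (f := U t) (f' := V t) (C := L) (hUt t).continuousOn
      (fun x hx => ?_) (fun x hx => hL t ht x ⟨hx.1, by linarith [hx.2, hy.2]⟩) y ⟨hy.1, le_rfl⟩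
    · simpa using this
    · rcases eq_or_lt_of_le hx.1 with e | e
      · subst e
        refine hasDerivWithinAt_Ici_of_tendsto_deriv (s := Ioo 0 R) (fun z hz =>
          (hS.d t ht z hz).differentiableAt.differentiableWithinAt) (hUt t).continuousWithinAt
          (Ioo_mem_nhdsGT hS.Rp) ?_
        have h2 : Tendsto (V t) (𝓝[>] 0) (𝓝 (V t 0)) :=
          ((hS.Vc.comp (f := fun y : ℝ => (t, y)) (by fun_prop)).tendsto 0).mono_left
            nhdsWithin_le_nhds
        refine h2.congr' ?_
        filter_upwards [Ioo_mem_nhdsGT hS.Rp] with z hz using ((hS.d t ht z hz).deriv).symm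
      · exact (hS.d t ht x ⟨e, by linarith [hx.2, hy.2]⟩).hasDerivWithinAt
  have hI := hS.I t ht t' ht' r ⟨hr0, hR⟩
  have hb : |∫ τ in t..t', (V τ r - V τ 0)| ≤ 2 * L * |t' - t| := by
    refine intervalIntegral.norm_integral_le_of_norm_le_const (f := fun τ => V τ r - V τ 0)
      (fun τ hτ => ?_)
    have hτ' : τ ∈ Icc t1 t3 := by
      have := uIoc_subset_uIcc hτ
      exact uIcc_subset_Icc ht ht' this
    have a1 := abs_le.1 (hL τ hτ' r ⟨hr0, hR⟩)
    have a2 := abs_le.1 (hL τ hτ' 0 ⟨le_rfl, hS.Rp.le⟩)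
    rw [Real.norm_eq_abs, abs_le]
    constructor <;> linarith
  have hsplit : ∫ y in (0:ℝ)..r, ((U t' y - U t y) - (U t' 0 - U t 0)) =
      (∫ y in (0:ℝ)..r, (U t' y - U t y)) - r * (U t' 0 - U t 0) := by
    have c1 := hUt t
    have c2 := hUt t'
    rw [intervalIntegral.integral_sub (Continuous.intervalIntegrable (by fun_prop) _ _) (by simp)]
    simp; ring
  have hb2 : |∫ y in (0:ℝ)..r, ((U t' y - U t y) - (U t' 0 - U t 0))| ≤ L * r * |r - 0| * 1 := by
    rw [intervalIntegral.integral_congr (g := fun y => (U t' y - U t' 0) - (U t y - U t 0))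
      (fun y _ => by ring)]
    have c1 := hUt t
    have c2 := hUt t'
    rw [intervalIntegral.integral_sub (Continuous.intervalIntegrable (by fun_prop) _ _)
      (Continuous.intervalIntegrable (by fun_prop) _ _)]
    have aux : ∀ t ∈ Icc t1 t3, |∫ y in (0:ℝ)..r, (U t y - U t 0)| ≤ L * r * r / 2 := by
      intro t ht
      have i := intervalIntegral.norm_integral_le_of_norm_le (a := 0) (b := r) (μ := volume)
        (f := fun y => U t y - U t 0) (g := fun y => L * y) hr0
        (Eventually.of_forall fun y hy => hlip t ht y ⟨hy.1.le, hy.2⟩)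
        (Continuous.intervalIntegrable (by fun_prop) _ _)
      rw [intervalIntegral.integral_const_mul, integral_id] at i
      rw [Real.norm_eq_abs] at i
      linarith
    have a1 := abs_le.1 (aux t' ht')
    have a2 := abs_le.1 (aux t ht)
    rw [sub_zero, abs_of_pos hrp, abs_le]
    constructor <;> linarith
  rw [hsplit, hI, sub_zero, abs_of_pos hrp, mul_one] at hb2
  have hrr : r * r = |t' - t| := Real.mul_self_sqrt (abs_nonneg _)
  rw [← hrr] at hb
  have k : r * |U t' 0 - U t 0| ≤ r * (3 * L * r) := by
    rw [← abs_of_pos hrp, ← abs_mul, abs_of_pos hrp]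
    have a1 := abs_le.1 hb
    have a2 := abs_le.1 hb2
    rw [abs_le]
    constructor <;> linarith
  exact le_of_mul_le_mul_left k hrp

theorem Strip.step (hS : Strip p t1 t3 R U V) (hC : Cut R Z ζ ζ') (h12 : t1 ≤ t2)
    {h : ℝ} (hh : 0 < h) (hh3 : t2 + h ≤ t3)
    (hΓ : ∀ t ∈ Icc t1 t3, ∀ x ∈ Icc (R / 2) R, |V t x| ≤ Γ) (lam : ℝ) {x : ℝ}
    (hx : x ∈ Icc 0 (R / 2)) :
    1 / 2 * (∫ y in (0:ℝ)..R, ζ y ^ 2 * (∫ r in (0:ℝ)..1, V (t2 + h * r) y) ^ 2) -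
    1 / 2 * (∫ y in (0:ℝ)..R, ζ y ^ 2 * (∫ r in (0:ℝ)..1, V (t1 + h * r) y) ^ 2) +
    lam * (∫ t in t1..t2, ((∫ r in (0:ℝ)..1, V (t + h * r) x) - ∫ r in (0:ℝ)..1, V (t + h * r) 0))
    ≤ (∫ t in t1..t2, (∫ r in (0:ℝ)..1, U (t + h * r) 0 ^ p) * (h⁻¹ * (U (t + h) 0 - U t 0)))
      + (Z ^ 2 * Γ ^ 2 * R + lam ^ 2 * x / 4) * (t2 - t1) := by
  have hR := hS.Rp
  have hUc := hS.Uc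
  have hVc := hS.Vc
  have hc := hC.c
  have hc' := hC.c'
  have hUx : ∀ t, Continuous (U t) := fun t => hUc.comp (f := fun y => (t, y)) (by fun_prop)
  have hVx : ∀ t, Continuous (V t) := fun t => hVc.comp (f := fun y => (t, y)) (by fun_prop)
  have hVt : ∀ x, Continuous (fun t => V t x) := fun x =>
    hVc.comp (f := fun t => (t, x)) (by fun_prop)
  set P : ℝ → ℝ → ℝ := fun t y => ∫ r in (0:ℝ)..1, V (t + h * r) y with hP
  set q : ℝ → ℝ → ℝ := fun t y => h⁻¹ * (U (t + h) y - U t y) with hq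
  set k : ℝ → ℝ → ℝ := fun t y => h⁻¹ * (V (t + h) y - V t y) with hk
  have hPc : Continuous (fun q : ℝ × ℝ => P q.1 q.2) := by
    simp only [hP]
    refine intervalIntegral.continuous_parametric_intervalIntegral_of_continuous' (f :=
      fun (q : ℝ × ℝ) r => V (q.1 + h * r) q.2) ?_ 0 1
    exact hVc.comp (f := fun z : (ℝ × ℝ) × ℝ => (z.1.1 + h * z.2, z.1.2)) (by fun_prop)
  have hqc : Continuous (fun z : ℝ × ℝ => q z.1 z.2) :=
    continuous_const.mul ((hUc.comp (f := fun z : ℝ × ℝ => (z.1 + h, z.2)) (by fun_prop)).sub hUc)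
  have hkc : Continuous (fun z : ℝ × ℝ => k z.1 z.2) :=
    continuous_const.mul ((hVc.comp (f := fun z : ℝ × ℝ => (z.1 + h, z.2)) (by fun_prop)).sub hVc)
  have hPx : ∀ t, Continuous (P t) := fun t => hPc.comp (f := fun y => (t, y)) (by fun_prop)
  have hqx : ∀ t, Continuous (q t) := fun t => hqc.comp (f := fun y => (t, y)) (by fun_prop)
  have hkx : ∀ t, Continuous (k t) := fun t => hkc.comp (f := fun y => (t, y)) (by fun_prop)
  have hPt : ∀ y, Continuous (fun t => P t y) := fun y =>
    hPc.comp (f := fun t => (t, y)) (by fun_prop)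
  have hqt : ∀ y, Continuous (fun t => q t y) := fun y =>
    hqc.comp (f := fun t => (t, y)) (by fun_prop)
  have hkt : ∀ y, Continuous (fun t => k t y) := fun y =>
    hkc.comp (f := fun t => (t, y)) (by fun_prop)
  have dPt : ∀ t y, HasDerivAt (fun t => P t y) (k t y) t := fun t y =>
    sub_int_deriv (hVt y) hh t
  have hPI : ∀ t ∈ Icc t1 t2, ∀ y ∈ Icc 0 R, ∫ z in (0:ℝ)..y, q t z = P t y - P t 0 := by
    intro t ht y hy
    have := hS.I t ⟨ht.1, by linarith [ht.2]⟩ (t + h) ⟨by linarith [ht.1], by linarith [ht.2]⟩ y hy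
    simp only [hq, hP]
    rw [intervalIntegral.integral_const_mul, this, sub_int (f := fun τ => V τ y) hh t,
      sub_int (f := fun τ => V τ 0) hh t, intervalIntegral.integral_sub
      ((hVt y).intervalIntegrable _ _) ((hVt 0).intervalIntegrable _ _)]
    ring
  have hpt : ∀ t ∈ Icc t1 t2, (∫ y in (0:ℝ)..R, ζ y ^ 2 * (P t y * k t y)) +
      lam * (P t x - P t 0) ≤ -(P t 0 * q t 0) + (Z ^ 2 * Γ ^ 2 * R + lam ^ 2 * x / 4) := by
    intro t ht
    have hxR : x ∈ Icc 0 R := ⟨hx.1, by linarith [hx.2]⟩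
    have c1 := hPx t
    have c2 := hqx t
    have c3 := hkx t
    have hIBP : ∫ y in (0:ℝ)..R, ((2 * ζ y * ζ' y * P t y * q t y + ζ y ^ 2 * q t y ^ 2) +
        ζ y ^ 2 * (P t y * k t y)) = -(P t 0 * q t 0) := by
      have := intervalIntegral.integral_eq_sub_of_hasDerivAt_of_le hR.le
        (f := fun y => ζ y ^ 2 * (P t y * q t y)) (f' := fun y =>
          ((2 * ζ y * ζ' y * P t y * q t y + ζ y ^ 2 * q t y ^ 2) + ζ y ^ 2 * (P t y * k t y)))
        (by fun_prop) (fun y hy => ?_) (Continuous.intervalIntegrable (by fun_prop) _ _)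
      · rw [this, hC.zero R le_rfl, hC.one 0 (by linarith)]; simp
      · have d1 : HasDerivAt (P t) (q t y) y := by
          have e1 : HasDerivAt (fun y => P t 0 + ∫ z in (0:ℝ)..y, q t z) (q t y) y :=
            (intervalIntegral.integral_hasDerivAt_right (c2.intervalIntegrable _ _)
              (c2.stronglyMeasurableAtFilter _ _) c2.continuousAt).const_add _
          refine e1.congr_of_eventuallyEq ?_
          filter_upwards [Ioo_mem_nhds hy.1 hy.2] with z hz
          rw [hPI t ht z ⟨hz.1.le, hz.2.le⟩]; ring
        have d2 : HasDerivAt (q t) (k t y) y :=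
          ((hS.d (t + h) ⟨by linarith [ht.1], by linarith [ht.2]⟩ y hy).fun_sub
            (hS.d t ⟨ht.1, by linarith [ht.2]⟩ y hy)).const_mul _
        refine (((hC.d y).fun_pow 2).fun_mul (d1.fun_mul d2)).congr_deriv ?_
        simp; ring
    rw [intervalIntegral.integral_add (Continuous.intervalIntegrable (by fun_prop) _ _)
      (Continuous.intervalIntegrable (by fun_prop) _ _)] at hIBP
    have ig : ∀ a b, IntervalIntegrable (fun y => 2 * ζ y * ζ' y * P t y * q t y +
      ζ y ^ 2 * q t y ^ 2) volume a b := fun a b => Continuous.intervalIntegrable (by fun_prop) _ _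
    have hs := intervalIntegral.integral_add_adjacent_intervals (ig 0 x) (ig x R)
    have l1 : lam * (P t x - P t 0) - lam ^ 2 * x / 4 ≤ ∫ y in (0:ℝ)..x,
        (2 * ζ y * ζ' y * P t y * q t y + ζ y ^ 2 * q t y ^ 2) := by
      have e : lam * (P t x - P t 0) - lam ^ 2 * x / 4 =
          ∫ y in (0:ℝ)..x, (lam * q t y - lam ^ 2 / 4) := by
        rw [intervalIntegral.integral_sub (Continuous.intervalIntegrable (by fun_prop) _ _)
          (by simp), intervalIntegral.integral_const_mul, hPI t ht x hxR]
        simp; ring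
      rw [e]
      refine intervalIntegral.integral_mono_on hx.1 (Continuous.intervalIntegrable (by fun_prop) _ _)
        (ig _ _) fun y hy => ?_
      have hy2 : y ≤ R / 2 := hy.2.trans hx.2
      rw [hC.one y hy2, hC.d0 y hy2]
      nlinarith [sq_nonneg (q t y - lam / 2)]
    have l2 : -(Z ^ 2 * Γ ^ 2 * R) ≤ ∫ y in x..R,
        (2 * ζ y * ζ' y * P t y * q t y + ζ y ^ 2 * q t y ^ 2) := by
      have e : ∫ y in x..R, (-(Z ^ 2 * Γ ^ 2)) = -(Z ^ 2 * Γ ^ 2) * (R - x) := by simp; ring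
      have hle : -(Z ^ 2 * Γ ^ 2 * R) ≤ -(Z ^ 2 * Γ ^ 2) * (R - x) := by
        nlinarith [mul_nonneg (mul_nonneg (sq_nonneg Z) (sq_nonneg Γ)) hx.1]
      refine hle.trans (e ▸ ?_)
      refine intervalIntegral.integral_mono_on hxR.2 (by simp) (ig _ _) fun y hy => ?_
      have hb : (ζ' y * P t y) ^ 2 ≤ Z ^ 2 * Γ ^ 2 := by
        rcases le_total y (R / 2) with hy2 | hy2
        · rw [hC.d0 y hy2, zero_mul, zero_pow two_ne_zero]; positivity
        · have hPb : |P t y| ≤ Γ := by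
            have := intervalIntegral.norm_integral_le_of_norm_le_const (a := 0) (b := 1)
              (f := fun r => V (t + h * r) y) (C := Γ) (fun r hr => by
                rw [uIoc_of_le zero_le_one] at hr
                exact hΓ _ ⟨by nlinarith [ht.1, hr.1], by nlinarith [ht.2, hr.2]⟩ y ⟨hy2, hy.2⟩)
            simpa using this
          rw [← mul_pow]
          refine sq_le_sq' ?_ ?_
          · have := abs_le.1 (show |ζ' y * P t y| ≤ Z * Γ by
              rw [abs_mul]; exact mul_le_mul (hC.Zb y) hPb (abs_nonneg _)
                ((abs_nonneg _).trans (hC.Zb y)))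
            exact this.1
          · have := abs_le.1 (show |ζ' y * P t y| ≤ Z * Γ by
              rw [abs_mul]; exact mul_le_mul (hC.Zb y) hPb (abs_nonneg _)
                ((abs_nonneg _).trans (hC.Zb y)))
            exact this.2
      nlinarith [sq_nonneg (ζ' y * P t y + ζ y * q t y)]
    linarith
  have hleft : 1 / 2 * (∫ y in (0:ℝ)..R, ζ y ^ 2 * P t2 y ^ 2) -
      1 / 2 * (∫ y in (0:ℝ)..R, ζ y ^ 2 * P t1 y ^ 2) =
      ∫ t in t1..t2, ∫ y in (0:ℝ)..R, ζ y ^ 2 * (P t y * k t y) := by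
    have c1 := hPx t1
    have c2 := hPx t2
    rw [swap_int (f := fun t y => ζ y ^ 2 * (P t y * k t y)) (by fun_prop) h12 hR.le, ← mul_sub,
      ← intervalIntegral.integral_sub (Continuous.intervalIntegrable (by fun_prop) _ _)
      (Continuous.intervalIntegrable (by fun_prop) _ _), ← intervalIntegral.integral_const_mul]
    refine intervalIntegral.integral_congr fun y _ => ?_
    have c3 := hPt y
    have c4 := hkt y
    have := intervalIntegral.integral_eq_sub_of_hasDerivAt (a := t1) (b := t2)
      (f := fun t => 1 / 2 * (ζ y ^ 2 * P t y ^ 2)) (f' := fun t => ζ y ^ 2 * (P t y * k t y))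
      (fun t _ => ((((dPt t y).fun_pow 2).const_mul (ζ y ^ 2)).const_mul (1 / 2)).congr_deriv (by
        simp; ring)) (Continuous.intervalIntegrable (by fun_prop) _ _)
    rw [this]; ring
  rw [hleft, ← intervalIntegral.integral_const_mul, ← intervalIntegral.integral_add]
  · have e : (∫ t in t1..t2, (∫ r in (0:ℝ)..1, U (t + h * r) 0 ^ p) * (h⁻¹ * (U (t + h) 0 - U t 0)))
        + (Z ^ 2 * Γ ^ 2 * R + lam ^ 2 * x / 4) * (t2 - t1) =
        ∫ t in t1..t2, (-(P t 0 * q t 0) + (Z ^ 2 * Γ ^ 2 * R + lam ^ 2 * x / 4)) := by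
      have c3 := hPt 0
      have c4 := hqt 0
      rw [intervalIntegral.integral_add (Continuous.intervalIntegrable (by fun_prop) _ _) (by simp),
        intervalIntegral.integral_const, smul_eq_mul, mul_comm (t2 - t1)]
      congr 1
      refine intervalIntegral.integral_congr fun t _ => ?_
      simp only [hP, hq, hS.bc, intervalIntegral.integral_neg]
      ring
    rw [e]
    have c3 := hPt 0
    have c4 := hqt 0
    have c5 := hPt x
    refine intervalIntegral.integral_mono_on h12 ?_ (Continuous.intervalIntegrable (by fun_prop) _ _)
      hpt
    exact Continuous.intervalIntegrable (by fun_prop) _ _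
  · exact Continuous.intervalIntegrable (by fun_prop) _ _
  · have c3 := hPt 0
    have c5 := hPt x
    exact Continuous.intervalIntegrable (by fun_prop) _ _
end

section
variable {p t1 t2 t3 R Z Γ : ℝ} {U V : ℝ → ℝ → ℝ} {ζ ζ' : ℝ → ℝ}

theorem Strip.energy (hp : 1 < p) (hS : Strip p t1 t3 R U V) (hC : Cut R Z ζ ζ') (h12 : t1 ≤ t2)
    (h23 : t2 < t3)
    (hΓ : ∀ t ∈ Icc t1 t3, ∀ x ∈ Icc (R / 2) R, |V t x| ≤ Γ) (lam : ℝ) {x : ℝ}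
    (hx : x ∈ Icc 0 (R / 2)) :
    lam * (∫ t in t1..t2, (V t x - V t 0)) ≤ Ez p R ζ U V t1 - Ez p R ζ U V t2
      + (Z ^ 2 * Γ ^ 2 * R + lam ^ 2 * x / 4) * (t2 - t1) := by
  have hUc := hS.Uc
  have hVc := hS.Vc
  have hc := hC.c
  have hVx : ∀ t, Continuous (V t) := fun t => hVc.comp (f := fun y => (t, y)) (by fun_prop)
  have hR := hS.Rp
  obtain ⟨L, hL⟩ := (isCompact_Icc (a := t1) (b := t3)).prod (isCompact_Icc (a := 0) (b := R))
    |>.exists_bound_of_continuousOn hVc.continuousOn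
  have hL' : ∀ t ∈ Icc t1 t3, ∀ x ∈ Icc 0 R, |V t x| ≤ L := fun t ht x hx => hL (t, x) ⟨ht, hx⟩
  have hL0 : 0 ≤ L := (abs_nonneg _).trans (hL' t1 ⟨le_rfl, by linarith⟩ 0 ⟨le_rfl, hR.le⟩)
  have hg : Continuous (fun t => U t 0) := by fun_prop
  have hlim := fb_lim (f := fun y => y ^ p) (F := fun y => y ^ (p + 1) / (p + 1))
    (f' := fun y => p * y ^ (p - 1)) (g := fun t => U t 0) (t1 := t1) (t2 := t2)
    (h0 := min (t3 - t2) (R ^ 2)) (K := 3 * L)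
    (fun y => ((Real.hasDerivAt_rpow_const (x := y) (p := p + 1) (Or.inr (by linarith))).div_const
      (p + 1)).congr_deriv (by
        rw [add_sub_cancel_right, mul_div_assoc, mul_div_cancel₀]; linarith))
    (fun y => Real.hasDerivAt_rpow_const (Or.inr hp.le))
    (continuous_const.mul (Real.continuous_rpow_const (by linarith)))
    hg h12 (lt_min (by linarith) (by positivity))
    (fun t ht h hh hh0 r hr => by
      have h1 : h ≤ t3 - t2 := hh0.trans (min_le_left _ _)
      have h2 : h ≤ R ^ 2 := hh0.trans (min_le_right _ _)
      have e : t + h * r - t = h * r := by ring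
      have hhr : |h * r| ≤ h := by
        rw [abs_of_nonneg (mul_nonneg hh.le hr.1)]; nlinarith [hr.2]
      refine (hS.holder hL' (t := t) (t' := t + h * r) ⟨ht.1, by linarith [ht.2]⟩
        ⟨by nlinarith [ht.1, hr.1], by nlinarith [ht.2, hr.2]⟩ ?_).trans ?_
      · rw [e]
        refine Real.sqrt_le_iff.2 ⟨hR.le, hhr.trans h2⟩
      · rw [e]
        exact mul_le_mul_of_nonneg_left (Real.sqrt_le_sqrt hhr) (by positivity))
  set A : ℝ → ℝ := fun h => 1 / 2 * (∫ y in (0:ℝ)..R, ζ y ^ 2 *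
      (∫ r in (0:ℝ)..1, V (t2 + h * r) y) ^ 2) -
    1 / 2 * (∫ y in (0:ℝ)..R, ζ y ^ 2 * (∫ r in (0:ℝ)..1, V (t1 + h * r) y) ^ 2) +
    lam * (∫ t in t1..t2, ((∫ r in (0:ℝ)..1, V (t + h * r) x) - ∫ r in (0:ℝ)..1, V (t + h * r) 0))
    with hA
  have hAc : Continuous A := by
    simp only [hA]
    fun_prop
  have hA0 := (hAc.tendsto 0).mono_left (nhdsWithin_le_nhds (s := Ioi 0))
  have hfin := le_of_tendsto_of_tendsto hA0 (hlim.add_const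
    ((Z ^ 2 * Γ ^ 2 * R + lam ^ 2 * x / 4) * (t2 - t1))) (by
      filter_upwards [Ioo_mem_nhdsGT (show 0 < t3 - t2 by linarith)] with h hh
      exact hS.step hC h12 hh.1 (by linarith [hh.2]) hΓ lam hx)
  simp only [hA, zero_mul, add_zero, intervalIntegral.integral_const, sub_zero, one_smul] at hfin
  simp only [Ez]
  linarith
end

section
variable {p Tm R t1 t3 : ℝ} {s : ℝ → ℝ} {u : ℝ → ℝ → ℝ}

/-- clamped version -/
def clampF (t1 t3 R : ℝ) (w : ℝ → ℝ → ℝ) (t x : ℝ) : ℝ := w (max t1 (min t3 t)) (max 0 (min R x))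

theorem clampF_eq {t1 t3 R : ℝ} {w : ℝ → ℝ → ℝ} {t x : ℝ} (ht : t ∈ Icc t1 t3) (hx : x ∈ Icc 0 R) :
    clampF t1 t3 R w t x = w t x := by
  simp [clampF, ht.1, ht.2, hx.1, hx.2]

theorem clampF_cont {w : ℝ → ℝ → ℝ} (h13 : t1 ≤ t3) (hR : 0 ≤ R)
    (h : ContinuousOn (fun q : ℝ × ℝ => w q.1 q.2) (Icc t1 t3 ×ˢ Icc 0 R)) :
    Continuous (fun q : ℝ × ℝ => clampF t1 t3 R w q.1 q.2) := by
  refine h.comp_continuous (f := fun q : ℝ × ℝ => (max t1 (min t3 q.1), max 0 (min R q.2)))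
    (by fun_prop) fun q => ⟨⟨le_max_left _ _, max_le h13 (min_le_left _ _)⟩,
      ⟨le_max_left _ _, max_le hR (min_le_left _ _)⟩⟩

theorem Cl.strip (h : Cl p Tm s u) (h1 : 0 < t1) (h13 : t1 ≤ t3) (h3 : t3 < Tm) (hR : 0 < R)
    (hRs : R < s 0) : Strip p t1 t3 R (clampF t1 t3 R u) (clampF t1 t3 R (fun t => deriv (u t))) := by
  have hmem : ∀ t ∈ Icc t1 t3, t ∈ Ioo 0 Tm := fun t ht => ⟨h1.trans_le ht.1, ht.2.trans_lt h3⟩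
  have hRt : ∀ t ∈ Icc t1 t3, R < s t := fun t ht => hRs.trans_le
    (h.s_mono ⟨le_rfl, (hmem t ht).1.trans (hmem t ht).2⟩ ⟨(hmem t ht).1.le, (hmem t ht).2⟩
      (hmem t ht).1.le)
  set U := clampF t1 t3 R u with hU
  set V := clampF t1 t3 R (fun t => deriv (u t)) with hV
  have hUc : Continuous (fun q : ℝ × ℝ => U q.1 q.2) := clampF_cont h13 hR.le
    (h.uc.mono fun q hq => ⟨⟨(hmem _ hq.1).1.le, (hmem _ hq.1).2⟩, hq.2.1,
      hq.2.2.trans (hRt _ hq.1).le⟩)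
  have hVc : Continuous (fun q : ℝ × ℝ => V q.1 q.2) := clampF_cont h13 hR.le
    (h.uxc.mono fun q hq => ⟨hmem _ hq.1, hq.2.1, hq.2.2.trans (hRt _ hq.1).le⟩)
  have hUx : ∀ t, Continuous (U t) := fun t => hUc.comp (f := fun y => (t, y)) (by fun_prop)
  have hVx : ∀ t, Continuous (V t) := fun t => hVc.comp (f := fun y => (t, y)) (by fun_prop)
  have hVt : ∀ x, Continuous (fun t => V t x) := fun x =>
    hVc.comp (f := fun t => (t, x)) (by fun_prop)
  have hI1 : ∀ t ∈ Icc t1 t3, ∀ t' ∈ Icc t1 t3, t ≤ t' → ∀ x ∈ Ioc 0 R, ∀ x' ∈ Ioc 0 x,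
      ∫ y in x'..x, (U t' y - U t y) = ∫ τ in t..t', (V τ x - V τ x') := by
    intro t ht t' ht' htt x hx x' hx'
    set f : ℝ → ℝ → ℝ := fun τ y => deriv (deriv (u (max t1 (min t3 τ)))) (max x' (min x y)) with hf
    have hfc : Continuous (fun q : ℝ × ℝ => f q.1 q.2) := by
      refine h.uxxc.comp_continuous (f := fun q : ℝ × ℝ => (max t1 (min t3 q.1),
        max x' (min x q.2))) (by fun_prop) fun q => ?_
      have : max t1 (min t3 q.1) ∈ Icc t1 t3 := ⟨le_max_left _ _, max_le h13 (min_le_left _ _)⟩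
      exact ⟨hmem _ this, hx'.1.trans_le (le_max_left _ _), (max_le hx'.2 (min_le_left _ _)).trans_lt
        (hx.2.trans_lt (hRt _ this))⟩
    have hft : ∀ y, Continuous (fun τ => f τ y) := fun y =>
      hfc.comp (f := fun t => (t, y)) (by fun_prop)
    have hfx : ∀ τ, Continuous (f τ) := fun y => hfc.comp (f := fun t => (y, t)) (by fun_prop)
    have e1 : ∀ y ∈ Icc x' x, U t' y - U t y = ∫ τ in t..t', f τ y := by
      intro y hy
      have hyR : y ∈ Icc 0 R := ⟨hx'.1.le.trans hy.1, hy.2.trans hx.2⟩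
      rw [hU, clampF_eq ht hyR, clampF_eq ht' hyR]
      refine (intervalIntegral.integral_eq_sub_of_hasDerivAt (f := fun τ => u τ y) (fun τ hτ => ?_)
        ((hft y).intervalIntegrable _ _)).symm
      have hτ' := uIcc_subset_Icc ht ht' hτ
      have := (h.jet τ (hmem τ hτ') y ⟨hx'.1.trans_le hy.1, hyR.2.trans_lt (hRt τ hτ')⟩).1
      simpa [hf, hτ'.1, hτ'.2, hy.1, hy.2] using this
    have e2 : ∀ τ ∈ Icc t1 t3, V τ x - V τ x' = ∫ y in x'..x, f τ y := by
      intro τ hτ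
      rw [hV, clampF_eq hτ ⟨hx.1.le, hx.2⟩, clampF_eq hτ ⟨hx'.1.le, hx'.2.trans hx.2⟩]
      refine (intervalIntegral.integral_eq_sub_of_hasDerivAt (f := deriv (u τ)) (fun y hy => ?_)
        ((hfx τ).intervalIntegrable _ _)).symm
      rw [uIcc_of_le hx'.2] at hy
      have hys : y ∈ Ioo 0 (s τ) := ⟨hx'.1.trans_le hy.1, (hy.2.trans hx.2).trans_lt (hRt τ hτ)⟩
      obtain ⟨-, wx, hw1, hw2⟩ := h.jet τ (hmem τ hτ) y hys
      have : HasDerivAt (deriv (u τ)) (deriv (deriv (u τ)) y) y := by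
        refine hw2.congr_of_eventuallyEq ?_
        filter_upwards [hw1] with z hz using hz.deriv
      simpa [hf, hτ.1, hτ.2, hy.1, hy.2] using this
    rw [intervalIntegral.integral_congr (g := fun y => ∫ τ in t..t', f τ y) (fun y hy => e1 y (by
      rwa [uIcc_of_le hx'.2] at hy)), intervalIntegral.integral_congr (a := t)
      (g := fun τ => ∫ y in x'..x, f τ y) (fun τ hτ => e2 τ (uIcc_subset_Icc ht ht' hτ))]
    exact (swap_int hfc htt hx'.2).symm
  have hI2 : ∀ t ∈ Icc t1 t3, ∀ t' ∈ Icc t1 t3, t ≤ t' → ∀ x ∈ Icc 0 R,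
      ∫ y in (0:ℝ)..x, (U t' y - U t y) = ∫ τ in t..t', (V τ x - V τ 0) := by
    intro t ht t' ht' htt x hx
    rcases eq_or_lt_of_le hx.1 with e | hx0
    · rw [← e]; simp
    have c1 := hUx t
    have c2 := hUx t'
    have hc1 : Continuous (fun x' => (∫ y in (0:ℝ)..x, (U t' y - U t y)) -
        ∫ y in (0:ℝ)..x', (U t' y - U t y)) :=
      continuous_const.sub (intervalIntegral.continuous_primitive (fun a b =>
        Continuous.intervalIntegrable (by fun_prop) _ _) 0)
    have hc2 : Continuous (fun x' => ∫ τ in t..t', (V τ x - V τ x')) := by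
      have := hVt x
      fun_prop
    have l1 := (hc1.tendsto 0).mono_left (nhdsWithin_le_nhds (s := Ioi 0))
    have l2 := (hc2.tendsto 0).mono_left (nhdsWithin_le_nhds (s := Ioi 0))
    have := tendsto_nhds_unique (l1.congr' (f₂ := fun x' => ∫ τ in t..t', (V τ x - V τ x')) (by
      filter_upwards [Ioo_mem_nhdsGT hx0] with x' hx'
      rw [← hI1 t ht t' ht' htt x ⟨hx0, hx.2⟩ x' ⟨hx'.1, hx'.2.le⟩,
        intervalIntegral.integral_interval_sub_left] <;>
      exact Continuous.intervalIntegrable (by fun_prop) _ _)) l2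
    simpa using this
  refine ⟨hR, hUc, hVc, ?_, ?_, ?_, ?_⟩
  · intro t ht x hx
    rw [hV, clampF_eq ht ⟨hx.1.le, hx.2.le⟩]
    refine (h.uxd (hmem t ht) ⟨hx.1, hx.2.trans (hRt t ht)⟩).congr_of_eventuallyEq ?_
    filter_upwards [Ioo_mem_nhds hx.1 hx.2] with y hy
    rw [hU, clampF_eq ht ⟨hy.1.le, hy.2.le⟩]
  · intro t ht t' ht' x hx
    rcases le_total t t' with htt | htt
    · exact hI2 t ht t' ht' htt x hx
    · have := hI2 t' ht' t ht htt x hx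
      rw [intervalIntegral.integral_symm t' t, ← this, ← intervalIntegral.integral_neg]
      exact intervalIntegral.integral_congr fun y _ => by ring
  · intro t
    have : max t1 (min t3 t) ∈ Icc t1 t3 := ⟨le_max_left _ _, max_le h13 (min_le_left _ _)⟩
    have hb := h.bc0 _ (hmem _ this)
    simpa [hU, hV, clampF, hR.le] using hb
  · intro t x
    have : max t1 (min t3 t) ∈ Icc t1 t3 := ⟨le_max_left _ _, max_le h13 (min_le_left _ _)⟩
    exact h.nn _ ⟨(hmem _ this).1.le, (hmem _ this).2⟩ _ ⟨le_max_left _ _,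
      (max_le hR.le (min_le_left _ _)).trans (hRt _ this).le⟩
end

section
variable {p t1 t2 R Z Γ : ℝ} {U V : ℝ → ℝ → ℝ} {ζ ζ' : ℝ → ℝ}

theorem Strip.energy' (hp : 1 < p) (hS : Strip p t1 t2 R U V) (hC : Cut R Z ζ ζ') (h12 : t1 < t2)
    (hΓ : ∀ t ∈ Icc t1 t2, ∀ x ∈ Icc (R / 2) R, |V t x| ≤ Γ) (lam : ℝ) {x : ℝ}
    (hx : x ∈ Icc 0 (R / 2)) :
    lam * (∫ t in t1..t2, (V t x - V t 0)) ≤ Ez p R ζ U V t1 - Ez p R ζ U V t2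
      + (Z ^ 2 * Γ ^ 2 * R + lam ^ 2 * x / 4) * (t2 - t1) := by
  have hUc := hS.Uc
  have hVc := hS.Vc
  have hc := hC.c
  have hVt : ∀ x, Continuous (fun t => V t x) := fun x =>
    hVc.comp (f := fun t => (t, x)) (by fun_prop)
  have c1 := hVt x
  have c2 := hVt 0
  have hU0 : Continuous (fun t => U t 0 ^ (p + 1)) :=
    (Real.continuous_rpow_const (by linarith)).comp (show Continuous (fun t => U t 0) by fun_prop)
  have l1 : Continuous (fun t' => lam * (∫ t in t1..t', (V t x - V t 0))) :=
    continuous_const.mul (intervalIntegral.continuous_primitive (fun a b =>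
        Continuous.intervalIntegrable (by fun_prop) _ _) t1)
  have l2 : Continuous (fun t' => Ez p R ζ U V t1 - Ez p R ζ U V t'
      + (Z ^ 2 * Γ ^ 2 * R + lam ^ 2 * x / 4) * (t' - t1)) := by
    unfold Ez
    fun_prop
  refine le_of_tendsto_of_tendsto ((l1.tendsto t2).mono_left (nhdsWithin_le_nhds (s := Iio t2)))
    ((l2.tendsto t2).mono_left (nhdsWithin_le_nhds (s := Iio t2))) ?_
  filter_upwards [Ioo_mem_nhdsLT h12] with t ht
  exact hS.energy hp hC ht.1.le ht.2 hΓ lam hx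

theorem Strip.line (hp : 1 < p) (hS : Strip p t1 t2 R U V) (hC : Cut R Z ζ ζ') (h12 : t1 < t2)
    (hΓ : ∀ t ∈ Icc t1 t2, ∀ x ∈ Icc (R / 2) R, |V t x| ≤ Γ) {γ : ℝ} (hγ : 0 < γ)
    (hX : 2 * γ ^ (1 - p) ≤ R / 2) (hg : ∀ t ∈ Icc t1 t2, γ ≤ U t 0) :
    γ ^ (3 * p - 1) / 4 * (t2 - t1) ≤ Ez p R ζ U V t1 - Ez p R ζ U V t2
      + Z ^ 2 * Γ ^ 2 * R * (t2 - t1) := by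
  have hUc := hS.Uc
  have hVc := hS.Vc
  have hR := hS.Rp
  have hVx : ∀ t, Continuous (V t) := fun t => hVc.comp (f := fun y => (t, y)) (by fun_prop)
  have hUx : ∀ t, Continuous (U t) := fun t => hUc.comp (f := fun y => (t, y)) (by fun_prop)
  have hVt : ∀ x, Continuous (fun t => V t x) := fun x =>
    hVc.comp (f := fun t => (t, x)) (by fun_prop)
  have hUt : ∀ x, Continuous (fun t => U t x) := fun x =>
    hUc.comp (f := fun t => (t, x)) (by fun_prop)
  set X := 2 * γ ^ (1 - p) with hXd
  have hX0 : 0 < X := by positivity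
  set D := Ez p R ζ U V t1 - Ez p R ζ U V t2 + Z ^ 2 * Γ ^ 2 * R * (t2 - t1) with hD
  set lam := 4 * γ / X ^ 2 with hlam
  have hlp : 0 < lam := by positivity
  have hin : ∀ x ∈ Icc 0 X, lam * (∫ t in t1..t2, (V t x - V t 0)) ≤
      D + lam ^ 2 / 4 * (t2 - t1) * x := fun x hx => by
    have := hS.energy' hp hC h12 hΓ lam (x := x) ⟨hx.1, hx.2.trans hX⟩
    rw [hD]; linarith
  have i1 := intervalIntegral.integral_mono_on (μ := volume) hX0.le
    (Continuous.intervalIntegrable (by fun_prop) _ _)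
    (Continuous.intervalIntegrable (by fun_prop) _ _) hin
  rw [intervalIntegral.integral_const_mul, ← swap_int (f := fun t x => V t x - V t 0)
    (by have := hVt 0; fun_prop) h12.le hX0.le, intervalIntegral.integral_add (by simp)
    (Continuous.intervalIntegrable (by fun_prop) _ _), intervalIntegral.integral_const_mul,
    integral_id, intervalIntegral.integral_const, smul_eq_mul] at i1
  have i2 : γ * (t2 - t1) ≤ ∫ t in t1..t2, ∫ x in (0:ℝ)..X, (V t x - V t 0) := by
    have e : γ * (t2 - t1) = ∫ t in t1..t2, γ := by simp; ring
    rw [e]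
    refine intervalIntegral.integral_mono_on h12.le (by simp)
      (Continuous.intervalIntegrable (by have := hVt 0; fun_prop) _ _) fun t ht => ?_
    have c1 := hVx t
    have c2 := hUx t
    rw [intervalIntegral.integral_sub (Continuous.intervalIntegrable (by fun_prop) _ _) (by simp),
      intervalIntegral.integral_eq_sub_of_hasDerivAt_of_le hX0.le c2.continuousOn
      (fun x hx => hS.d t ht x ⟨hx.1, by linarith [hx.2]⟩) (c1.intervalIntegrable _ _), hS.bc]
    have n1 := hS.nn t X
    have n2 := hg t ht
    have n3 : γ ^ (p - 1) * U t 0 ≤ U t 0 ^ p := by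
      have : U t 0 ^ p = U t 0 ^ (p - 1) * U t 0 := by
        rw [← Real.rpow_add_one (by linarith), sub_add_cancel]
      rw [this]
      exact mul_le_mul_of_nonneg_right (Real.rpow_le_rpow hγ.le n2 (by linarith)) (by linarith)
    have n4 : X * (γ ^ (p - 1) * U t 0) = 2 * U t 0 := by
      have : γ ^ (1 - p) * γ ^ (p - 1) = 1 := by
        rw [← Real.rpow_add hγ]; simp
      calc _ = 2 * (γ ^ (1 - p) * γ ^ (p - 1)) * U t 0 := by rw [hXd]; ring
        _ = _ := by rw [this]; ring
    have n5 := mul_le_mul_of_nonneg_left n3 hX0.le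
    simp only [intervalIntegral.integral_const, smul_eq_mul, sub_zero]
    linarith
  have i3 := mul_le_mul_of_nonneg_left i2 hlp.le
  have i4 : 2 * γ ^ 2 * (t2 - t1) ≤ X ^ 3 * D := by
    have h5 := i3.trans i1
    have e1 : lam * (γ * (t2 - t1)) = 4 * γ ^ 2 / X ^ 2 * (t2 - t1) := by rw [hlam]; ring
    have e2 : lam ^ 2 / 4 * (t2 - t1) * ((X ^ 2 - 0 ^ 2) / 2) = 2 * γ ^ 2 / X ^ 2 * (t2 - t1) := by
      rw [hlam]; field_simp; ring
    rw [e1, e2] at h5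
    have h6 : 2 * γ ^ 2 / X ^ 2 * (t2 - t1) ≤ X * D := by
      have : 4 * γ ^ 2 / X ^ 2 * (t2 - t1) = 2 * (2 * γ ^ 2 / X ^ 2 * (t2 - t1)) := by ring
      linarith
    have h7 := mul_le_mul_of_nonneg_left h6 (sq_nonneg X)
    have : X ^ 2 * (2 * γ ^ 2 / X ^ 2 * (t2 - t1)) = 2 * γ ^ 2 * (t2 - t1) := by field_simp
    rw [this] at h7
    linarith
  have e3 : γ ^ (3 * p - 1) * X ^ 3 = 8 * γ ^ 2 := by
    rw [hXd, mul_pow, ← Real.rpow_natCast (γ ^ (1 - p)), ← Real.rpow_mul hγ.le, mul_left_comm,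
      ← Real.rpow_add hγ, show (3 * p - 1 + (1 - p) * ((3 : ℕ) : ℝ)) = 2 by push_cast; ring,
      Real.rpow_two]
    norm_num
  have hX3 : 0 < X ^ 3 := by positivity
  refine le_of_mul_le_mul_left ?_ hX3
  calc X ^ 3 * (γ ^ (3 * p - 1) / 4 * (t2 - t1)) = (γ ^ (3 * p - 1) * X ^ 3) / 4 * (t2 - t1) := by ring
    _ = 2 * γ ^ 2 * (t2 - t1) := by rw [e3]; ring
    _ ≤ _ := i4

theorem Strip.jump (hp : 1 < p) (hS : Strip p t1 t2 R U V) (hC : Cut R Z ζ ζ') (h12 : t1 < t2)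
    (hΓ : ∀ t ∈ Icc t1 t2, ∀ x ∈ Icc (R / 2) R, |V t x| ≤ Γ) {m A : ℝ} (hm : 0 < m) (hA : 0 < A)
    (hj : m ≤ |U t2 0 - U t1 0|)
    (hA1 : Ez p R ζ U V t1 + U t1 0 ^ (p + 1) / (p + 1) ≤ A / 2)
    (hA2 : Ez p R ζ U V t2 + U t2 0 ^ (p + 1) / (p + 1) ≤ A / 2) :
    min (R / 2) (m ^ 2 / (16 * A)) * m ^ 2 / 4 ≤ (Ez p R ζ U V t1 - Ez p R ζ U V t2
      + Z ^ 2 * Γ ^ 2 * R * (t2 - t1)) * (t2 - t1) := by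
  have hUc := hS.Uc
  have hVc := hS.Vc
  have hR := hS.Rp
  have hc := hC.c
  have hVx : ∀ t, Continuous (V t) := fun t => hVc.comp (f := fun y => (t, y)) (by fun_prop)
  have hUx : ∀ t, Continuous (U t) := fun t => hUc.comp (f := fun y => (t, y)) (by fun_prop)
  set l := min (R / 2) (m ^ 2 / (16 * A)) with hl
  have hl0 : 0 < l := lt_min (by linarith) (by positivity)
  have hlR : l ≤ R / 2 := min_le_left _ _
  have hlA : A * l ≤ m ^ 2 / 16 := by
    have : l ≤ m ^ 2 / (16 * A) := min_le_right _ _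
    rw [le_div_iff₀ (by positivity)] at this; linarith
  have hosc : ∀ t ∈ Icc t1 t2, Ez p R ζ U V t + U t 0 ^ (p + 1) / (p + 1) ≤ A / 2 →
      ∀ y ∈ Icc 0 l, |U t y - U t 0| ≤ m / 4 := by
    intro t ht hE y hy
    have c1 := hVx t
    have hE' : ∫ x in (0:ℝ)..R, ζ x ^ 2 * V t x ^ 2 ≤ A := by
      simp only [Ez] at hE; linarith
    have h1 : ∫ x in (0:ℝ)..y, V t x ^ 2 ≤ A := by
      have e : ∫ x in (0:ℝ)..y, V t x ^ 2 = ∫ x in (0:ℝ)..y, ζ x ^ 2 * V t x ^ 2 :=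
        intervalIntegral.integral_congr fun x hx => by
          rw [uIcc_of_le hy.1] at hx
          rw [hC.one x (by linarith [hx.2, hy.2])]; ring
      rw [e]
      refine le_trans ?_ hE'
      refine intervalIntegral.integral_mono_interval le_rfl hy.1 (by linarith [hy.2])
        (Eventually.of_forall fun x => by positivity) (Continuous.intervalIntegrable (by fun_prop) _ _)
    have h2 : U t y - U t 0 = ∫ x in (0:ℝ)..y, V t x :=
      (intervalIntegral.integral_eq_sub_of_hasDerivAt_of_le hy.1 (hUx t).continuousOn
      (fun x hx => hS.d t ht x ⟨hx.1, by linarith [hx.2, hy.2]⟩) (c1.intervalIntegrable _ _)).symm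
    have h3 : |∫ x in (0:ℝ)..y, V t x| ≤ ∫ x in (0:ℝ)..y, (m / (8 * A) * V t x ^ 2 + 2 * A / m) := by
      refine intervalIntegral.norm_integral_le_of_norm_le (f := V t)
        (g := fun x => m / (8 * A) * V t x ^ 2 + 2 * A / m) hy.1 (Eventually.of_forall fun x _ => ?_)
        (Continuous.intervalIntegrable (by fun_prop) _ _)
      rw [Real.norm_eq_abs]
      have hpos : 0 < 8 * A * m := by positivity
      have : m / (8 * A) * V t x ^ 2 + 2 * A / m = (m ^ 2 * |V t x| ^ 2 + 16 * A ^ 2) / (8 * A * m) := by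
        rw [sq_abs]; field_simp; ring
      rw [this, le_div_iff₀ hpos]
      nlinarith [sq_nonneg (m * |V t x| - 4 * A)]
    rw [intervalIntegral.integral_add (Continuous.intervalIntegrable (by fun_prop) _ _) (by simp),
      intervalIntegral.integral_const_mul, intervalIntegral.integral_const, smul_eq_mul] at h3
    rw [h2]
    refine h3.trans ?_
    have h4 : m / (8 * A) * (∫ x in (0:ℝ)..y, V t x ^ 2) ≤ m / (8 * A) * A :=
      mul_le_mul_of_nonneg_left h1 (by positivity)
    have h5 : m / (8 * A) * A = m / 8 := by field_simp
    have h6 : (y - 0) * (2 * A / m) ≤ m / 8 := by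
      have : (y - 0) * (2 * A / m) = (2 * (A * y)) / m := by ring
      rw [this, div_le_iff₀ hm]
      nlinarith [mul_le_mul_of_nonneg_left hy.2 hA.le]
    linarith
  have hI := hS.I t1 ⟨le_rfl, h12.le⟩ t2 ⟨h12.le, le_rfl⟩ l ⟨hl0.le, by linarith⟩
  set Q := ∫ τ in t1..t2, (V τ l - V τ 0) with hQ
  have hen := hS.energy' hp hC h12 hΓ (2 * Q / (l * (t2 - t1))) (x := l) ⟨hl0.le, hlR⟩
  rw [← hQ] at hen
  set D := Ez p R ζ U V t1 - Ez p R ζ U V t2 + Z ^ 2 * Γ ^ 2 * R * (t2 - t1) with hD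
  have hdt : 0 < t2 - t1 := by linarith
  have hQ2 : Q ^ 2 ≤ D * (l * (t2 - t1)) := by
    have e : 2 * Q / (l * (t2 - t1)) * Q ≤ D + Q ^ 2 / (l * (t2 - t1)) := by
      have : (2 * Q / (l * (t2 - t1))) ^ 2 * l / 4 * (t2 - t1) = Q ^ 2 / (l * (t2 - t1)) := by
        field_simp; ring
      rw [hD, ← this]; linarith
    have e2 : 2 * Q / (l * (t2 - t1)) * Q = 2 * (Q ^ 2 / (l * (t2 - t1))) := by ring
    have e3 : Q ^ 2 / (l * (t2 - t1)) ≤ D := by linarith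
    rwa [div_le_iff₀ (by positivity)] at e3
  have hQl : l * m / 2 ≤ |Q| := by
    have o1 := hosc t1 ⟨le_rfl, h12.le⟩ hA1
    have o2 := hosc t2 ⟨h12.le, le_rfl⟩ hA2
    rw [← hI]
    have c1 := hUx t1
    have c2 := hUx t2
    have ii : ∀ c : ℝ, ∫ y in (0:ℝ)..l, c = l * c := fun c => by simp
    rcases le_abs.1 hj with hj | hj
    · refine le_trans ?_ (le_abs_self _)
      rw [mul_div_assoc, ← ii]
      refine intervalIntegral.integral_mono_on hl0.le (by simp)
        (Continuous.intervalIntegrable (by fun_prop) _ _) fun y hy => ?_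
      have a1 := abs_le.1 (o1 y hy)
      have a2 := abs_le.1 (o2 y hy)
      linarith
    · refine le_trans ?_ (neg_le_abs _)
      rw [mul_div_assoc, ← ii, ← intervalIntegral.integral_neg]
      refine intervalIntegral.integral_mono_on hl0.le (by simp)
        (Continuous.intervalIntegrable (by fun_prop) _ _) fun y hy => ?_
      have a1 := abs_le.1 (o1 y hy)
      have a2 := abs_le.1 (o2 y hy)
      linarith
  have h9 : (l * m / 2) ^ 2 ≤ Q ^ 2 := by
    rw [← sq_abs Q]
    exact pow_le_pow_left₀ (by positivity) hQl 2
  refine le_of_mul_le_mul_left ?_ hl0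
  nlinarith
end

section
variable {p Tm t1 t2 R Z Γ : ℝ} {s : ℝ → ℝ} {u : ℝ → ℝ → ℝ} {ζ ζ' : ℝ → ℝ}

/-- localized energy of a solution -/
def Eu (p R : ℝ) (ζ : ℝ → ℝ) (u : ℝ → ℝ → ℝ) (t : ℝ) : ℝ := Ez p R ζ u (fun t => deriv (u t)) t

theorem Eu_eq {t : ℝ} (ht : t ∈ Icc t1 t2) (hR : 0 ≤ R) : Ez p R ζ (clampF t1 t2 R u)
    (clampF t1 t2 R (fun t => deriv (u t))) t = Eu p R ζ u t := by
  simp only [Eu, Ez]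
  rw [clampF_eq ht ⟨le_rfl, hR⟩]
  congr 2
  refine intervalIntegral.integral_congr fun x hx => ?_
  rw [uIcc_of_le hR] at hx
  rw [clampF_eq ht hx]

theorem Cl.strip' (h : Cl p Tm s u) (h1 : 0 < t1) (h12 : t1 ≤ t2) (h3 : t2 < Tm) (hR : 0 < R)
    (hRs : R < s 0)
    (hΓ : ∀ t ∈ Icc t1 t2, ∀ x ∈ Icc (R / 2) R, |deriv (u t) x| ≤ Γ) :
    ∃ U V, Strip p t1 t2 R U V ∧ (∀ t ∈ Icc t1 t2, ∀ x ∈ Icc (R / 2) R, |V t x| ≤ Γ) ∧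
      (∀ t ∈ Icc t1 t2, U t 0 = u t 0) ∧ Ez p R ζ U V t1 = Eu p R ζ u t1 ∧
      Ez p R ζ U V t2 = Eu p R ζ u t2 := by
  refine ⟨_, _, h.strip h1 h12 h3 hR hRs, fun t ht x hx => ?_, fun t ht =>
    clampF_eq ht ⟨le_rfl, hR.le⟩, Eu_eq ⟨le_rfl, h12⟩ hR.le, Eu_eq ⟨h12, le_rfl⟩ hR.le⟩
  rw [clampF_eq ht ⟨by linarith [hx.1], hx.2⟩]
  exact hΓ t ht x hx

theorem Cl.diss (hp : 1 < p) (h : Cl p Tm s u) (hC : Cut R Z ζ ζ') (h1 : 0 < t1) (h12 : t1 ≤ t2)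
    (h3 : t2 < Tm) (hR : 0 < R) (hRs : R < s 0)
    (hΓ : ∀ t ∈ Icc t1 t2, ∀ x ∈ Icc (R / 2) R, |deriv (u t) x| ≤ Γ) :
    0 ≤ Eu p R ζ u t1 - Eu p R ζ u t2 + Z ^ 2 * Γ ^ 2 * R * (t2 - t1) := by
  rcases eq_or_lt_of_le h12 with e | hlt
  · rw [e]; simp
  obtain ⟨U, V, hS, hΓ', hU, e1, e2⟩ := h.strip' (ζ := ζ) h1 h12 h3 hR hRs hΓ
  have := hS.energy' hp hC hlt hΓ' 0 (x := 0) ⟨le_rfl, by linarith⟩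
  rw [e1, e2] at this
  simpa using this

theorem Cl.line (hp : 1 < p) (h : Cl p Tm s u) (hC : Cut R Z ζ ζ') (h1 : 0 < t1) (h12 : t1 < t2)
    (h3 : t2 < Tm) (hR : 0 < R) (hRs : R < s 0)
    (hΓ : ∀ t ∈ Icc t1 t2, ∀ x ∈ Icc (R / 2) R, |deriv (u t) x| ≤ Γ) {γ : ℝ} (hγ : 0 < γ)
    (hX : 2 * γ ^ (1 - p) ≤ R / 2) (hg : ∀ t ∈ Icc t1 t2, γ ≤ u t 0) :
    γ ^ (3 * p - 1) / 4 * (t2 - t1) ≤ Eu p R ζ u t1 - Eu p R ζ u t2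
      + Z ^ 2 * Γ ^ 2 * R * (t2 - t1) := by
  obtain ⟨U, V, hS, hΓ', hU, e1, e2⟩ := h.strip' (ζ := ζ) h1 h12.le h3 hR hRs hΓ
  have := hS.line hp hC h12 hΓ' hγ hX (fun t ht => by rw [hU t ht]; exact hg t ht)
  rwa [e1, e2] at this

theorem Cl.jump (hp : 1 < p) (h : Cl p Tm s u) (hC : Cut R Z ζ ζ') (h1 : 0 < t1) (h12 : t1 < t2)
    (h3 : t2 < Tm) (hR : 0 < R) (hRs : R < s 0)
    (hΓ : ∀ t ∈ Icc t1 t2, ∀ x ∈ Icc (R / 2) R, |deriv (u t) x| ≤ Γ)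
    {m A : ℝ} (hm : 0 < m) (hA : 0 < A)
    (hj : m ≤ |u t2 0 - u t1 0|)
    (hA1 : Eu p R ζ u t1 + u t1 0 ^ (p + 1) / (p + 1) ≤ A / 2)
    (hA2 : Eu p R ζ u t2 + u t2 0 ^ (p + 1) / (p + 1) ≤ A / 2) :
    min (R / 2) (m ^ 2 / (16 * A)) * m ^ 2 / 4 ≤ (Eu p R ζ u t1 - Eu p R ζ u t2
      + Z ^ 2 * Γ ^ 2 * R * (t2 - t1)) * (t2 - t1) := by
  obtain ⟨U, V, hS, hΓ', hU, e1, e2⟩ := h.strip' (ζ := ζ) h1 h12.le h3 hR hRs hΓ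
  have u1 := hU t1 ⟨le_rfl, h12.le⟩
  have u2 := hU t2 ⟨h12.le, le_rfl⟩
  have := hS.jump hp hC h12 hΓ' hm hA (by rwa [u1, u2]) (by rwa [e1, u1]) (by rwa [e2, u2])
  rwa [e1, e2] at this

theorem Eu_ge (hp : 1 < p) (t : ℝ) (hR : 0 < R) (h0 : 0 ≤ u t 0) :
    -(u t 0 ^ (p + 1)) ≤ Eu p R ζ u t := by
  simp only [Eu, Ez]
  have h1 : 0 ≤ ∫ x in (0:ℝ)..R, ζ x ^ 2 * deriv (u t) x ^ 2 :=
    intervalIntegral.integral_nonneg hR.le fun x _ => by positivity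
  have h2 : u t 0 ^ (p + 1) / (p + 1) ≤ u t 0 ^ (p + 1) :=
    div_le_self (Real.rpow_nonneg h0 _) (by linarith)
  linarith
end

/-- scalar consequences of the localized energy inequality -/
def EP (p R : ℝ) (g E : ℝ → ℝ) (κ a b : ℝ) : Prop :=
  ∀ t1 t2, a ≤ t1 → t1 ≤ t2 → t2 ≤ b →
    0 ≤ E t1 - E t2 + κ * (t2 - t1) ∧
    (∀ γ, 0 < γ → 2 * γ ^ (1 - p) ≤ R / 2 → (∀ t ∈ Icc t1 t2, γ ≤ g t) →
      γ ^ (3 * p - 1) / 4 * (t2 - t1) ≤ E t1 - E t2 + κ * (t2 - t1)) ∧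
    (∀ m A, 0 < m → 0 < A → m ≤ |g t2 - g t1| → E t1 + g t1 ^ (p + 1) / (p + 1) ≤ A / 2 →
      E t2 + g t2 ^ (p + 1) / (p + 1) ≤ A / 2 →
      min (R / 2) (m ^ 2 / (16 * A)) * m ^ 2 / 4 ≤ (E t1 - E t2 + κ * (t2 - t1)) * (t2 - t1))

section
variable {p Tm t0 R Z Γ : ℝ} {s : ℝ → ℝ} {u : ℝ → ℝ → ℝ} {ζ ζ' : ℝ → ℝ}
theorem Cl.EP (hp : 1 < p) (h : Cl p Tm s u) (hC : Cut R Z ζ ζ') {a b : ℝ} (h1 : 0 < a)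
    (h3 : b < Tm) (hR : 0 < R) (hRs : R < s 0)
    (hΓ : ∀ t ∈ Icc a b, ∀ x ∈ Icc (R / 2) R, |deriv (u t) x| ≤ Γ) :
    EP p R (fun t => u t 0) (Eu p R ζ u) (Z ^ 2 * Γ ^ 2 * R) a b := by
  intro t1 t2 ht1 h12 ht2
  have hΓ' : ∀ t ∈ Icc t1 t2, ∀ x ∈ Icc (R / 2) R, |deriv (u t) x| ≤ Γ := fun t ht =>
    hΓ t ⟨ht1.trans ht.1, ht.2.trans ht2⟩
  refine ⟨h.diss hp hC (by linarith) h12 (by linarith) hR hRs hΓ', fun γ hγ hX hg => ?_,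
    fun m A hm hA hj hA1 hA2 => ?_⟩
  · rcases eq_or_lt_of_le h12 with e | hlt
    · rw [e]; simp
    · exact h.line hp hC (by linarith) hlt (by linarith) hR hRs hΓ' hγ hX hg
  · rcases eq_or_lt_of_le h12 with e | hlt
    · rw [e] at hj; simp at hj; linarith
    · exact h.jump hp hC (by linarith) hlt (by linarith) hR hRs hΓ' hm hA hj hA1 hA2
end

section
variable {p R c N1 t0 Tm : ℝ} {g E : ℝ → ℝ}

set_option maxHeartbeats 1000000 in
theorem claim_lem (hp : 1 < p) (hR : 0 < R) (hc : 0 ≤ c) (h0T : t0 < Tm)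
    (hg0 : ∀ t ∈ Ico t0 Tm, 0 ≤ g t)
    (hE : ∀ t ∈ Ico t0 Tm, -(g t ^ (p + 1)) ≤ E t)
    (hEP : ∀ N, N1 ≤ N → ∀ b, t0 ≤ b → b < Tm → (∀ t ∈ Icc t0 b, g t ≤ N) →
      EP p R g E (c * N ^ 2) t0 b) :
    ∃ K > 0, ∃ N0, 1 ≤ N0 ∧ ∀ N, N0 ≤ N → ∀ t1 ∈ Ico t0 Tm, g t1 = N → (∀ t ∈ Icc t0 t1, g t ≤ N) →
      t1 + K / (N ^ (p - 1)) ^ 2 < Tm → ∃ t ∈ Icc t1 (t1 + K / (N ^ (p - 1)) ^ 2), 2 * N < g t := by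
  set B : ℝ := 1 + 2 ^ (p + 1) with hB
  have hBp : 1 < B := by rw [hB]; have : (0:ℝ) < 2 ^ (p + 1) := by positivity
                         linarith
  set q : ℝ := min ((1 / 2) ^ (3 * p - 1) / 4) (1 / (128 * B) / 16) with hq
  have hq0 : 0 < q := lt_min (by positivity) (by positivity)
  set η : ℝ := min (1 / 2) (q / 4) with hη
  have hη0 : 0 < η := lt_min (by norm_num) (by positivity)
  have hη1 : η ≤ 1 / 2 := min_le_left _ _
  set ε : ℝ := η ^ (p + 1) with hε
  have hε0 : 0 < ε := by positivity
  have hεη : ε ≤ η := by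
    have := Real.rpow_le_rpow_of_exponent_ge hη0 (by linarith) (show 1 ≤ p + 1 by linarith)
    rwa [Real.rpow_one] at this
  have hεq : 2 * ε < q := by
    have : η ≤ q / 4 := min_le_right _ _
    linarith
  set K : ℝ := 8 * (1 + B) / η ^ (3 * p - 1) with hK
  have hη3 : η ^ (3 * p - 1) ≤ 1 := Real.rpow_le_one hη0.le (by linarith) (by linarith)
  have hK16 : 16 ≤ K := by
    rw [hK, le_div_iff₀ (by positivity)]; nlinarith
  set W : ℝ := |E t0| + 8 * c * (Tm - t0) with hW
  have hW0 : 0 ≤ W := by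
    have : 0 ≤ c * (Tm - t0) := mul_nonneg hc (by linarith)
    have := abs_nonneg (E t0)
    rw [hW]; linarith
  obtain ⟨N0, hN0⟩ := eventually_atTop.1 ((tendsto_rpow_atTop (show 0 < p - 1 by linarith)).eventually_ge_atTop
    (max (W / ε) (max (4 / (η ^ (p - 1) * R)) (2 * (1 / (128 * B)) / R))))
  refine ⟨K, by linarith, max (max N0 N1) 1, le_max_right _ _, ?_⟩
  have hKe : K * η ^ (3 * p - 1) = 8 * (1 + B) := by rw [hK]; field_simp
  have hq1 : q ≤ (1 / 2) ^ (3 * p - 1) / 4 := min_le_left _ _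
  have hq2 : q ≤ 1 / (128 * B) / 16 := min_le_right _ _
  clear_value B q η ε K W
  intro N hN t1 ht1 hgt1 hrec htE
  have hN1 : 1 ≤ N := (le_max_right _ _).trans hN
  have hN' : N1 ≤ N := ((le_max_right _ _).trans (le_max_left _ _)).trans hN
  have hNa := hN0 N (((le_max_left _ _).trans (le_max_left _ _)).trans hN)
  set a := N ^ (p - 1) with ha
  have hNp : 0 < N := by linarith
  have ha0 : 0 < a := by positivity
  have a1 : W ≤ ε * a := by
    have := (le_max_left _ _).trans hNa
    rw [div_le_iff₀ hε0] at this; linarith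
  have a2 : 4 / (η ^ (p - 1) * R) ≤ a := ((le_max_left _ _).trans (le_max_right _ _)).trans hNa
  have a3 : 2 * (1 / (128 * B)) / R ≤ a := ((le_max_right _ _).trans (le_max_right _ _)).trans hNa
  have eN : N ^ (p + 1) = N ^ 2 * a := by
    rw [ha, ← Real.rpow_two, ← Real.rpow_add hNp]; congr 1; ring
  have eN3 : N ^ (3 * p - 1) = N ^ 2 * a ^ 3 := by
    rw [ha, ← Real.rpow_two, ← Real.rpow_natCast (N ^ (p - 1)), ← Real.rpow_mul hNp.le,
      ← Real.rpow_add hNp]; congr 1; push_cast; ring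
  clear_value a
  set tE := t1 + K / a ^ 2 with htEd
  have hKa : 0 < K / a ^ 2 := by positivity
  by_contra hcon
  push Not at hcon
  have hg2 : ∀ t ∈ Icc t0 tE, g t ≤ 2 * N := by
    intro t ht
    rcases le_total t t1 with h | h
    · linarith [hrec t ⟨ht.1, h⟩]
    · exact hcon t ⟨h, ht.2⟩
  have hep := hEP (2 * N) (by linarith) tE (by linarith [ht1.1]) htE hg2
  set κ := c * (2 * N) ^ 2 with hκ
  have hκ0 : 0 ≤ κ := by positivity
  clear_value κ tE
  have hin : ∀ t ∈ Icc t0 tE, t ∈ Ico t0 Tm := fun t ht => ⟨ht.1, ht.2.trans_lt htE⟩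
  have hEW : ∀ t ∈ Icc t0 tE, ∀ r, 0 ≤ r → r ≤ Tm - t0 → E t + κ * r ≤ ε * (N ^ 2 * a) := by
    intro t ht r hr hr'
    have h1 := (hep t0 t le_rfl ht.1 ht.2).1
    have h2 : κ * (t - t0) ≤ κ * (Tm - t0) := mul_le_mul_of_nonneg_left (by linarith [(hin t ht).2]) hκ0
    have h3 : κ * r ≤ κ * (Tm - t0) := mul_le_mul_of_nonneg_left hr' hκ0
    have h4 : E t0 ≤ |E t0| * N ^ 2 :=
      (le_abs_self _).trans (le_mul_of_one_le_right (abs_nonneg _) (one_le_pow₀ hN1))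
    have h5 : W * N ^ 2 ≤ ε * a * N ^ 2 := mul_le_mul_of_nonneg_right a1 (by positivity)
    have h6 : W * N ^ 2 = |E t0| * N ^ 2 + 2 * (κ * (Tm - t0)) := by rw [hW, hκ]; ring
    linarith
  have hX : ∀ γ, η * N ≤ γ → 2 * γ ^ (1 - p) ≤ R / 2 := by
    intro γ hγ
    have hγ0 : 0 < η * N := by positivity
    have e : γ ^ (1 - p) ≤ (η * N) ^ (1 - p) :=
      Real.rpow_le_rpow_of_nonpos hγ0 hγ (by linarith)
    have e2 : (η * N) ^ (1 - p) = 1 / (η ^ (p - 1) * a) := by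
      rw [show 1 - p = -(p - 1) by ring, Real.rpow_neg hγ0.le, Real.mul_rpow hη0.le hNp.le, one_div, ha]
    have hη' : 0 < η ^ (p - 1) := by positivity
    rw [div_le_iff₀ (by positivity)] at a2
    have e3 : 1 / (η ^ (p - 1) * a) ≤ R / 4 := by
      rw [div_le_iff₀ (by positivity)]; linarith
    linarith
  have hNN : 0 < N ^ 2 * a := by positivity
  have hεB : ε * (N ^ 2 * a) ≤ N ^ 2 * a := mul_le_of_le_one_left hNN.le (by linarith)
  have hBM : B * (N ^ 2 * a) = N ^ 2 * a + 2 ^ (p + 1) * (N ^ 2 * a) := by rw [hB]; ring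
  have hqM : 2 * ε * (N ^ 2 * a) < q * (N ^ 2 * a) := mul_lt_mul_of_pos_right hεq hNN
  have g2p : ∀ t ∈ Icc t0 tE, g t ^ (p + 1) ≤ 2 ^ (p + 1) * (N ^ 2 * a) := fun t ht => by
    rw [← eN, ← Real.mul_rpow (by norm_num) hNp.le]
    exact Real.rpow_le_rpow (hg0 t (hin t ht)) (hg2 t ht) (by linarith)
  -- step 1
  obtain ⟨ts, hts, hgts⟩ : ∃ t ∈ Icc (t1 + K / (2 * a ^ 2)) tE, g t < η * N := by
    by_contra hno
    push Not at hno
    have hhalf : K / (2 * a ^ 2) = K / a ^ 2 / 2 := by ring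
    have hm0 : t1 + K / (2 * a ^ 2) ≤ tE := by rw [hhalf]; linarith
    have hmm : t0 ≤ t1 + K / (2 * a ^ 2) := by rw [hhalf]; linarith [ht1.1]
    have hl := (hep _ tE hmm hm0 le_rfl).2.1 (η * N) (by positivity) (hX _ le_rfl) hno
    have hEE := hE tE (hin tE ⟨by linarith [ht1.1], le_rfl⟩)
    have hgE := g2p tE ⟨by linarith [ht1.1], le_rfl⟩
    have h5 := hEW _ ⟨hmm, hm0⟩ (tE - (t1 + K / (2 * a ^ 2))) (by linarith) (by linarith)
    have e1 : (η * N) ^ (3 * p - 1) / 4 * (tE - (t1 + K / (2 * a ^ 2))) = (1 + B) * (N ^ 2 * a) := by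
      have e0 : tE - (t1 + K / (2 * a ^ 2)) = K / (2 * a ^ 2) := by rw [hhalf, htEd]; ring
      rw [Real.mul_rpow hη0.le hNp.le, eN3, e0]
      calc _ = K * η ^ (3 * p - 1) / 8 * (N ^ 2 * a) := by field_simp; ring
        _ = _ := by rw [hKe]; ring
    rw [e1, add_mul, one_mul, hBM] at hl
    linarith
  have hts1 : t1 + 1 / a ^ 2 ≤ ts := by
    refine le_trans ?_ hts.1
    have : 1 / a ^ 2 ≤ K / (2 * a ^ 2) := by
      rw [div_le_div_iff₀ (by positivity) (by positivity)]
      have := mul_le_mul_of_nonneg_right hK16 (sq_nonneg a)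
      linarith [sq_nonneg a]
    linarith
  have ha2 : 0 < 1 / a ^ 2 := by positivity
  have hDs : ∀ t2, t1 ≤ t2 → t2 ≤ ts → E t1 - E t2 + κ * (t2 - t1) ≤ 2 * ε * (N ^ 2 * a) := by
    intro t2 h2 h2'
    have d1 := (hep t2 ts (by linarith [ht1.1]) h2' hts.2).1
    have hts' : ts ∈ Icc t0 tE := ⟨by linarith [ht1.1], hts.2⟩
    have d2 := hEW t1 ⟨ht1.1, by linarith⟩ (ts - t1) (by linarith) (by linarith [ht1.1, hts.2])
    have d3 := hE ts (hin ts hts')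
    have d4 : g ts ^ (p + 1) ≤ ε * (N ^ 2 * a) := by
      rw [← eN, hε, ← Real.mul_rpow hη0.le hNp.le]
      exact Real.rpow_le_rpow (hg0 ts (hin ts hts')) hgts.le (by linarith)
    linarith
  -- step 3
  obtain ⟨t2, ht2, hgt2⟩ : ∃ t ∈ Icc t1 (t1 + 1 / a ^ 2), g t < N / 2 := by
    by_contra hno
    push Not at hno
    have hl := (hep t1 (t1 + 1 / a ^ 2) ht1.1 (by linarith) (hts1.trans hts.2)).2.1 (N / 2)
      (by positivity) (hX _ (by
        have := mul_le_mul_of_nonneg_right hη1 hNp.le; linarith)) hno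
    have hd := hDs _ (by linarith) hts1
    have e1 : (N / 2) ^ (3 * p - 1) / 4 * (t1 + 1 / a ^ 2 - t1) =
        (1 / 2) ^ (3 * p - 1) / 4 * (N ^ 2 * a) := by
      rw [div_eq_mul_one_div N 2, Real.mul_rpow hNp.le (by norm_num), eN3]
      field_simp
      ring
    rw [e1] at hl
    have := mul_le_mul_of_nonneg_right hq1 hNN.le
    linarith
  -- step 4
  have hA : ∀ t ∈ Icc t0 tE, E t + g t ^ (p + 1) / (p + 1) ≤ (2 * B * (N ^ 2 * a)) / 2 := by
    intro t ht
    have d2 := hEW t ht 0 le_rfl (by linarith)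
    have d3 := g2p t ht
    have d4 : g t ^ (p + 1) / (p + 1) ≤ g t ^ (p + 1) :=
      div_le_self (Real.rpow_nonneg (hg0 t (hin t ht)) _) (by linarith)
    have e5 : (2 * B * (N ^ 2 * a)) / 2 = B * (N ^ 2 * a) := by ring
    rw [e5, hBM]
    linarith
  have ht2E : t2 ∈ Icc t0 tE := ⟨ht1.1.trans ht2.1, (ht2.2.trans hts1).trans hts.2⟩
  have hj := (hep t1 t2 ht1.1 ht2.1 ht2E.2).2.2 (N / 2) (2 * B * (N ^ 2 * a)) (by positivity)
    (by positivity) (by rw [le_abs]; right; linarith) (hA t1 ⟨ht1.1, by linarith⟩) (hA t2 ht2E)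
  have hd := hDs t2 ht2.1 (ht2.2.trans hts1)
  have hd0 := (hep t1 t2 ht1.1 ht2.1 ht2E.2).1
  have e1 : (N / 2) ^ 2 / (16 * (2 * B * (N ^ 2 * a))) = 1 / (128 * B) / a := by
    field_simp; ring
  have e2 : min (R / 2) (1 / (128 * B) / a) = 1 / (128 * B) / a := by
    refine min_eq_right ?_
    rw [div_le_iff₀ hR] at a3
    rw [div_le_iff₀ ha0]; linarith
  rw [e1, e2] at hj
  have h6 : (E t1 - E t2 + κ * (t2 - t1)) * (t2 - t1) ≤ 2 * ε * (N ^ 2 * a) * (1 / a ^ 2) :=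
    mul_le_mul hd (by linarith [ht2.2]) (by linarith [ht2.1]) (by positivity)
  have h7 := hj.trans h6
  have e3 : 1 / (128 * B) / a * (N / 2) ^ 2 / 4 = 1 / (128 * B) / 16 * (N ^ 2 / a) := by
    field_simp; ring
  have e4 : 2 * ε * (N ^ 2 * a) * (1 / a ^ 2) = 2 * ε * (N ^ 2 / a) := by field_simp
  rw [e3, e4] at h7
  have hpos : 0 < N ^ 2 / a := by positivity
  have := le_of_mul_le_mul_right h7 hpos
  linarith
end

section
variable {p R c N1 t0 Tm : ℝ} {g E : ℝ → ℝ}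

theorem rate_lem (hp : 1 < p) (hR : 0 < R) (hc : 0 ≤ c) (h0T : t0 < Tm)
    (hgc : ContinuousOn g (Ico t0 Tm))
    (hg0 : ∀ t ∈ Ico t0 Tm, 0 ≤ g t)
    (hE : ∀ t ∈ Ico t0 Tm, -(g t ^ (p + 1)) ≤ E t)
    (hEP : ∀ N, N1 ≤ N → ∀ b, t0 ≤ b → b < Tm → (∀ t ∈ Icc t0 b, g t ≤ N) →
      EP p R g E (c * N ^ 2) t0 b) :
    ∃ C, 0 ≤ C ∧ ∀ t ∈ Ico t0 Tm, (Tm - t) ^ (1 / (2 * (p - 1))) * g t ≤ C := by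
  obtain ⟨K, hK, N0, hN0, hcl⟩ := claim_lem hp hR hc h0T hg0 hE hEP
  have hp1 : 0 < p - 1 := by linarith
  set b : ℝ := 2 ^ (p - 1) with hb
  have hb1 : 1 < b := Real.one_lt_rpow (by norm_num) hp1
  have hb2 : 1 < b ^ 2 := one_lt_pow₀ hb1 two_ne_zero
  set K' := K / (1 - 1 / b ^ 2) with hK'
  have hbb : 1 / b ^ 2 < 1 := by rw [div_lt_one (by positivity)]; exact hb2
  have hKK : K + K' / b ^ 2 = K' := by
    have : 1 - 1 / b ^ 2 ≠ 0 := by linarith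
    have e : K' * (1 - 1 / b ^ 2) = K := by rw [hK']; exact div_mul_cancel₀ _ this
    have : K' / b ^ 2 = K' * (1 / b ^ 2) := by ring
    rw [this]; linarith
  have hK'0 : 0 < K' := div_pos hK (by linarith)
  have hK'K : K ≤ K' := by
    have : 0 < K' / b ^ 2 := by positivity
    linarith
  clear_value K'
  set Rec : ℝ → ℝ → Prop := fun N t => t ∈ Ico t0 Tm ∧ g t = N ∧ ∀ τ ∈ Icc t0 t, g τ ≤ N with hRec
  have step : ∀ N t, N0 ≤ N → Rec N t → t + K / (N ^ (p - 1)) ^ 2 < Tm →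
      ∃ t' ∈ Icc t (t + K / (N ^ (p - 1)) ^ 2), Rec (2 * N) t' := by
    intro N t hN hr hlt
    obtain ⟨t3, ht3, hg3⟩ := hcl N hN t hr.1 hr.2.1 hr.2.2 hlt
    have hsub : Icc t t3 ⊆ Ico t0 Tm := fun τ hτ => ⟨hr.1.1.trans hτ.1, (hτ.2.trans ht3.2).trans_lt hlt⟩
    have hgc' : ContinuousOn g (Icc t t3) := hgc.mono hsub
    have hcomp : IsCompact {τ ∈ Icc t t3 | 2 * N ≤ g τ} := by
      have : IsClosed (Icc t t3 ∩ g ⁻¹' Ici (2 * N)) :=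
        hgc'.preimage_isClosed_of_isClosed isClosed_Icc isClosed_Ici
      exact isCompact_Icc.of_isClosed_subset this inter_subset_left
    obtain ⟨t', ht', hmin⟩ := hcomp.exists_isLeast ⟨t3, ⟨ht3.1, le_rfl⟩, hg3.le⟩
    have hlast : ∀ τ ∈ Icc t t', τ < t' → g τ < 2 * N := fun τ hτ hτ' => by
      by_contra hcon
      push Not at hcon
      exact absurd (hmin ⟨⟨hτ.1, hτ.2.trans ht'.1.2⟩, hcon⟩) (by simpa using hτ')
    have heq : g t' = 2 * N := by
      obtain ⟨c, hc1, hc2⟩ := intermediate_value_Icc ht'.1.1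
        (hgc'.mono (Icc_subset_Icc_right ht'.1.2)) (show 2 * N ∈ Icc (g t) (g t') from
          ⟨by rw [hr.2.1]; linarith, ht'.2⟩)
      have := hmin ⟨⟨hc1.1, hc1.2.trans ht'.1.2⟩, hc2.ge⟩
      rwa [le_antisymm hc1.2 this] at hc2
    refine ⟨t', ⟨ht'.1.1, ht'.1.2.trans ht3.2⟩, hsub ht'.1, heq, fun τ hτ => ?_⟩
    rcases le_total τ t with h | h
    · linarith [hr.2.2 τ ⟨hτ.1, h⟩]
    · rcases eq_or_lt_of_le hτ.2 with e | e
      · rw [e, heq]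
      · exact (hlast τ ⟨h, hτ.2⟩ e).le
  have main : ∀ N t, N0 ≤ N → Rec N t → Tm - t ≤ K' / (N ^ (p - 1)) ^ 2 := by
    intro N t hN hr
    by_contra hcon
    push Not at hcon
    have hNp : 0 < N := by linarith
    set ti := t + K' / (N ^ (p - 1)) ^ 2 with hti
    have hti' : ti < Tm := by linarith
    have ind : ∀ n : ℕ, ∃ τ, Rec (2 ^ n * N) τ ∧ τ + K' / ((2 ^ n * N) ^ (p - 1)) ^ 2 ≤ ti := by
      intro n
      induction n with
      | zero => exact ⟨t, by simpa using hr, by simp [hti]⟩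
      | succ n ih =>
        obtain ⟨τ, hτ, hle⟩ := ih
        have hge : N0 ≤ 2 ^ n * N := hN.trans (le_mul_of_one_le_left hNp.le (one_le_pow₀ (by norm_num)))
        set a := (2 ^ n * N) ^ (p - 1) with ha
        have ha0 : 0 < a := by positivity
        have h1 : K / a ^ 2 ≤ K' / a ^ 2 := by gcongr
        obtain ⟨t', ht', hr'⟩ := step _ τ hge hτ (by linarith)
        have e : 2 ^ (n + 1) * N = 2 * (2 ^ n * N) := by ring
        refine ⟨t', by rwa [e], ?_⟩
        rw [e, Real.mul_rpow (by norm_num) (by positivity), ← ha, ← hb]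
        have e2 : K' / (b * a) ^ 2 = (K' / b ^ 2) / a ^ 2 := by field_simp
        have e3 : K / a ^ 2 + (K' / b ^ 2) / a ^ 2 = K' / a ^ 2 := by rw [← add_div, hKK]
        rw [e2]
        linarith [ht'.2]
    obtain ⟨M, hM⟩ := isCompact_Icc.exists_bound_of_continuousOn
      (hgc.mono (fun τ hτ => ⟨hτ.1, hτ.2.trans_lt hti'⟩ : Icc t0 ti ⊆ Ico t0 Tm))
    obtain ⟨n, hn⟩ := pow_unbounded_of_one_lt M (show (1:ℝ) < 2 by norm_num)
    obtain ⟨τ, hτ, hle⟩ := ind n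
    have h1 := hM τ ⟨hτ.1.1, by
      have : 0 ≤ K' / ((2 ^ n * N) ^ (p - 1)) ^ 2 := by positivity
      linarith⟩
    rw [hτ.2.1, Real.norm_eq_abs] at h1
    have h2 := le_abs_self (2 ^ n * N)
    have h3 : (2:ℝ) ^ n ≤ 2 ^ n * N := le_mul_of_one_le_right (by positivity) (by linarith)
    linarith
  set α := 1 / (2 * (p - 1)) with hα
  have hα0 : 0 < α := by positivity
  refine ⟨K' ^ α + (Tm - t0) ^ α * N0, by
    have : 0 ≤ (Tm - t0) ^ α := Real.rpow_nonneg (by linarith) _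
    positivity, ?_⟩
  intro t ht
  have hKα : 0 ≤ K' ^ α := by positivity
  have hTα : 0 ≤ (Tm - t0) ^ α * N0 := mul_nonneg (Real.rpow_nonneg (by linarith) _) (by linarith)
  obtain ⟨t1, ht1, hmax⟩ := isCompact_Icc.exists_isMaxOn ⟨t, ht.1, le_rfl⟩
    (hgc.mono (fun τ hτ => ⟨hτ.1, hτ.2.trans_lt ht.2⟩ : Icc t0 t ⊆ Ico t0 Tm))
  have hgm : g t ≤ g t1 := hmax ⟨ht.1, le_rfl⟩
  have hTt : 0 < Tm - t := by linarith [ht.2]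
  rcases le_total N0 (g t1) with hN | hN
  · have := main (g t1) t1 hN ⟨⟨ht1.1, ht1.2.trans_lt ht.2⟩, rfl, fun τ hτ =>
      hmax ⟨hτ.1, hτ.2.trans ht1.2⟩⟩
    have hgp : 0 < g t1 := by linarith
    have h1 : (Tm - t) * (g t1 ^ (p - 1)) ^ 2 ≤ K' := by
      have : Tm - t ≤ K' / (g t1 ^ (p - 1)) ^ 2 := by linarith [ht1.2]
      rwa [le_div_iff₀ (by positivity)] at this
    have h2 := Real.rpow_le_rpow (by positivity) h1 hα0.le
    rw [Real.mul_rpow hTt.le (by positivity), ← Real.rpow_natCast (g t1 ^ (p - 1)),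
      ← Real.rpow_mul hgp.le, ← Real.rpow_mul hgp.le,
      show (p - 1) * ((2:ℕ):ℝ) * α = 1 by rw [hα]; push_cast; field_simp, Real.rpow_one] at h2
    have h3 : (Tm - t) ^ α * g t ≤ (Tm - t) ^ α * g t1 :=
      mul_le_mul_of_nonneg_left hgm (by positivity)
    linarith
  · have h1 : (Tm - t) ^ α ≤ (Tm - t0) ^ α := Real.rpow_le_rpow hTt.le (by linarith [ht.1]) hα0.le
    have h3 : (Tm - t) ^ α * g t ≤ (Tm - t0) ^ α * N0 :=
      mul_le_mul h1 (hgm.trans hN) (hg0 t ht) (by positivity)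
    linarith

theorem bdd_lem (hp : 1 < p) (hR : 0 < R) (hc : 0 ≤ c) (h0T : t0 < Tm)
    (hgc : ContinuousOn g (Ico t0 Tm))
    (hg0 : ∀ t ∈ Ico t0 Tm, 0 ≤ g t)
    (hE : ∀ t ∈ Ico t0 Tm, -(g t ^ (p + 1)) ≤ E t)
    (hEP : ∀ b, t0 ≤ b → b < Tm → EP p R g E c t0 b) (hn : ¬ Tendsto g (𝓝[<] Tm) atTop) :
    ∃ M, ∀ t ∈ Ico t0 Tm, g t ≤ M := by
  rw [tendsto_atTop] at hn
  push Not at hn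
  obtain ⟨M', hM'⟩ := hn
  set M := max M' 1 with hM
  have hM1 : 1 ≤ M := le_max_right _ _
  have hfr : ∀ t1, t1 < Tm → ∃ t ∈ Ioo t1 Tm, g t ≤ M := by
    intro t1 ht1
    obtain ⟨t, ht, ht'⟩ := (hM'.and_eventually (Ioo_mem_nhdsLT ht1)).exists
    exact ⟨t, ht', ht.le.trans (le_max_left _ _)⟩
  clear_value M
  have hT : 0 < Tm - t0 := by linarith
  have hmono : ∀ t1 t2, t0 ≤ t1 → t1 ≤ t2 → t2 < Tm → E t2 ≤ E t1 + c * (Tm - t0) := by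
    intro t1 t2 h1 h2 h3
    have := (hEP t2 (h1.trans h2) h3 t1 t2 h1 h2 le_rfl).1
    have : c * (t2 - t1) ≤ c * (Tm - t0) := mul_le_mul_of_nonneg_left (by linarith) hc
    linarith
  have hlow : ∀ t ∈ Ico t0 Tm, -(M ^ (p + 1)) - c * (Tm - t0) ≤ E t := by
    intro t ht
    obtain ⟨t2, ht2, hg2⟩ := hfr t ht.2
    have h1 := hmono t t2 ht.1 ht2.1.le ht2.2
    have ht2' : t2 ∈ Ico t0 Tm := ⟨ht.1.trans ht2.1.le, ht2.2⟩
    have h2 := hE t2 ht2'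
    have h3 := Real.rpow_le_rpow (hg0 t2 ht2') hg2 (show 0 ≤ p + 1 by linarith)
    linarith
  set cT := c * (Tm - t0) with hcT
  have hcT0 : 0 ≤ cT := mul_nonneg hc hT.le
  set D := |E t0| + M ^ (p + 1) + 3 * cT with hD
  have hMp : 0 < M ^ (p + 1) := by positivity
  have hD0 : 0 < D := by have := abs_nonneg (E t0); linarith
  set A := 2 * (|E t0| + cT + (2 * M) ^ (p + 1)) with hA
  have h2Mp : 0 < (2 * M) ^ (p + 1) := by positivity
  have hA0 : 0 < A := by have := abs_nonneg (E t0); linarith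
  have hAb : ∀ t ∈ Ico t0 Tm, g t ≤ 2 * M → E t + g t ^ (p + 1) / (p + 1) ≤ A / 2 := by
    intro t ht hg
    have h1 := hmono t0 t le_rfl ht.1 ht.2
    have h3 := Real.rpow_le_rpow (hg0 t ht) hg (show 0 ≤ p + 1 by linarith)
    have h4 : g t ^ (p + 1) / (p + 1) ≤ g t ^ (p + 1) :=
      div_le_self (Real.rpow_nonneg (hg0 t ht) _) (by linarith)
    have := le_abs_self (E t0)
    rw [hA]; linarith
  set q := min (R / 2) (M ^ 2 / (16 * A)) * M ^ 2 / 4 with hq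
  have hq0 : 0 < q := by
    have : 0 < min (R / 2) (M ^ 2 / (16 * A)) := lt_min (by linarith) (by positivity)
    positivity
  clear_value q A D
  obtain ⟨t1, ht1, hg1⟩ := hfr (max t0 (Tm - q / D)) (max_lt h0T (by
    have : 0 < q / D := by positivity
    linarith))
  have ht1' : t1 ∈ Ico t0 Tm := ⟨(le_max_left _ _).trans ht1.1.le, ht1.2⟩
  have ht1q : Tm - t1 < q / D := by
    have := (le_max_right _ _).trans_lt ht1.1
    linarith
  have hbd : ∀ t, t1 ≤ t → t < Tm → g t ≤ 2 * M := by
    intro t h1 h2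
    by_contra hcon
    push Not at hcon
    obtain ⟨t2, ht2, hg2⟩ := intermediate_value_Icc h1 (hgc.mono (fun τ hτ =>
      ⟨ht1'.1.trans hτ.1, hτ.2.trans_lt h2⟩)) (show 2 * M ∈ Icc (g t1) (g t) from
        ⟨by linarith, hcon.le⟩)
    have ht2' : t2 ∈ Ico t0 Tm := ⟨ht1'.1.trans ht2.1, ht2.2.trans_lt h2⟩
    have hj := (hEP t2 ht2'.1 ht2'.2 t1 t2 ht1'.1 ht2.1 le_rfl).2.2 M A (by linarith) hA0
      (by rw [le_abs]; left; linarith) (hAb t1 ht1' (by linarith)) (hAb t2 ht2' hg2.le)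
    rw [← hq] at hj
    have d1 : E t1 - E t2 + c * (t2 - t1) ≤ D := by
      have e1 := hmono t0 t1 le_rfl ht1'.1 ht1'.2
      have e2 := hlow t2 ht2'
      have e3 : c * (t2 - t1) ≤ cT := mul_le_mul_of_nonneg_left (by linarith [ht1'.1, ht2'.2]) hc
      have := le_abs_self (E t0)
      rw [hD]; linarith
    have d2 : (E t1 - E t2 + c * (t2 - t1)) * (t2 - t1) ≤ D * (Tm - t1) :=
      mul_le_mul d1 (by linarith [ht2'.2]) (by linarith [ht2.1]) hD0.le
    rw [lt_div_iff₀ hD0] at ht1q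
    linarith
  obtain ⟨B, hB⟩ := isCompact_Icc.exists_bound_of_continuousOn
      (hgc.mono (fun τ hτ => ⟨hτ.1, hτ.2.trans_lt ht1'.2⟩ : Icc t0 t1 ⊆ Ico t0 Tm))
  refine ⟨max (2 * M) B, fun t ht => ?_⟩
  rcases le_total t1 t with h | h
  · exact (hbd t h ht.2).trans (le_max_left _ _)
  · exact ((le_abs_self _).trans (hB t ⟨ht.1, h⟩)).trans (le_max_right _ _)
end

section
variable {p R c t0 Tm : ℝ} {g E : ℝ → ℝ}

set_option maxHeartbeats 1000000 in
theorem energy_lem (hp : 1 < p) (hR : 0 < R) (hc : 0 ≤ c) (h0T : t0 < Tm)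
    (hgc : ContinuousOn g (Ico t0 Tm))
    (hg0 : ∀ t ∈ Ico t0 Tm, 0 ≤ g t)
    (hEP : ∀ b, t0 ≤ b → b < Tm → EP p R g E c t0 b) (hg : Tendsto g (𝓝[<] Tm) atTop) :
    Tendsto E (𝓝[<] Tm) atBot := by
  by_contra hn
  rw [tendsto_atBot] at hn
  push Not at hn
  obtain ⟨B, hB⟩ := hn
  have hT : 0 < Tm - t0 := by linarith
  have hmono : ∀ t1 t2, t0 ≤ t1 → t1 ≤ t2 → t2 < Tm → E t2 ≤ E t1 + c * (Tm - t0) := by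
    intro t1 t2 h1 h2 h3
    have := (hEP t2 (h1.trans h2) h3 t1 t2 h1 h2 le_rfl).1
    have : c * (t2 - t1) ≤ c * (Tm - t0) := mul_le_mul_of_nonneg_left (by linarith) hc
    linarith
  have hlow : ∀ t ∈ Ico t0 Tm, B - c * (Tm - t0) ≤ E t := by
    intro t ht
    obtain ⟨t2, ht2, ht2'⟩ := (hB.and_eventually (Ioo_mem_nhdsLT ht.2)).exists
    have := hmono t t2 ht.1 ht2'.1.le ht2'.2
    linarith
  set cT := c * (Tm - t0) with hcT
  have hcT0 : 0 ≤ cT := mul_nonneg hc hT.le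
  set D := |E t0| + |B| + 3 * cT + 1 with hD
  have hD0 : 0 < D := by have := abs_nonneg (E t0); have := abs_nonneg B; linarith
  set c1 : ℝ := 1 / (64 * 2 ^ (p + 1)) with hc1
  have hc10 : 0 < c1 := by positivity
  have e1 : ∀ᶠ γ : ℝ in atTop, γ ^ (1 - p) < R / 4 := by
    have := (tendsto_rpow_neg_atTop (show 0 < p - 1 by linarith)).eventually_lt_const
      (show (0:ℝ) < R / 4 by linarith)
    simpa using this
  have e2 : ∀ᶠ γ : ℝ in atTop, |E t0| + cT < γ ^ (p + 1) :=
    (tendsto_rpow_atTop (show 0 < p + 1 by linarith)).eventually_gt_atTop _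
  obtain ⟨γ, hγR, hγE, hγ1, hγ0, hγD⟩ := (e1.and (e2.and ((eventually_ge_atTop 1).and
    ((eventually_ge_atTop (g t0)).and (eventually_gt_atTop (16 * D ^ 2 / c1)))))).exists
  have hγp : 0 < γ := by linarith
  obtain ⟨tb, htb, htb'⟩ := (((tendsto_atTop.1 hg) (2 * γ)).and (Ioo_mem_nhdsLT h0T)).exists
  have hcb : ContinuousOn g (Icc t0 tb) := hgc.mono fun τ hτ => ⟨hτ.1, hτ.2.trans_lt htb'.2⟩
  have hK : IsCompact {t | t ∈ Icc t0 tb ∧ g t ≤ γ} := by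
    have : IsClosed (Icc t0 tb ∩ g ⁻¹' Iic γ) := hcb.preimage_isClosed_of_isClosed isClosed_Icc
      isClosed_Iic
    exact isCompact_Icc.of_isClosed_subset this inter_subset_left
  obtain ⟨t1, ⟨ht1, hg1⟩, hmx⟩ := hK.exists_isGreatest ⟨t0, ⟨le_rfl, htb'.1.le⟩, hγ0⟩
  have hcb1 : ContinuousOn g (Icc t1 tb) := hcb.mono (Icc_subset_Icc_left ht1.1)
  have hgt : ∀ t ∈ Icc t1 tb, γ ≤ g t := by
    intro t ht
    rcases eq_or_lt_of_le ht.1 with e | hlt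
    · obtain ⟨t', ht', hgt'⟩ := intermediate_value_Icc ht1.2 hcb1 (show γ ∈ Icc (g t1) (g tb) from
        ⟨hg1, by linarith⟩)
      have : t' ≤ t1 := hmx ⟨⟨ht1.1.trans ht'.1, ht'.2⟩, hgt'.le⟩
      have : t' = t := by linarith [ht'.1]
      rw [← this, hgt']
    · by_contra hcon
      push Not at hcon
      have : t ≤ t1 := hmx ⟨⟨ht1.1.trans ht.1, ht.2⟩, hcon.le⟩
      linarith
  obtain ⟨t2, ht2, hg2⟩ := intermediate_value_Icc ht1.2 hcb1 (show 2 * γ ∈ Icc (g t1) (g tb) from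
        ⟨by linarith, htb⟩)
  have ht1' : t1 ∈ Ico t0 Tm := ⟨ht1.1, ht1.2.trans_lt htb'.2⟩
  have ht2' : t2 ∈ Ico t0 Tm := ⟨ht1.1.trans ht2.1, ht2.2.trans_lt htb'.2⟩
  have hep := (hEP t2 ht2'.1 ht2'.2 t1 t2 ht1'.1 ht2.1 le_rfl).2
  have hAb : ∀ t ∈ Ico t0 Tm, g t ≤ 2 * γ → E t + g t ^ (p + 1) / (p + 1) ≤
      4 * (2 * γ) ^ (p + 1) / 2 := by
    intro t ht hg
    have h1 := hmono t0 t le_rfl ht.1 ht.2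
    have h3 := Real.rpow_le_rpow (hg0 t ht) hg (show 0 ≤ p + 1 by linarith)
    have h4 : g t ^ (p + 1) / (p + 1) ≤ g t ^ (p + 1) :=
      div_le_self (Real.rpow_nonneg (hg0 t ht) _) (by linarith)
    have h5 := le_abs_self (E t0)
    have h6 : γ ^ (p + 1) ≤ (2 * γ) ^ (p + 1) :=
      Real.rpow_le_rpow hγp.le (by linarith) (by linarith)
    linarith
  have hline := hep.1 γ hγp (by linarith) (fun t ht => hgt t ⟨ht.1, ht.2.trans ht2.2⟩)
  have hj := hep.2 γ (4 * (2 * γ) ^ (p + 1)) hγp (by positivity)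
      (by rw [le_abs]; left; linarith) (hAb t1 ht1' (by linarith)) (hAb t2 ht2' hg2.le)
  have d1 : E t1 - E t2 + c * (t2 - t1) ≤ D := by
    have e1 := hmono t0 t1 le_rfl ht1'.1 ht1'.2
    have e2 := hlow t2 ht2'
    have e3 : c * (t2 - t1) ≤ cT := mul_le_mul_of_nonneg_left (by linarith [ht1'.1, ht2'.2]) hc
    have := le_abs_self (E t0)
    have := neg_abs_le B
    rw [hD]; linarith
  have hr : γ ^ 2 / (16 * (4 * (2 * γ) ^ (p + 1))) = c1 * γ ^ (1 - p) := by
    rw [hc1, Real.mul_rpow (by norm_num) hγp.le, show (1 - p) = 2 - (p + 1) by ring,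
      Real.rpow_sub hγp]
    have : γ ^ (2:ℝ) = γ ^ 2 := by exact_mod_cast Real.rpow_natCast γ 2
    rw [this]; field_simp; ring
  have hc11 : c1 ≤ 1 := by
    rw [hc1, div_le_one (by positivity)]
    have : (1:ℝ) ≤ 2 ^ (p + 1) := Real.one_le_rpow (by norm_num) (by linarith)
    linarith
  have hr0 : 0 < γ ^ (1 - p) := by positivity
  rw [hr, min_eq_right (by
    have := mul_le_mul_of_nonneg_right hc11 hr0.le
    linarith)] at hj
  set Δ := t2 - t1 with hΔ
  have hΔ0 : 0 ≤ Δ := by have := ht2.1; linarith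
  have hj' : c1 * γ ^ (1 - p) * γ ^ 2 / 4 ≤ D * Δ := hj.trans (mul_le_mul_of_nonneg_right d1 hΔ0)
  have hl' : γ ^ (3 * p - 1) / 4 * Δ ≤ D := hline.trans d1
  have hq0 : 0 < γ ^ (3 * p - 1) / 4 := by positivity
  have m1 := mul_le_mul_of_nonneg_right hj' hq0.le
  have m2 := mul_le_mul_of_nonneg_left hl' hD0.le
  have hpw : γ ^ (1 - p) * γ ^ 2 * γ ^ (3 * p - 1) = γ ^ (2 * p + 2) := by
    rw [← Real.rpow_natCast γ 2, ← Real.rpow_add hγp, ← Real.rpow_add hγp]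
    congr 1; push_cast; ring
  have hpw1 : γ ≤ γ ^ (2 * p + 2) := by
    have := Real.rpow_le_rpow_of_exponent_le hγ1 (show 1 ≤ 2 * p + 2 by linarith)
    rwa [Real.rpow_one] at this
  have m3 : c1 * γ ^ (2 * p + 2) ≤ 16 * D ^ 2 := by
    rw [← hpw]; linarith
  have m4 : c1 * γ ≤ c1 * γ ^ (2 * p + 2) := mul_le_mul_of_nonneg_left hpw1 hc10.le
  rw [div_lt_iff₀ hc10] at hγD
  linarith
end

section
variable {p Tm : ℝ} {s : ℝ → ℝ} {u : ℝ → ℝ → ℝ}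

/-- bounds on the initial slice `t0` -/
theorem Cl.slice (h : Cl p Tm s u) {t0 : ℝ} (ht : t0 ∈ Ioo 0 Tm) : ∃ N, 1 ≤ N ∧
    (∀ x ∈ Icc 0 (s t0), u t0 x ≤ N) ∧ (∀ x ∈ Icc 0 (s t0), |deriv (u t0) x| ≤ N) ∧
    (∀ x ∈ Icc 0 (s t0), u t0 x ≤ N * (s t0 - x)) := by
  obtain ⟨B, hB⟩ := isCompact_Icc.exists_bound_of_continuousOn (h.utc (Ioo_subset_Ico_self ht))
  obtain ⟨L, hL⟩ := isCompact_Icc.exists_bound_of_continuousOn (h.uxtc ht)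
  have hL' : ∀ x ∈ Icc 0 (s t0), |deriv (u t0) x| ≤ max 1 (max B L) := fun x hx =>
    (hL x hx).trans ((le_max_right _ _).trans (le_max_right _ _))
  refine ⟨max 1 (max B L), le_max_left _ _, fun x hx => ((le_abs_self _).trans (hB x hx)).trans
    ((le_max_left _ _).trans (le_max_right _ _)), hL', fun x hx => ?_⟩
  have hs := h.spos t0 (Ioo_subset_Ico_self ht)
  have := h.lip ht le_rfl le_rfl hL' (s t0) ⟨hs.le, le_rfl⟩ x hx
  rw [h.bcs t0 ht, sub_zero, abs_sub_comm, abs_of_nonneg (by linarith [hx.2] : 0 ≤ s t0 - x)] at this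
  exact (le_abs_self _).trans this

theorem Cl.gc (h : Cl p Tm s u) {t0 : ℝ} (ht : 0 ≤ t0) : ContinuousOn (fun t => u t 0) (Ico t0 Tm) := by
  have : ContinuousOn (fun t : ℝ => ((t, 0) : ℝ × ℝ)) (Ico t0 Tm) := by fun_prop
  exact h.uc.comp this fun t ht' => ⟨⟨ht.trans ht'.1, ht'.2⟩, le_rfl,
    (h.spos t ⟨ht.trans ht'.1, ht'.2⟩).le⟩

theorem Cl.g0 (h : Cl p Tm s u) {t : ℝ} (ht : t ∈ Ico 0 Tm) : 0 ≤ u t 0 :=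
  h.nn t ht 0 ⟨le_rfl, (h.spos t ht).le⟩

theorem Cl.rate (hp : 1 < p) (h : Cl p Tm s u) (hT : 0 < Tm) : ∃ C, 0 ≤ C ∧
    ∀ t ∈ Ico (Tm / 2) Tm, (Tm - t) ^ (1 / (2 * (p - 1))) * u t 0 ≤ C := by
  have ht0 : Tm / 2 ∈ Ioo 0 Tm := ⟨by linarith, by linarith⟩
  obtain ⟨N1, hN1, hu1, hd1, -⟩ := h.slice ht0
  have h00 : (0:ℝ) ∈ Ico 0 Tm := ⟨le_rfl, hT⟩
  have hs0 := h.spos 0 h00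
  have hsm : s 0 ≤ s (Tm / 2) := h.s_mono h00 (Ioo_subset_Ico_self ht0) ht0.1.le
  set R := s 0 / 2 with hR
  have hR0 : 0 < R := by linarith
  obtain ⟨Z, ζ, ζ', hC⟩ := Cut.exists hR0
  refine rate_lem (N1 := N1) (E := Eu p R ζ u) (c := Z ^ 2 * (2 / R + 1) ^ 2 * R) hp hR0 (by positivity)
    (by linarith) (h.gc (by linarith)) (fun t ht => h.g0 ⟨by linarith [ht.1], ht.2⟩)
    (fun t ht => Eu_ge hp t hR0 (h.g0 ⟨by linarith [ht.1], ht.2⟩)) ?_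
  intro N hN b hb hbT hg
  have hb1 := h.sup_bound ht0.1.le hbT (by linarith) (fun x hx => (hu1 x hx).trans hN)
    (fun t ht => hg t (Ioc_subset_Icc_self ht))
  have := h.EP hp hC ht0.1 hbT hR0 (by linarith) (Γ := (2 / R + 1) * N) (by
    intro t ht x hx
    have := h.int_grad (r := R / 2) (x0 := x) ht0.1 hbT (by linarith) hx.1 (by linarith [hx.2])
      (C1 := N) (L0 := N) (by linarith) (fun t ht y hy => hb1 t ht y ⟨by linarith [hy.1, hx.1], by
        have := h.s_mono (Ioo_subset_Ico_self ht0) ⟨by linarith [ht.1], by linarith [ht.2]⟩ ht.1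
        linarith [hy.2, hx.2]⟩)
      (fun y hy => (hd1 y ⟨by linarith [hy.1, hx.1], by linarith [hy.2, hx.2]⟩).trans hN) t ht
    refine this.trans (le_of_eq ?_)
    field_simp)
  convert this using 1
  ring

set_option maxHeartbeats 800000 in
theorem Cl.interior (hp : 1 < p) (h : Cl p Tm s u) (hT : 0 < Tm) {δ : ℝ} (hδ : 0 < δ) : ∃ C, 0 ≤ C ∧
    ∀ t ∈ Ico (Tm / 2) Tm, ∀ x ∈ Icc δ (s t), u t x ≤ C := by
  obtain ⟨C, hC0, hC⟩ := h.rate hp hT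
  have ht0 : Tm / 2 ∈ Ioo 0 Tm := ⟨by linarith, by linarith⟩
  obtain ⟨B, hB1, hB, -, -⟩ := h.slice ht0
  set α := 1 / (2 * (p - 1)) with hα
  have hα0 : 0 < α := by have : 0 < p - 1 := by linarith
                         positivity
  clear_value α
  set κ := 4 * α + 2 with hκ
  have hκ0 : 0 < κ := by linarith
  set A := C * κ ^ α with hA
  have hA0 : 0 ≤ A := by positivity
  set w : ℝ → ℝ → ℝ := fun t x => A * (x ^ 2 + κ * (Tm - t)) ^ (-α) + B with hw
  have hQ : ∀ t x : ℝ, t < Tm → 0 < x ^ 2 + κ * (Tm - t) := fun t x ht => by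
    have : 0 < κ * (Tm - t) := mul_pos hκ0 (by linarith)
    positivity
  refine ⟨A * (δ ^ 2) ^ (-α) + B, by positivity, fun t ht x hx => ?_⟩
  have hcmp := h.comp (t0 := Tm / 2) (t1 := t) (a := fun _ => 0) (b := s) (w := w) ht0.1.le ht.2
    continuousOn_const (h.sc.mono fun τ hτ => ⟨by linarith [hτ.1], hτ.2.trans_lt ht.2⟩)
    (fun _ _ => le_rfl) (fun _ _ => le_rfl) (by
      refine ContinuousOn.add (ContinuousOn.mul continuousOn_const
        (ContinuousOn.rpow_const (by fun_prop) fun q hq => Or.inl ?_)) continuousOn_const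
      exact (hQ q.1 q.2 (hq.1.2.trans_lt ht.2)).ne') (by
      intro τ hτ y hy
      have hτT : τ < Tm := hτ.2.trans_lt ht.2
      have hq := hQ τ y hτT
      set Q := y ^ 2 + κ * (Tm - τ) with hQd
      refine ⟨A * (-κ * (-α) * Q ^ (-α - 1)),
        A * (-α * 2 * (1 * Q ^ (-α - 1) + y * (2 * y * (-α - 1) * Q ^ (-α - 1 - 1)))), ⟨?_, ?_⟩, ?_⟩
      · have h1 : HasDerivAt (fun τ => y ^ 2 + κ * (Tm - τ)) (-κ) τ :=
          ((((hasDerivAt_id τ).const_sub Tm).const_mul κ).const_add (y ^ 2)).congr_deriv (by simp)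
        exact ((h1.rpow_const (p := -α) (Or.inl hq.ne')).const_mul A).add_const B
      · have h1 : ∀ z, HasDerivAt (fun z => z ^ 2 + κ * (Tm - τ)) (2 * z) z := fun z =>
          ((hasDerivAt_pow 2 z).add_const _).congr_deriv (by simp)
        refine ⟨fun z => A * (-α * 2 * (z * (z ^ 2 + κ * (Tm - τ)) ^ (-α - 1))), Eventually.of_forall
          fun z => ?_, ?_⟩
        · refine (((h1 z).rpow_const (p := -α) (Or.inl (hQ τ z hτT).ne')).const_mul A
            |>.add_const B).congr_deriv (by ring)
        · exact (((hasDerivAt_id y).mul ((h1 y).rpow_const (p := -α - 1) (Or.inl hq.ne'))).const_mul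
            (-α * 2)).const_mul A
      · refine mul_le_mul_of_nonneg_left ?_ hA0
        have e : Q ^ (-α - 1) = Q * Q ^ (-α - 1 - 1) := by
          rw [Real.rpow_sub_one hq.ne' (-α - 1)]; field_simp
        have hP : 0 < Q ^ (-α - 1 - 1) := by positivity
        rw [e]
        set P := Q ^ (-α - 1 - 1)
        have hy2 : y ^ 2 ≤ Q := by
          have : 0 ≤ κ * (Tm - τ) := mul_nonneg hκ0.le (by linarith)
          linarith
        have := mul_le_mul_of_nonneg_left hy2 (show 0 ≤ 4 * α * (α + 1) * P by positivity)
        rw [hκ]; linarith)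
    (fun y hy => (hB y hy).trans (by
      have := (hQ (Tm / 2) y ht0.2).le
      have : 0 ≤ A * (y ^ 2 + κ * (Tm - Tm / 2)) ^ (-α) := by positivity
      simp only [hw]; linarith)) (by
      intro τ hτ _
      have hτ' : 0 < Tm - τ := by linarith [hτ.2, ht.2]
      have h1 := hC τ ⟨hτ.1.le, by linarith⟩
      simp only [hw]
      rw [show (0:ℝ) ^ 2 + κ * (Tm - τ) = κ * (Tm - τ) by ring, Real.mul_rpow hκ0.le hτ'.le, hA,
        Real.rpow_neg hκ0.le, Real.rpow_neg hτ'.le]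
      have h2 : 0 < κ ^ α := by positivity
      have h3 : 0 < (Tm - τ) ^ α := by positivity
      have h4 : C * κ ^ α * ((κ ^ α)⁻¹ * ((Tm - τ) ^ α)⁻¹) = C / (Tm - τ) ^ α := by field_simp
      rw [h4]
      have : u τ 0 ≤ C / (Tm - τ) ^ α := by rw [le_div_iff₀ h3]; linarith
      linarith) (by
      intro τ hτ _
      rw [h.bcs τ ⟨by linarith [hτ.1], by linarith [hτ.2, ht.2]⟩]
      have := (hQ τ (s τ) (by linarith [hτ.2, ht.2])).le
      have : 0 ≤ A * (s τ ^ 2 + κ * (Tm - τ)) ^ (-α) := by positivity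
      simp only [hw]; linarith)
  have h1 := hcmp t ⟨ht.1, le_rfl⟩ x ⟨by linarith [hx.1], hx.2⟩
  refine h1.trans (add_le_add_left (mul_le_mul_of_nonneg_left ?_ hA0) B)
  refine Real.rpow_le_rpow_of_nonpos (by positivity) ?_ (by linarith)
  have : 0 ≤ κ * (Tm - t) := mul_nonneg hκ0.le (by linarith [ht.2])
  have := pow_le_pow_left₀ hδ.le hx.1 2
  linarith
end

section
variable {p Tm : ℝ} {s : ℝ → ℝ} {u : ℝ → ℝ → ℝ}

theorem Cl.free (hp : 1 < p) (h : Cl p Tm s u) (hT : 0 < Tm) : ∃ Λ, 1 ≤ Λ ∧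
    ∀ t ∈ Ico (Tm / 2) Tm, (∀ x ∈ Icc (s t - s 0 / 2) (s t), u t x ≤ Λ * (s t - x)) ∧
      -(deriv (u t) (s t)) ≤ Λ := by
  have ht0 : Tm / 2 ∈ Ioo 0 Tm := ⟨by linarith, by linarith⟩
  obtain ⟨N, hN1, -, -, hN⟩ := h.slice ht0
  have h00 : (0:ℝ) ∈ Ico 0 Tm := ⟨le_rfl, hT⟩
  have hs0 := h.spos 0 h00
  obtain ⟨C, hC0, hC⟩ := h.interior hp hT (δ := s 0 / 2) (by linarith)
  have hsm : ∀ t ∈ Ico (Tm / 2) Tm, s 0 ≤ s t := fun t ht =>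
    h.s_mono h00 ⟨by linarith [ht.1], ht.2⟩ (by linarith [ht.1])
  have hd : 0 < s 0 / 2 := by linarith
  have h1 : 0 ≤ 2 * C / (s 0 / 2) := by positivity
  refine ⟨2 * C / (s 0 / 2) + N, by linarith, fun t ht => ?_⟩
  have ht' := hsm (Tm / 2) ⟨le_rfl, ht0.2⟩
  have := h.fb_bound ht0.1.le ht.2 hd (by linarith) hC0 (by linarith)
    (fun τ hτ => hC τ ⟨hτ.1, hτ.2.trans_lt ht.2⟩ _ ⟨by
      linarith [hsm τ ⟨hτ.1, hτ.2.trans_lt ht.2⟩], by linarith⟩)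
    (fun x hx => hN x ⟨by linarith [hx.1], hx.2⟩) t ⟨ht.1, le_rfl⟩
  exact ⟨this, h.sd_bound ⟨by linarith [ht.1], ht.2⟩ hd (by linarith [hsm t ht]) this⟩

theorem Cl.s_lim (hp : 1 < p) (h : Cl p Tm s u) (hT : 0 < Tm) : ∃ L, Tendsto s (𝓝[<] Tm) (𝓝 L) ∧
    ∀ t ∈ Ico 0 Tm, s t ≤ L := by
  obtain ⟨Λ, hΛ, hf⟩ := h.free hp hT
  have ht0 : Tm / 2 ∈ Ico 0 Tm := ⟨by linarith, by linarith⟩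
  have hb : ∀ t ∈ Ico 0 Tm, s t ≤ s (Tm / 2) + Λ * Tm := by
    intro t ht
    rcases le_total t (Tm / 2) with hle | hle
    · have := h.s_mono ht ht0 hle
      have : 0 ≤ Λ * Tm := by positivity
      linarith
    · have := (convex_Icc (Tm / 2) t).image_sub_le_mul_sub_of_deriv_le
        (h.sc.mono fun τ hτ => ⟨by linarith [hτ.1], by linarith [hτ.2, ht.2]⟩) (by
          intro τ hτ
          rw [interior_Icc] at hτ
          exact (h.sd τ ⟨by linarith [hτ.1], by linarith [hτ.2, ht.2]⟩).differentiableAt.differentiableWithinAt)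
        (C := Λ) (by
          intro τ hτ
          rw [interior_Icc] at hτ
          rw [(h.sd τ ⟨by linarith [hτ.1], by linarith [hτ.2, ht.2]⟩).deriv]
          exact (hf τ ⟨by linarith [hτ.1], by linarith [hτ.2, ht.2]⟩).2) (Tm / 2) ⟨le_rfl, hle⟩ t
        ⟨hle, le_rfl⟩ hle
      have h2 : Λ * (t - Tm / 2) ≤ Λ * Tm := mul_le_mul_of_nonneg_left (by linarith [ht.2]) (by linarith)
      linarith
  have hbd : BddAbove (s '' Ioo 0 Tm) :=
    ⟨s (Tm / 2) + Λ * Tm, by rintro _ ⟨t, ht, rfl⟩; exact hb t (Ioo_subset_Ico_self ht)⟩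
  refine ⟨sSup (s '' Ioo 0 Tm), (h.s_mono.mono Ioo_subset_Ico_self).tendsto_nhdsWithin_Ioo_left
    ⟨Tm / 2, by linarith, by linarith⟩ hbd, fun t ht => ?_⟩
  refine (h.s_mono ht ⟨by linarith [ht.1], by linarith [ht.2]⟩ (by linarith [ht.2] :
    t ≤ (t + Tm) / 2)).trans (le_csSup hbd ⟨_, ⟨by linarith [ht.1], by linarith [ht.2]⟩, rfl⟩)

/-- uniform gradient bound away from `x = 0`; also at `x = 0` if `g` is bounded. -/
theorem Cl.grad_away (hp : 1 < p) (h : Cl p Tm s u) (hT : 0 < Tm) : ∃ Γ, 0 ≤ Γ ∧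
    ∀ t ∈ Ico (Tm / 2) Tm, ∀ x ∈ Icc (s 0 / 4) (s t), |deriv (u t) x| ≤ Γ := by
  have ht0 : Tm / 2 ∈ Ioo 0 Tm := ⟨by linarith, by linarith⟩
  obtain ⟨N, hN1, -, hN, -⟩ := h.slice ht0
  obtain ⟨Λ, hΛ, hf⟩ := h.free hp hT
  have h00 : (0:ℝ) ∈ Ico 0 Tm := ⟨le_rfl, hT⟩
  have hs0 := h.spos 0 h00
  obtain ⟨C, hC0, hC⟩ := h.interior hp hT (δ := s 0 / 8) (by linarith)
  have hsm : ∀ t ∈ Ico (Tm / 2) Tm, s 0 ≤ s t := fun t ht =>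
    h.s_mono h00 ⟨by linarith [ht.1], ht.2⟩ (by linarith [ht.1])
  have h1 : 0 ≤ C / (s 0 / 8) := by positivity
  have hst := hsm (Tm / 2) ⟨le_rfl, ht0.2⟩
  refine ⟨C / (s 0 / 8) + N + Λ + 1, by linarith, fun t ht => ?_⟩
  refine h.grad (t0 := Tm / 2) (δ := s 0 / 4) ht0.1 ht.2 (by linarith) (by linarith)
    (fun τ hτ => ?_) (fun x hx => (hN x ⟨by linarith [hx.1], hx.2⟩).trans (by linarith))
    ⟨s 0 / 2, by linarith, fun τ hτ x hx => ((hf τ ⟨hτ.1, hτ.2.trans_lt ht.2⟩).1 x hx).trans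
      (mul_le_mul_of_nonneg_right (by linarith) (by linarith [hx.2]))⟩ t ⟨ht.1, le_rfl⟩
  have := h.int_grad (t0 := Tm / 2) (x0 := s 0 / 4) (r := s 0 / 8) (C1 := C) (L0 := N) ht0.1 ht.2
    (by linarith) (by linarith) (by linarith) hC0 (fun τ hτ x hx => hC τ ⟨hτ.1, hτ.2.trans_lt ht.2⟩ x
      ⟨by linarith [hx.1], by linarith [hx.2, hsm τ ⟨hτ.1, hτ.2.trans_lt ht.2⟩]⟩)
    (fun x hx => hN x ⟨by linarith [hx.1], by linarith [hx.2]⟩) τ hτ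
  linarith

theorem Cl.blow (hp : 1 < p) (h : Cl p Tm s u) (hT : 0 < Tm) :
    (Tendsto (fun t => u t 0) (𝓝[<] Tm) atTop → Tendsto (fun t => energy p s u t) (𝓝[<] Tm) atBot) ∧
    (¬ Tendsto (fun t => u t 0) (𝓝[<] Tm) atTop → ∃ M, 1 ≤ M ∧ ∀ t ∈ Ico (Tm / 2) Tm,
      ∀ x ∈ Icc 0 (s t), u t x ≤ M ∧ |deriv (u t) x| ≤ M) := by
  have ht0 : Tm / 2 ∈ Ioo 0 Tm := ⟨by linarith, by linarith⟩
  have h00 : (0:ℝ) ∈ Ico 0 Tm := ⟨le_rfl, hT⟩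
  have hs0 := h.spos 0 h00
  have hsm : ∀ t ∈ Ico (Tm / 2) Tm, s 0 ≤ s t := fun t ht =>
    h.s_mono h00 ⟨by linarith [ht.1], ht.2⟩ (by linarith [ht.1])
  obtain ⟨Γ, hΓ0, hΓ⟩ := h.grad_away hp hT
  set R := s 0 / 2 with hR
  have hR0 : 0 < R := by linarith
  obtain ⟨Z, ζ, ζ', hC⟩ := Cut.exists hR0
  have hEP : ∀ b, Tm / 2 ≤ b → b < Tm → _root_.EP p R (fun t => u t 0) (Eu p R ζ u) (Z ^ 2 * Γ ^ 2 * R) (Tm / 2) b :=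
    fun b hb hbT => h.EP hp hC ht0.1 hbT hR0 (by linarith) (fun t ht x hx =>
      hΓ t ⟨ht.1, ht.2.trans_lt hbT⟩ x ⟨by linarith [hx.1], by
        linarith [hx.2, hsm t ⟨ht.1, ht.2.trans_lt hbT⟩]⟩)
  have hg0 : ∀ t ∈ Ico (Tm / 2) Tm, 0 ≤ u t 0 := fun t ht => h.g0 ⟨by linarith [ht.1], ht.2⟩
  refine ⟨fun hg => ?_, fun hn => ?_⟩
  · have hlim := energy_lem hp hR0 (by positivity) ht0.2 (h.gc ht0.1.le) hg0 hEP hg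
    obtain ⟨L, -, hL⟩ := h.s_lim hp hT
    refine tendsto_atBot_mono' _ ?_ (tendsto_atBot_add_const_right _ (1 / 2 * (L * Γ ^ 2)) hlim)
    filter_upwards [Ioo_mem_nhdsLT ht0.2] with t ht
    have ht' : t ∈ Ioo 0 Tm := ⟨by linarith [ht.1], ht.2⟩
    have hst := hsm t (Ioo_subset_Ico_self ht)
    simp only [energy, Eu, Ez]
    have hcx := h.uxtc ht'
    have i1 : IntervalIntegrable (fun x => deriv (u t) x ^ 2) volume 0 (R / 2) :=
      ((hcx.pow 2).mono (by rw [uIcc_of_le (by linarith)]; exact Icc_subset_Icc le_rfl (by linarith))).intervalIntegrable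
    have i2 : IntervalIntegrable (fun x => deriv (u t) x ^ 2) volume (R / 2) (s t) :=
      ((hcx.pow 2).mono (by rw [uIcc_of_le (by linarith)]; exact Icc_subset_Icc (by linarith) le_rfl)).intervalIntegrable
    have hcz : ContinuousOn (fun x => ζ x ^ 2 * deriv (u t) x ^ 2) (Icc 0 (s t)) :=
      (hC.c.continuousOn.pow 2).mul (hcx.pow 2)
    have j1 : IntervalIntegrable (fun x => ζ x ^ 2 * deriv (u t) x ^ 2) volume 0 (R / 2) :=
      (hcz.mono (by rw [uIcc_of_le (by linarith)]; exact Icc_subset_Icc le_rfl (by linarith))).intervalIntegrable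
    have j2 : IntervalIntegrable (fun x => ζ x ^ 2 * deriv (u t) x ^ 2) volume (R / 2) R :=
      (hcz.mono (by rw [uIcc_of_le (by linarith)]; exact Icc_subset_Icc (by linarith) (by linarith))).intervalIntegrable
    rw [← intervalIntegral.integral_add_adjacent_intervals i1 i2,
      ← intervalIntegral.integral_add_adjacent_intervals j1 j2]
    have e1 : ∫ x in (0:ℝ)..(R / 2), ζ x ^ 2 * deriv (u t) x ^ 2 = ∫ x in (0:ℝ)..(R / 2), deriv (u t) x ^ 2 := by
      refine intervalIntegral.integral_congr fun x hx => ?_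
      rw [uIcc_of_le (by linarith)] at hx
      simp [hC.one x hx.2]
    have e2 : 0 ≤ ∫ x in (R / 2)..R, ζ x ^ 2 * deriv (u t) x ^ 2 :=
      intervalIntegral.integral_nonneg (by linarith) fun x _ => by positivity
    have e3 : ∫ x in (R / 2)..(s t), deriv (u t) x ^ 2 ≤ L * Γ ^ 2 := by
      have := intervalIntegral.integral_mono_on (by linarith) i2 (intervalIntegrable_const (c := Γ ^ 2))
        (fun x hx => sq_le_sq.2 ((hΓ t (Ioo_subset_Ico_self ht) x ⟨by linarith [hx.1], hx.2⟩).trans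
          (le_abs_self _)))
      rw [intervalIntegral.integral_const, smul_eq_mul] at this
      refine this.trans (mul_le_mul_of_nonneg_right ?_ (by positivity))
      linarith [hL t (Ioo_subset_Ico_self ht')]
    rw [e1]; linarith
  · obtain ⟨M, hM⟩ := bdd_lem hp hR0 (by positivity) ht0.2 (h.gc ht0.1.le) hg0
      (fun t ht => Eu_ge hp t hR0 (hg0 t ht)) hEP hn
    obtain ⟨N, hN1, hNu, hN, -⟩ := h.slice ht0
    obtain ⟨Λ, hΛ, hf⟩ := h.free hp hT
    set M1 := max N M
    have hM1 : 1 ≤ M1 := hN1.trans (le_max_left _ _)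
    have hMp : 0 ≤ M1 ^ p := by positivity
    refine ⟨M1 + M1 ^ p + Λ + 1, by linarith, fun t ht x hx => ⟨?_, ?_⟩⟩
    · have := h.sup_bound ht0.1.le ht.2 (M := M1) (by linarith) (fun x hx => (hNu x hx).trans
        (le_max_left _ _)) (fun τ hτ => (hM τ ⟨hτ.1.le, hτ.2.trans_lt ht.2⟩).trans (le_max_right _ _))
        t ⟨ht.1, le_rfl⟩ x hx
      linarith
    · refine h.grad (t0 := Tm / 2) (δ := 0) ht0.1 ht.2 le_rfl (h.spos _ (Ioo_subset_Ico_self ht0))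
        (fun τ hτ => ?_) (fun x hx => (hN x hx).trans (by linarith [le_max_left N M]))
        ⟨s 0 / 2, by linarith, fun τ hτ x hx => ((hf τ ⟨hτ.1, hτ.2.trans_lt ht.2⟩).1 x hx).trans
        (mul_le_mul_of_nonneg_right (by linarith) (by linarith [hx.2]))⟩ t ⟨ht.1, le_rfl⟩ x hx
      have hτ' : τ ∈ Ico (Tm / 2) Tm := ⟨hτ.1, hτ.2.trans_lt ht.2⟩
      rw [h.bc0 τ ⟨by linarith [hτ.1], hτ'.2⟩, abs_neg, abs_of_nonneg (Real.rpow_nonneg (hg0 τ hτ') _)]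
      have := Real.rpow_le_rpow (hg0 τ hτ') ((hM τ hτ').trans (le_max_right N M)) (by linarith : 0 ≤ p)
      linarith
end

def k0 (r z : ℝ) : ℝ := exp (-z ^ 2 / (4 * r)) / √(4 * π * r)
def k1 (r z : ℝ) : ℝ := -z / (2 * r) * k0 r z
def k2 (r z : ℝ) : ℝ := (z ^ 2 / (4 * r ^ 2) - 1 / (2 * r)) * k0 r z

theorem k0_of_nonpos {r : ℝ} (hr : r ≤ 0) (z : ℝ) : k0 r z = 0 := by
  have : √(4 * π * r) = 0 := Real.sqrt_eq_zero_of_nonpos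
    (mul_nonpos_of_nonneg_of_nonpos (by positivity) hr)
  simp [k0, this]
theorem k1_of_nonpos {r : ℝ} (hr : r ≤ 0) (z : ℝ) : k1 r z = 0 := by simp [k1, k0_of_nonpos hr]
theorem k2_of_nonpos {r : ℝ} (hr : r ≤ 0) (z : ℝ) : k2 r z = 0 := by simp [k2, k0_of_nonpos hr]

theorem k0_nn (r z : ℝ) : 0 ≤ k0 r z := by unfold k0; positivity
theorem k0_neg (r z : ℝ) : k0 r (-z) = k0 r z := by simp [k0]
theorem k1_neg (r z : ℝ) : k1 r (-z) = -k1 r z := by simp [k1, k0_neg]; ring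

theorem k0_le' {r : ℝ} (hr : 0 < r) (z : ℝ) : k0 r z ≤ exp (-z ^ 2 / (4 * r)) / √r := by
  refine div_le_div_of_nonneg_left (exp_pos _).le (by positivity) (Real.sqrt_le_sqrt ?_)
  have := Real.pi_gt_three
  have := mul_le_mul_of_nonneg_right (show (1:ℝ) ≤ 4 * π by linarith) hr.le
  linarith

theorem rs_eq {r : ℝ} (hr : 0 < r) : r ^ (-(1 / 2) : ℝ) = 1 / √r := by
  rw [Real.rpow_neg hr.le, Real.sqrt_eq_rpow]; ring

theorem k0_le {r : ℝ} (hr : 0 < r) (z : ℝ) : k0 r z ≤ r ^ (-(1 / 2) : ℝ) := by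
  rw [rs_eq hr]
  refine (k0_le' hr z).trans (div_le_div_of_nonneg_right ?_ (by positivity))
  rw [Real.exp_le_one_iff, neg_div]
  have : 0 ≤ z ^ 2 / (4 * r) := by positivity
  linarith

theorem k0_dz (r z : ℝ) : HasDerivAt (k0 r) (k1 r z) z := by
  have h1 : HasDerivAt (fun z : ℝ => -z ^ 2 / (4 * r)) (-(2 * z) / (4 * r)) z :=
    (((hasDerivAt_pow 2 z).fun_neg).div_const (4 * r)).congr_deriv (by simp)
  refine (h1.exp.div_const _).congr_deriv ?_
  rcases eq_or_ne r 0 with rfl | hr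
  · simp [k1, k0]
  · simp only [k1, k0]; field_simp; norm_num

theorem k1_dz (r z : ℝ) : HasDerivAt (k1 r) (k2 r z) z := by
  have h1 : HasDerivAt (fun z : ℝ => -z / (2 * r)) (-1 / (2 * r)) z :=
    ((hasDerivAt_id z).fun_neg.div_const _)
  refine (h1.mul (k0_dz r z)).congr_deriv ?_
  rcases eq_or_ne r 0 with rfl | hr
  · simp [k2, k1]
  · simp only [k1, k2]; field_simp; ring

/-- smallness of the kernels away from `z = 0` -/
theorem k0_small {r z : ℝ} (hr : 0 < r) (hz : z ≠ 0) : k0 r z ≤ 384 * r ^ 2 * √r / z ^ 6 := by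
  refine (k0_le' hr z).trans ?_
  have hy : 0 ≤ z ^ 2 / (4 * r) := by positivity
  have h1 := Real.pow_div_factorial_le_exp _ hy 3
  have hz2 : 0 < z ^ 2 := by positivity
  have h2 : exp (-z ^ 2 / (4 * r)) ≤ 384 * r ^ 3 / z ^ 6 := by
    rw [neg_div, Real.exp_neg]
    refine (inv_anti₀ (by positivity) h1).trans (le_of_eq ?_)
    simp [Nat.factorial]; field_simp; norm_num
  refine (div_le_div_of_nonneg_right h2 (by positivity)).trans (le_of_eq ?_)
  have hs : √r * √r = r := Real.mul_self_sqrt hr.le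
  have : 0 < √r := Real.sqrt_pos.2 hr
  have h3 : r ^ 3 = r ^ 2 * √r * √r := by rw [mul_assoc, hs]; ring
  rw [h3]; field_simp

theorem k1_small {r z : ℝ} (hr : 0 < r) (hz : z ≠ 0) : |k1 r z| ≤ 192 * r * √r / |z| ^ 5 := by
  have h := k0_small hr hz
  have hz' : 0 < |z| := abs_pos.2 hz
  rw [k1, abs_mul, abs_div, abs_neg, abs_of_pos (by linarith : 0 < 2 * r), abs_of_nonneg (k0_nn r z)]
  refine (mul_le_mul_of_nonneg_left h (by positivity)).trans (le_of_eq ?_)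
  rw [← (by norm_num : Even 6).pow_abs z]; field_simp; norm_num

theorem k2_small {r z : ℝ} (hr : 0 < r) (hz : z ≠ 0) :
    |k2 r z| ≤ 96 * √r / z ^ 4 + 192 * r * √r / z ^ 6 := by
  have h := k0_small hr hz
  have hz' : 0 < z ^ 2 := by positivity
  rw [k2, abs_mul, abs_of_nonneg (k0_nn r z)]
  have h1 : |z ^ 2 / (4 * r ^ 2) - 1 / (2 * r)| ≤ z ^ 2 / (4 * r ^ 2) + 1 / (2 * r) := by
    refine (abs_sub _ _).trans (le_of_eq ?_)
    rw [abs_of_nonneg (by positivity), abs_of_nonneg (by positivity)]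
  refine (mul_le_mul h1 h (k0_nn r z) (by positivity)).trans (le_of_eq ?_)
  field_simp; ring

theorem k0_cont_pos {q : ℝ × ℝ} (hq : 0 < q.1) : ContinuousAt (fun q : ℝ × ℝ => k0 q.1 q.2) q := by
  unfold k0
  have : √(4 * π * q.1) ≠ 0 := by positivity
  have : 4 * q.1 ≠ 0 := by positivity
  fun_prop (disch := assumption)

theorem k_cont_aux {k : ℝ → ℝ → ℝ} {B : ℝ × ℝ → ℝ} (h0 : ∀ r ≤ 0, ∀ z, k r z = 0)
    (hB : ∀ r z, 0 < r → z ≠ 0 → |k r z| ≤ B (r, z))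
    (hBc : ∀ z, z ≠ 0 → ContinuousAt B (0, z)) (hB0 : ∀ z, B (0, z) = 0)
    (hpos : ∀ q : ℝ × ℝ, 0 < q.1 → ContinuousAt (fun q : ℝ × ℝ => k q.1 q.2) q) {q : ℝ × ℝ}
    (hq : q ≠ 0) : ContinuousAt (fun q : ℝ × ℝ => k q.1 q.2) q := by
  rcases lt_trichotomy q.1 0 with h | h | h
  · have : (fun q : ℝ × ℝ => k q.1 q.2) =ᶠ[𝓝 q] fun _ => 0 := by
      filter_upwards [continuousAt_fst.eventually_lt_const h] with y hy using h0 _ hy.le _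
    exact continuousAt_const.congr this.symm
  · have hz : q.2 ≠ 0 := fun e => hq (Prod.ext h e)
    have hq' : q = (0, q.2) := Prod.ext h rfl
    have hl := (hBc q.2 hz).abs
    rw [← hq'] at hl
    have hb0 : B q = 0 := by rw [hq']; exact hB0 _
    unfold ContinuousAt at hl ⊢
    simp only [hb0, abs_zero] at hl
    show Tendsto _ _ (𝓝 (k q.1 q.2))
    rw [show k q.1 q.2 = 0 from h0 _ h.le _]
    refine squeeze_zero_norm' ?_ hl
    filter_upwards [(continuousAt_snd (p := q)).eventually_ne hz] with y hy
    rcases le_or_gt y.1 0 with h' | h'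
    · rw [h0 _ h']; simp
    · exact (hB _ _ h' hy).trans (le_abs_self _)
  · exact hpos q h

theorem k0_cont {q : ℝ × ℝ} (hq : q ≠ 0) : ContinuousAt (fun q : ℝ × ℝ => k0 q.1 q.2) q :=
  k_cont_aux (B := fun q => 384 * q.1 ^ 2 * √q.1 / q.2 ^ 6) (fun r hr z => k0_of_nonpos hr z)
    (fun r z hr hz => by rw [abs_of_nonneg (k0_nn r z)]; exact k0_small hr hz)
    (fun z hz => by
      have : z ^ 6 ≠ 0 := by positivity
      fun_prop (disch := assumption)) (fun z => by simp) (fun q hq => k0_cont_pos hq) hq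

theorem k1_cont {q : ℝ × ℝ} (hq : q ≠ 0) : ContinuousAt (fun q : ℝ × ℝ => k1 q.1 q.2) q :=
  k_cont_aux (B := fun q => 192 * q.1 * √q.1 / |q.2| ^ 5) (fun r hr z => k1_of_nonpos hr z)
    (fun r z hr hz => k1_small hr hz)
    (fun z hz => by
      have : |z| ^ 5 ≠ 0 := by positivity
      fun_prop (disch := assumption)) (fun z => by simp) (fun q hq => by
        unfold k1
        have : 2 * q.1 ≠ 0 := by positivity
        have h0 := k0_cont_pos hq
        fun_prop (disch := assumption)) hq

theorem k2_cont {q : ℝ × ℝ} (hq : q ≠ 0) : ContinuousAt (fun q : ℝ × ℝ => k2 q.1 q.2) q :=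
  k_cont_aux (B := fun q => 96 * √q.1 / q.2 ^ 4 + 192 * q.1 * √q.1 / q.2 ^ 6)
    (fun r hr z => k2_of_nonpos hr z)
    (fun r z hr hz => k2_small hr hz)
    (fun z hz => by
      have : z ^ 6 ≠ 0 := by positivity
      have : z ^ 4 ≠ 0 := by positivity
      fun_prop (disch := assumption)) (fun z => by simp) (fun q hq => by
        unfold k2
        have : 2 * q.1 ≠ 0 := by positivity
        have : 4 * q.1 ^ 2 ≠ 0 := by positivity
        have h0 := k0_cont_pos hq
        fun_prop (disch := assumption)) hq

theorem k0_dt {r z : ℝ} (hq : ((r, z) : ℝ × ℝ) ≠ 0) : HasDerivAt (fun r => k0 r z) (k2 r z) r := by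
  rcases lt_trichotomy r 0 with h | h | h
  · rw [k2_of_nonpos h.le]
    refine (hasDerivAt_const r (0:ℝ)).congr_of_eventuallyEq ?_
    filter_upwards [eventually_lt_nhds h] with y hy using k0_of_nonpos hy.le _
  · subst h
    have hz : z ≠ 0 := fun e => hq (by rw [e]; rfl)
    rw [k2_of_nonpos le_rfl, hasDerivAt_iff_isLittleO, k0_of_nonpos le_rfl]
    simp only [sub_zero, smul_zero]
    have : Tendsto (fun r : ℝ => 384 * r * √r / z ^ 6) (𝓝 0) (𝓝 0) := by
      have : ContinuousAt (fun r : ℝ => 384 * r * √r / z ^ 6) 0 := by fun_prop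
      simpa [ContinuousAt] using this
    rw [Asymptotics.isLittleO_iff]
    intro c hc
    filter_upwards [this.eventually_lt_const hc] with r hr
    rcases le_or_gt r 0 with h' | h'
    · rw [k0_of_nonpos h']; simp; positivity
    · rw [Real.norm_of_nonneg (k0_nn r z), Real.norm_of_nonneg h'.le]
      refine (k0_small h' hz).trans ?_
      have := mul_le_mul_of_nonneg_right hr.le h'.le
      refine le_trans (le_of_eq ?_) this
      ring
  · have h1 : HasDerivAt (fun r : ℝ => -z ^ 2 / (4 * r)) (z ^ 2 / (4 * r ^ 2)) r :=
      ((hasDerivAt_const r (-z ^ 2)).fun_div ((hasDerivAt_id r).const_mul 4)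
        (by simp; exact h.ne')).congr_deriv (by simp; field_simp)
    have h2 : HasDerivAt (fun r : ℝ => √(4 * π * r)) (4 * π / (2 * √(4 * π * r))) r :=
      ((hasDerivAt_id r).const_mul (4 * π)).sqrt (by simp; positivity) |>.congr_deriv (by simp)
    have hs : √(4 * π * r) ≠ 0 := by positivity
    refine (h1.exp.fun_div h2 hs).congr_deriv ?_
    simp only [k2, k0]
    have hs2 : √(4 * π * r) ^ 2 = 4 * π * r := Real.sq_sqrt (by positivity)
    set Q := √(4 * π * r)
    have hπ : π = Q ^ 2 / (4 * r) := by rw [hs2]; field_simp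
    rw [hπ]
    field_simp

theorem k0_meas : Measurable (fun q : ℝ × ℝ => k0 q.1 q.2) := by unfold k0; fun_prop
theorem k1_meas : Measurable (fun q : ℝ × ℝ => k1 q.1 q.2) := by
  unfold k1; have := k0_meas; fun_prop
theorem k2_meas : Measurable (fun q : ℝ × ℝ => k2 q.1 q.2) := by
  unfold k2; have := k0_meas; fun_prop

/-- potentials -/
def Pot (k : ℝ → ℝ → ℝ) (τ c ρ : ℝ → ℝ) (t x : ℝ) : ℝ := ∫ y, k (t - τ y) (x - c y) * ρ y

/-- point off the curve -/
def Off (τ c : ℝ → ℝ) (K : Set ℝ) (q : ℝ × ℝ) : Prop := ∀ y ∈ K, ((q.1 - τ y, q.2 - c y) : ℝ × ℝ) ≠ 0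

section
variable {τ c ρ : ℝ → ℝ} {K : Set ℝ} {k k' : ℝ → ℝ → ℝ} {q0 : ℝ × ℝ}

theorem Off.nhds (hτ : Continuous τ) (hc : Continuous c) (hK : IsCompact K) (h : Off τ c K q0) :
    ∃ ε > 0, ∀ q ∈ Metric.closedBall q0 ε, Off τ c K q := by
  obtain ⟨δ, hδ, hb⟩ := hK.exists_forall_le' (f := fun y => ‖((q0.1 - τ y, q0.2 - c y) : ℝ × ℝ)‖)
    (by fun_prop) (a := 0) (fun y hy => norm_pos_iff.2 (h y hy))
  refine ⟨δ / 2, by linarith, fun q hq y hy e => ?_⟩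
  have h1 := hb y hy
  have h2 : ((q0.1 - τ y, q0.2 - c y) : ℝ × ℝ) = q0 - q := by
    have e1 := congrArg Prod.fst e
    have e2 := congrArg Prod.snd e
    simp only [Prod.fst_zero, Prod.snd_zero] at e1 e2
    ext <;> simp <;> linarith
  rw [h2, ← dist_eq_norm, dist_comm] at h1
  rw [Metric.mem_closedBall] at hq
  linarith

theorem Off.bound (hτ : Continuous τ) (hc : Continuous c) (hK : IsCompact K) (h : Off τ c K q0)
    (hk : ∀ q : ℝ × ℝ, q ≠ 0 → ContinuousAt (fun q : ℝ × ℝ => k q.1 q.2) q) :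
    ∃ ε > 0, ∃ C, ∀ q ∈ Metric.closedBall q0 ε, Off τ c K q ∧
      ∀ y ∈ K, |k (q.1 - τ y) (q.2 - c y)| ≤ C := by
  obtain ⟨ε, hε, hO⟩ := h.nhds hτ hc hK
  obtain ⟨C, hC⟩ := ((isCompact_closedBall q0 ε).prod hK).exists_bound_of_continuousOn
    (f := fun z : (ℝ × ℝ) × ℝ => k (z.1.1 - τ z.2) (z.1.2 - c z.2)) (by
      intro z hz
      have h1 : ContinuousAt (fun z : (ℝ × ℝ) × ℝ => ((z.1.1 - τ z.2, z.1.2 - c z.2) : ℝ × ℝ)) z := by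
        fun_prop
      exact (ContinuousAt.comp (f := fun z : (ℝ × ℝ) × ℝ => ((z.1.1 - τ z.2, z.1.2 - c z.2) : ℝ × ℝ))
        (hk _ (hO z.1 hz.1 z.2 hz.2)) h1).continuousWithinAt)
  exact ⟨ε, hε, C, fun q hq => ⟨hO q hq, fun y hy => hC (q, y) ⟨hq, hy⟩⟩⟩

theorem Pot_meas (hkm : Measurable (fun q : ℝ × ℝ => k q.1 q.2)) (hτ : Continuous τ) (hc : Continuous c)
    (hρ : Integrable ρ) (t x : ℝ) :
    AEStronglyMeasurable (fun y => k (t - τ y) (x - c y) * ρ y) volume := by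
  have : Measurable (fun y => ((t - τ y, x - c y) : ℝ × ℝ)) := by fun_prop
  exact (hkm.comp this).aestronglyMeasurable.mul hρ.1

theorem Pot_bd {C t x y : ℝ} (hs : ∀ y ∉ K, ρ y = 0) (h : ∀ y ∈ K, |k (t - τ y) (x - c y)| ≤ C) :
    ‖k (t - τ y) (x - c y) * ρ y‖ ≤ C * ‖ρ y‖ := by
  by_cases hy : y ∈ K
  · rw [norm_mul]; exact mul_le_mul_of_nonneg_right (h y hy) (norm_nonneg _)
  · rw [hs y hy]; simp

theorem Pot_cont (hkm : Measurable (fun q : ℝ × ℝ => k q.1 q.2)) (hτ : Continuous τ) (hc : Continuous c)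
    (hK : IsCompact K) (hρ : Integrable ρ) (hs : ∀ y ∉ K, ρ y = 0)
    (hk : ∀ q : ℝ × ℝ, q ≠ 0 → ContinuousAt (fun q : ℝ × ℝ => k q.1 q.2) q)
    (h : Off τ c K q0) : ContinuousAt (fun q : ℝ × ℝ => Pot k τ c ρ q.1 q.2) q0 := by
  obtain ⟨ε, hε, C, hb⟩ := h.bound hτ hc hK hk
  refine continuousAt_of_dominated (bound := fun y => C * ‖ρ y‖)
    (Eventually.of_forall fun q => Pot_meas hkm hτ hc hρ q.1 q.2) ?_ (hρ.norm.const_mul C)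
    (Eventually.of_forall fun y => ?_)
  · filter_upwards [Metric.closedBall_mem_nhds q0 hε] with q hq
    exact Eventually.of_forall fun y => Pot_bd hs (hb q hq).2
  · by_cases hy : y ∈ K
    · have h1 : ContinuousAt (fun q : ℝ × ℝ => ((q.1 - τ y, q.2 - c y) : ℝ × ℝ)) q0 := by fun_prop
      exact (ContinuousAt.comp (f := fun q : ℝ × ℝ => ((q.1 - τ y, q.2 - c y) : ℝ × ℝ))
        (hk _ (h y hy)) h1).mul continuousAt_const
    · simp only [hs y hy, mul_zero]; exact continuousAt_const

theorem Pot_int (hkm : Measurable (fun q : ℝ × ℝ => k q.1 q.2)) (hτ : Continuous τ) (hc : Continuous c)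
    (hK : IsCompact K) (hρ : Integrable ρ) (hs : ∀ y ∉ K, ρ y = 0)
    (hk : ∀ q : ℝ × ℝ, q ≠ 0 → ContinuousAt (fun q : ℝ × ℝ => k q.1 q.2) q)
    (h : Off τ c K q0) : Integrable (fun y => k (q0.1 - τ y) (q0.2 - c y) * ρ y) := by
  obtain ⟨ε, hε, C, hb⟩ := h.bound hτ hc hK hk
  exact (hρ.norm.const_mul C).mono' (Pot_meas hkm hτ hc hρ _ _) (Eventually.of_forall fun y =>
    Pot_bd hs (hb q0 (Metric.mem_closedBall_self hε.le)).2)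

theorem Pot_dx {t x : ℝ} (hkm : Measurable (fun q : ℝ × ℝ => k q.1 q.2))
    (hkm' : Measurable (fun q : ℝ × ℝ => k' q.1 q.2)) (hτ : Continuous τ) (hc : Continuous c)
    (hK : IsCompact K) (hρ : Integrable ρ) (hs : ∀ y ∉ K, ρ y = 0)
    (hk : ∀ q : ℝ × ℝ, q ≠ 0 → ContinuousAt (fun q : ℝ × ℝ => k q.1 q.2) q)
    (hk' : ∀ q : ℝ × ℝ, q ≠ 0 → ContinuousAt (fun q : ℝ × ℝ => k' q.1 q.2) q)
    (hd : ∀ r z, HasDerivAt (k r) (k' r z) z)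
    (h : Off τ c K (t, x)) : HasDerivAt (Pot k τ c ρ t) (Pot k' τ c ρ t x) x := by
  obtain ⟨ε, hε, C, hb⟩ := h.bound hτ hc hK hk'
  refine (hasDerivAt_integral_of_dominated_loc_of_deriv_le (bound := fun y => C * ‖ρ y‖)
    (F := fun x y => k (t - τ y) (x - c y) * ρ y) (F' := fun x y => k' (t - τ y) (x - c y) * ρ y)
    (Metric.closedBall_mem_nhds x hε)
    (Eventually.of_forall fun x => Pot_meas hkm hτ hc hρ t x)
    (Pot_int hkm hτ hc hK hρ hs hk h) (Pot_meas hkm' hτ hc hρ t x)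
    (Eventually.of_forall fun y z hz => ?_) (hρ.norm.const_mul C)
    (Eventually.of_forall fun y z hz => ?_)).2
  · refine Pot_bd hs (hb (t, z) ?_).2
    rw [Metric.mem_closedBall, Prod.dist_eq]; exact max_le (by simpa using hε.le) hz
  · have := ((hd (t - τ y) (z - c y)).comp z ((hasDerivAt_id z).sub_const (c y))).mul_const (ρ y)
    exact this.congr_deriv (by simp)

theorem Pot_dt {t x : ℝ} (hkm : Measurable (fun q : ℝ × ℝ => k q.1 q.2))
    (hkm' : Measurable (fun q : ℝ × ℝ => k' q.1 q.2)) (hτ : Continuous τ) (hc : Continuous c)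
    (hK : IsCompact K) (hρ : Integrable ρ) (hs : ∀ y ∉ K, ρ y = 0)
    (hk : ∀ q : ℝ × ℝ, q ≠ 0 → ContinuousAt (fun q : ℝ × ℝ => k q.1 q.2) q)
    (hk' : ∀ q : ℝ × ℝ, q ≠ 0 → ContinuousAt (fun q : ℝ × ℝ => k' q.1 q.2) q)
    (hd : ∀ r z, ((r, z) : ℝ × ℝ) ≠ 0 → HasDerivAt (fun r => k r z) (k' r z) r)
    (h : Off τ c K (t, x)) : HasDerivAt (fun t => Pot k τ c ρ t x) (Pot k' τ c ρ t x) t := by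
  obtain ⟨ε, hε, C, hb⟩ := h.bound hτ hc hK hk'
  have hm : ∀ z ∈ Metric.closedBall t ε, ((z, x) : ℝ × ℝ) ∈ Metric.closedBall (t, x) ε := by
    intro z hz
    rw [Metric.mem_closedBall, Prod.dist_eq]; exact max_le hz (by simpa using hε.le)
  refine (hasDerivAt_integral_of_dominated_loc_of_deriv_le (bound := fun y => C * ‖ρ y‖)
    (F := fun t y => k (t - τ y) (x - c y) * ρ y) (F' := fun t y => k' (t - τ y) (x - c y) * ρ y)
    (Metric.closedBall_mem_nhds t hε)
    (Eventually.of_forall fun t => Pot_meas hkm hτ hc hρ t x)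
    (Pot_int hkm hτ hc hK hρ hs hk h) (Pot_meas hkm' hτ hc hρ t x)
    (Eventually.of_forall fun y z hz => Pot_bd hs (hb (z, x) (hm z hz)).2) (hρ.norm.const_mul C)
    (Eventually.of_forall fun y z hz => ?_)).2
  by_cases hy : y ∈ K
  · have := ((hd _ _ ((hb (z, x) (hm z hz)).1 y hy)).comp z
      ((hasDerivAt_id z).sub_const (τ y))).mul_const (ρ y)
    exact this.congr_deriv (by simp)
  · simp only [hs y hy, mul_zero]; exact hasDerivAt_const _ _

/-- all facts off the curve -/
structure Reg (P P1 P2 : ℝ → ℝ → ℝ) (q0 : ℝ × ℝ) : Prop where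
  c0 : ContinuousAt (fun q : ℝ × ℝ => P q.1 q.2) q0
  c1 : ContinuousAt (fun q : ℝ × ℝ => P1 q.1 q.2) q0
  c2 : ContinuousAt (fun q : ℝ × ℝ => P2 q.1 q.2) q0
  dt : HasDerivAt (fun t => P t q0.2) (P2 q0.1 q0.2) q0.1
  dx : HasDerivAt (P q0.1) (P1 q0.1 q0.2) q0.2
  dxx : HasDerivAt (P1 q0.1) (P2 q0.1 q0.2) q0.2

theorem Pot_reg (hτ : Continuous τ) (hc : Continuous c)
    (hK : IsCompact K) (hρ : Integrable ρ) (hs : ∀ y ∉ K, ρ y = 0)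
    (h : Off τ c K q0) : Reg (Pot k0 τ c ρ) (Pot k1 τ c ρ) (Pot k2 τ c ρ) q0 where
  c0 := Pot_cont k0_meas hτ hc hK hρ hs (fun q hq => k0_cont hq) h
  c1 := Pot_cont k1_meas hτ hc hK hρ hs (fun q hq => k1_cont hq) h
  c2 := Pot_cont k2_meas hτ hc hK hρ hs (fun q hq => k2_cont hq) h
  dt := Pot_dt k0_meas k2_meas hτ hc hK hρ hs (fun q hq => k0_cont hq) (fun q hq => k2_cont hq)
    (fun _ _ h => k0_dt h) h
  dx := Pot_dx k0_meas k1_meas hτ hc hK hρ hs (fun q hq => k0_cont hq) (fun q hq => k1_cont hq)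
    k0_dz h
  dxx := Pot_dx k1_meas k2_meas hτ hc hK hρ hs (fun q hq => k1_cont hq) (fun q hq => k2_cont hq)
    k1_dz h

theorem Reg.jet {P P1 P2 : ℝ → ℝ → ℝ} {t x : ℝ} (h : ∀ᶠ q in 𝓝 ((t, x) : ℝ × ℝ), Reg P P1 P2 q) :
    HeatJet P t x (P2 t x) (P2 t x) := by
  refine ⟨h.self_of_nhds.dt, P1 t, ?_, h.self_of_nhds.dxx⟩
  have : Tendsto (fun y : ℝ => ((t, y) : ℝ × ℝ)) (𝓝 x) (𝓝 (t, x)) :=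
    Continuous.tendsto (by fun_prop) x
  filter_upwards [this.eventually h] with y hy using hy.dx

theorem Reg.add {P P1 P2 Q Q1 Q2 : ℝ → ℝ → ℝ} (h : Reg P P1 P2 q0) (h' : Reg Q Q1 Q2 q0) :
    Reg (fun t x => P t x + Q t x) (fun t x => P1 t x + Q1 t x) (fun t x => P2 t x + Q2 t x) q0 :=
  ⟨h.c0.add h'.c0, h.c1.add h'.c1, h.c2.add h'.c2, h.dt.add h'.dt, h.dx.add h'.dx, h.dxx.add h'.dxx⟩

theorem Reg.sub {P P1 P2 Q Q1 Q2 : ℝ → ℝ → ℝ} (h : Reg P P1 P2 q0) (h' : Reg Q Q1 Q2 q0) :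
    Reg (fun t x => P t x - Q t x) (fun t x => P1 t x - Q1 t x) (fun t x => P2 t x - Q2 t x) q0 :=
  ⟨h.c0.sub h'.c0, h.c1.sub h'.c1, h.c2.sub h'.c2, h.dt.sub h'.dt, h.dx.sub h'.dx, h.dxx.sub h'.dxx⟩
end

/-- densities -/
structure Dens (a B M : ℝ) (ρ : ℝ → ℝ) : Prop where
  meas : Measurable ρ
  bd : ∀ y, |ρ y| ≤ M
  zero : ∀ y, y ∉ Ioo a B → ρ y = 0
  cont : ∀ y, y ≠ a → y ≠ B → ContinuousAt ρ y

theorem Dens.nn {a B M : ℝ} {ρ : ℝ → ℝ} (h : Dens a B M ρ) : 0 ≤ M := (abs_nonneg _).trans (h.bd 0)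

theorem Dens.int {a B M : ℝ} {ρ : ℝ → ℝ} (h : Dens a B M ρ) : Integrable ρ := by
  have h1 : IntegrableOn ρ (Ioo a B) :=
    Measure.integrableOn_of_bounded (M := M) (by simp) h.meas.aestronglyMeasurable
      (Eventually.of_forall h.bd)
  rwa [integrableOn_iff_integrable_of_support_subset] at h1
  intro y hy; by_contra hn; exact hy (h.zero y hn)

theorem rs_int (R : ℝ) : IntegrableOn (fun r : ℝ => r ^ (-(1 / 2) : ℝ)) (Ioc 0 R) := by
  rcases le_or_gt 0 R with h | h
  · exact (intervalIntegrable_iff_integrableOn_Ioc_of_le h).1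
      (intervalIntegral.intervalIntegrable_rpow' (by norm_num))
  · rw [Ioc_eq_empty (by simpa using h.le)]; simp

theorem rs_val {R : ℝ} (h : 0 ≤ R) : ∫ r in Ioc 0 R, r ^ (-(1 / 2) : ℝ) = 2 * √R := by
  rw [← intervalIntegral.integral_of_le h, integral_rpow (by left; norm_num), Real.sqrt_eq_rpow]
  norm_num; ring

/-- dominating bound -/
theorem dom_bd {a B M A R t r : ℝ} {ρ κ : ℝ → ℝ} (h : Dens a B M ρ) (h0 : ∀ r ≤ 0, κ r = 0)
    (hb : ∀ r, 0 < r → r ≤ R → |κ r| ≤ A * r ^ (-(1 / 2) : ℝ)) (ht : t - a ≤ R) :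
    ‖κ r * ρ (t - r)‖ ≤ (Ioc 0 R).indicator (fun r => A * M * r ^ (-(1 / 2) : ℝ)) r := by
  by_cases hr : r ∈ Ioc 0 R
  · rw [indicator_of_mem hr, norm_mul]
    have := mul_le_mul (hb r hr.1 hr.2) (h.bd (t - r)) (abs_nonneg _) ((abs_nonneg _).trans (hb r hr.1 hr.2))
    refine this.trans (le_of_eq (by ring))
  · rw [indicator_of_notMem hr]
    rcases le_or_gt r 0 with h' | h'
    · rw [h0 r h']; simp
    · rw [h.zero _ (fun hh => hr ⟨h', by linarith [hh.1]⟩)]; simp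

theorem dom_int (A M R : ℝ) :
    Integrable ((Ioc 0 R).indicator (fun r => A * M * r ^ (-(1 / 2) : ℝ))) :=
  (integrable_indicator_iff measurableSet_Ioc).2 ((rs_int R).const_mul (A * M))

theorem con_int {a B M A R t : ℝ} {ρ κ : ℝ → ℝ} (h : Dens a B M ρ) (hm : Measurable κ)
    (h0 : ∀ r ≤ 0, κ r = 0)
    (hb : ∀ r, 0 < r → r ≤ R → |κ r| ≤ A * r ^ (-(1 / 2) : ℝ)) (ht : t - a ≤ R) :
    Integrable (fun r => κ r * ρ (t - r)) := by
  have := h.meas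
  exact (dom_int A M R).mono' (by fun_prop) (Eventually.of_forall fun r => dom_bd h h0 hb ht)

theorem con_bd {a B M A R t : ℝ} {ρ κ : ℝ → ℝ} (h : Dens a B M ρ)
    (h0 : ∀ r ≤ 0, κ r = 0) (hR : 0 ≤ R)
    (hb : ∀ r, 0 < r → r ≤ R → |κ r| ≤ A * r ^ (-(1 / 2) : ℝ)) (ht : t - a ≤ R) :
    |∫ r, κ r * ρ (t - r)| ≤ A * M * (2 * √R) := by
  have := norm_integral_le_of_norm_le (dom_int A M R) (Eventually.of_forall fun r => dom_bd h h0 hb ht)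
  rwa [integral_indicator measurableSet_Ioc, integral_const_mul, rs_val hR] at this

theorem con_cont {X : Type*} [TopologicalSpace X] [FirstCountableTopology X] {a B M A : ℝ}
    {ρ : ℝ → ℝ} {κ : X → ℝ → ℝ} {τ : X → ℝ} {q0 : X}
    (h : Dens a B M ρ) (hm : ∀ q, Measurable (κ q)) (h0 : ∀ q, ∀ r ≤ 0, κ q r = 0)
    (hb : ∀ q r, 0 < r → |κ q r| ≤ A * r ^ (-(1 / 2) : ℝ)) (hτ : ContinuousAt τ q0)
    (hc : ∀ r > 0, ContinuousAt (fun q => κ q r) q0) :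
    ContinuousAt (fun q => ∫ r, κ q r * ρ (τ q - r)) q0 := by
  have hρ := h.meas
  refine continuousAt_of_dominated (Eventually.of_forall fun q => ?_)
    (bound := (Ioc 0 (τ q0 - a + 1)).indicator (fun r => A * M * r ^ (-(1 / 2) : ℝ))) ?_
    (dom_int A M _) ?_
  · have := hm q; fun_prop
  · filter_upwards [hτ.eventually_lt_const (lt_add_one _)] with q hq
    exact Eventually.of_forall fun r => dom_bd h (h0 q) (fun r hr _ => hb q r hr) (by linarith)
  · have e1 : ∀ᵐ r : ℝ, r ≠ τ q0 - a := (measure_eq_zero_iff_ae_notMem.1 (measure_singleton (τ q0 - a)))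
    have e2 : ∀ᵐ r : ℝ, r ≠ τ q0 - B := (measure_eq_zero_iff_ae_notMem.1 (measure_singleton (τ q0 - B)))
    filter_upwards [e1, e2] with r h1 h2
    rcases le_or_gt r 0 with h' | h'
    · simp only [h0 _ r h', zero_mul]; exact continuousAt_const
    · refine (hc r h').mul (ContinuousAt.comp (f := fun q => τ q - r) (h.cont _ ?_ ?_) (hτ.sub_const r))
      · intro e; exact h1 (by linarith)
      · intro e; exact h2 (by linarith)

theorem Pot_r (k : ℝ → ℝ → ℝ) (c ρ : ℝ → ℝ) (t x : ℝ) :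
    Pot k id c ρ t x = ∫ r, k r (x - c (t - r)) * ρ (t - r) := by
  rw [Pot, ← integral_sub_left_eq_self (fun y => k (t - id y) (x - c y) * ρ y) volume t]
  simp

theorem meas_r {k : ℝ → ℝ → ℝ} (hk : Measurable (fun q : ℝ × ℝ => k q.1 q.2)) {f : ℝ → ℝ}
    (hf : Measurable f) : Measurable (fun r => k r (f r)) :=
  hk.comp (measurable_id.prodMk hf)

theorem k0_contz (r : ℝ) : Continuous (k0 r) :=
  continuous_iff_continuousAt.2 fun z => (k0_dz r z).continuousAt
theorem k1_contz (r : ℝ) : Continuous (k1 r) :=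
  continuous_iff_continuousAt.2 fun z => (k1_dz r z).continuousAt

theorem k1_near {r z m : ℝ} (hr : 0 < r) (hz : |z| ≤ m * r) :
    |k1 r z| ≤ m / 2 * r ^ (-(1 / 2) : ℝ) := by
  rw [k1, abs_mul, abs_of_nonneg (k0_nn r z)]
  refine mul_le_mul ?_ (k0_le hr z) (k0_nn r z) ?_
  · rw [abs_div, abs_neg, abs_of_pos (by linarith : 0 < 2 * r), div_le_div_iff₀ (by linarith) (by norm_num)]
    linarith
  · have : 0 ≤ m * r := (abs_nonneg z).trans hz
    have := nonneg_of_mul_nonneg_left this hr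
    linarith

section
variable {a B M m : ℝ} {ρ c : ℝ → ℝ}

theorem S0_cont (h : Dens a B M ρ) (hc : Continuous c) :
    Continuous (fun q : ℝ × ℝ => Pot k0 id c ρ q.1 q.2) := by
  simp_rw [Pot_r]
  refine continuous_iff_continuousAt.2 fun q0 => ?_
  refine con_cont (A := 1) (τ := fun q : ℝ × ℝ => q.1) (q0 := q0)
    (κ := fun (q : ℝ × ℝ) r => k0 r (q.2 - c (q.1 - r))) h (fun q => meas_r (k := k0) (f := fun r => q.2 - c (q.1 - r)) k0_meas (by fun_prop))
    (fun q r hr => k0_of_nonpos hr _) (fun q r hr => ?_) continuousAt_fst (fun r hr => ?_)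
  · rw [abs_of_nonneg (k0_nn _ _), one_mul]; exact k0_le hr _
  · have := k0_contz r
    fun_prop

theorem S1_cont (h : Dens a B M ρ) (hc : Continuous c) (hl : ∀ t r, |c t - c r| ≤ m * |t - r|) :
    Continuous (fun t : ℝ => Pot k1 id c ρ t (c t)) := by
  simp_rw [Pot_r]
  refine continuous_iff_continuousAt.2 fun q0 => con_cont (A := m / 2) (τ := fun t => t) (q0 := q0)
    (κ := fun t r => k1 r (c t - c (t - r))) h (fun q => meas_r (k := k1) (f := fun r => c q - c (q - r)) k1_meas (by fun_prop))
    (fun q r hr => k1_of_nonpos hr _) (fun q r hr => ?_) continuousAt_id (fun r hr => ?_)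
  · refine k1_near hr ((hl _ _).trans (le_of_eq ?_))
    rw [sub_sub_cancel, abs_of_pos hr]
  · have := k1_contz r
    fun_prop
end

theorem gq_eq {β x : ℝ} (hx : x ∈ Ioi (0:ℝ)) : (|(-2:ℝ)| * x ^ ((-2:ℝ) - 1)) •
    ((x ^ (-2:ℝ)) ^ (-(3 / 2) : ℝ) * exp (-β / x ^ (-2:ℝ))) = 2 * exp (-β * x ^ 2) := by
  have hx : 0 < x := hx
  rw [← Real.rpow_mul hx.le, Real.rpow_neg hx.le 2, div_inv_eq_mul, smul_eq_mul]
  have : x ^ ((-2:ℝ) - 1) * x ^ ((-2:ℝ) * -(3 / 2)) = 1 := by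
    rw [← Real.rpow_add hx]; norm_num
  rw [show (2:ℝ) = ((2:ℕ):ℝ) by norm_num, Real.rpow_natCast] at *
  norm_num at this ⊢
  linear_combination (2 * exp (-(β * x ^ 2))) * this

theorem gq_int {β : ℝ} (hβ : 0 < β) :
    IntegrableOn (fun q : ℝ => q ^ (-(3 / 2) : ℝ) * exp (-β / q)) (Ioi 0) := by
  rw [← integrableOn_Ioi_comp_rpow_iff _ (p := -2) (by norm_num)]
  refine IntegrableOn.congr_fun (f := fun x => 2 * exp (-β * x ^ 2)) ?_ (fun x hx => (gq_eq hx).symm) measurableSet_Ioi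
  exact ((integrable_exp_neg_mul_sq hβ).const_mul 2).integrableOn

theorem gq_val {β : ℝ} : ∫ q in Ioi (0:ℝ), q ^ (-(3 / 2) : ℝ) * exp (-β / q) = √(π / β) := by
  rw [← integral_comp_rpow_Ioi _ (p := -2) (by norm_num), setIntegral_congr_fun measurableSet_Ioi (fun x hx => gq_eq hx),
    integral_const_mul, integral_gaussian_Ioi]
  ring

theorem q32 {q : ℝ} (hq : 0 < q) : q ^ (-(3 / 2) : ℝ) = 1 / (q * √q) := by
  rw [show (-(3 / 2) : ℝ) = -1 + -(1 / 2) by norm_num, Real.rpow_add hq, rs_eq hq, Real.rpow_neg_one]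
  field_simp

theorem k0_one {q : ℝ} (hq : 0 < q) (z : ℝ) :
    1 / (2 * q) * k0 q z = 1 / (4 * √π) * (q ^ (-(3 / 2) : ℝ) * exp (-(z ^ 2 / 4) / q)) := by
  rw [q32 hq, k0, Real.sqrt_mul (by positivity), Real.sqrt_mul (by norm_num),
    show √4 = 2 by rw [show (4:ℝ) = 2 ^ 2 by norm_num]; exact Real.sqrt_sq (by norm_num)]
  rw [show -z ^ 2 / (4 * q) = -(z ^ 2 / 4) / q by field_simp]
  have : 0 < √q := Real.sqrt_pos.2 hq
  have : 0 < √π := Real.sqrt_pos.2 Real.pi_pos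
  field_simp
  norm_num

theorem jump_const : ∫ q in Ioi (0:ℝ), 1 / (2 * q) * k0 q 1 = 1 / 2 := by
  rw [setIntegral_congr_fun measurableSet_Ioi (fun q hq => k0_one hq 1), integral_const_mul]
  norm_num only
  have := gq_val (β := 1 / 4)
  norm_num only at this
  rw [this, show π / (1 / 4) = 4 * π by ring, Real.sqrt_mul (by norm_num),
    show √4 = 2 by rw [show (4:ℝ) = 2 ^ 2 by norm_num]; exact Real.sqrt_sq (by norm_num)]
  have : 0 < √π := Real.sqrt_pos.2 Real.pi_pos
  field_simp; norm_num

theorem k0_scale {δ q : ℝ} (hδ : 0 < δ) (z : ℝ) : k0 (δ ^ 2 * q) (δ * z) = k0 q z / δ := by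
  rw [k0, k0, show 4 * π * (δ ^ 2 * q) = δ ^ 2 * (4 * π * q) by ring, Real.sqrt_mul (by positivity),
    Real.sqrt_sq hδ.le, show -(δ * z) ^ 2 / (4 * (δ ^ 2 * q)) = -z ^ 2 / (4 * q) by
      rcases eq_or_ne q 0 with rfl | h
      · simp
      · field_simp]
  rw [div_div, mul_comm δ]

section
variable {a B M m : ℝ} {ρ c : ℝ → ℝ}

theorem J_lim (h : Dens a B M ρ) (hc : Continuous c) (hl : ∀ t r, |c t - c r| ≤ m * |t - r|) {t0 : ℝ}
    (ha : a < t0) (hB : t0 < B) :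
    Tendsto (fun w : ℝ × ℝ => ∫ q in Ioi (0:ℝ), 1 / (2 * q) *
      k0 q (1 + (c w.1 - c (w.1 - w.2 ^ 2 * q)) / w.2) * ρ (w.1 - w.2 ^ 2 * q))
      (𝓝 t0 ×ˢ 𝓝[>] 0) (𝓝 (ρ t0 / 2)) := by
  have hρ := h.meas
  have hv : ρ t0 / 2 = ∫ q in Ioi (0:ℝ), 1 / (2 * q) * k0 q 1 * ρ t0 := by
    rw [integral_mul_const, jump_const]; ring
  have hm0 : 0 ≤ m := by
    have := (abs_nonneg _).trans (hl 1 0); simpa using this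
  have f1 : ∀ᶠ w : ℝ × ℝ in 𝓝 t0 ×ˢ 𝓝[>] 0, 0 < w.2 :=
    tendsto_snd.eventually self_mem_nhdsWithin
  have f2 : Tendsto (fun w : ℝ × ℝ => w.2) (𝓝 t0 ×ˢ 𝓝[>] 0) (𝓝 0) :=
    tendsto_snd.mono_right nhdsWithin_le_nhds
  have f3 : Tendsto (fun w : ℝ × ℝ => w.1) (𝓝 t0 ×ˢ 𝓝[>] 0) (𝓝 t0) := tendsto_fst
  have hη : ∀ w : ℝ × ℝ, ∀ q : ℝ, 0 < w.2 → 0 < q →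
      |(c w.1 - c (w.1 - w.2 ^ 2 * q)) / w.2| ≤ m * w.2 * q := by
    intro w q hw hq
    rw [abs_div, abs_of_pos hw, div_le_iff₀ hw]
    refine (hl _ _).trans (le_of_eq ?_)
    rw [sub_sub_cancel, abs_of_pos (by positivity)]; ring
  rw [hv]
  set R := t0 - a + 1 with hR
  have hRp : 0 < R := by linarith
  refine tendsto_integral_filter_of_dominated_convergence
    (fun q => 1 / (4 * √π) * exp (m ^ 2 * R / 4) * M * (q ^ (-(3 / 2) : ℝ) * exp (-(1 / 8) / q)))
    (Eventually.of_forall fun w => ?_) ?_ ((gq_int (by norm_num)).const_mul _) ?_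
  · have h1 : Measurable (fun q => k0 q (1 + (c w.1 - c (w.1 - w.2 ^ 2 * q)) / w.2)) :=
      meas_r (k := k0) (f := fun q => 1 + (c w.1 - c (w.1 - w.2 ^ 2 * q)) / w.2) k0_meas (by fun_prop)
    exact Measurable.aestronglyMeasurable (by fun_prop)
  · filter_upwards [f1, f3.eventually_lt_const (lt_add_one t0)] with w hw hw1
    refine (ae_restrict_mem measurableSet_Ioi).mono fun q hq => ?_
    have hq : 0 < q := hq
    by_cases hs : w.1 - w.2 ^ 2 * q ∈ Ioo a B
    · rw [norm_mul, k0_one hq, Real.norm_of_nonneg (by positivity)]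
      have h3 := hη w q hw hq
      set η := (c w.1 - c (w.1 - w.2 ^ 2 * q)) / w.2
      have h4 : η ^ 2 ≤ m ^ 2 * R * q := by
        have h5 : η ^ 2 ≤ (m * w.2 * q) ^ 2 := sq_le_sq' (by linarith [neg_abs_le η]) (by linarith [le_abs_self η])
        have h6 : w.2 ^ 2 * q ≤ R := by linarith [hs.1]
        have h7 := mul_le_mul_of_nonneg_left h6 (by positivity : 0 ≤ m ^ 2 * q)
        linarith
      have h8 : exp (-((1 + η) ^ 2 / 4) / q) ≤ exp (m ^ 2 * R / 4) * exp (-(1 / 8) / q) := by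
        rw [← Real.exp_add]
        refine Real.exp_le_exp.2 ?_
        rw [div_add_div _ _ (by norm_num) hq.ne', div_le_div_iff₀ hq (by positivity)]
        have : -(1 + η) ^ 2 ≤ m ^ 2 * R * q - 1 / 2 := by
          have := sq_nonneg (η + 1 / 2)
          linarith
        have := mul_le_mul_of_nonneg_right this hq.le
        linarith
      have h9 : 0 ≤ q ^ (-(3 / 2) : ℝ) := Real.rpow_nonneg hq.le _
      have h10 := mul_le_mul_of_nonneg_left h8 (by positivity : 0 ≤ 1 / (4 * √π) * q ^ (-(3 / 2) : ℝ))
      refine (mul_le_mul (le_of_eq rfl) (h.bd _) (abs_nonneg _) (by positivity)).trans ?_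
      refine (mul_le_mul_of_nonneg_right (le_trans (le_of_eq (by ring)) h10) h.nn).trans (le_of_eq (by ring))
    · rw [h.zero _ hs]
      have h9 : 0 ≤ q ^ (-(3 / 2) : ℝ) := Real.rpow_nonneg hq.le _
      have := h.nn
      simp only [mul_zero, norm_zero]; positivity
  · refine (ae_restrict_mem measurableSet_Ioi).mono fun q hq => ?_
    have hq : 0 < q := hq
    refine Tendsto.mul (Tendsto.mul tendsto_const_nhds ?_) ?_
    · refine ((k0_contz q).tendsto 1).comp ?_
      have : Tendsto (fun w : ℝ × ℝ => (c w.1 - c (w.1 - w.2 ^ 2 * q)) / w.2) (𝓝 t0 ×ˢ 𝓝[>] 0) (𝓝 0) := by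
        have h1 : Tendsto (fun w : ℝ × ℝ => m * w.2 * q) (𝓝 t0 ×ˢ 𝓝[>] 0) (𝓝 0) := by
          simpa using (f2.const_mul m).mul_const q
        refine squeeze_zero_norm' ?_ h1
        filter_upwards [f1] with w hw using hη w q hw hq
      simpa using this.const_add 1
    · refine (h.cont t0 ha.ne' hB.ne).tendsto.comp ?_
      have := f3.sub ((f2.pow 2).mul_const q)
      simpa using this

theorem Off_id {t x : ℝ} (hx : x ≠ c t) (K : Set ℝ) : Off id c K (t, x) := by
  intro y _ e
  have e1 : t - y = 0 := congrArg Prod.fst e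
  have e2 : x - c y = 0 := congrArg Prod.snd e
  rw [show y = t by linarith] at e2
  exact hx (by linarith)

theorem S1_jump (h : Dens a B M ρ) (hc : Continuous c) (hl : ∀ t r, |c t - c r| ≤ m * |t - r|) {t δ : ℝ}
    (hδ : 0 < δ) :
    Pot k1 id c ρ t (c t + δ) = (∫ r, -(c t - c (t - r)) / (2 * r) * k0 r (c t + δ - c (t - r)) * ρ (t - r)) -
      ∫ q in Ioi (0:ℝ), 1 / (2 * q) *
      k0 q (1 + (c t - c (t - δ ^ 2 * q)) / δ) * ρ (t - δ ^ 2 * q) := by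
  have hi : Integrable (fun r => k1 r (c t + δ - c (t - r)) * ρ (t - r)) := by
    have := (Pot_int (q0 := (t, c t + δ)) k1_meas continuous_id hc isCompact_Icc h.int
      (fun y hy => h.zero y (fun hh => hy (Ioo_subset_Icc_self hh))) (fun q hq => k1_cont hq)
      (Off_id (by linarith) _)).comp_sub_left t
    simpa using this
  have hD : Integrable (fun r => -(c t - c (t - r)) / (2 * r) * k0 r (c t + δ - c (t - r)) * ρ (t - r)) := by
    have h1 : Measurable (fun r => k0 r (c t + δ - c (t - r))) :=
      meas_r (k := k0) (f := fun r => c t + δ - c (t - r)) k0_meas (by fun_prop)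
    refine con_int (A := m / 2) (R := t - a) (κ := fun r => -(c t - c (t - r)) / (2 * r) * k0 r (c t + δ - c (t - r))) h (by fun_prop) (fun r hr => ?_) (fun r hr _ => ?_) le_rfl
    · simp only [k0_of_nonpos hr, mul_zero]
    · rw [abs_mul, abs_of_nonneg (k0_nn _ _), abs_div, abs_neg, abs_of_pos (by linarith : 0 < 2 * r)]
      have h2 := hl t (t - r)
      rw [sub_sub_cancel, abs_of_pos hr] at h2
      refine mul_le_mul ?_ (k0_le hr _) (k0_nn _ _) ?_
      · rw [div_le_div_iff₀ (by linarith) (by norm_num)]; linarith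
      · have : 0 ≤ m * r := (abs_nonneg _).trans h2
        have := nonneg_of_mul_nonneg_left this hr
        linarith
  rw [eq_sub_iff_add_eq', Pot_r, ← eq_sub_iff_add_eq, ← integral_sub hD hi]
  have e1 : (fun r => -(c t - c (t - r)) / (2 * r) * k0 r (c t + δ - c (t - r)) * ρ (t - r) -
      k1 r (c t + δ - c (t - r)) * ρ (t - r)) =
      fun r => δ / (2 * r) * k0 r (c t + δ - c (t - r)) * ρ (t - r) := by
    funext r
    rw [k1]
    ring
  have e4 := setIntegral_eq_integral_of_forall_compl_eq_zero (μ := volume) (s := Ioi (0:ℝ))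
    (f := fun r => δ / (2 * r) * k0 r (c t + δ - c (t - r)) * ρ (t - r)) (fun r hr => by
    rw [k0_of_nonpos (by simpa using hr)]; simp)
  rw [e1, ← e4]
  have e2 := integral_comp_mul_left_Ioi (fun r => δ / (2 * r) * k0 r (c t + δ - c (t - r)) * ρ (t - r)) 0
    (b := δ ^ 2) (by positivity)
  rw [mul_zero, smul_eq_mul, eq_inv_mul_iff_mul_eq₀ (by positivity)] at e2
  rw [← e2, ← integral_const_mul]
  refine setIntegral_congr_fun measurableSet_Ioi fun q hq => ?_
  have hq : 0 < q := hq
  have e3 : c t + δ - c (t - δ ^ 2 * q) = δ * (1 + (c t - c (t - δ ^ 2 * q)) / δ) := by field_simp; ring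
  rw [e3, k0_scale hδ]
  field_simp

theorem S1_right (h : Dens a B M ρ) (hc : Continuous c) (hl : ∀ t r, |c t - c r| ≤ m * |t - r|) {t0 : ℝ}
    (ha : a < t0) (hB : t0 < B) :
    Tendsto (fun q : ℝ × ℝ => Pot k1 id c ρ q.1 q.2) (𝓝[{q | c q.1 < q.2}] (t0, c t0))
      (𝓝 (Pot k1 id c ρ t0 (c t0) - ρ t0 / 2)) := by
  obtain ⟨F, hF⟩ : ∃ F : ℝ × ℝ → ℝ, F = fun q : ℝ × ℝ => ∫ r, -(c q.1 - c (q.1 - r)) / (2 * r) *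
      k0 r (q.2 - c (q.1 - r)) * ρ (q.1 - r) := ⟨_, rfl⟩
  have hD : ContinuousAt F (t0, c t0) := by
    rw [hF]
    refine con_cont (A := m / 2) (τ := fun q : ℝ × ℝ => q.1) (q0 := (t0, c t0))
      (κ := fun (q : ℝ × ℝ) r => -(c q.1 - c (q.1 - r)) / (2 * r) * k0 r (q.2 - c (q.1 - r))) h
      (fun q => ?_) (fun q r hr => ?_) (fun q r hr => ?_) continuousAt_fst (fun r hr => ?_)
    · have h1 : Measurable (fun r => k0 r (q.2 - c (q.1 - r))) :=
        meas_r (k := k0) (f := fun r => q.2 - c (q.1 - r)) k0_meas (by fun_prop)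
      fun_prop
    · simp only [k0_of_nonpos hr, mul_zero]
    · rw [abs_mul, abs_of_nonneg (k0_nn _ _), abs_div, abs_neg, abs_of_pos (by linarith : 0 < 2 * r)]
      have h2 := hl q.1 (q.1 - r)
      rw [sub_sub_cancel, abs_of_pos hr] at h2
      refine mul_le_mul ?_ (k0_le hr _) (k0_nn _ _) ?_
      · rw [div_le_div_iff₀ (by linarith) (by norm_num)]; linarith
      · have : 0 ≤ m * r := (abs_nonneg _).trans h2
        have := nonneg_of_mul_nonneg_left this hr
        linarith
    · have := k0_contz r
      have : (2 * r) ≠ 0 := by positivity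
      fun_prop (disch := assumption)
  have hm : Tendsto (fun q : ℝ × ℝ => ((q.1, q.2 - c q.1) : ℝ × ℝ)) (𝓝[{q | c q.1 < q.2}] (t0, c t0))
      (𝓝 t0 ×ˢ 𝓝[>] 0) := by
    refine Tendsto.prodMk (continuousAt_fst.mono_left nhdsWithin_le_nhds) (tendsto_nhdsWithin_iff.2 ⟨?_, ?_⟩)
    · have : ContinuousAt (fun q : ℝ × ℝ => q.2 - c q.1) (t0, c t0) := by fun_prop
      have := this.tendsto.mono_left (nhdsWithin_le_nhds (s := {q : ℝ × ℝ | c q.1 < q.2}))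
      simpa using this
    · exact eventually_nhdsWithin_of_forall fun q hq => (sub_pos.2 hq : 0 < q.2 - c q.1)
  have hJ := (J_lim h hc hl ha hB).comp hm
  have := (hD.tendsto.mono_left (nhdsWithin_le_nhds (s := {q : ℝ × ℝ | c q.1 < q.2}))).sub hJ
  have e : Pot k1 id c ρ t0 (c t0) = F (t0, c t0) := by rw [hF, Pot_r]; rfl
  rw [e]
  refine Tendsto.congr' (f₂ := fun q : ℝ × ℝ => Pot k1 id c ρ q.1 q.2) ?_ this
  filter_upwards [self_mem_nhdsWithin] with q (hq : c q.1 < q.2)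
  have e2 := S1_jump h hc hl (t := q.1) (sub_pos.2 hq)
  rw [add_sub_cancel] at e2
  rw [hF]
  exact e2.symm

theorem Pot_refl1 (c ρ : ℝ → ℝ) (t x : ℝ) :
    Pot k1 id (fun y => -c y) ρ t (-x) = -Pot k1 id c ρ t x := by
  rw [Pot, Pot, ← integral_neg]
  congr 1; funext y
  rw [show -x - -c y = -(x - c y) by ring, k1_neg]; ring

theorem S1_left (h : Dens a B M ρ) (hc : Continuous c) (hl : ∀ t r, |c t - c r| ≤ m * |t - r|) {t0 : ℝ}
    (ha : a < t0) (hB : t0 < B) :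
    Tendsto (fun q : ℝ × ℝ => Pot k1 id c ρ q.1 q.2) (𝓝[{q | q.2 < c q.1}] (t0, c t0))
      (𝓝 (Pot k1 id c ρ t0 (c t0) + ρ t0 / 2)) := by
  have h1 := (S1_right h (c := fun y => -c y) (by fun_prop) (m := m)
    (fun t r => by rw [← neg_sub', abs_neg]; exact hl t r) ha hB).neg
  rw [Pot_refl1, neg_sub, sub_neg_eq_add, add_comm] at h1
  have hm : Tendsto (fun q : ℝ × ℝ => ((q.1, -q.2) : ℝ × ℝ)) (𝓝[{q | q.2 < c q.1}] (t0, c t0))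
      (𝓝[{q | -c q.1 < q.2}] (t0, -c t0)) := by
    refine tendsto_nhdsWithin_iff.2 ⟨?_, eventually_nhdsWithin_of_forall fun q hq => (neg_lt_neg hq : -c q.1 < -q.2)⟩
    have : ContinuousAt (fun q : ℝ × ℝ => ((q.1, -q.2) : ℝ × ℝ)) (t0, c t0) := by fun_prop
    exact this.tendsto.mono_left nhdsWithin_le_nhds
  refine (h1.comp hm).congr fun q => ?_
  show -(Pot k1 id (fun y => -c y) ρ q.1 (-q.2)) = _
  rw [Pot_refl1, neg_neg]
end

theorem k0_1_eq (w : ℝ) : k0 1 w = exp (-(1 / 4) * w ^ 2) / √(4 * π) := by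
  rw [k0, mul_one, mul_one]; congr 2; ring
theorem k0_1_int : Integrable (k0 1) := by
  rw [funext k0_1_eq]
  exact (integrable_exp_neg_mul_sq (by norm_num)).div_const _
theorem k0_1_val : ∫ w, k0 1 w = 1 := by
  simp_rw [k0_1_eq]
  rw [integral_div, integral_gaussian, show π / (1 / 4) = 4 * π by ring]
  exact div_self (by positivity)
theorem k1_1_int : Integrable (k1 1) := by
  have : k1 1 = fun w => -1 / (2 * √(4 * π)) * (w * exp (-(1 / 4) * w ^ 2)) := by
    funext w; rw [k1, k0_1_eq]; field_simp
  rw [this]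
  exact (integrable_mul_exp_neg_mul_sq (by norm_num)).const_mul _
theorem k1_scale {δ : ℝ} (hδ : 0 < δ) (q z : ℝ) : k1 (δ ^ 2 * q) (δ * z) = k1 q z / δ ^ 2 := by
  rw [k1, k1, k0_scale hδ]
  rcases eq_or_ne q 0 with rfl | h
  · simp
  · field_simp

/-- caloric extension of initial data -/
def HH (a : ℝ) (ψ : ℝ → ℝ) (t x : ℝ) : ℝ := ∫ w, k0 1 w * ψ (x - √(t - a) * w)

structure Ini (b N Γ : ℝ) (ψ : ℝ → ℝ) : Prop where
  bd : ∀ y, |ψ y| ≤ N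
  lip : ∀ x y, |ψ x - ψ y| ≤ Γ * |x - y|
  zero : ∀ y, y ∉ Icc (-b) b → ψ y = 0
  even : ∀ y, ψ (-y) = ψ y

theorem con_rescale {k : ℝ → ℝ} {ψ : ℝ → ℝ} {d x : ℝ} (hd : 0 < d) :
    ∫ y, k (x - y) * ψ y = d * ∫ w, k (d * w) * ψ (x - d * w) := by
  have h1 := integral_sub_left_eq_self (fun y => k (x - y) * ψ y) volume x
  simp only [sub_sub_cancel] at h1
  have h2 := Measure.integral_comp_mul_left (fun z => k z * ψ (x - z)) d
  rw [h2, abs_of_pos (inv_pos.2 hd), smul_eq_mul, ← h1, ← mul_assoc, mul_inv_cancel₀ hd.ne', one_mul]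

section
variable {a b N Γ : ℝ} {ψ : ℝ → ℝ}

theorem Ini.cont (h : Ini b N Γ ψ) : Continuous ψ := by
  have : LipschitzWith (Real.toNNReal Γ) ψ := LipschitzWith.of_dist_le_mul fun x y => by
    rw [Real.dist_eq, Real.dist_eq]
    exact (h.lip x y).trans (mul_le_mul_of_nonneg_right (Real.le_coe_toNNReal Γ) (abs_nonneg _))
  exact this.continuous

theorem Ini.int (h : Ini b N Γ ψ) : Integrable ψ :=
  h.cont.integrable_of_hasCompactSupport (HasCompactSupport.intro isCompact_Icc h.zero)

theorem Ini.H_int (h : Ini b N Γ ψ) {k : ℝ → ℝ} (hk : Integrable k) (x d : ℝ) :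
    Integrable (fun w => k w * ψ (x - d * w)) := by
  have := h.cont
  exact hk.mul_bdd (c := N) (by fun_prop) (Eventually.of_forall fun w => h.bd _)

theorem Ini.H_bd (h : Ini b N Γ ψ) (t x : ℝ) : |HH a ψ t x| ≤ N := by
  have h1 : Integrable (fun w => k0 1 w * N) := k0_1_int.mul_const N
  have := norm_integral_le_of_norm_le (f := fun w => k0 1 w * ψ (x - √(t - a) * w)) h1
    (Eventually.of_forall fun w => by
    rw [norm_mul, Real.norm_of_nonneg (k0_nn _ _)]
    exact mul_le_mul_of_nonneg_left (h.bd _) (k0_nn _ _))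
  rwa [integral_mul_const, k0_1_val, one_mul] at this

theorem Ini.H_lip (h : Ini b N Γ ψ) (t x y : ℝ) : |HH a ψ t x - HH a ψ t y| ≤ Γ * |x - y| := by
  rw [HH, HH, ← integral_sub (h.H_int k0_1_int _ _) (h.H_int k0_1_int _ _)]
  have h1 : Integrable (fun w => k0 1 w * (Γ * |x - y|)) := k0_1_int.mul_const _
  have := norm_integral_le_of_norm_le
    (f := fun w => k0 1 w * ψ (x - √(t - a) * w) - k0 1 w * ψ (y - √(t - a) * w)) h1
    (Eventually.of_forall fun w => by
    rw [← mul_sub, norm_mul, Real.norm_of_nonneg (k0_nn _ _)]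
    refine mul_le_mul_of_nonneg_left ((h.lip _ _).trans (le_of_eq ?_)) (k0_nn _ _)
    rw [sub_sub_sub_cancel_right])
  rwa [integral_mul_const, k0_1_val, one_mul] at this

theorem Ini.H_cont (h : Ini b N Γ ψ) : Continuous (fun q : ℝ × ℝ => HH a ψ q.1 q.2) := by
  have := h.cont
  have := k0_contz 1
  refine continuous_of_dominated (bound := fun w => k0 1 w * N) (fun q => ?_) (fun q => ?_)
    (k0_1_int.mul_const N) ?_
  · exact Continuous.aestronglyMeasurable (by fun_prop)
  · exact Eventually.of_forall fun w => by
      rw [norm_mul, Real.norm_of_nonneg (k0_nn _ _)]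
      exact mul_le_mul_of_nonneg_left (h.bd _) (k0_nn _ _)
  · exact Eventually.of_forall fun w => by fun_prop

theorem HH_init {t : ℝ} (ht : t ≤ a) (x : ℝ) : HH a ψ t x = ψ x := by
  simp only [HH, Real.sqrt_eq_zero_of_nonpos (sub_nonpos.2 ht), zero_mul, sub_zero]
  rw [integral_mul_const, k0_1_val, one_mul]

theorem HH_pot {t : ℝ} (ht : a < t) (x : ℝ) : HH a ψ t x = Pot k0 (fun _ => a) id ψ t x := by
  have hr : 0 < √(t - a) := Real.sqrt_pos.2 (by linarith)
  have hs : √(t - a) ^ 2 = t - a := Real.sq_sqrt (by linarith)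
  rw [Pot, show (∫ y, k0 (t - a) (x - id y) * ψ y) = ∫ y, k0 (t - a) (x - y) * ψ y from rfl,
    con_rescale hr, HH, ← integral_const_mul]
  congr 1; funext w
  have := k0_scale (q := 1) hr w
  rw [hs, mul_one] at this
  rw [this]; field_simp

theorem H1_pot {t : ℝ} (ht : a < t) (x : ℝ) : Pot k1 (fun _ => a) id ψ t x =
    (1 / √(t - a)) * ∫ w, k1 1 w * ψ (x - √(t - a) * w) := by
  have hr : 0 < √(t - a) := Real.sqrt_pos.2 (by linarith)
  have hs : √(t - a) ^ 2 = t - a := Real.sq_sqrt (by linarith)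
  rw [Pot, show (∫ y, k1 (t - a) (x - id y) * ψ y) = ∫ y, k1 (t - a) (x - y) * ψ y from rfl,
    con_rescale hr, ← integral_const_mul, ← integral_const_mul]
  congr 1; funext w
  have := k1_scale hr 1 w
  rw [hs, mul_one] at this
  have h2 : √(t - a) * (k1 1 w / (t - a)) = 1 / √(t - a) * k1 1 w := by
    nth_rw 2 [← hs]
    field_simp
  rw [this, ← mul_assoc, h2, mul_assoc]

theorem Ini.reg (h : Ini b N Γ ψ) {q : ℝ × ℝ} (hq : a < q.1) :
    Reg (HH a ψ) (Pot k1 (fun _ => a) id ψ) (Pot k2 (fun _ => a) id ψ) q := by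
  have h1 := Pot_reg (τ := fun _ => a) (c := id) (q0 := q) continuous_const continuous_id
    (isCompact_Icc (a := -b) (b := b)) h.int h.zero (fun y _ e => by
      have e1 : q.1 - a = 0 := congrArg Prod.fst e
      linarith)
  have hq' : ∀ᶠ q' : ℝ × ℝ in 𝓝 q, a < q'.1 := continuousAt_fst.eventually_const_lt hq
  refine ⟨h.H_cont.continuousAt, h1.c1, h1.c2, ?_, ?_, h1.dxx⟩
  · refine h1.dt.congr_of_eventuallyEq ?_
    filter_upwards [eventually_gt_nhds hq] with t ht using HH_pot ht _
  · refine h1.dx.congr_of_eventuallyEq (Eventually.of_forall fun x => HH_pot hq x)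

theorem Ini.H1_bd (h : Ini b N Γ ψ) {t : ℝ} (ht : a < t) (x : ℝ) : |Pot k1 (fun _ => a) id ψ t x| ≤ Γ := by
  have hΓ : 0 ≤ Γ := by have := (abs_nonneg _).trans (h.lip 1 0); simpa using this
  exact (h.reg (q := (t, x)) ht).dx.le_of_lip' hΓ (Eventually.of_forall fun y => h.H_lip t y x)

theorem Ini.H1_lip (h : Ini b N Γ ψ) {t : ℝ} (ht : a < t) (x y : ℝ) :
    |Pot k1 (fun _ => a) id ψ t x - Pot k1 (fun _ => a) id ψ t y| ≤
      (∫ w, ‖k1 1 w‖) * Γ * |x - y| / √(t - a) := by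
  have hr : 0 < √(t - a) := Real.sqrt_pos.2 (by linarith)
  rw [H1_pot ht, H1_pot ht, ← mul_sub, ← integral_sub (h.H_int k1_1_int _ _) (h.H_int k1_1_int _ _),
    abs_mul, abs_of_pos (by positivity), mul_comm, mul_one_div]
  refine div_le_div_of_nonneg_right ?_ hr.le
  have h1 : Integrable (fun w => ‖k1 1 w‖ * (Γ * |x - y|)) := k1_1_int.norm.mul_const _
  have := norm_integral_le_of_norm_le
    (f := fun w => k1 1 w * ψ (x - √(t - a) * w) - k1 1 w * ψ (y - √(t - a) * w)) h1
    (Eventually.of_forall fun w => by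
    rw [← mul_sub, norm_mul]
    refine mul_le_mul_of_nonneg_left ((h.lip _ _).trans (le_of_eq ?_)) (norm_nonneg _)
    rw [sub_sub_sub_cancel_right])
  rwa [integral_mul_const, ← mul_assoc] at this

theorem Ini.H1_zero (h : Ini b N Γ ψ) (t : ℝ) : Pot k1 (fun _ => a) id ψ t 0 = 0 := by
  have h1 := integral_neg_eq_self (fun y => k1 (t - a) (0 - y) * ψ y) volume
  have h2 : (∫ y, k1 (t - a) (0 - -y) * ψ (-y)) = -∫ y, k1 (t - a) (0 - y) * ψ y := by
    rw [← integral_neg]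
    congr 1; funext y
    rw [h.even, show (0 - -y) = -(0 - y) by ring, k1_neg]; ring
  show (∫ y, k1 (t - a) (0 - y) * ψ y) = 0
  rw [h2] at h1; linarith
end

theorem exp_jet {c : ℝ → ℝ} {C a σ t x d : ℝ} (hσ : σ ^ 2 = 1) (hd : HasDerivAt c d t) :
    HeatJet (fun t x => exp (C * (t - a) + σ * (x - c t))) t x
      ((C - σ * d) * exp (C * (t - a) + σ * (x - c t))) (exp (C * (t - a) + σ * (x - c t))) := by
  refine ⟨?_, fun x => σ * exp (C * (t - a) + σ * (x - c t)), Eventually.of_forall fun y => ?_, ?_⟩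
  · have h1 : HasDerivAt (fun t => C * (t - a) + σ * (x - c t)) (C - σ * d) t :=
      ((((hasDerivAt_id t).sub_const a).const_mul C).fun_add ((hd.const_sub x).const_mul σ)).congr_deriv (by ring)
    exact h1.exp.congr_deriv (by ring)
  · have h1 : HasDerivAt (fun x => C * (t - a) + σ * (x - c t)) σ y :=
      ((((hasDerivAt_id y).sub_const (c t)).const_mul σ).const_add _).congr_deriv (by simp)
    exact h1.exp.congr_deriv (by ring)
  · have h1 : HasDerivAt (fun x => C * (t - a) + σ * (x - c t)) σ x :=
      ((((hasDerivAt_id x).sub_const (c t)).const_mul σ).const_add _).congr_deriv (by simp)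
    refine (h1.exp.const_mul σ).congr_deriv ?_
    linear_combination exp (C * (t - a) + σ * (x - c t)) * hσ

theorem quad_jet (a t x : ℝ) : HeatJet (fun t x => x ^ 2 + 2 * (t - a)) t x 2 2 := by
  refine ⟨?_, fun x => 2 * x, Eventually.of_forall fun y => ?_, ?_⟩
  · exact ((((hasDerivAt_id t).sub_const a).const_mul 2).const_add _).congr_deriv (by simp)
  · exact ((hasDerivAt_pow 2 y).add_const _).congr_deriv (by simp)
  · exact ((hasDerivAt_id x).const_mul 2).congr_deriv (by simp)

/-- exponential ridge derivative -/
theorem ridge_d {A σ z x : ℝ} {S : Set ℝ} (hS : ∀ᶠ y in 𝓝[S] x, |y - z| = -σ * (y - z)) (h0 : |x - z| = -σ * (x - z)) :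
    HasDerivWithinAt (fun y => exp (A - |y - z|)) (σ * exp (A - |x - z|)) S x := by
  have h1 : HasDerivAt (fun y => A + σ * (y - z)) σ x :=
    ((((hasDerivAt_id x).sub_const z).const_mul σ).const_add _).congr_deriv (by simp)
  have h2 := h1.exp.hasDerivWithinAt (s := S)
  rw [show A + σ * (x - z) = A - |x - z| by rw [h0]; ring] at h2
  refine (h2.congr_of_eventuallyEq ?_ ?_).congr_deriv (by ring)
  · filter_upwards [hS] with y hy; rw [hy]; congr 1; ring
  · rw [h0]; congr 1; ring

theorem ridge_side {z x : ℝ} (h : x ≠ z) :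
    ∃ σ : ℝ, σ ^ 2 = 1 ∧ |σ| = 1 ∧ 0 < -σ * (x - z) := by
  rcases lt_or_gt_of_ne h with h | h
  · exact ⟨1, by norm_num, by norm_num, by linarith⟩
  · exact ⟨-1, by norm_num, by norm_num, by linarith⟩

theorem ridge_abs {σ v : ℝ} (h : |σ| = 1) (h0 : 0 ≤ -σ * v) : |v| = -σ * v := by
  rw [← abs_of_nonneg h0, abs_mul, abs_neg, h, one_mul]

theorem MPT {c1 c2 : ℝ → ℝ} {a T M Bd : ℝ} (hc1 : Continuous c1) (hc2 : Continuous c2)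
    (hd1 : ∀ t ∈ Ioc a T, ∃ d, HasDerivAt c1 d t ∧ |d| ≤ M)
    (hd2 : ∀ t ∈ Ioc a T, ∃ d, HasDerivAt c2 d t ∧ |d| ≤ M)
    (hne : ∀ t ∈ Icc a T, c1 t ≠ c2 t) {w : ℝ → ℝ → ℝ}
    (hw : ContinuousOn (fun q : ℝ × ℝ => w q.1 q.2) {q | q.1 ∈ Icc a T ∧ c1 q.1 ≤ q.2})
    (hb : ∀ t ∈ Icc a T, ∀ x, c1 t ≤ x → w t x ≤ Bd) (hi : ∀ x, c1 a ≤ x → w a x ≤ 0)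
    (h1 : ∀ t ∈ Ioc a T, ∃ d, 0 ≤ d ∧ HasDerivWithinAt (w t) d (Ici (c1 t)) (c1 t))
    (h2 : ∀ t ∈ Ioc a T, c1 t < c2 t → ∃ d d', d' ≤ d ∧
      HasDerivWithinAt (w t) d (Ici (c2 t)) (c2 t) ∧ HasDerivWithinAt (w t) d' (Iic (c2 t)) (c2 t))
    (hj : ∀ t ∈ Ioc a T, ∀ x, c1 t < x → x ≠ c2 t → ∃ wt, HeatJet w t x wt wt) :
    ∀ t ∈ Icc a T, ∀ x, c1 t ≤ x → w t x ≤ 0 := by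
  obtain ⟨K1, hK1⟩ := isCompact_Icc.exists_bound_of_continuousOn (s := Icc a T) hc1.continuousOn
  obtain ⟨K2, hK2⟩ := isCompact_Icc.exists_bound_of_continuousOn (s := Icc a T) hc2.continuousOn
  simp only [Real.norm_eq_abs] at hK1 hK2
  intro t' ht' x' hx'
  set Λ := 2 + 2 * K1 with hΛ
  set C := 1 + M with hC
  have hK1n : 0 ≤ K1 := (abs_nonneg _).trans (hK1 t' ht')
  set E : ℝ → ℝ → ℝ := fun t x => Λ * exp (C * (t - a) + (-1) * (x - c1 t)) +
    exp (C * (t - a) - |x - c2 t|) + (x ^ 2 + 2 * (t - a)) with hE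
  have hE0 : ∀ t ∈ Icc a T, ∀ x, x ^ 2 ≤ E t x := fun t ht x => by
    have : 0 ≤ Λ * exp (C * (t - a) + (-1) * (x - c1 t)) + exp (C * (t - a) - |x - c2 t|) := by
      positivity
    simp only [hE]
    linarith [ht.1]
  have main : ∀ ε > 0, w t' x' - ε * E t' x' ≤ 0 := by
    intro ε hε
    set X := max x' (max (K1 + 1) (max (K2 + 1) (Bd / ε + 1))) with hX
    have hX1 : x' ≤ X := le_max_left _ _
    have hX2 : K1 + 1 ≤ X := (le_max_left _ _).trans (le_max_right _ _)
    have hX3 : K2 + 1 ≤ X := (le_max_left _ _).trans ((le_max_right _ _).trans (le_max_right _ _))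
    have hX4 : Bd / ε + 1 ≤ X := (le_max_right _ _).trans ((le_max_right _ _).trans (le_max_right _ _))
    have hBd : Bd ≤ ε * X ^ 2 := by
      have h3 : X ≤ X ^ 2 := by
        have : 1 ≤ X := by linarith
        nlinarith
      have h4 : Bd / ε ≤ X ^ 2 := by linarith
      rw [div_le_iff₀ hε] at h4; linarith
    clear_value X
    refine max_principle (a := c1) (b := fun _ => X) (t0 := a) (t1 := T)
      (W := fun t x => w t x - ε * E t x) hc1.continuousOn continuousOn_const ?_ ?_ ?_ t' ht' x' ⟨hx', hX1⟩
    · refine (hw.mono fun q hq => ⟨hq.1, hq.2.1⟩).sub ?_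
      simp only [hE]; fun_prop
    · intro x hx
      have haT : a ≤ T := ht'.1.trans ht'.2
      have := mul_nonneg hε.le ((sq_nonneg x).trans (hE0 a ⟨le_rfl, haT⟩ x))
      linarith [hi x hx.1]
    · intro t ht x hx
      have htI : t ∈ Icc a T := Ioc_subset_Icc_self ht
      have hb1 := abs_le.1 (hK1 t htI)
      have hb2 := abs_le.1 (hK2 t htI)
      obtain ⟨d1, hd1, hd1'⟩ := hd1 t ht
      obtain ⟨d2, hd2, hd2'⟩ := hd2 t ht
      have hM : 0 ≤ M := (abs_nonneg _).trans hd1'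
      have hA : 1 ≤ exp (C * (t - a)) := Real.one_le_exp (mul_nonneg (by linarith) (by linarith [ht.1]))
      have hEd : ∀ (S : Set ℝ) (y d : ℝ), HasDerivWithinAt (fun y => exp (C * (t - a) - |y - c2 t|)) d S y →
          HasDerivWithinAt (E t) (-(Λ * exp (C * (t - a) + (-1) * (y - c1 t))) + d + 2 * y) S y := by
        intro S y d hd
        have g1 : HasDerivAt (fun x => C * (t - a) + (-1) * (x - c1 t)) (-1) y :=
          ((((hasDerivAt_id y).sub_const (c1 t)).const_mul (-1)).const_add _).congr_deriv (by simp)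
        have g2 : HasDerivAt (fun x => x ^ 2 + 2 * (t - a)) (2 * y) y :=
          ((hasDerivAt_pow 2 y).add_const _).congr_deriv (by simp)
        exact (((g1.exp.const_mul Λ).hasDerivWithinAt.fun_add hd).fun_add g2.hasDerivWithinAt).congr_deriv (by ring)
      rcases eq_or_lt_of_le hx.2 with rfl | hxX
      · left
        have h5 := mul_le_mul_of_nonneg_left (hE0 t htI x) hε.le
        have h6 := hb t htI x hx.1
        linarith
      rcases eq_or_lt_of_le hx.1 with rfl | hx1
      · right; right; left
        refine ⟨hxX, ?_⟩
        obtain ⟨d, hd, hd'⟩ := h1 t ht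
        obtain ⟨σ, hσ, hσ1, hσ0⟩ := ridge_side (hne t htI)
        have hr := ridge_d (A := C * (t - a)) (σ := σ) (z := c2 t) (x := c1 t) (S := Ici (c1 t)) (by
          have : ContinuousAt (fun y => -σ * (y - c2 t)) (c1 t) := by fun_prop
          filter_upwards [mem_nhdsWithin_of_mem_nhds (this.eventually_const_lt hσ0)] with y hy
          exact ridge_abs hσ1 hy.le) (ridge_abs hσ1 hσ0.le)
        refine ⟨_, ?_, hd'.fun_sub ((hEd _ _ _ hr).const_mul ε)⟩
        have e1 : σ * exp (C * (t - a) - |c1 t - c2 t|) ≤ exp (C * (t - a)) := by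
          refine (le_abs_self _).trans ?_
          rw [abs_mul, hσ1, one_mul, abs_of_pos (exp_pos _)]
          exact Real.exp_le_exp.2 (by linarith [abs_nonneg (c1 t - c2 t)])
        rw [sub_self, mul_zero, add_zero]
        have e2 : 1 + 2 * K1 ≤ (1 + 2 * K1) * exp (C * (t - a)) := le_mul_of_one_le_right (by linarith) hA
        have : 0 < ε * (Λ * exp (C * (t - a)) - σ * exp (C * (t - a) - |c1 t - c2 t|) - 2 * c1 t) := by
          refine mul_pos hε ?_
          rw [hΛ]; linarith [hb1.2]
        linarith
      rcases eq_or_ne x (c2 t) with rfl | hx2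
      · right; right
        obtain ⟨d, d', hdd, hd, hd'⟩ := h2 t ht hx1
        have hr1 := ridge_d (A := C * (t - a)) (σ := -1) (z := c2 t) (x := c2 t) (S := Ici (c2 t))
          (eventually_nhdsWithin_of_forall fun y hy => by rw [abs_of_nonneg (sub_nonneg.2 hy)]; ring) (by simp)
        have hr2 := ridge_d (A := C * (t - a)) (σ := 1) (z := c2 t) (x := c2 t) (S := Iic (c2 t))
          (eventually_nhdsWithin_of_forall fun y hy => by rw [abs_of_nonpos (sub_nonpos.2 hy)]; ring) (by simp)
        rw [sub_self, abs_zero, sub_zero] at hr1 hr2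
        have g1 := hd.fun_sub ((hEd _ _ _ hr1).const_mul ε)
        have g2 := hd'.fun_sub ((hEd _ _ _ hr2).const_mul ε)
        have hpos := mul_pos hε (zero_lt_one.trans_le hA)
        set Q := -(Λ * exp (C * (t - a) + (-1) * (c2 t - c1 t)))
        by_cases hc : 0 < d - ε * (Q + -1 * exp (C * (t - a)) + 2 * c2 t)
        · left; exact ⟨hxX, _, hc, g1⟩
        · right; exact ⟨hx1, _, by linarith, g2⟩
      · right; left
        refine ⟨⟨hx1, hxX⟩, ?_⟩
        obtain ⟨wt, hwt⟩ := hj t ht x hx1 hx2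
        obtain ⟨σ, hσ, hσ1, hσ0⟩ := ridge_side hx2
        have j1 := (exp_jet (C := C) (a := a) (σ := -1) (x := x) (by norm_num) hd1).smul Λ
        have j2 : HeatJet (fun t x => exp (C * (t - a) - |x - c2 t|)) t x _ _ :=
          (exp_jet (C := C) (a := a) (σ := σ) (x := x) hσ hd2).congr (by
          have : ContinuousAt (fun q : ℝ × ℝ => -σ * (q.2 - c2 q.1)) (t, x) := by fun_prop
          filter_upwards [this.eventually_const_lt hσ0] with q hq
          rw [ridge_abs hσ1 hq.le]; congr 1; ring)
        have j := hwt.sub (((j1.add j2).add (quad_jet a t x)).smul ε)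
        refine ⟨_, _, j, ?_⟩
        have e1 : 1 ≤ C - -1 * d1 := by linarith [(abs_le.1 hd1').1]
        have e2 : 1 ≤ C - σ * d2 := by
          have : σ * d2 ≤ M := by
            refine (le_abs_self _).trans ?_
            rw [abs_mul, hσ1, one_mul]; exact hd2'
          linarith
        have hΛ0 : 0 ≤ Λ := by linarith
        have f1 := le_mul_of_one_le_left (exp_pos (C * (t - a) + -1 * (x - c1 t))).le e1
        have f2 := le_mul_of_one_le_left (exp_pos (C * (t - a) + σ * (x - c2 t))).le e2
        have f3 := mul_le_mul_of_nonneg_left f1 hΛ0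
        have f4 := mul_le_mul_of_nonneg_left (add_le_add f3 f2) hε.le
        linarith
  by_contra hcon
  push Not at hcon
  have hE1 : 0 ≤ E t' x' := (sq_nonneg x').trans (hE0 t' ht' x')
  have := main (w t' x' / (E t' x' + 1)) (by positivity)
  have e : w t' x' - w t' x' / (E t' x' + 1) * E t' x' = w t' x' / (E t' x' + 1) := by field_simp; ring
  rw [e] at this
  have : 0 < w t' x' / (E t' x' + 1) := by positivity
  linarith

theorem side_right {f f' : ℝ → ℝ} {x e : ℝ} (hc : ContinuousAt f x)
    (hd : ∀ᶠ y in 𝓝[>] x, HasDerivAt f (f' y) y) (ht : Tendsto f' (𝓝[>] x) (𝓝 e)) :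
    HasDerivWithinAt f e (Ici x) x := by
  refine hasDerivWithinAt_Ici_of_tendsto_deriv (s := {y | HasDerivAt f (f' y) y})
    (fun y hy => (HasDerivAt.differentiableAt hy).differentiableWithinAt) hc.continuousWithinAt hd
    (ht.congr' ?_)
  filter_upwards [hd] with y hy using hy.deriv.symm

theorem side_left {f f' : ℝ → ℝ} {x e : ℝ} (hc : ContinuousAt f x)
    (hd : ∀ᶠ y in 𝓝[<] x, HasDerivAt f (f' y) y) (ht : Tendsto f' (𝓝[<] x) (𝓝 e)) :
    HasDerivWithinAt f e (Iic x) x := by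
  refine hasDerivWithinAt_Iic_of_tendsto_deriv (s := {y | HasDerivAt f (f' y) y})
    (fun y hy => (HasDerivAt.differentiableAt hy).differentiableWithinAt) hc.continuousWithinAt hd
    (ht.congr' ?_)
  filter_upwards [hd] with y hy using hy.deriv.symm

def UU (a : ℝ) (ψ k s v : ℝ → ℝ) (t x : ℝ) : ℝ :=
  HH a ψ t x + Pot k0 id (fun _ => 0) k t x - Pot k0 id s v t x - Pot k0 id (fun y => -s y) v t x
def U1 (a : ℝ) (ψ k s v : ℝ → ℝ) (t x : ℝ) : ℝ :=
  Pot k1 (fun _ => a) id ψ t x + Pot k1 id (fun _ => 0) k t x - Pot k1 id s v t x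
    - Pot k1 id (fun y => -s y) v t x
def U2 (a : ℝ) (ψ k s v : ℝ → ℝ) (t x : ℝ) : ℝ :=
  Pot k2 (fun _ => a) id ψ t x + Pot k2 id (fun _ => 0) k t x - Pot k2 id s v t x
    - Pot k2 id (fun y => -s y) v t x

structure Sys (a B M m b N Γ : ℝ) (ψ k s v : ℝ → ℝ) : Prop where
  ini : Ini b N Γ ψ
  dk : Dens a B M k
  dv : Dens a B M v
  sc : Continuous s
  sl : ∀ t r, |s t - s r| ≤ m * |t - r|

theorem Dens.reg {a B M : ℝ} {ρ c : ℝ → ℝ} (h : Dens a B M ρ) (hc : Continuous c) {q : ℝ × ℝ}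
    (hx : q.2 ≠ c q.1) : Reg (Pot k0 id c ρ) (Pot k1 id c ρ) (Pot k2 id c ρ) q :=
  Pot_reg continuous_id hc isCompact_Icc h.int
    (fun y hy => h.zero y (fun hh => hy (Ioo_subset_Icc_self hh))) (Off_id (t := q.1) (x := q.2) hx _)

theorem slice {F : ℝ → ℝ → ℝ} {t x0 e : ℝ} {P : Set (ℝ × ℝ)} {S : Set ℝ}
    (hF : Tendsto (fun q : ℝ × ℝ => F q.1 q.2) (𝓝[P] (t, x0)) (𝓝 e)) (hP : ∀ y ∈ S, (t, y) ∈ P) :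
    Tendsto (F t) (𝓝[S] x0) (𝓝 e) :=
  Tendsto.comp (f := fun y : ℝ => ((t, y) : ℝ × ℝ)) (g := fun q : ℝ × ℝ => F q.1 q.2) hF <|
  tendsto_nhdsWithin_iff.2 ⟨(Continuous.tendsto (by fun_prop) x0).mono_left nhdsWithin_le_nhds,
    eventually_nhdsWithin_of_forall hP⟩

namespace Sys
variable {a B M m b N Γ : ℝ} {ψ k s v : ℝ → ℝ} (h : Sys a B M m b N Γ ψ k s v)
include h

theorem sc' : Continuous (fun y => -s y) := h.sc.neg

theorem cont : Continuous (fun q : ℝ × ℝ => UU a ψ k s v q.1 q.2) :=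
  ((h.ini.H_cont.add (S0_cont h.dk continuous_const)).sub (S0_cont h.dv h.sc)).sub (S0_cont h.dv h.sc')

theorem reg {q : ℝ × ℝ} (ht : a < q.1) (hx : q.2 ≠ 0) (h1 : q.2 ≠ s q.1) (h2 : q.2 ≠ -s q.1) :
    Reg (UU a ψ k s v) (U1 a ψ k s v) (U2 a ψ k s v) q :=
  (((h.ini.reg ht).add (h.dk.reg continuous_const hx)).sub (h.dv.reg h.sc h1)).sub (h.dv.reg h.sc' h2)

theorem reg_ev {t x : ℝ} (ht : a < t) (hx : x ≠ 0) (h1 : x ≠ s t) (h2 : x ≠ -s t) :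
    ∀ᶠ q in 𝓝 ((t, x) : ℝ × ℝ), Reg (UU a ψ k s v) (U1 a ψ k s v) (U2 a ψ k s v) q := by
  have := h.sc
  have c1 : ContinuousAt (fun q : ℝ × ℝ => q.2 - s q.1) (t, x) := by fun_prop
  have c2 : ContinuousAt (fun q : ℝ × ℝ => q.2 + s q.1) (t, x) := by fun_prop
  filter_upwards [(continuousAt_fst (p := (t, x))).eventually_const_lt ht,
    (continuousAt_snd (p := (t, x))).eventually_ne hx, c1.eventually_ne (sub_ne_zero.2 h1),
    c2.eventually_ne (y := 0) (fun e => h2 (by linarith [show x + s t = 0 from e]))] with q g1 g2 g3 g4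
  exact h.reg g1 g2 (sub_ne_zero.1 g3) (fun e => g4 (by show q.2 + s q.1 = 0; linarith))

theorem jet {t x : ℝ} (ht : a < t) (hx : x ≠ 0) (h1 : x ≠ s t) (h2 : x ≠ -s t) :
    HeatJet (UU a ψ k s v) t x (U2 a ψ k s v t x) (U2 a ψ k s v t x) :=
  Reg.jet (h.reg_ev ht hx h1 h2)

theorem cx (t x : ℝ) : ContinuousAt (UU a ψ k s v t) x :=
  (h.cont.comp (by fun_prop : Continuous fun x : ℝ => ((t, x) : ℝ × ℝ))).continuousAt

theorem lim0 {t : ℝ} (ht : a < t) (hB : t < B) (hs : 0 < s t) :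
    Tendsto (fun q : ℝ × ℝ => U1 a ψ k s v q.1 q.2) (𝓝[{q | 0 < q.2}] (t, 0)) (𝓝 (-(k t / 2))) := by
  have e1 := (h.ini.reg (q := (t, 0)) ht).c1.tendsto.mono_left (nhdsWithin_le_nhds (s := {q | 0 < q.2}))
  have e2 := S1_right h.dk (c := fun _ => 0) continuous_const (m := 0) (fun t r => by simp) ht hB
  have e3 := (h.dv.reg h.sc (q := (t, 0)) hs.ne).c1.tendsto.mono_left (nhdsWithin_le_nhds (s := {q | 0 < q.2}))
  have e4 := (h.dv.reg h.sc' (q := (t, 0)) (by simp; exact hs.ne')).c1.tendsto.mono_left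
    (nhdsWithin_le_nhds (s := {q | 0 < q.2}))
  have e5 := ((e1.add e2).sub e3).sub e4
  simp only at e5
  have f1 : Pot k1 id (fun y => -s y) v t 0 = - Pot k1 id s v t 0 := by
    have := Pot_refl1 s v t 0
    rwa [neg_zero] at this
  have f2 : Pot k1 id (fun _ => 0) k t 0 = 0 := by simp [Pot, k1]
  rw [h.ini.H1_zero, f1, f2] at e5
  have f3 : -(k t / 2) = 0 + (0 - k t / 2) - Pot k1 id s v t 0 - -Pot k1 id s v t 0 := by ring
  rw [f3]; exact e5

theorem limr {t : ℝ} (ht : a < t) (hB : t < B) (hs : 0 < s t) :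
    Tendsto (fun q : ℝ × ℝ => U1 a ψ k s v q.1 q.2) (𝓝[{q | s q.1 < q.2}] (t, s t))
      (𝓝 (U1 a ψ k s v t (s t) + v t / 2)) := by
  have e1 := (h.ini.reg (q := (t, s t)) ht).c1.tendsto.mono_left (nhdsWithin_le_nhds (s := {q | s q.1 < q.2}))
  have e2 := (h.dk.reg (c := fun _ => 0) continuous_const (q := (t, s t)) hs.ne').c1.tendsto.mono_left
    (nhdsWithin_le_nhds (s := {q | s q.1 < q.2}))
  have e3 := S1_right h.dv h.sc h.sl ht hB
  have e4 := (h.dv.reg h.sc' (q := (t, s t)) (by simp; linarith)).c1.tendsto.mono_left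
    (nhdsWithin_le_nhds (s := {q | s q.1 < q.2}))
  have e5 := ((e1.add e2).sub e3).sub e4
  have f3 : U1 a ψ k s v t (s t) + v t / 2 = Pot k1 (fun _ => a) id ψ t (s t) + Pot k1 id (fun _ => 0) k t (s t)
    - (Pot k1 id s v t (s t) - v t / 2) - Pot k1 id (fun y => -s y) v t (s t) := by simp only [U1]; ring
  rw [f3]; exact e5

theorem liml {t : ℝ} (ht : a < t) (hB : t < B) (hs : 0 < s t) :
    Tendsto (fun q : ℝ × ℝ => U1 a ψ k s v q.1 q.2) (𝓝[{q | q.2 < s q.1}] (t, s t))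
      (𝓝 (U1 a ψ k s v t (s t) - v t / 2)) := by
  have e1 := (h.ini.reg (q := (t, s t)) ht).c1.tendsto.mono_left (nhdsWithin_le_nhds (s := {q | q.2 < s q.1}))
  have e2 := (h.dk.reg (c := fun _ => 0) continuous_const (q := (t, s t)) hs.ne').c1.tendsto.mono_left
    (nhdsWithin_le_nhds (s := {q | q.2 < s q.1}))
  have e3 := S1_left h.dv h.sc h.sl ht hB
  have e4 := (h.dv.reg h.sc' (q := (t, s t)) (by simp; linarith)).c1.tendsto.mono_left
    (nhdsWithin_le_nhds (s := {q | q.2 < s q.1}))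
  have e5 := ((e1.add e2).sub e3).sub e4
  have f3 : U1 a ψ k s v t (s t) - v t / 2 = Pot k1 (fun _ => a) id ψ t (s t) + Pot k1 id (fun _ => 0) k t (s t)
    - (Pot k1 id s v t (s t) + v t / 2) - Pot k1 id (fun y => -s y) v t (s t) := by simp only [U1]; ring
  rw [f3]; exact e5

theorem d0 {t : ℝ} (ht : a < t) (hB : t < B) (hs : 0 < s t) :
    HasDerivWithinAt (UU a ψ k s v t) (-(k t / 2)) (Ici 0) 0 := by
  refine side_right (h.cx t 0) (f' := U1 a ψ k s v t) ?_
    (slice (h.lim0 ht hB hs) (fun y hy => hy))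
  filter_upwards [Ioo_mem_nhdsGT hs] with y hy
  exact (h.reg (q := (t, y)) ht hy.1.ne' hy.2.ne (by simp; linarith [hy.1])).dx

theorem dr {t : ℝ} (ht : a < t) (hB : t < B) (hs : 0 < s t) :
    HasDerivWithinAt (UU a ψ k s v t) (U1 a ψ k s v t (s t) + v t / 2) (Ici (s t)) (s t) := by
  refine side_right (h.cx t _) (f' := U1 a ψ k s v t) ?_
    (slice (h.limr ht hB hs) (fun y hy => hy))
  filter_upwards [self_mem_nhdsWithin] with y (hy : s t < y)
  exact (h.reg (q := (t, y)) ht (by simp; linarith) hy.ne' (by simp; linarith)).dx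

theorem dl {t : ℝ} (ht : a < t) (hB : t < B) (hs : 0 < s t) :
    HasDerivWithinAt (UU a ψ k s v t) (U1 a ψ k s v t (s t) - v t / 2) (Iic (s t)) (s t) := by
  refine side_left (h.cx t _) (f' := U1 a ψ k s v t) ?_
    (slice (h.liml ht hB hs) (fun y hy => hy))
  filter_upwards [Ioo_mem_nhdsLT hs] with y hy
  exact (h.reg (q := (t, y)) ht hy.1.ne' hy.2.ne (by simp; linarith [hy.1])).dx

theorem init (x : ℝ) : UU a ψ k s v a x = ψ x := by
  have hz : ∀ (c ρ : ℝ → ℝ), Dens a B M ρ → Pot k0 id c ρ a x = 0 := by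
    intro c ρ hρ
    rw [Pot, ← integral_zero ℝ ℝ]
    congr 1; funext y
    rcases le_or_gt y a with hy | hy
    · rw [hρ.zero y (fun hh => by linarith [hh.1]), mul_zero]
    · rw [k0_of_nonpos (by simp; linarith), zero_mul]
  rw [UU, HH_init le_rfl, hz _ _ h.dk, hz _ _ h.dv, hz _ _ h.dv]; ring

theorem bd {t T : ℝ} (hT : t ≤ T) (haT : a ≤ T) (x : ℝ) : |UU a ψ k s v t x| ≤ N + 3 * (M * (2 * √(T - a))) := by
  have hz : ∀ (c ρ : ℝ → ℝ), Dens a B M ρ → |Pot k0 id c ρ t x| ≤ M * (2 * √(T - a)) := by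
    intro c ρ hρ
    rw [Pot_r]
    have := con_bd (A := 1) (R := T - a) (t := t) (κ := fun r => k0 r (x - c (t - r))) hρ
      (fun r hr => k0_of_nonpos hr _) (by linarith)
      (fun r hr _ => by rw [abs_of_nonneg (k0_nn _ _), one_mul]; exact k0_le hr _) (by linarith)
    simpa using this
  have h1 := h.ini.H_bd (a := a) t x
  have h2 := hz (fun _ => 0) _ h.dk
  have h3 := hz s _ h.dv
  have h4 := hz (fun y => -s y) _ h.dv
  rw [abs_le] at *
  rw [UU]
  constructor <;> linarith
end Sys

theorem k_mvt {k k' : ℝ → ℝ} {D z z' : ℝ} {S : Set ℝ} (hS : Convex ℝ S) (hd : ∀ z, HasDerivAt k (k' z) z)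
    (hb : ∀ z ∈ S, |k' z| ≤ D) (hz : z ∈ S) (hz' : z' ∈ S) : |k z - k z'| ≤ D * |z - z'| :=
  hS.norm_image_sub_le_of_norm_hasDerivWithin_le (fun x _ => (hd x).hasDerivWithinAt) hb hz' hz

theorem k_off {β r : ℝ} (hβ : 0 < β) (hr : 0 < r) (hr1 : r ≤ 1) {z z' : ℝ} (hz : β ≤ z) (hz' : β ≤ z') :
    |k1 r z| ≤ (192 / β ^ 5 + (96 / β ^ 4 + 192 / β ^ 6)) * r ^ (-(1 / 2) : ℝ) ∧
    |k0 r z - k0 r z'| ≤ (192 / β ^ 5 + (96 / β ^ 4 + 192 / β ^ 6)) * |z - z'| * r ^ (-(1 / 2) : ℝ) ∧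
    |k1 r z - k1 r z'| ≤ (192 / β ^ 5 + (96 / β ^ 4 + 192 / β ^ 6)) * |z - z'| * r ^ (-(1 / 2) : ℝ) := by
  have hs : √r * √r = r := Real.mul_self_sqrt hr.le
  have hs0 : 0 < √r := Real.sqrt_pos.2 hr
  have hs1 : √r ≤ r ^ (-(1 / 2) : ℝ) := by
    rw [rs_eq hr, le_div_iff₀ hs0, hs]; exact hr1
  have hs2 : r * √r ≤ r ^ (-(1 / 2) : ℝ) := (mul_le_of_le_one_left hs0.le hr1).trans hs1
  have hp : 0 < r ^ (-(1 / 2) : ℝ) := hs0.trans_le hs1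
  have b1 : ∀ y ∈ Ici β, |k1 r y| ≤ 192 / β ^ 5 * r ^ (-(1 / 2) : ℝ) := by
    intro y (hy : β ≤ y)
    have hy0 : 0 < y := hβ.trans_le hy
    refine (k1_small hr hy0.ne').trans ?_
    rw [abs_of_pos hy0, mul_assoc, mul_div_right_comm]
    gcongr
  have b2 : ∀ y ∈ Ici β, |k2 r y| ≤ (96 / β ^ 4 + 192 / β ^ 6) * r ^ (-(1 / 2) : ℝ) := by
    intro y (hy : β ≤ y)
    have hy0 : 0 < y := hβ.trans_le hy
    refine (k2_small hr hy0.ne').trans ?_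
    rw [mul_assoc 192, mul_div_right_comm, mul_div_right_comm, add_mul]
    gcongr
  have e1 : 0 ≤ 192 / β ^ 5 * r ^ (-(1 / 2) : ℝ) := by positivity
  have e2 : 0 ≤ (96 / β ^ 4 + 192 / β ^ 6) * r ^ (-(1 / 2) : ℝ) := by positivity
  have key : ∀ X, X ≤ (192 / β ^ 5 + (96 / β ^ 4 + 192 / β ^ 6)) * r ^ (-(1 / 2) : ℝ) →
      X * |z - z'| ≤ (192 / β ^ 5 + (96 / β ^ 4 + 192 / β ^ 6)) * |z - z'| * r ^ (-(1 / 2) : ℝ) := by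
    intro X hX; rw [mul_right_comm]; exact mul_le_mul_of_nonneg_right hX (abs_nonneg _)
  refine ⟨(b1 z hz).trans ?_, (k_mvt (convex_Ici β) (k0_dz r) b1 hz hz').trans ?_,
    (k_mvt (convex_Ici β) (k1_dz r) b2 hz hz').trans ?_⟩
  · rw [add_mul]; linarith
  all_goals
    refine key _ ?_
    rw [add_mul]
    linarith

theorem k_on {m r d z z' : ℝ} (hr : 0 < r) (hr1 : r ≤ 1) (hz : |z| ≤ m * r) (hz' : |z'| ≤ m * r)
    (hd : |z - z'| ≤ d * r) : |k1 r z - k1 r z'| ≤ (m ^ 2 / 4 + 1 / 2) * d * r ^ (-(1 / 2) : ℝ) := by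
  have hp : 0 < r ^ (-(1 / 2) : ℝ) := rpow_pos_of_pos hr _
  have b : ∀ y ∈ Icc (-(m * r)) (m * r), |k2 r y| ≤ (m ^ 2 / 4 + 1 / (2 * r)) * r ^ (-(1 / 2) : ℝ) := by
    intro y hy
    have hy := sq_le_sq' hy.1 hy.2
    rw [k2, abs_mul, abs_of_nonneg (k0_nn r y)]
    refine mul_le_mul ?_ (k0_le hr y) (k0_nn r y) (by positivity)
    have h1 : 0 ≤ y ^ 2 / (4 * r ^ 2) := by positivity
    have h2 : 0 ≤ 1 / (2 * r) := by positivity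
    have h3 : y ^ 2 / (4 * r ^ 2) ≤ m ^ 2 / 4 := by
      rw [div_le_div_iff₀ (by positivity) (by norm_num)]; nlinarith
    rw [abs_le]; constructor <;> linarith [sq_nonneg m]
  refine (k_mvt (convex_Icc _ _) (k1_dz r) b (abs_le.1 hz) (abs_le.1 hz')).trans ?_
  have hd0 : 0 ≤ d * r := (abs_nonneg _).trans hd
  have hd1 : 0 ≤ d := nonneg_of_mul_nonneg_left hd0 hr
  calc _ ≤ (m ^ 2 / 4 + 1 / (2 * r)) * r ^ (-(1 / 2) : ℝ) * (d * r) := by gcongr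
    _ = (m ^ 2 / 4 * r + 1 / 2) * d * r ^ (-(1 / 2) : ℝ) := by field_simp
    _ ≤ _ := by
      gcongr
      exact mul_le_of_le_one_right (by positivity) hr1

theorem Dens.sub {a B M d : ℝ} {ρ ρ' : ℝ → ℝ} (h : Dens a B M ρ) (h' : Dens a B M ρ')
    (hd : ∀ y, |ρ y - ρ' y| ≤ d) : Dens a B d (fun y => ρ y - ρ' y) :=
  ⟨h.meas.sub h'.meas, hd, fun y hy => by rw [h.zero y hy, h'.zero y hy, sub_zero],
    fun y h1 h2 => (h.cont y h1 h2).sub (h'.cont y h1 h2)⟩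

theorem IL {a B M A A' d t x x' : ℝ} {k : ℝ → ℝ → ℝ} {c c' ρ ρ' : ℝ → ℝ} (h : Dens a B M ρ) (h' : Dens a B M ρ')
    (hd : ∀ y, |ρ y - ρ' y| ≤ d) (hk : Measurable (fun q : ℝ × ℝ => k q.1 q.2)) (h0 : ∀ r ≤ 0, ∀ z, k r z = 0)
    (hc : Continuous c) (hc' : Continuous c') (ht : a < t)
    (hA : ∀ r, 0 < r → r ≤ t - a → |k r (x - c (t - r))| ≤ A * r ^ (-(1 / 2) : ℝ))
    (hA' : ∀ r, 0 < r → r ≤ t - a → |k r (x - c (t - r)) - k r (x' - c' (t - r))| ≤ A' * r ^ (-(1 / 2) : ℝ)) :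
    |Pot k id c ρ t x - Pot k id c' ρ' t x'| ≤ (A * d + A' * M) * (2 * √(t - a)) := by
  have m1 : Measurable (fun r => k r (x - c (t - r))) := meas_r hk (f := fun r => x - c (t - r)) (continuous_const.sub (hc.comp (continuous_const.sub continuous_id))).measurable
  have m2 : Measurable (fun r => k r (x' - c' (t - r))) := meas_r hk (f := fun r => x' - c' (t - r)) (continuous_const.sub (hc'.comp (continuous_const.sub continuous_id))).measurable
  have hs := h.sub h' hd
  have i1 := con_int hs m1 (fun r hr => h0 r hr _) hA le_rfl
  have i2 := con_int h' (κ := fun r => k r (x - c (t - r)) - k r (x' - c' (t - r))) (m1.sub m2) (fun r hr => by simp [h0 r hr]) hA' le_rfl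
  have b1 := con_bd hs (fun r hr => h0 r hr _) (by linarith) hA le_rfl
  have b2 := con_bd h' (κ := fun r => k r (x - c (t - r)) - k r (x' - c' (t - r)))
    (fun r hr => by simp [h0 r hr]) (by linarith) hA' le_rfl
  have e : Pot k id c ρ t x - Pot k id c' ρ' t x' =
      (∫ r, k r (x - c (t - r)) * (ρ (t - r) - ρ' (t - r))) +
      ∫ r, (k r (x - c (t - r)) - k r (x' - c' (t - r))) * ρ' (t - r) := by
    have j1 := con_int h m1 (fun r hr => h0 r hr _) hA le_rfl
    have j2 := con_int h' m2 (A := A + A') (fun r hr => h0 r hr _) (fun r hr hr' => by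
      have e1 := hA r hr hr'
      have e2 := hA' r hr hr'
      rw [abs_le] at *
      rw [add_mul]
      constructor <;> linarith) le_rfl
    rw [Pot_r, Pot_r, ← integral_sub j1 j2, ← integral_add i1 i2]
    congr 1; funext r; ring
  rw [e]
  refine (abs_add_le _ _).trans ?_
  linarith

/-- Lipschitz dependence of the two boundary maps on the densities. -/
theorem Phi_lip {m β Q Γ Λ : ℝ} (hβ : 0 < β) (hm : 0 ≤ m) (hQ : 0 ≤ Q) (hΓ : 0 ≤ Γ) (hΛ : 0 ≤ Λ) :
    ∃ C, 0 ≤ C ∧ ∀ {a B b N d t : ℝ} {ψ k s v k' s' v' : ℝ → ℝ},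
    Sys a B Q m b N Γ ψ k s v → Sys a B Q m b N Γ ψ k' s' v' → a < t → t - a ≤ 1 →
    (∀ y, |k y - k' y| ≤ Λ * d) → (∀ y, |v y - v' y| ≤ d) → s a = s' a →
    (∀ t r, |(s t - s' t) - (s r - s' r)| ≤ d * |t - r|) →
    (∀ y ∈ Icc a t, β ≤ s y) → (∀ y ∈ Icc a t, β ≤ s' y) →
    |UU a ψ k s v t 0 - UU a ψ k' s' v' t 0| ≤ C * d * √(t - a) ∧
    |U1 a ψ k s v t (s t) - U1 a ψ k' s' v' t (s' t)| ≤ C * d * √(t - a) := by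
  obtain ⟨E, hE⟩ : ∃ E, E = 192 / β ^ 5 + (96 / β ^ 4 + 192 / β ^ 6) := ⟨_, rfl⟩
  obtain ⟨J, hJ⟩ : ∃ J, J = ∫ w, ‖k1 1 w‖ := ⟨_, rfl⟩
  have hE0 : 0 ≤ E := by rw [hE]; positivity
  have hJ0 : 0 ≤ J := by rw [hJ]; positivity
  refine ⟨(Λ + 2 * (1 + E * Q)) * 2 + (J * Γ + ((E * Λ + E * Q) + (m / 2 + (m ^ 2 / 4 + 1 / 2) * Q) + (E + E * 2 * Q)) * 2),
    by positivity, ?_⟩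
  intro a B b N d t ψ k s v k' s' v' h h' ht ht1 hk hv hsa hs hβs hβs'
  have hq : 0 < √(t - a) := Real.sqrt_pos.2 (by linarith)
  have hd : 0 ≤ d := (abs_nonneg _).trans (hv 0)
  have hrr : ∀ r, 0 < r → r ≤ t - a → t - r ∈ Icc a t := fun r h1 h2 => ⟨by linarith, by linarith⟩
  have hsd : ∀ y ∈ Icc a t, |s y - s' y| ≤ d * (t - a) := by
    intro y hy
    have := hs y a
    rw [hsa, sub_self, sub_zero, abs_of_nonneg (show 0 ≤ y - a by linarith [hy.1])] at this
    exact this.trans (mul_le_mul_of_nonneg_left (by linarith [hy.2]) hd)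
  have hsd1 : ∀ y ∈ Icc a t, |s y - s' y| ≤ d := fun y hy =>
    (hsd y hy).trans (mul_le_of_le_one_right hd ht1)
  have tt : t ∈ Icc a t := ⟨ht.le, le_rfl⟩
  have hEd : ∀ r z : ℝ, 0 < r → z ≤ d → E * z * r ^ (-(1 / 2) : ℝ) ≤ E * d * r ^ (-(1 / 2) : ℝ) := fun r z hr hz => by gcongr
  have A0 : ∀ r, 0 < r → ∀ z, |k0 r z| ≤ 1 * r ^ (-(1 / 2) : ℝ) := fun r hr z => by
    rw [abs_of_nonneg (k0_nn _ _), one_mul]; exact k0_le hr _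
  have a1 := IL (k := k0) (c := fun _ => 0) (c' := fun _ => 0) (x := 0) (x' := 0) (A := 1) (A' := 0) h.dk h'.dk hk k0_meas
    (fun r hr z => k0_of_nonpos hr z) continuous_const continuous_const ht (fun r hr _ => A0 r hr _) (fun r hr _ => by simp)
  have a2 := IL (k := k0) (c := s) (c' := s') (x := 0) (x' := 0) (A := 1) (A' := E * d) h.dv h'.dv hv k0_meas
    (fun r hr z => k0_of_nonpos hr z) h.sc h'.sc ht (fun r hr _ => A0 r hr _) (fun r hr hr' => by
      rw [zero_sub, zero_sub, k0_neg, k0_neg]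
      have := (k_off hβ hr (hr'.trans ht1) (hβs _ (hrr r hr hr')) (hβs' _ (hrr r hr hr'))).2.1
      rw [← hE] at this
      exact this.trans (hEd _ _ hr (hsd1 _ (hrr r hr hr'))))
  have a3 := IL (k := k0) (c := fun y => -s y) (c' := fun y => -s' y) (x := 0) (x' := 0) (A := 1) (A' := E * d) h.dv h'.dv hv k0_meas
    (fun r hr z => k0_of_nonpos hr z) h.sc' h'.sc' ht (fun r hr _ => A0 r hr _) (fun r hr hr' => by
      rw [zero_sub, zero_sub, neg_neg, neg_neg]
      have := (k_off hβ hr (hr'.trans ht1) (hβs _ (hrr r hr hr')) (hβs' _ (hrr r hr hr'))).2.1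
      rw [← hE] at this
      exact this.trans (hEd _ _ hr (hsd1 _ (hrr r hr hr'))))
  have c0 := h.ini.H1_lip ht (s t) (s' t)
  rw [← hJ] at c0
  have c0' : J * Γ * |s t - s' t| / √(t - a) ≤ J * Γ * d * √(t - a) := by
    rw [div_le_iff₀ hq, mul_assoc _ (√(t - a)), Real.mul_self_sqrt (by linarith), mul_assoc (J * Γ) d]
    exact mul_le_mul_of_nonneg_left (hsd t tt) (by positivity)
  have c1 := IL (k := k1) (c := fun _ => 0) (c' := fun _ => 0) (x := s t) (x' := s' t) (A := E) (A' := E * d) h.dk h'.dk hk k1_meas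
    (fun r hr z => k1_of_nonpos hr z) continuous_const continuous_const ht (fun r hr hr' => by
      rw [sub_zero]
      have := (k_off hβ hr (hr'.trans ht1) (hβs _ tt) (hβs' _ tt)).1
      rwa [← hE] at this) (fun r hr hr' => by
      rw [sub_zero, sub_zero]
      have := (k_off hβ hr (hr'.trans ht1) (hβs _ tt) (hβs' _ tt)).2.2
      rw [← hE] at this
      exact this.trans (hEd _ _ hr (hsd1 _ tt)))
  have nr : ∀ {f : ℝ → ℝ}, (∀ t r, |f t - f r| ≤ m * |t - r|) → ∀ r, 0 < r → |f t - f (t - r)| ≤ m * r := by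
    intro f hf r hr
    have := hf t (t - r)
    rwa [sub_sub_cancel, abs_of_pos hr] at this
  have c2 := IL (k := k1) (c := s) (c' := s') (x := s t) (x' := s' t) (A := m / 2) (A' := (m ^ 2 / 4 + 1 / 2) * d) h.dv h'.dv hv k1_meas
    (fun r hr z => k1_of_nonpos hr z) h.sc h'.sc ht (fun r hr hr' => k1_near hr (nr h.sl r hr)) (fun r hr hr' => by
      refine k_on hr (hr'.trans ht1) (nr h.sl r hr) (nr h'.sl r hr) ?_
      have := hs t (t - r)
      rw [sub_sub_cancel, abs_of_pos hr] at this
      rwa [show s t - s (t - r) - (s' t - s' (t - r)) = s t - s' t - (s (t - r) - s' (t - r)) by ring])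
  have c3 := IL (k := k1) (c := fun y => -s y) (c' := fun y => -s' y) (x := s t) (x' := s' t) (A := E) (A' := E * (2 * d)) h.dv h'.dv hv k1_meas
    (fun r hr z => k1_of_nonpos hr z) h.sc' h'.sc' ht (fun r hr hr' => by
      rw [sub_neg_eq_add]
      have e1 : β ≤ s t + s (t - r) := by linarith [hβs _ tt, hβs _ (hrr r hr hr')]
      have := (k_off hβ hr (hr'.trans ht1) e1 e1).1
      rwa [← hE] at this) (fun r hr hr' => by
      rw [sub_neg_eq_add, sub_neg_eq_add]
      have e1 : β ≤ s t + s (t - r) := by linarith [hβs _ tt, hβs _ (hrr r hr hr')]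
      have e2 : β ≤ s' t + s' (t - r) := by linarith [hβs' _ tt, hβs' _ (hrr r hr hr')]
      have := (k_off hβ hr (hr'.trans ht1) e1 e2).2.2
      rw [← hE] at this
      refine this.trans ?_
      have e3 : |s t + s (t - r) - (s' t + s' (t - r))| ≤ 2 * d := by
        have f1 := hsd1 _ tt
        have f2 := hsd1 _ (hrr r hr hr')
        rw [abs_le] at *
        constructor <;> linarith
      gcongr)
  have hdq : 0 ≤ d * √(t - a) := by positivity
  have P1 : 0 ≤ (J * Γ + ((E * Λ + E * Q) + (m / 2 + (m ^ 2 / 4 + 1 / 2) * Q) + (E + E * 2 * Q)) * 2) * (d * √(t - a)) := by positivity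
  have P2 : 0 ≤ ((Λ + 2 * (1 + E * Q)) * 2) * (d * √(t - a)) := by positivity
  rw [UU, UU, U1, U1]
  clear hsd hsd1 hEd A0 nr hrr hs hβs hβs' hk hv
  rw [abs_le] at a1 a2 a3 c0 c1 c2 c3
  constructor <;> rw [abs_le] <;> constructor <;> linarith

def cl (lo hi x : ℝ) : ℝ := max lo (min x hi)
theorem cl_mem {lo hi : ℝ} (h : lo ≤ hi) (x : ℝ) : lo ≤ cl lo hi x ∧ cl lo hi x ≤ hi :=
  ⟨le_max_left _ _, max_le h (min_le_right _ _)⟩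
theorem cl_eq {lo hi x : ℝ} (h1 : lo ≤ x) (h2 : x ≤ hi) : cl lo hi x = x := by
  rw [cl, min_eq_left h2, max_eq_right h1]
theorem cl_lip (lo hi x y : ℝ) : |cl lo hi x - cl lo hi y| ≤ |x - y| := by
  rw [cl, cl, max_comm lo, max_comm lo]
  exact (abs_max_sub_max_le_abs _ _ _).trans (abs_inf_sub_inf_le_abs _ _ _)
theorem cl_cont (lo hi : ℝ) : Continuous (cl lo hi) := by unfold cl; fun_prop

def kW (p a B M : ℝ) (W : ℝ → ℝ × ℝ) : ℝ → ℝ := (Ioo a B).indicator fun y => 2 * cl 0 M (W y).1 ^ p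
def vW (a B M : ℝ) (W : ℝ → ℝ × ℝ) : ℝ → ℝ := (Ioo a B).indicator fun y => cl (-M) M (W y).2
def sW (a b M : ℝ) (W : ℝ → ℝ × ℝ) (t : ℝ) : ℝ := b + ∫ y in a..t, cl (-M) M (W y).2

theorem Dens.ind {a B M : ℝ} {f : ℝ → ℝ} (hf : Continuous f) (hb : ∀ y, |f y| ≤ M) :
    Dens a B M ((Ioo a B).indicator f) := by
  refine ⟨hf.measurable.indicator measurableSet_Ioo, fun y => ?_, fun y hy => indicator_of_notMem hy _, fun y h1 h2 => ?_⟩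
  · rw [indicator]; split_ifs
    · exact hb y
    · rw [abs_zero]; exact (abs_nonneg _).trans (hb 0)
  · by_cases hy : y ∈ Ioo a B
    · refine hf.continuousAt.congr ?_
      filter_upwards [isOpen_Ioo.mem_nhds hy] with z hz using (indicator_of_mem hz f).symm
    · refine (continuousAt_const (y := (0:ℝ))).congr ?_
      have : y ∈ (Icc a B)ᶜ := fun h => hy ⟨lt_of_le_of_ne h.1 h1.symm, lt_of_le_of_ne h.2 h2⟩
      filter_upwards [isClosed_Icc.isOpen_compl.mem_nhds this] with z hz
      exact (indicator_of_notMem (fun h => hz (Ioo_subset_Icc_self h)) f).symm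

section W
variable {p a B M b N Γ : ℝ} {ψ : ℝ → ℝ} {W W' : ℝ → ℝ × ℝ}

theorem c2_cont (hW : Continuous W) : Continuous (fun y => cl (-M) M (W y).2) :=
  (cl_cont _ _).comp (continuous_snd.comp hW)

theorem c2_bd (hM : 0 ≤ M) (y : ℝ) : |cl (-M) M (W y).2| ≤ M := abs_le.2 (cl_mem (by linarith) _)

theorem sW_sub (hW : Continuous W) (t r : ℝ) :
    sW a b M W t - sW a b M W r = ∫ y in r..t, cl (-M) M (W y).2 := by
  have i := fun x y => (c2_cont (M := M) hW).intervalIntegrable (μ := volume) x y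
  rw [sW, sW, add_sub_add_left_eq_sub, intervalIntegral.integral_interval_sub_left (i _ _) (i _ _)]

theorem sW_deriv (hW : Continuous W) (t : ℝ) : HasDerivAt (sW a b M W) (cl (-M) M (W t).2) t :=
  ((c2_cont hW).integral_hasStrictDerivAt a t).hasDerivAt.const_add b

theorem Sys_W (hp : 1 < p) (hM : 0 ≤ M) (hi : Ini b N Γ ψ) (hW : Continuous W) :
    Sys a B (2 * M ^ p + M) M b N Γ ψ (kW p a B M W) (sW a b M W) (vW a B M W) := by
  have hMp : 0 ≤ M ^ p := rpow_nonneg hM p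
  refine ⟨hi, .ind ?_ fun y => ?_, .ind (c2_cont hW) fun y => (c2_bd hM y).trans (by linarith),
    continuous_iff_continuousAt.2 fun t => (sW_deriv hW t).continuousAt, fun t r => ?_⟩
  · exact continuous_const.mul (((cl_cont _ _).comp (continuous_fst.comp hW)).rpow_const fun y => Or.inr (by linarith))
  · have h1 := cl_mem hM (W y).1
    have h2 := rpow_le_rpow h1.1 h1.2 (by linarith : 0 ≤ p)
    have h3 := rpow_nonneg h1.1 p
    rw [abs_of_nonneg (by linarith)]; linarith
  · rw [sW_sub hW]
    exact intervalIntegral.norm_integral_le_of_norm_le_const (C := M) (f := fun y => cl (-M) M (W y).2) fun y _ => c2_bd hM y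

theorem W_diff (hp : 1 < p) (hM : 0 ≤ M) (hW : Continuous W) (hW' : Continuous W') {d : ℝ}
    (h1 : ∀ y, |(W y).1 - (W' y).1| ≤ d) (h2 : ∀ y, |(W y).2 - (W' y).2| ≤ d) :
    (∀ y, |kW p a B M W y - kW p a B M W' y| ≤ (2 * (p * M ^ (p - 1)) + 1) * d) ∧
    (∀ y, |vW a B M W y - vW a B M W' y| ≤ d) ∧
    ∀ t r, |(sW a b M W t - sW a b M W' t) - (sW a b M W r - sW a b M W' r)| ≤ d * |t - r| := by
  have hd : 0 ≤ d := (abs_nonneg _).trans (h1 0)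
  have hc := c2_cont (M := M) hW
  have hc' := c2_cont (M := M) hW'
  have e2 : ∀ y, |cl (-M) M (W y).2 - cl (-M) M (W' y).2| ≤ d := fun y => (cl_lip _ _ _ _).trans (h2 y)
  have hPM : 0 ≤ p * M ^ (p - 1) := mul_nonneg (by linarith) (rpow_nonneg hM _)
  refine ⟨fun y => ?_, fun y => ?_, fun t r => ?_⟩
  · rw [kW, kW, indicator, indicator]; split_ifs
    · have key := (convex_Icc 0 M).norm_image_sub_le_of_norm_hasDerivWithin_le (C := p * M ^ (p - 1))
        (f := fun x : ℝ => x ^ p) (f' := fun x => p * x ^ (p - 1))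
        (fun x _ => (Real.hasDerivAt_rpow_const (Or.inr hp.le)).hasDerivWithinAt)
        (fun x hx => by
          have := rpow_nonneg hx.1 (p - 1)
          rw [Real.norm_of_nonneg (by nlinarith)]
          exact mul_le_mul_of_nonneg_left (rpow_le_rpow hx.1 hx.2 (by linarith)) (by linarith))
        (cl_mem hM (W' y).1) (cl_mem hM (W y).1)
      rw [Real.norm_eq_abs, Real.norm_eq_abs] at key
      have k2 := mul_le_mul_of_nonneg_left ((cl_lip 0 M (W y).1 (W' y).1).trans (h1 y)) hPM
      rw [← mul_sub, abs_mul, abs_two]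
      linarith
    · rw [sub_self, abs_zero]; positivity
  · rw [vW, vW, indicator, indicator]; split_ifs
    · exact e2 y
    · simpa using hd
  · rw [show sW a b M W t - sW a b M W' t - (sW a b M W r - sW a b M W' r) =
      (sW a b M W t - sW a b M W r) - (sW a b M W' t - sW a b M W' r) by ring, sW_sub hW, sW_sub hW',
      ← intervalIntegral.integral_sub (hc.intervalIntegrable _ _) (hc'.intervalIntegrable _ _)]
    exact intervalIntegral.norm_integral_le_of_norm_le_const (C := d)
      (f := fun y => cl (-M) M (W y).2 - cl (-M) M (W' y).2) fun y _ => e2 y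

theorem sW_low (hM : 0 ≤ M) {L y : ℝ} (hy : y ∈ Icc a (a + L)) : b - M * L ≤ sW a b M W y := by
  have h1 := intervalIntegral.norm_integral_le_of_norm_le_const (a := a) (b := y)
    (f := fun y => cl (-M) M (W y).2) (C := M) fun y _ => c2_bd hM y
  rw [Real.norm_eq_abs, abs_of_nonneg (sub_nonneg.2 hy.1)] at h1
  have h2 : M * (y - a) ≤ M * L := mul_le_mul_of_nonneg_left (by linarith [hy.2]) hM
  have h3 := abs_le.1 h1
  rw [sW]; linarith [h3.1]
end W

theorem Sys.U1s_cont {a B M m b N Γ : ℝ} {ψ k s v : ℝ → ℝ} (h : Sys a B M m b N Γ ψ k s v) {t : ℝ} (ht : a < t)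
    (hs : 0 < s t) : ContinuousAt (fun t => U1 a ψ k s v t (s t)) t := by
  have hc : ContinuousAt (fun t => ((t, s t) : ℝ × ℝ)) t := (continuous_id.prodMk h.sc).continuousAt
  have e1 := ContinuousAt.comp (f := fun t => ((t, s t) : ℝ × ℝ)) (h.ini.reg (q := (t, s t)) ht).c1 hc
  have e2 := ContinuousAt.comp (f := fun t => ((t, s t) : ℝ × ℝ))
    (h.dk.reg (c := fun _ => 0) continuous_const (q := (t, s t)) hs.ne').c1 hc
  have e3 := (S1_cont h.dv h.sc h.sl).continuousAt (x := t)
  have e4 := ContinuousAt.comp (f := fun t => ((t, s t) : ℝ × ℝ))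
    (h.dv.reg h.sc' (q := (t, s t)) (by simp; linarith)).c1 hc
  exact ((e1.add e2).sub e3).sub e4

theorem U1_zero (a : ℝ) (ψ s : ℝ → ℝ) (t x : ℝ) :
    U1 a ψ (fun _ => 0) s (fun _ => 0) t x = Pot k1 (fun _ => a) id ψ t x ∧
    UU a ψ (fun _ => 0) s (fun _ => 0) t x = HH a ψ t x := by
  have : ∀ (k : ℝ → ℝ → ℝ) (c : ℝ → ℝ), Pot k id c (fun _ => 0) t x = 0 := fun k c => by simp [Pot]
  rw [U1, UU]; simp only [this]; constructor <;> ring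

def WW (m : ℝ) (g f : ℝ → ℝ) (V : BoundedContinuousFunction ℝ (ℝ × ℝ)) (t : ℝ) : ℝ × ℝ :=
  (g (min t m), f (min t m)) + V (max t m) - V m

theorem WW_cont {m : ℝ} {g f : ℝ → ℝ} (hg : Continuous g) (hf : Continuous f) (V) : Continuous (WW m g f V) := by
  have := V.continuous
  unfold WW
  fun_prop

theorem WW_lip (m : ℝ) (g f : ℝ → ℝ) (V V' : BoundedContinuousFunction ℝ (ℝ × ℝ)) (y : ℝ) :
    |(WW m g f V y).1 - (WW m g f V' y).1| ≤ 2 * dist V V' ∧ |(WW m g f V y).2 - (WW m g f V' y).2| ≤ 2 * dist V V' := by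
  have h1 := V.dist_coe_le_dist (g := V') (max y m)
  have h2 := V.dist_coe_le_dist (g := V') m
  rw [Prod.dist_eq, max_le_iff, Real.dist_eq, Real.dist_eq] at h1 h2
  simp only [WW, Prod.fst_add, Prod.snd_add, Prod.fst_sub, Prod.snd_sub]
  rw [abs_le] at *
  simp only [abs_le] at *
  refine ⟨⟨?_, ?_⟩, ⟨?_, ?_⟩⟩ <;> linarith [h1.1.1, h1.1.2, h1.2.1, h1.2.2, h2.1.1, h2.1.2, h2.2.1, h2.2.2]

theorem FP {p M1 s0 : ℝ} (hp : 1 < p) (hM1 : 0 ≤ M1) (hs0 : 0 < s0) : ∃ L Q M : ℝ, 0 < L ∧ L ≤ 1 ∧ 0 ≤ M ∧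
    ∀ {a b m : ℝ} {ψ g f : ℝ → ℝ}, s0 ≤ b → Ini b M1 M1 ψ → Continuous g → Continuous f →
    (∀ t, 0 ≤ g t ∧ g t ≤ M1) → (∀ t, |f t| ≤ M1) → a < m → m ≤ a + L →
    (∀ k s v, Sys a (a + L + 1) Q M b M1 M1 ψ k s v → (∀ t ∈ Ioc a m, k t = 2 * g t ^ p ∧ v t = f t) →
      (∀ t ∈ Icc a m, s t = b + ∫ y in a..t, f y) → ∀ t ∈ Ioc a m,
      UU a ψ k s v t 0 = g t ∧ -2 * U1 a ψ k s v t (s t) = f t) →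
    ∃ k s v, Sys a (a + L + 1) Q M b M1 M1 ψ k s v ∧ (∀ t ∈ Ioc a m, k t = 2 * g t ^ p ∧ v t = f t) ∧
      (∀ t ∈ Icc a m, s t = b + ∫ y in a..t, f y) ∧ ∀ t ∈ Icc a (a + L), s0 / 2 ≤ s t ∧ (a < t →
      HasDerivAt s (v t) t ∧ k t = 2 * (max 0 (UU a ψ k s v t 0)) ^ p ∧ v t = -2 * U1 a ψ k s v t (s t)) := by
  obtain ⟨M, hMe⟩ : ∃ M, M = 2 * M1 + 1 := ⟨_, rfl⟩
  have hM : 0 ≤ M := by linarith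
  obtain ⟨Q, hQe⟩ : ∃ Q, Q = 2 * M ^ p + M := ⟨_, rfl⟩
  have hQ : 0 ≤ Q := by have := rpow_nonneg hM p; linarith
  obtain ⟨Λ, hΛe⟩ : ∃ Λ, Λ = 2 * (p * M ^ (p - 1)) + 1 := ⟨_, rfl⟩
  have hΛ : 1 ≤ Λ := by
    have := mul_nonneg (by linarith : 0 ≤ p) (rpow_nonneg hM (p - 1)); linarith
  obtain ⟨C, hC, H⟩ := Phi_lip (m := M) (β := s0 / 2) (Q := Q) (Γ := M1) (Λ := Λ) (by linarith) hM hQ hM1 (by linarith)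
  obtain ⟨L, hL0, hL1, hL2, hL3⟩ : ∃ L : ℝ, 0 < L ∧ L ≤ 1 ∧ M * L ≤ s0 / 2 ∧ √L ≤ 1 / (8 * (C + 1) * (Q + 1)) := by
    have q1 : 0 < 1 / (8 * (C + 1) * (Q + 1)) := by positivity
    refine ⟨min 1 (min (s0 / 2 / (M + 1)) ((1 / (8 * (C + 1) * (Q + 1))) ^ 2)), by positivity, min_le_left _ _, ?_, ?_⟩
    · have : min 1 (min (s0 / 2 / (M + 1)) ((1 / (8 * (C + 1) * (Q + 1))) ^ 2)) ≤ s0 / 2 / (M + 1) :=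
        (min_le_right _ _).trans (min_le_left _ _)
      rw [le_div_iff₀ (by linarith)] at this
      have q3 : 0 < min 1 (min (s0 / 2 / (M + 1)) ((1 / (8 * (C + 1) * (Q + 1))) ^ 2)) := by positivity
      linarith
    · rw [Real.sqrt_le_left q1.le]
      exact (min_le_right _ _).trans (min_le_right _ _)
  have hq0 := Real.sqrt_nonneg L
  have hL4 : C * √L ≤ 1 / 8 ∧ C * Q * √L ≤ 1 / 8 := by
    rw [le_div_iff₀ (by positivity)] at hL3
    have z1 : 0 ≤ C * √L := by positivity
    have z2 : 0 ≤ Q * √L := by positivity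
    have z3 : 0 ≤ C * Q * √L := by positivity
    constructor <;> linarith
  refine ⟨L, Q, M, hL0, hL1, hM, ?_⟩
  intro a b m ψ g f hb hi hg hf hgb hfb ham hmL hrep
  set B := a + L + 1 with hB
  have sys : ∀ W, Continuous W → Sys a B Q M b M1 M1 ψ (kW p a B M W) (sW a b M W) (vW a B M W) := fun W hW => by
    rw [hQe]; exact Sys_W hp hM hi hW
  have low : ∀ W : ℝ → ℝ × ℝ, ∀ y ∈ Icc a (a + L), s0 / 2 ≤ sW a b M W y := fun W y hy => by
    have := sW_low (W := W) (b := b) hM hy; linarith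
  have hWc := fun V => WW_cont (m := m) hg hf V
  obtain ⟨τ, hτ⟩ : ∃ τ : ℝ → ℝ, τ = cl m (a + L) := ⟨_, rfl⟩
  have τm : ∀ t, m ≤ τ t ∧ τ t ≤ a + L := fun t => by rw [hτ]; exact cl_mem hmL t
  have sqt : ∀ t, t ≤ a + L → √(t - a) ≤ √L := fun t ht => Real.sqrt_le_sqrt (by linarith)
  let F : BoundedContinuousFunction ℝ (ℝ × ℝ) → ℝ → ℝ × ℝ := fun V t =>
    (UU a ψ (kW p a B M (WW m g f V)) (sW a b M (WW m g f V)) (vW a B M (WW m g f V)) t 0,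
      -2 * U1 a ψ (kW p a B M (WW m g f V)) (sW a b M (WW m g f V)) (vW a B M (WW m g f V)) t (sW a b M (WW m g f V) t))
  have Fb : ∀ V t, a < t → t ≤ a + L → |(F V t).1| ≤ M ∧ |(F V t).2| ≤ M := by
    intro V t h1 h2
    have S := sys _ (hWc V)
    have z : Dens a B Q (fun _ => 0) := ⟨measurable_const, fun y => by simpa using hQ, fun _ _ => rfl, fun _ _ _ => continuousAt_const⟩
    have lw := fun y (hy : y ∈ Icc a t) => low (WW m g f V) y ⟨hy.1, hy.2.trans h2⟩
    have := H S ⟨S.ini, z, z, S.sc, S.sl⟩ h1 (by linarith) (d := Q)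
      (fun y => by rw [sub_zero]; exact (S.dk.bd y).trans (le_mul_of_one_le_left hQ hΛ))
      (fun y => by rw [sub_zero]; exact S.dv.bd y) rfl (fun t r => by simp; positivity) lw lw
    rw [(U1_zero _ _ _ _ _).1, (U1_zero _ _ _ _ _).2] at this
    have e1 := hi.H_bd (a := a) t 0
    have e2 := hi.H1_bd h1 (sW a b M (WW m g f V) t)
    have e3 : C * Q * √(t - a) ≤ 1 / 8 := (mul_le_mul_of_nonneg_left (sqt t h2) (by positivity)).trans hL4.2
    obtain ⟨t1, t2⟩ := this
    simp only [F]
    rw [abs_le] at t1 t2 e1 e2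
    constructor <;> rw [abs_le] <;> constructor <;> linarith
  have Fc : ∀ V, Continuous fun t => F V (τ t) := by
    intro V
    have S := sys _ (hWc V)
    have tc : Continuous τ := by rw [hτ]; exact cl_cont _ _
    refine Continuous.prodMk (S.cont.comp (tc.prodMk continuous_const)) (continuous_const.mul ?_)
    refine continuous_iff_continuousAt.2 fun t => ?_
    have h1 := τm t
    exact ContinuousAt.comp (f := τ) (S.U1s_cont (by linarith) (lt_of_lt_of_le (by linarith) (low _ (τ t) ⟨by linarith, h1.2⟩))) tc.continuousAt
  let Φ : BoundedContinuousFunction ℝ (ℝ × ℝ) → BoundedContinuousFunction ℝ (ℝ × ℝ) := fun V =>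
    BoundedContinuousFunction.ofNormedAddCommGroup (fun t => F V (τ t)) (Fc V) M fun t => by
      have h1 := τm t
      have := Fb V (τ t) (by linarith) h1.2
      rw [Prod.norm_def]; exact max_le this.1 this.2
  have hΦ : ContractingWith (1 / 2 : NNReal) Φ := by
    refine ⟨by norm_num, LipschitzWith.of_dist_le_mul fun V V' => ?_⟩
    refine (BoundedContinuousFunction.dist_le (by positivity)).2 fun t => ?_
    have h1 := τm t
    obtain ⟨d1, d2, d3⟩ := W_diff (a := a) (B := B) (b := b) hp hM (hWc V) (hWc V') (fun y => (WW_lip m g f V V' y).1) (fun y => (WW_lip m g f V V' y).2)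
    rw [← hΛe] at d1
    obtain ⟨t1, t2⟩ := H (sys _ (hWc V)) (sys _ (hWc V')) (t := τ t) (by linarith) (by linarith) d1 d2 (by simp [sW]) d3
      (fun y hy => low _ y ⟨hy.1, hy.2.trans h1.2⟩) (fun y hy => low _ y ⟨hy.1, hy.2.trans h1.2⟩)
    have e3 : C * √(τ t - a) ≤ 1 / 8 := (mul_le_mul_of_nonneg_left (sqt _ h1.2) hC).trans hL4.1
    have e4 := mul_le_mul_of_nonneg_right e3 (dist_nonneg (x := V) (y := V'))
    show dist (F V (τ t)) (F V' (τ t)) ≤ _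
    rw [Prod.dist_eq, Real.dist_eq, Real.dist_eq]
    refine max_le ?_ ?_
    · refine t1.trans ?_
      push_cast
      linarith [dist_nonneg (x := V) (y := V')]
    · simp only [F]
      rw [← mul_sub, abs_mul, abs_neg, abs_two]
      push_cast
      linarith
  obtain ⟨V, hV⟩ : ∃ V, Φ V = V := ⟨_, hΦ.fixedPoint_isFixedPt⟩
  have hV' : ∀ t ∈ Icc m (a + L), V t = F V t := by
    intro t ht
    have e : Φ V t = F V (τ t) := rfl
    rw [hV, hτ, cl_eq ht.1 ht.2] at e
    exact e
  have W1 : ∀ t ≤ m, WW m g f V t = (g t, f t) := fun t ht => by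
    rw [WW, min_eq_left ht, max_eq_right ht]; simp
  have ck : ∀ t ∈ Ioo a B, kW p a B M (WW m g f V) t = 2 * cl 0 M (WW m g f V t).1 ^ p := fun t ht => indicator_of_mem ht _
  have cv : ∀ t ∈ Ioo a B, vW a B M (WW m g f V) t = cl (-M) M (WW m g f V t).2 := fun t ht => indicator_of_mem ht _
  have fcl : ∀ t ≤ m, cl (-M) M (WW m g f V t).2 = f t := fun t ht => by
    have := abs_le.1 (hfb t)
    rw [W1 t ht]; exact cl_eq (by linarith) (by linarith)
  have r1 : ∀ t ∈ Ioc a m, kW p a B M (WW m g f V) t = 2 * g t ^ p ∧ vW a B M (WW m g f V) t = f t := by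
    intro t ht
    have tB : t ∈ Ioo a B := ⟨ht.1, by linarith [ht.2]⟩
    rw [ck t tB, cv t tB, fcl t ht.2, W1 t ht.2, cl_eq (hgb t).1 (by linarith [(hgb t).2])]
    exact ⟨rfl, rfl⟩
  have r2 : ∀ t ∈ Icc a m, sW a b M (WW m g f V) t = b + ∫ y in a..t, f y := by
    intro t ht
    rw [sW]; congr 1
    refine intervalIntegral.integral_congr fun y hy => ?_
    rw [uIcc_of_le ht.1] at hy
    exact fcl y (hy.2.trans ht.2)
  have S := sys _ (hWc V)
  have r3 := hrep _ _ _ S r1 r2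
  have key : ∀ t, a < t → t ≤ a + L → WW m g f V t = F V t := by
    intro t h1 h2
    rcases le_or_gt t m with h | h
    · rw [W1 t h]
      have := r3 t ⟨h1, h⟩
      exact (Prod.ext this.1 this.2).symm
    · have e1 := r3 m ⟨ham, le_rfl⟩
      have e2 : V m = (g m, f m) := by rw [hV' m ⟨le_rfl, hmL⟩]; exact Prod.ext e1.1 e1.2
      rw [WW, min_eq_right h.le, max_eq_left h.le, e2, add_sub_cancel_left, hV' t ⟨h.le, h2⟩]
  refine ⟨_, _, _, S, r1, r2, fun t ht => ⟨low _ t ht, fun hat => ?_⟩⟩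
  have tB : t ∈ Ioo a B := ⟨hat, by linarith [ht.2]⟩
  have b1 := Fb V t hat ht.2
  have kt := key t hat ht.2
  rw [cv t tB]
  refine ⟨sW_deriv (hWc V) t, ?_, ?_⟩
  · rw [ck t tB, kt, cl, min_eq_left (abs_le.1 b1.1).2]
  · rw [kt, cl_eq (abs_le.1 b1.2).1 (abs_le.1 b1.2).2]

theorem eps_le {ε A B a b : ℝ} (h : |ε| ≤ 1) (h1 : |A| ≤ a) (h2 : |B| ≤ b) : ε * (A - B) ≤ a + b :=
  calc ε * (A - B) ≤ |ε * (A - B)| := le_abs_self _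
    _ = |ε| * |A - B| := abs_mul _ _
    _ ≤ 1 * |A - B| := by gcongr
    _ ≤ _ := by rw [one_mul]; exact (abs_sub _ _).trans (add_le_add h1 h2)

theorem Cl.rep {p Tm : ℝ} {s : ℝ → ℝ} {u : ℝ → ℝ → ℝ} (h : Cl p Tm s u) {a m B Q M b N Γ M1 : ℝ}
    {ψ k σ v : ℝ → ℝ} (ha : 0 < a) (ham : a < m) (hm : m < Tm) (hmB : m < B) (H : Sys a B Q M b N Γ ψ k σ v)
    (hψ : ∀ x, 0 ≤ x → ψ x = u a (min x (s a)))
    (hk : ∀ t ∈ Ioc a m, k t = 2 * u t 0 ^ p ∧ v t = -deriv (u t) (s t))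
    (hσ : ∀ t ∈ Icc a m, σ t = s t) (hu : ∀ t ∈ Icc a m, ∀ x ∈ Icc 0 (s t), |u t x| ≤ M1) :
    ∀ t ∈ Icc a m, ∀ x, 0 ≤ x → UU a ψ k σ v t x = u t (min x (s t)) := by
  set V : ℝ → ℝ → ℝ := fun t x => u t (min x (σ t)) with hV
  have hsp : ∀ t ∈ Icc a m, 0 < σ t := fun t ht => by
    rw [hσ t ht]; exact h.spos t ⟨by linarith [ht.1], by linarith [ht.2]⟩
  have hmem : ∀ t ∈ Icc a m, ∀ x, 0 ≤ x → min x (σ t) ∈ Icc 0 (s t) := fun t ht x hx =>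
    ⟨le_min hx (hsp t ht).le, by rw [← hσ t ht]; exact min_le_right _ _⟩
  have hVc : ContinuousOn (fun q : ℝ × ℝ => V q.1 q.2) {q : ℝ × ℝ | q.1 ∈ Icc a m ∧ 0 ≤ q.2} := by
    have hc : Continuous (fun q : ℝ × ℝ => ((q.1, min q.2 (σ q.1)) : ℝ × ℝ)) := by
      have := H.sc; fun_prop
    exact h.uc.comp (f := fun q : ℝ × ℝ => ((q.1, min q.2 (σ q.1)) : ℝ × ℝ)) hc.continuousOn
      (fun q hq => ⟨⟨by linarith [hq.1.1], by linarith [hq.1.2]⟩, hmem q.1 hq.1 q.2 hq.2⟩)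
  have key : ∀ T < m, a ≤ T → ∀ ε : ℝ, |ε| ≤ 1 → ∀ t ∈ Icc a T, ∀ x, 0 ≤ x →
      ε * (UU a ψ k σ v t x - V t x) ≤ 0 := by
    intro T hT haT ε hε
    have hσe : ∀ t ∈ Ioc a T, ∀ᶠ r in 𝓝 t, r ∈ Ioo a m := fun t ht =>
      Ioo_mem_nhds ht.1 (by linarith [ht.2])
    have im : ∀ {t}, t ∈ Ioc a T → t ∈ Ioc a m := fun ht => ⟨ht.1, by linarith [ht.2]⟩
    have iT : ∀ {t}, t ∈ Ioc a T → t ∈ Ioo 0 Tm := fun ht => ⟨by linarith [ht.1], by linarith [ht.2]⟩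
    have icc : ∀ {t}, t ∈ Ioc a T → t ∈ Icc a m := fun ht => ⟨ht.1.le, by linarith [ht.2]⟩
    have dσ : ∀ t ∈ Ioc a T, HasDerivAt σ (v t) t := fun t ht => by
      rw [(hk t (im ht)).2]
      refine (h.sd t (iT ht)).congr_of_eventuallyEq ?_
      filter_upwards [hσe t ht] with r hr using hσ r ⟨hr.1.le, hr.2.le⟩
    refine MPT (c1 := fun _ => 0) (c2 := σ) (M := Q) (Bd := N + 3 * (Q * (2 * √(T - a))) + M1)
      (w := fun t x => ε * (UU a ψ k σ v t x - V t x))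
      continuous_const H.sc (fun t _ => ⟨0, hasDerivAt_const _ _, by simpa using H.dv.nn⟩)
      (fun t ht => ⟨v t, dσ t ht, H.dv.bd t⟩) (fun t ht => (hsp t ⟨ht.1, by linarith [ht.2]⟩).ne)
      ?_ ?_ ?_ ?_ ?_ ?_
    · exact continuousOn_const.mul (H.cont.continuousOn.sub (hVc.mono fun q hq => ⟨⟨hq.1.1, by linarith [hq.1.2]⟩, hq.2⟩))
    · intro t ht x hx
      have e1 := H.bd ht.2 haT x
      have ht' : t ∈ Icc a m := ⟨ht.1, by linarith [ht.2]⟩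
      have e2 := hu t ht' _ (hmem t ht' x hx)
      exact eps_le hε e1 e2
    · intro x hx
      simp only [hV]
      rw [H.init, hψ x hx, hσ a ⟨le_rfl, ham.le⟩, sub_self, mul_zero]
    · intro t ht
      have hs := hsp t (icc ht)
      have e1 := H.d0 ht.1 (by linarith [ht.2]) hs
      have e2 := h.ux t (iT ht) 0 ⟨le_rfl, by rw [← hσ t (icc ht)]; exact hs.le⟩
      have e3 : HasDerivWithinAt (V t) (deriv (u t) 0) (Ici 0) 0 := by
        rw [← hσ t (icc ht)] at e2
        have := (e2.mono_of_mem_nhdsWithin (s := Ici 0) (Icc_mem_nhdsGE hs))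
        refine this.congr_of_eventuallyEq ?_ (by simp [hV, hs.le])
        filter_upwards [Icc_mem_nhdsGE hs] with y hy
        simp [hV, hy.2]
      refine ⟨0, le_rfl, ((e1.sub e3).const_mul ε).congr_deriv ?_⟩
      rw [(hk t (im ht)).1, h.bc0 t (iT ht)]; ring
    · intro t ht hs
      have e1 := H.dr ht.1 (by linarith [ht.2]) hs
      have e2 := H.dl ht.1 (by linarith [ht.2]) hs
      have e3 : HasDerivWithinAt (V t) 0 (Ici (σ t)) (σ t) := by
        refine (hasDerivWithinAt_const _ _ (V t (σ t))).congr (fun y hy => ?_) rfl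
        simp only [hV, min_self]; rw [min_eq_right hy]
      have e4 : HasDerivWithinAt (V t) (deriv (u t) (s t)) (Iic (σ t)) (σ t) := by
        have e := h.ux t (iT ht) (s t) ⟨by rw [← hσ t (icc ht)]; exact hs.le, le_rfl⟩
        rw [← hσ t (icc ht)] at e ⊢
        refine (e.mono_of_mem_nhdsWithin (s := Iic (σ t)) (Icc_mem_nhdsLE hs)).congr (fun y hy => ?_) (by simp [hV])
        simp only [hV]; rw [min_eq_left hy]
      refine ⟨_, _, le_of_eq ?_, (e1.sub e3).const_mul ε, (e2.sub e4).const_mul ε⟩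
      rw [(hk t (im ht)).2]; ring
    · intro t ht x hx hne
      have hs := hsp t (icc ht)
      have J := H.jet ht.1 hx.ne' hne (by linarith)
      have cσ : ContinuousAt (fun q : ℝ × ℝ => q.2 - σ q.1) (t, x) := by have := H.sc; fun_prop
      rcases lt_or_gt_of_ne hne with hl | hg
      · have J2 := h.jet t (iT ht) x ⟨hx, by rw [← hσ t (icc ht)]; exact hl⟩
        have J3 := J2.congr (V := V) (by
          filter_upwards [cσ.tendsto.eventually_lt_const (sub_neg.2 hl)] with q hq
          simp only [hV]; rw [min_eq_left (by linarith)])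
        exact ⟨_, (J.sub J3).smul ε⟩
      · have J3 := (HeatJet.const 0 t x).congr (V := V) (by
          filter_upwards [cσ.tendsto.eventually_const_lt (sub_pos.2 hg),
            (continuousAt_fst (p := (t, x))).eventually (hσe t ht)] with q hq hr
          simp only [hV]
          rw [min_eq_right (by linarith), hσ q.1 ⟨hr.1.le, hr.2.le⟩]
          exact h.bcs q.1 ⟨by linarith [hr.1], by linarith [hr.2]⟩)
        exact ⟨_, (J.sub J3).smul ε⟩
  have key2 : ∀ t ∈ Ico a m, ∀ x, 0 ≤ x → UU a ψ k σ v t x = V t x := fun t ht x hx => by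
    have e1 := key t ht.2 ht.1 1 (by simp) t ⟨ht.1, le_rfl⟩ x hx
    have e2 := key t ht.2 ht.1 (-1) (by simp) t ⟨ht.1, le_rfl⟩ x hx
    linarith
  intro t ht x hx
  have hcx : Continuous (fun t : ℝ => ((t, x) : ℝ × ℝ)) := by fun_prop
  have := Set.EqOn.of_subset_closure (s := Ico a m) (t := Icc a m) (f := fun t => UU a ψ k σ v t x)
    (g := fun t => V t x) (fun t ht => key2 t ht x hx) (H.cont.comp hcx).continuousOn
    (hVc.comp hcx.continuousOn (fun t ht => ⟨ht, hx⟩)) Ico_subset_Icc_self (by rw [closure_Ico ham.ne])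
  have e := this ht
  simp only [hV] at e
  rw [e, hσ t ht]

theorem Sys.fix {a B Q M b N Γ T : ℝ} {ψ k s v : ℝ → ℝ} (H : Sys a B Q M b N Γ ψ k s v) (haT : a < T) (hTB : T < B)
    (hs : ∀ t ∈ Icc a T, 0 < s t)
    (hd : ∀ t ∈ Ioc a T, HasDerivAt s (v t) t ∧ 0 ≤ k t ∧ v t = -2 * U1 a ψ k s v t (s t))
    (hψ : ∀ x, 0 ≤ ψ x) (hb : ∀ x, s a ≤ x → ψ x = 0) :
    (∀ t ∈ Icc a T, ∀ x, s t ≤ x → UU a ψ k s v t x = 0) ∧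
    (∀ t ∈ Icc a T, ∀ x ∈ Icc 0 (s t), 0 ≤ UU a ψ k s v t x) := by
  have ic : ∀ {t}, t ∈ Ioc a T → t ∈ Icc a T := fun ht => ⟨ht.1.le, ht.2⟩
  have key : ∀ ε : ℝ, |ε| ≤ 1 → ∀ t ∈ Icc a T, ∀ x, s t ≤ x → ε * (UU a ψ k s v t x - 0) ≤ 0 := by
    intro ε hε
    refine MPT (c1 := s) (c2 := fun t => s t - 1) (M := Q) (Bd := N + 3 * (Q * (2 * √(T - a))) + 0)
      (w := fun t x => ε * (UU a ψ k s v t x - 0)) H.sc (H.sc.sub continuous_const)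
      (fun t ht => ⟨v t, (hd t ht).1, H.dv.bd t⟩)
      (fun t ht => ⟨v t, (hd t ht).1.sub_const 1, H.dv.bd t⟩) (fun t _ => (sub_one_lt (s t)).ne')
      ?_ ?_ ?_ ?_ ?_ ?_
    · exact continuousOn_const.mul (H.cont.continuousOn.sub continuousOn_const)
    · intro t ht x hx
      exact eps_le hε (H.bd ht.2 haT.le x) (by simp)
    · intro x hx
      rw [H.init, hb x hx]; simp
    · intro t ht
      have e1 := H.dr ht.1 (by linarith [ht.2]) (hs t (ic ht))
      refine ⟨0, le_rfl, ((e1.sub_const 0).const_mul ε).congr_deriv ?_⟩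
      linear_combination ε / 2 * (hd t ht).2.2
    · intro t ht h1; linarith
    · intro t ht x hx hne
      have h0 := hs t (ic ht)
      have J := H.jet ht.1 (by linarith) hx.ne' (by linarith)
      exact ⟨_, (J.sub (HeatJet.const 0 t x)).smul ε⟩
  have h1 : ∀ t ∈ Icc a T, ∀ x, s t ≤ x → UU a ψ k s v t x = 0 := fun t ht x hx => by
    have e1 := key 1 (by simp) t ht x hx
    have e2 := key (-1) (by simp) t ht x hx
    linarith
  refine ⟨h1, ?_⟩
  obtain ⟨K, hK⟩ := isCompact_Icc.exists_bound_of_continuousOn (s := Icc a T) H.sc.continuousOn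
  have hK : ∀ t ∈ Icc a T, s t ≤ K := fun t ht => (le_abs_self _).trans (hK t ht)
  have main : ∀ ε > 0, ∀ t ∈ Icc a T, ∀ x ∈ Icc 0 (s t), ε * (x - K) - UU a ψ k s v t x ≤ 0 := by
    intro ε hε
    refine max_principle (a := fun _ => 0) (b := s) (W := fun t x => ε * (x - K) - UU a ψ k s v t x)
      continuousOn_const H.sc.continuousOn ?_ ?_ ?_
    · have := H.cont
      exact Continuous.continuousOn (by fun_prop)
    · intro x hx
      rw [H.init]
      have := mul_nonneg hε.le (sub_nonneg.2 (hx.2.trans (hK a ⟨le_rfl, haT.le⟩)))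
      linarith [hψ x]
    · intro t ht x hx
      have h0 := hs t (ic ht)
      have hle := mul_nonneg hε.le (sub_nonneg.2 (hx.2.trans (hK t (ic ht))))
      have dl : ∀ y, HasDerivAt (fun x => ε * (x - K)) ε y := fun y =>
        (((hasDerivAt_id y).sub_const K).const_mul ε).congr_deriv (by simp)
      rcases eq_or_lt_of_le hx.1 with e | e
      · subst e
        refine Or.inr (Or.inr (Or.inl ⟨h0, _, ?_, (dl 0).hasDerivWithinAt.fun_sub (H.d0 ht.1 (by linarith [ht.2]) h0)⟩))
        linarith [(hd t ht).2.1]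
      · rcases eq_or_lt_of_le hx.2 with e' | e'
        · left
          rw [h1 t (ic ht) x e'.ge]; linarith
        · refine Or.inr (Or.inl ⟨⟨e, e'⟩, _, _, HeatJet.sub (W := fun _ x => ε * (x - K)) (a := 0) (b := 0)
            ⟨hasDerivAt_const _ _, fun _ => ε, Eventually.of_forall dl, hasDerivAt_const _ _⟩
            (H.jet ht.1 e.ne' e'.ne (by linarith)), le_rfl⟩)
  intro t ht x hx
  refine le_of_forall_pos_le_add fun η hη => ?_
  have hK0 : 0 ≤ K := (hs t ht).le.trans (hK t ht)
  have e := main (η / (K + 1)) (by positivity) t ht x hx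
  have e1 : η / (K + 1) * (K - x) ≤ η := by
    rw [div_mul_eq_mul_div, div_le_iff₀ (by linarith)]
    exact mul_le_mul_of_nonneg_left (by linarith [hx.1]) hη.le
  have e2 : η / (K + 1) * (x - K) = -(η / (K + 1) * (K - x)) := by ring
  linarith

theorem Cl.ext0 {p Tm : ℝ} {s : ℝ → ℝ} {u : ℝ → ℝ → ℝ} (hp : 1 < p) (h : Cl p Tm s u) (hT : 0 < Tm) {M1 : ℝ}
    (hM1 : 1 ≤ M1) (hb : ∀ t ∈ Ico (Tm / 2) Tm, ∀ x ∈ Icc 0 (s t), u t x ≤ M1 ∧ |deriv (u t) x| ≤ M1) :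
    ∃ a m T2 B Q M b : ℝ, ∃ ψ k σ v : ℝ → ℝ, 0 < a ∧ a < m ∧ m < Tm ∧ Tm < T2 ∧ T2 < B ∧
    Sys a B Q M b M1 M1 ψ k σ v ∧
    (∀ t ∈ Icc a m, σ t = s t ∧ ∀ x ∈ Icc 0 (s t), UU a ψ k σ v t x = u t x) ∧
    ∀ t ∈ Ioc a T2, 0 < σ t ∧ HasDerivAt σ (v t) t ∧ k t = 2 * (UU a ψ k σ v t 0) ^ p ∧
      v t = -2 * U1 a ψ k σ v t (σ t) ∧ UU a ψ k σ v t (σ t) = 0 ∧ ∀ x ∈ Icc 0 (σ t), 0 ≤ UU a ψ k σ v t x := by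
  have hs0 := h.spos 0 ⟨le_rfl, hT⟩
  obtain ⟨L, Q, M, hL, hL1, hM, F⟩ := FP (p := p) (M1 := M1) (s0 := s 0) hp (by linarith) hs0
  obtain ⟨a, h2, h3, h4⟩ : ∃ a, Tm / 2 ≤ a ∧ a < Tm ∧ Tm ≤ a + L / 2 :=
    ⟨max (Tm / 2) (Tm - L / 2), le_max_left _ _, max_lt (by linarith) (by linarith),
      by linarith [le_max_right (Tm / 2) (Tm - L / 2)]⟩
  obtain ⟨m, h5, h6⟩ : ∃ m, a < m ∧ m < Tm := exists_between h3
  have ha : 0 < a := by linarith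
  have icm : ∀ {t}, t ∈ Icc a m → t ∈ Ico (Tm / 2) Tm ∧ t ∈ Ioo 0 Tm ∧ t ∈ Ico 0 Tm := fun ht =>
    ⟨⟨by linarith [ht.1], by linarith [ht.2]⟩, ⟨by linarith [ht.1], by linarith [ht.2]⟩,
      ⟨by linarith [ht.1], by linarith [ht.2]⟩⟩
  have haa : a ∈ Icc a m := ⟨le_rfl, h5.le⟩
  have hclm : ∀ t, cl a m t ∈ Icc a m := fun t => cl_mem h5.le t
  have hsa := h.spos a (icm haa).2.2
  have h0 : ∀ t ∈ Icc a m, (0:ℝ) ∈ Icc 0 (s t) := fun t ht => ⟨le_rfl, (h.spos t (icm ht).2.2).le⟩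
  have h1 : ∀ t ∈ Icc a m, s t ∈ Icc 0 (s t) := fun t ht => ⟨(h.spos t (icm ht).2.2).le, le_rfl⟩
  have hua : ∀ t ∈ Icc a m, ∀ x ∈ Icc 0 (s t), |u t x| ≤ M1 := fun t ht x hx => by
    rw [abs_of_nonneg (h.nn t (icm ht).2.2 x hx)]; exact (hb t (icm ht).1 x hx).1
  obtain ⟨ψ, hψ⟩ : ∃ ψ : ℝ → ℝ, ψ = fun y => u a (cl 0 (s a) |y|) := ⟨_, rfl⟩
  have hcl0 : ∀ y, cl 0 (s a) |y| ∈ Icc 0 (s a) := fun y => cl_mem hsa.le _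
  have hψz : ∀ y, s a ≤ |y| → ψ y = 0 := fun y hy => by
    rw [hψ]; simp only [cl]; rw [min_eq_right hy, max_eq_right hsa.le]; exact h.bcs a (icm haa).2.1
  have hini : Ini (s a) M1 M1 ψ := by
    refine ⟨fun y => ?_, fun x y => ?_, fun y hy => ?_, fun y => ?_⟩
    · rw [hψ]; exact hua a haa _ (hcl0 y)
    · have e := h.lip (icm haa).2.1 le_rfl le_rfl (fun x hx => (hb a (icm haa).1 x hx).2) _ (hcl0 y) _ (hcl0 x)
      rw [hψ]
      exact e.trans (mul_le_mul_of_nonneg_left ((cl_lip _ _ _ _).trans (abs_abs_sub_abs_le x y)) (by linarith))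
    · refine hψz y (le_of_not_ge fun hc => hy (abs_le.1 hc))
    · rw [hψ]; simp only [abs_neg]
  obtain ⟨g, hg⟩ : ∃ g : ℝ → ℝ, g = fun t => u (cl a m t) 0 := ⟨_, rfl⟩
  obtain ⟨f, hf⟩ : ∃ f : ℝ → ℝ, f = fun t => -deriv (u (cl a m t)) (s (cl a m t)) := ⟨_, rfl⟩
  have hge : ∀ t ∈ Icc a m, g t = u t 0 := fun t ht => by rw [hg]; simp only [cl_eq ht.1 ht.2]
  have hfe : ∀ t ∈ Icc a m, f t = -deriv (u t) (s t) := fun t ht => by rw [hf]; simp only [cl_eq ht.1 ht.2]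
  have hgc : Continuous g := by
    rw [hg]
    exact h.uc.comp_continuous (f := fun t => ((cl a m t, 0) : ℝ × ℝ)) ((cl_cont a m).prodMk continuous_const)
      (fun t => ⟨(icm (hclm t)).2.2, h0 _ (hclm t)⟩)
  have hsc : Continuous (fun t => s (cl a m t)) :=
    h.sc.comp_continuous (cl_cont a m) (fun t => (icm (hclm t)).2.2)
  have hfc : Continuous f := by
    rw [hf]
    exact (h.uxc.comp_continuous (f := fun t => ((cl a m t, s (cl a m t)) : ℝ × ℝ)) ((cl_cont a m).prodMk hsc)
      (fun t => ⟨(icm (hclm t)).2.1, h1 _ (hclm t)⟩)).neg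
  have hse : ∀ t ∈ Icc a m, s a + ∫ y in a..t, f y = s t := fun t ht => by
    rw [intervalIntegral.integral_eq_sub_of_hasDerivAt (f := s) (fun y hy => ?_) (hfc.intervalIntegrable _ _)]
    · ring
    · rw [uIcc_of_le ht.1] at hy
      have hy' : y ∈ Icc a m := ⟨hy.1, hy.2.trans ht.2⟩
      rw [hfe y hy']; exact h.sd y (icm hy').2.1
  have R : ∀ k σ v, Sys a (a + L + 1) Q M (s a) M1 M1 ψ k σ v → (∀ t ∈ Ioc a m, k t = 2 * g t ^ p ∧ v t = f t) →
      (∀ t ∈ Icc a m, σ t = s a + ∫ y in a..t, f y) → ∀ t ∈ Icc a m, ∀ x, 0 ≤ x →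
      UU a ψ k σ v t x = u t (min x (s t)) := by
    intro k σ v H hk hσ
    refine h.rep ha h5 h6 (by linarith) H (fun x hx => ?_) (fun t ht => ?_) (fun t ht => (hσ t ht).trans (hse t ht)) hua
    · rw [hψ]; simp only [cl, abs_of_nonneg hx]; rw [max_eq_right (le_min hx hsa.le)]
    · have ht' : t ∈ Icc a m := ⟨ht.1.le, ht.2⟩
      rw [← hge t ht', ← hfe t ht']; exact hk t ht
  have hF := F (a := a) (b := s a) (m := m) (ψ := ψ) (g := g) (f := f)
    (h.s_mono ⟨le_rfl, hT⟩ (icm haa).2.2 ha.le) hini hgc hfc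
    (fun t => by rw [hg]; exact ⟨h.nn _ (icm (hclm t)).2.2 _ (h0 _ (hclm t)), (hb _ (icm (hclm t)).1 _ (h0 _ (hclm t))).1⟩)
    (fun t => by rw [hf]; simp only [abs_neg]; exact (hb _ (icm (hclm t)).1 _ (h1 _ (hclm t))).2) h5 (by linarith)
    (fun k σ v H hk hσ t ht => by
      have ht' : t ∈ Icc a m := ⟨ht.1.le, ht.2⟩
      have hst := h.spos t (icm ht').2.2
      have e0 : σ t = s t := (hσ t ht').trans (hse t ht')
      have r := R k σ v H hk hσ t ht'
      refine ⟨by rw [r 0 le_rfl, min_eq_left hst.le, hge t ht'], ?_⟩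
      have d1 := H.dr ht.1 (by linarith [ht.2]) (by rw [e0]; exact hst)
      have d2 : HasDerivWithinAt (UU a ψ k σ v t) 0 (Ici (σ t)) (σ t) := by
        refine (hasDerivWithinAt_const _ _ (UU a ψ k σ v t (σ t))).congr (fun y hy => ?_) rfl
        have hy : s t ≤ y := by rw [← e0]; exact hy
        rw [e0, r y (hst.le.trans hy), r _ hst.le, min_eq_right hy, min_self]
      have := (uniqueDiffOn_Ici (σ t) (σ t) self_mem_Ici).eq_deriv _ d1 d2
      rw [← (hk t ht).2]; linarith)
  obtain ⟨k, σ, v, H, hk, hσ, hfix⟩ := hF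
  have hσe : ∀ t ∈ Icc a m, σ t = s t := fun t ht => (hσ t ht).trans (hse t ht)
  have hsig : ∀ t ∈ Icc a (a + L), 0 < σ t := fun t ht => lt_of_lt_of_le (by linarith) (hfix t ht).1
  have ic : ∀ {t}, t ∈ Ioc a (a + L) → t ∈ Icc a (a + L) := fun ht => ⟨ht.1.le, ht.2⟩
  obtain ⟨z1, z2⟩ := H.fix (T := a + L) (by linarith) (by linarith) hsig (fun t ht => by
      obtain ⟨-, q⟩ := hfix t (ic ht)
      obtain ⟨q1, q2, q3⟩ := q ht.1
      exact ⟨q1, by rw [q2]; positivity, q3⟩)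
    (fun x => by rw [hψ]; exact h.nn a (icm haa).2.2 _ (hcl0 x))
    (fun x hx => hψz x (by rw [hσe a haa] at hx; exact hx.trans (le_abs_self x)))
  refine ⟨a, m, a + L, a + L + 1, Q, M, s a, ψ, k, σ, v, ha, h5, h6, by linarith, by linarith, H, ?_, ?_⟩
  · intro t ht
    exact ⟨hσe t ht, fun x hx => by rw [R k σ v H hk hσ t ht x hx.1, min_eq_left hx.2]⟩
  · intro t ht
    obtain ⟨-, q⟩ := hfix t (ic ht)
    obtain ⟨q1, q2, q3⟩ := q ht.1
    have hst := hsig t (ic ht)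
    refine ⟨hst, q1, ?_, q3, z1 t (ic ht) _ le_rfl, z2 t (ic ht)⟩
    rw [q2, max_eq_right (z2 t (ic ht) 0 ⟨le_rfl, hst.le⟩)]

theorem gl {F F' : ℝ × ℝ → ℝ} {G G' U : Set (ℝ × ℝ)} {q : ℝ × ℝ} (hU : U ∈ 𝓝 q) (hq : q ∈ G)
    (hG : ∀ r ∈ U, r ∈ G → r ∈ G' ∧ F r = F' r) (hc : ContinuousWithinAt F' G' q) : ContinuousWithinAt F G q := by
  have e : U ∩ G ∈ 𝓝[G] q := inter_mem (mem_nhdsWithin_of_mem_nhds hU) self_mem_nhdsWithin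
  refine (hc.mono_of_mem_nhdsWithin (mem_of_superset e fun r hr => (hG r hr.1 hr.2).1)).congr_of_eventuallyEq
    (mem_of_superset e fun r hr => (hG r hr.1 hr.2).2) (hG q (mem_of_mem_nhds hU) hq).2

/-- glued solution -/
structure Glu (p a m T2 : ℝ) (s : ℝ → ℝ) (u P P1 P2 : ℝ → ℝ → ℝ) (k σ v σ' : ℝ → ℝ) (w : ℝ → ℝ → ℝ) : Prop where
  am : 0 < a ∧ a < m ∧ m < T2
  s1 : ∀ t < m, σ' t = s t
  s2 : ∀ t > a, σ' t = σ t
  w1 : ∀ t < m, w t = u t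
  w2 : ∀ t > a, ∀ x ∈ Icc 0 (σ t), w t x = P t x
  sc : Continuous σ
  sp : ∀ t ∈ Ioc a T2, 0 < σ t
  sd : ∀ t ∈ Ioc a T2, HasDerivAt σ (v t) t
  vc : ∀ t ∈ Ioc a T2, ContinuousAt v t
  kc : ∀ t ∈ Ioc a T2, ContinuousAt k t
  pc : Continuous (fun q : ℝ × ℝ => P q.1 q.2)
  reg : ∀ q : ℝ × ℝ, a < q.1 → 0 < q.2 → q.2 < σ q.1 → Reg P P1 P2 q
  l0 : ∀ t ∈ Ioc a T2, Tendsto (fun q : ℝ × ℝ => P1 q.1 q.2) (𝓝[{q : ℝ × ℝ | 0 < q.2}] (t, 0)) (𝓝 (-(k t / 2)))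
  ls : ∀ t ∈ Ioc a T2, Tendsto (fun q : ℝ × ℝ => P1 q.1 q.2) (𝓝[{q : ℝ × ℝ | q.2 < σ q.1}] (t, σ t)) (𝓝 (-v t))
  b0 : ∀ t ∈ Ioc a T2, deriv (w t) 0 = -(k t / 2)
  bs : ∀ t ∈ Ioc a T2, deriv (w t) (σ t) = -v t
  bc : ∀ t ∈ Ioc a T2, k t = 2 * P t 0 ^ p ∧ P t (σ t) = 0 ∧ ∀ x ∈ Icc 0 (σ t), 0 ≤ P t x

theorem Glu.int {p a m T2 : ℝ} {s : ℝ → ℝ} {u P P1 P2 : ℝ → ℝ → ℝ} {k σ v σ' : ℝ → ℝ} {w : ℝ → ℝ → ℝ}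
    (h : Glu p a m T2 s u P P1 P2 k σ v σ' w) {t x : ℝ} (ht : a < t) (hx : 0 < x) (hs : x < σ t) :
    HasDerivAt (fun τ => w τ x) (P2 t x) t ∧ HasDerivAt (w t) (P1 t x) x ∧ HasDerivAt (deriv (w t)) (P2 t x) x := by
  have hr := h.reg (t, x) ht hx hs
  have d1 : ∀ y, 0 < y → y < σ t → HasDerivAt (w t) (P1 t y) y := fun y h1 h2 => by
    refine (h.reg (t, y) ht h1 h2).dx.congr_of_eventuallyEq ?_
    filter_upwards [Ioo_mem_nhds h1 h2] with z hz using h.w2 t ht z ⟨hz.1.le, hz.2.le⟩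
  refine ⟨hr.dt.congr_of_eventuallyEq ?_, d1 x hx hs, hr.dxx.congr_of_eventuallyEq ?_⟩
  · filter_upwards [lt_mem_nhds ht, h.sc.continuousAt.tendsto.eventually_const_lt hs] with r h1 h2
    exact h.w2 r h1 x ⟨hx.le, h2.le⟩
  · filter_upwards [Ioo_mem_nhds hx hs] with z hz using (d1 z hz.1 hz.2).deriv

theorem Glu.uxc {p a m T2 : ℝ} {s : ℝ → ℝ} {u P P1 P2 : ℝ → ℝ → ℝ} {k σ v σ' : ℝ → ℝ} {w : ℝ → ℝ → ℝ}
    (h : Glu p a m T2 s u P P1 P2 k σ v σ' w) {q : ℝ × ℝ} (ht : q.1 ∈ Ioc a T2) (hx : q.2 ∈ Icc 0 (σ q.1)) :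
    ContinuousWithinAt (fun q : ℝ × ℝ => deriv (w q.1) q.2)
      {q : ℝ × ℝ | q.1 ∈ Ioc a T2 ∧ q.2 ∈ Icc 0 (σ q.1)} q := by
  obtain ⟨t, x⟩ := q
  have hσ := h.sp t ht
  have c := h.sc
  have ct : ContinuousAt (fun q : ℝ × ℝ => q.1) (t, x) := continuousAt_fst
  have U1 : ContinuousAt (fun q : ℝ × ℝ => σ q.1 - q.2) (t, x) := by fun_prop
  rcases eq_or_lt_of_le hx.1 with e | e
  · change 0 = x at e
    subst e
    have hU : {q : ℝ × ℝ | 0 < σ q.1 - q.2} ∈ 𝓝 ((t, 0) : ℝ × ℝ) :=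
      U1.tendsto.eventually_const_lt (by simpa using hσ)
    refine gl (F' := fun q => if q.2 = 0 then -(k q.1 / 2) else P1 q.1 q.2)
      (G' := {q : ℝ × ℝ | q.2 = 0} ∪ {q : ℝ × ℝ | 0 < q.2}) hU ⟨ht, hx⟩ ?_ ?_
    · rintro ⟨r, y⟩ h1 ⟨h2, h3⟩
      rcases eq_or_lt_of_le h3.1 with e | e
      · change 0 = y at e
        subst e
        exact ⟨Or.inl rfl, by simp [h.b0 r h2]⟩
      · exact ⟨Or.inr e, by simpa [(show y ≠ 0 from e.ne')] using (h.int h2.1 e (sub_pos.1 h1)).2.1.deriv⟩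
    · refine ContinuousWithinAt.union ?_ ?_
      · have k1 : ContinuousAt (fun q : ℝ × ℝ => -(k q.1 / 2)) (t, 0) :=
          ((ContinuousAt.comp (f := fun q : ℝ × ℝ => q.1) (h.kc t ht) ct).div_const 2).neg
        exact k1.continuousWithinAt.congr (fun q hq => if_pos hq) (by simp)
      · show Tendsto _ _ (𝓝 (if (0:ℝ) = 0 then -(k t / 2) else P1 t 0))
        rw [if_pos rfl]
        exact (h.l0 t ht).congr' (eventually_nhdsWithin_of_forall fun q hq => (if_neg (show q.2 ≠ 0 from ne_of_gt hq)).symm)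
  rcases eq_or_lt_of_le hx.2 with e' | e'
  · change x = σ t at e'
    subst e'
    have hU : {q : ℝ × ℝ | 0 < q.2} ∈ 𝓝 ((t, σ t) : ℝ × ℝ) :=
      (continuousAt_snd (p := (t, σ t))).tendsto.eventually_const_lt hσ
    refine gl (F' := fun q => if q.2 = σ q.1 then -v q.1 else P1 q.1 q.2)
      (G' := {q : ℝ × ℝ | q.2 = σ q.1} ∪ {q : ℝ × ℝ | q.2 < σ q.1}) hU ⟨ht, hx⟩ ?_ ?_
    · rintro ⟨r, y⟩ h1 ⟨h2, h3⟩
      rcases eq_or_lt_of_le h3.2 with e | e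
      · change y = σ r at e
        subst e
        exact ⟨Or.inl rfl, by simp [h.bs r h2]⟩
      · exact ⟨Or.inr e, by simpa [(show y ≠ σ r from e.ne)] using (h.int h2.1 h1 e).2.1.deriv⟩
    · refine ContinuousWithinAt.union ?_ ?_
      · have k1 : ContinuousAt (fun q : ℝ × ℝ => -v q.1) (t, σ t) :=
          (ContinuousAt.comp (f := fun q : ℝ × ℝ => q.1) (h.vc t ht) ct).neg
        exact k1.continuousWithinAt.congr (fun q hq => if_pos hq) (by simp)
      · show Tendsto _ _ (𝓝 (if σ t = σ t then -v t else P1 t (σ t)))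
        rw [if_pos rfl]
        exact (h.ls t ht).congr' (eventually_nhdsWithin_of_forall fun q hq => (if_neg (show q.2 ≠ σ q.1 from ne_of_lt hq)).symm)
  · have hU : {q : ℝ × ℝ | 0 < q.2 ∧ 0 < σ q.1 - q.2} ∈ 𝓝 ((t, x) : ℝ × ℝ) :=
      ((continuousAt_snd (p := (t, x))).tendsto.eventually_const_lt e).and
      (U1.tendsto.eventually_const_lt (sub_pos.2 e'))
    refine gl (F' := fun q => P1 q.1 q.2) (G' := univ) hU ⟨ht, hx⟩
      (fun r h1 h2 => ⟨trivial, (h.int h2.1.1 h1.1 (sub_pos.1 h1.2)).2.1.deriv⟩)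
      (h.reg (t, x) ht.1 e e').c1.continuousWithinAt

theorem Glu.sol {p s₀ a m T2 : ℝ} {φ s : ℝ → ℝ} {u P P1 P2 : ℝ → ℝ → ℝ} {k σ v σ' : ℝ → ℝ} {w : ℝ → ℝ → ℝ}
    (h : Glu p a m T2 s u P P1 P2 k σ v σ' w) (H : IsSolOn p s₀ φ m s u) : IsSolOn p s₀ φ T2 σ' w := by
  obtain ⟨ha, ham, hmT⟩ := h.am
  have c := h.sc
  have cs : ∀ t, t < m ∨ (a < t ∧ σ' t = σ t) := fun t => by
    rcases lt_or_ge t m with e | e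
    · exact Or.inl e
    · exact Or.inr ⟨by linarith, h.s2 t (by linarith)⟩
  have n1 : ∀ {t}, t < m → ∀ᶠ r in 𝓝 t, r < m := fun e => gt_mem_nhds e
  have n2 : ∀ {t}, a < t → ∀ᶠ r in 𝓝 t, a < r := fun e => lt_mem_nhds e
  have N1 : ∀ {q : ℝ × ℝ}, q.1 < m → {q : ℝ × ℝ | q.1 < m} ∈ 𝓝 q := fun {q} e =>
    (continuousAt_fst (p := q)).tendsto.eventually_lt_const e
  have N2 : ∀ {q : ℝ × ℝ}, a < q.1 → {q : ℝ × ℝ | a < q.1} ∈ 𝓝 q := fun {q} e =>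
    (continuousAt_fst (p := q)).tendsto.eventually_const_lt e
  have D1 : ∀ t < m, σ' =ᶠ[𝓝 t] s := fun t e => by filter_upwards [n1 e] with r hr using h.s1 r hr
  have D2 : ∀ t > a, σ' =ᶠ[𝓝 t] σ := fun t e => by filter_upwards [n2 e] with r hr using h.s2 r hr
  have T1 : ∀ t x, t < m → (fun τ => w τ x) =ᶠ[𝓝 t] fun τ => u τ x := fun t x e => by
    filter_upwards [n1 e] with r hr; rw [h.w1 r hr]
  have Dv : ∀ t ∈ Ioc a T2, deriv σ' t = v t := fun t ht => by
    rw [(D2 t ht.1).deriv_eq, (h.sd t ht).deriv]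
  have I1 : ∀ {t}, t ∈ Ioc 0 T2 → t < m → t ∈ Ioc 0 m := fun ht e => ⟨ht.1, e.le⟩
  have I1' : ∀ {t}, t ∈ Icc 0 T2 → t < m → t ∈ Icc 0 m := fun ht e => ⟨ht.1, e.le⟩
  -- continuity in the interior region
  have ctn : ∀ {F Fu : ℝ × ℝ → ℝ}, (∀ q : ℝ × ℝ, q.1 < m → F q = Fu q) →
      (∀ q : ℝ × ℝ, a < q.1 → 0 < q.2 → q.2 < σ q.1 → F q = P2 q.1 q.2) →
      ContinuousOn Fu {q : ℝ × ℝ | q.1 ∈ Ioc 0 m ∧ q.2 ∈ Ioo 0 (s q.1)} →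
      ContinuousOn F {q : ℝ × ℝ | q.1 ∈ Ioc 0 T2 ∧ q.2 ∈ Ioo 0 (σ' q.1)} := by
    intro F Fu e1 e2 hc q hq
    rcases cs q.1 with e | ⟨e, e'⟩
    · have hq2 : q.2 ∈ Ioo 0 (s q.1) := by rw [← h.s1 _ e]; exact hq.2
      exact gl (F' := Fu) (G' := {q : ℝ × ℝ | q.1 ∈ Ioc 0 m ∧ q.2 ∈ Ioo 0 (s q.1)}) (N1 e) hq (fun r hr hg => ⟨⟨I1 hg.1 hr, by rw [← h.s1 _ hr]; exact hg.2⟩, e1 r hr⟩)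
        (hc q ⟨I1 hq.1 e, hq2⟩)
    · have hq2 : q.2 ∈ Ioo 0 (σ q.1) := by rw [← e']; exact hq.2
      exact gl (F' := fun q => P2 q.1 q.2) (G' := univ) (N2 e) hq
        (fun r hr hg => ⟨trivial, e2 r hr hg.2.1 (by rw [← h.s2 _ hr]; exact hg.2.2)⟩)
        (h.reg q e hq2.1 hq2.2).c2.continuousWithinAt
  refine ⟨by linarith, ?_, ?_, ?_, ?_, ?_, ?_, ?_, ?_, ?_, ?_, ?_, ?_, ?_, ?_, ?_, ?_, ?_, ?_⟩
  · intro t ht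
    rcases cs t with e | ⟨e, e'⟩
    · refine ((H.s_cont t (I1' ht e)).mono_of_mem_nhdsWithin ?_).congr_of_eventuallyEq
        ((D1 t e).filter_mono nhdsWithin_le_nhds) (h.s1 t e)
      filter_upwards [self_mem_nhdsWithin, mem_nhdsWithin_of_mem_nhds (n1 e)] with r h1 h2 using I1' h1 h2
    · exact (c.continuousAt.congr (D2 t e).symm).continuousWithinAt
  · intro t ht
    rcases cs t with e | ⟨e, e'⟩
    · exact (D1 t e).differentiableAt_iff.2 (H.s_diff t (I1 ht e))
    · exact (D2 t e).differentiableAt_iff.2 (h.sd t ⟨e, ht.2⟩).differentiableAt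
  · intro t ht
    rcases cs t with e | ⟨e, e'⟩
    · refine ((H.s_deriv_cont t (I1 ht e)).mono_of_mem_nhdsWithin ?_).congr_of_eventuallyEq
        ((D1 t e).deriv.filter_mono nhdsWithin_le_nhds) (D1 t e).deriv_eq
      filter_upwards [self_mem_nhdsWithin, mem_nhdsWithin_of_mem_nhds (n1 e)] with r h1 h2 using I1 h1 h2
    · refine (h.vc t ⟨e, ht.2⟩).continuousWithinAt.congr_of_eventuallyEq ?_ (Dv t ⟨e, ht.2⟩)
      filter_upwards [self_mem_nhdsWithin, mem_nhdsWithin_of_mem_nhds (n2 e)] with r h1 h2 using Dv r ⟨h2, h1.2⟩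
  · intro t ht
    rcases cs t with e | ⟨e, e'⟩
    · rw [h.s1 t e]; exact H.s_pos t (I1' ht e)
    · rw [e']; exact h.sp t ⟨e, ht.2⟩
  · intro t ht x hx
    rcases cs t with e | ⟨e, e'⟩
    · rw [h.s1 t e] at hx
      exact (T1 t x e).differentiableAt_iff.2 (H.ut_diff t (I1 ht e) x hx)
    · rw [e'] at hx; exact (h.int e hx.1 hx.2).1.differentiableAt
  · intro t ht x hx
    rcases cs t with e | ⟨e, e'⟩
    · rw [h.s1 t e] at hx
      rw [h.w1 t e]; exact H.ux_diff t (I1 ht e) x hx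
    · rw [e'] at hx; exact (h.int e hx.1 hx.2).2.1.differentiableAt
  · intro t ht x hx
    rcases cs t with e | ⟨e, e'⟩
    · rw [h.s1 t e] at hx
      rw [h.w1 t e]; exact H.uxx_diff t (I1 ht e) x hx
    · rw [e'] at hx; exact (h.int e hx.1 hx.2).2.2.differentiableAt
  · exact ctn (fun q e => (T1 q.1 q.2 e).deriv_eq) (fun q e h1 h2 => (h.int e h1 h2).1.deriv) H.ut_cont
  · exact ctn (Fu := fun q : ℝ × ℝ => deriv (deriv (u q.1)) q.2) (fun q e => by rw [h.w1 _ e])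
      (fun q e h1 h2 => (h.int e h1 h2).2.2.deriv) H.uxx_cont
  · intro q hq
    rcases cs q.1 with e | ⟨e, e'⟩
    · have hq2 : q.2 ∈ Icc 0 (s q.1) := by rw [← h.s1 _ e]; exact hq.2
      exact gl (F' := fun q => deriv (u q.1) q.2) (G' := {q : ℝ × ℝ | q.1 ∈ Ioc 0 m ∧ q.2 ∈ Icc 0 (s q.1)}) (N1 e) hq (fun r hr hg => ⟨⟨I1 hg.1 hr, by rw [← h.s1 _ hr]; exact hg.2⟩, by rw [h.w1 _ hr]⟩)
        (H.ux_cont q ⟨I1 hq.1 e, hq2⟩)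
    · have hq2 : q.2 ∈ Icc 0 (σ q.1) := by rw [← e']; exact hq.2
      exact gl (F' := fun q => deriv (w q.1) q.2) (G' := {q : ℝ × ℝ | q.1 ∈ Ioc a T2 ∧ q.2 ∈ Icc 0 (σ q.1)}) (N2 e) hq (fun r hr hg => ⟨⟨⟨hr, hg.1.2⟩, by rw [← h.s2 _ hr]; exact hg.2⟩, rfl⟩)
        (h.uxc ⟨e, hq.1.2⟩ hq2)
  · intro q hq
    rcases cs q.1 with e | ⟨e, e'⟩
    · have hq2 : q.2 ∈ Icc 0 (s q.1) := by rw [← h.s1 _ e]; exact hq.2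
      exact gl (F' := fun q => u q.1 q.2) (G' := {q : ℝ × ℝ | q.1 ∈ Icc 0 m ∧ q.2 ∈ Icc 0 (s q.1)}) (N1 e) hq (fun r hr hg => ⟨⟨I1' hg.1 hr, by rw [← h.s1 _ hr]; exact hg.2⟩, by rw [h.w1 _ hr]⟩)
        (H.u_cont q ⟨I1' hq.1 e, hq2⟩)
    · exact gl (F' := fun q => P q.1 q.2) (G' := univ) (N2 e) hq
        (fun r hr hg => ⟨trivial, h.w2 r.1 hr r.2 (by rw [← h.s2 _ hr]; exact hg.2)⟩)
        h.pc.continuousWithinAt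
  · intro t ht x hx
    rcases cs t with e | ⟨e, e'⟩
    · rw [h.s1 t e] at hx
      rw [h.w1 t e]; exact H.u_nonneg t (I1' ht e) x hx
    · rw [e'] at hx; rw [h.w2 t e x hx]; exact (h.bc t ⟨e, ht.2⟩).2.2 x hx
  · intro t ht x hx
    rcases cs t with e | ⟨e, e'⟩
    · rw [h.s1 t e] at hx
      rw [(T1 t x e).deriv_eq, h.w1 t e]; exact H.heat t (I1 ht e) x hx
    · rw [e'] at hx
      obtain ⟨k1, -, k3⟩ := h.int e hx.1 hx.2
      rw [k1.deriv, k3.deriv]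
  · intro t ht
    rcases cs t with e | ⟨e, e'⟩
    · rw [h.w1 t e]; exact H.bc_zero t (I1 ht e)
    · have ht' : t ∈ Ioc a T2 := ⟨e, ht.2⟩
      rw [h.b0 t ht', h.w2 t e 0 ⟨le_rfl, (h.sp t ht').le⟩, (h.bc t ht').1]; ring
  · intro t ht
    rcases cs t with e | ⟨e, e'⟩
    · rw [h.w1 t e, h.s1 t e]; exact H.bc_free t (I1 ht e)
    · have ht' : t ∈ Ioc a T2 := ⟨e, ht.2⟩
      rw [e', h.w2 t e _ ⟨(h.sp t ht').le, le_rfl⟩, (h.bc t ht').2.1]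
  · intro t ht
    rcases cs t with e | ⟨e, e'⟩
    · rw [(D1 t e).deriv_eq, h.w1 t e, h.s1 t e]; exact H.stefan t (I1 ht e)
    · have ht' : t ∈ Ioc a T2 := ⟨e, ht.2⟩
      rw [Dv t ht', e', h.bs t ht', neg_neg]
  · intro x hx
    rw [h.w1 0 (by linarith)]; exact H.init x hx
  · rw [h.s1 0 (by linarith)]; exact H.init_s

def exF (P : ℝ → ℝ → ℝ) (k σ v : ℝ → ℝ) (t x : ℝ) : ℝ :=
  if x < 0 then P t 0 - k t / 2 * x else if x ≤ σ t then P t x else P t (σ t) - v t * (x - σ t)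

theorem both {f : ℝ → ℝ} {d x A : ℝ} {r : ℝ} (hr : r < x) (h1 : HasDerivWithinAt f d (Ici x) x)
    (h2 : ∀ y ∈ Ioc r x, f y = A + d * (y - x)) : deriv f x = d := by
  have e1 : HasDerivAt (fun y => A + d * (y - x)) d x :=
    ((((hasDerivAt_id x).sub_const x).const_mul d).const_add A).congr_deriv (by simp)
  have e2 : HasDerivWithinAt f d (Iic x) x := by
    refine e1.hasDerivWithinAt.congr_of_eventuallyEq ?_ (h2 x ⟨hr, le_rfl⟩)
    filter_upwards [Ioc_mem_nhdsLE hr] with y hy using h2 y hy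
  have := e2.union h1
  rw [Iic_union_Ici, hasDerivWithinAt_univ] at this
  exact this.deriv

theorem both' {f : ℝ → ℝ} {d x A : ℝ} (h1 : HasDerivWithinAt f d (Iic x) x)
    (h2 : ∀ y ∈ Ici x, f y = A + d * (y - x)) : deriv f x = d := by
  have e1 : HasDerivAt (fun y => A + d * (y - x)) d x :=
    ((((hasDerivAt_id x).sub_const x).const_mul d).const_add A).congr_deriv (by simp)
  have e2 : HasDerivWithinAt f d (Ici x) x :=
    e1.hasDerivWithinAt.congr (fun y hy => h2 y hy) (h2 x self_mem_Ici)
  have := h1.union e2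
  rw [Iic_union_Ici, hasDerivWithinAt_univ] at this
  exact this.deriv

theorem ext_exists {p s₀ Tm : ℝ} {φ s : ℝ → ℝ} {u : ℝ → ℝ → ℝ} (hp : 1 < p) (hT : 0 < Tm)
    (hsol : ∀ T, 0 < T → T < Tm → IsSolOn p s₀ φ T s u) {M1 : ℝ} (hM1 : 1 ≤ M1)
    (hb : ∀ t ∈ Ico (Tm / 2) Tm, ∀ x ∈ Icc 0 (s t), u t x ≤ M1 ∧ |deriv (u t) x| ≤ M1) :
    ∃ T2 > Tm, ∃ σ w, IsSolOn p s₀ φ T2 σ w := by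
  have h := Cl.of_sol hsol
  obtain ⟨a, m, T2, B, Q, M, b, ψ, k, σ, v, ha, ham, hmT, hT2, hB, S, he, hf⟩ := h.ext0 hp hT hM1 hb
  refine ⟨T2, hT2, fun t => if t < m then s t else σ t, fun t => if t < m then u t else exF (UU a ψ k σ v) k σ v t, ?_⟩
  refine Glu.sol (a := a) (m := m) (s := s) (u := u) (P := UU a ψ k σ v) (P1 := U1 a ψ k σ v)
    (P2 := U2 a ψ k σ v) (k := k) (σ := σ) (v := v) ?_ (hsol m (by linarith) hmT)
  have iB : ∀ {t}, t ∈ Ioc a T2 → t < B := fun ht => by linarith [ht.2]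
  have im : ∀ {t}, t > a → t < m → t ∈ Icc a m := fun h1 h2 => ⟨h1.le, h2.le⟩
  have iT : ∀ {t}, t > a → t < m → t ∈ Ioo 0 Tm := fun h1 h2 => ⟨by linarith, by linarith⟩
  refine ⟨⟨ha, ham, by linarith⟩, fun t ht => if_pos ht, fun t ht => ?_, fun t ht => if_pos ht, fun t ht x hx => ?_,
    S.sc, fun t ht => (hf t ht).1, fun t ht => (hf t ht).2.1,
    fun t ht => S.dv.cont t ht.1.ne' (iB ht).ne, fun t ht => S.dk.cont t ht.1.ne' (iB ht).ne, S.cont,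
    fun q h1 h2 h3 => S.reg h1 h2.ne' h3.ne (by linarith), fun t ht => S.lim0 ht.1 (iB ht) (hf t ht).1, fun t ht => ?_,
    fun t ht => ?_, fun t ht => ?_, fun t ht => ⟨(hf t ht).2.2.1, (hf t ht).2.2.2.2⟩⟩
  · by_cases e : t < m
    · simp only [e, if_true]; exact (he t (im ht e)).1.symm
    · simp only [e, if_false]
  · by_cases e : t < m
    · simp only [e, if_true]
      obtain ⟨e1, e2⟩ := he t (im ht e)
      rw [e1] at hx; exact (e2 x hx).symm
    · simp only [e, if_false, exF, not_lt.2 hx.1, hx.2, if_true]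
  · have := S.liml ht.1 (iB ht) (hf t ht).1
    rwa [show U1 a ψ k σ v t (σ t) - v t / 2 = -v t by linarith [(hf t ht).2.2.2.1]] at this
  · have hs := (hf t ht).1
    by_cases e : t < m
    · simp only [e, if_true]
      obtain ⟨e1, e2⟩ := he t (im ht.1 e)
      rw [h.bc0 t (iT ht.1 e), (hf t ht).2.2.1, e2 0 ⟨le_rfl, by rw [← e1]; exact hs.le⟩]; ring
    · simp only [e, if_false]
      refine both (r := -1) (A := UU a ψ k σ v t 0) (by norm_num) ?_ (fun y hy => ?_)
      · refine (S.d0 ht.1 (iB ht) hs).congr_of_eventuallyEq ?_ (by simp [exF, hs.le])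
        filter_upwards [Icc_mem_nhdsGE hs] with y hy
        simp only [exF, not_lt.2 hy.1, hy.2, if_true, if_false]
      · rcases eq_or_lt_of_le hy.2 with e | e
        · subst e; simp [exF, hs.le]
        · simp only [exF, e, if_true]; ring
  · have hs := (hf t ht).1
    by_cases e : t < m
    · simp only [e, if_true]
      obtain ⟨e1, -⟩ := he t (im ht.1 e)
      have d1 : HasDerivAt s (v t) t := by
        refine (hf t ht).2.1.congr_of_eventuallyEq ?_
        filter_upwards [Ioo_mem_nhds ht.1 e] with r hr using (he r ⟨hr.1.le, hr.2.le⟩).1.symm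
      rw [e1, d1.unique (h.sd t (iT ht.1 e)), neg_neg]
    · simp only [e, if_false]
      refine both' (A := UU a ψ k σ v t (σ t)) ?_ (fun y hy => ?_)
      · refine ((S.dl ht.1 (iB ht) hs).congr_of_eventuallyEq ?_ (by simp [exF, hs.le])).congr_deriv
          (by linarith [(hf t ht).2.2.2.1])
        filter_upwards [Icc_mem_nhdsLE hs] with y hy
        simp only [exF, not_lt.2 hy.1, hy.2, if_true, if_false]
      · have hy : σ t ≤ y := hy
        rcases eq_or_lt_of_le hy with e | e
        · rw [← e]; simp [exF, hs.le]
        · simp only [exF, not_lt.2 (hs.le.trans hy), not_le.2 e, if_false]; ring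

/-- Theorem 1.1 (2): behaviour of solutions blowing up in finite time. -/
theorem stmt_1 (p : ℝ) (hp : 1 < p) (s₀ : ℝ) (φ : ℝ → ℝ) (hW : memW s₀ φ)
    (s : ℝ → ℝ) (u : ℝ → ℝ → ℝ) (Tm : ℝ≥0∞)
    (hmax : IsMaxSol p s₀ φ Tm s u) (hfin : Tm ≠ ⊤) :
    Tendsto (fun t => u t 0) (𝓝[<] Tm.toReal) atTop ∧
    (∃ L : ℝ, Tendsto s (𝓝[<] Tm.toReal) (𝓝 L)) ∧
    (∃ C : ℝ, ∀ t ∈ Ioo (Tm.toReal / 2) Tm.toReal,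
      (Tm.toReal - t) ^ (1 / (2 * (p - 1))) * u t 0 ≤ C) ∧
    (∀ δ ∈ Ioo 0 s₀, ∃ C : ℝ, ∀ t ∈ Ioo (Tm.toReal / 2) Tm.toReal,
      ∀ x ∈ Ioo δ (s t), u t x ≤ C) ∧
    Tendsto (fun t => energy p s u t) (𝓝[<] Tm.toReal) atBot := by
  obtain ⟨h0, h1, h2⟩ := hmax
  have hT : 0 < Tm.toReal := ENNReal.toReal_pos h0.ne' hfin
  have hsol : ∀ T, 0 < T → T < Tm.toReal → IsSolOn p s₀ φ T s u := fun T ha hb =>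
    h1 T ha ((ENNReal.ofReal_lt_iff_lt_toReal ha.le hfin).2 hb)
  have h := Cl.of_sol hsol
  obtain ⟨b1, b2⟩ := h.blow hp hT
  have hinf : Tendsto (fun t => u t 0) (𝓝[<] Tm.toReal) atTop := by
    by_contra hc
    obtain ⟨M, hM, hb⟩ := b2 hc
    obtain ⟨T2, hT2, σ, w, hw⟩ := ext_exists hp hT hsol hM hb
    exact h2 T2 ((ENNReal.lt_ofReal_iff_toReal_lt hfin).2 hT2) ⟨σ, w, hw⟩
  obtain ⟨L, hL, -⟩ := h.s_lim hp hT
  obtain ⟨C, -, hC⟩ := h.rate hp hT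
  refine ⟨hinf, ⟨L, hL⟩, ⟨C, fun t ht => hC t ⟨ht.1.le, ht.2⟩⟩, fun δ hδ => ?_, b1 hinf⟩
  obtain ⟨C', -, hC'⟩ := h.interior hp hT hδ.1
  exact ⟨C', fun t ht x hx => hC' t ⟨ht.1.le, ht.2⟩ x ⟨hx.1.le, hx.2.le⟩⟩
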